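/- Let k ≥ 2. There exist constants λ(k) and C(k) > 0, depending only on k, such that for every integer s ≥ 2: liminf_{A→∞} #{tuples a = (a_1,…,a_s) of nonzero integers with |a| ≤ A such that a_1 x_1^k + … + a_s x_s^k = 0 has a solution with all x_j prime}/(2A)^s ≥ 1 − C(k)·s^{λ(k)}·2^{−s}. -/

import Mathlib

open scoped BigOperators Classical
open Filter

noncomputable section

/-- `hgt a = max_j |a_j|` as a real number. -/
def hgt {s : ℕ} (a : Fin s → ℤ) : ℝ :=
  ((Finset.univ.sup fun j => (a j).natAbs : ℕ) : ℝ)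

/-- Solubility of `∑ a_j x_j^k = 0` in positive reals. -/
def solRplus (k : ℕ) {s : ℕ} (a : Fin s → ℤ) : Prop :=
  ∃ x : Fin s → ℝ, (∀ j, 0 < x j) ∧ ∑ j, (a j : ℝ) * x j ^ k = 0

/-- Solubility of `∑ a_j x_j^k = 0` in `p`-adic units. -/
def solZpUnit (k : ℕ) {s : ℕ} (p : ℕ) [Fact p.Prime] (a : Fin s → ℤ) : Prop :=
  ∃ x : Fin s → ℤ_[p], (∀ j, IsUnit (x j)) ∧ ∑ j, (a j : ℤ_[p]) * x j ^ k = 0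

/-- `a ∈ C'(k,s)`: real-positive solubility together with solubility in `p`-adic
units for every prime `p`. -/
def memC' (k : ℕ) {s : ℕ} (a : Fin s → ℤ) : Prop :=
  solRplus k a ∧ ∀ (p : ℕ) [Fact p.Prime], solZpUnit k p a

/-- Half of the Fejér kernel of bandwidth `T`. -/
def fejerKer (T u : ℝ) : ℝ := ∫ t in (0:ℝ)..T, (1 - t / T) * Real.cos (t * u)

theorem fejerKer_eq {T u : ℝ} (hT : 0 < T) (hu : u ≠ 0) :
    fejerKer T u = (1 - Real.cos (T * u)) / (T * u ^ 2) := by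
  have h : ∀ t ∈ Set.uIcc 0 T, HasDerivAt
      (fun t => (1 - t / T) * (Real.sin (t * u) / u) - Real.cos (t * u) / (T * u ^ 2))
      ((1 - t / T) * Real.cos (t * u)) t := by
    intro t _
    have h1 : HasDerivAt (fun t : ℝ => t * u) u t := by simpa using (hasDerivAt_id t).mul_const u
    have h2 := (h1.sin).div_const u
    have h3 := (h1.cos).div_const (T * u ^ 2)
    have h4 : HasDerivAt (fun t : ℝ => 1 - t / T) (-(1 / T)) t := by
      simpa using ((hasDerivAt_id t).div_const T).const_sub 1
    refine ((h4.mul h2).sub h3).congr_deriv ?_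
    field_simp
    ring
  unfold fejerKer
  rw [intervalIntegral.integral_eq_sub_of_hasDerivAt h]
  · simp [hT.ne']
    field_simp
    ring
  · apply Continuous.intervalIntegrable
    fun_prop

theorem fejerKer_zero {T : ℝ} (hT : 0 < T) : fejerKer T 0 = T / 2 := by
  have h : ∀ t ∈ Set.uIcc 0 T, HasDerivAt (fun t => t - t ^ 2 / (2 * T))
      ((1 - t / T) * Real.cos (t * 0)) t := by
    intro t _
    have := (hasDerivAt_id t).sub ((hasDerivAt_pow 2 t).div_const (2 * T))
    refine this.congr_deriv ?_
    simp
    field_simp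
  unfold fejerKer
  rw [intervalIntegral.integral_eq_sub_of_hasDerivAt h]
  · field_simp
    ring
  · apply Continuous.intervalIntegrable
    fun_prop

theorem fejerKer_nonneg {T : ℝ} (hT : 0 < T) (u : ℝ) : 0 ≤ fejerKer T u := by
  rcases eq_or_ne u 0 with rfl | hu
  · rw [fejerKer_zero hT]; positivity
  · rw [fejerKer_eq hT hu]
    have := Real.cos_le_one (T * u)
    apply div_nonneg <;> [linarith; positivity]

theorem fejerKer_le {T : ℝ} (hT : 0 < T) (u : ℝ) : fejerKer T u ≤ T / 2 := by
  rcases eq_or_ne u 0 with rfl | hu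
  · rw [fejerKer_zero hT]
  · rw [fejerKer_eq hT hu, div_le_iff₀ (by positivity)]
    have := Real.one_sub_sq_div_two_le_cos (x := T * u)
    nlinarith

theorem fejerKer_le_tail {T u : ℝ} (hT : 0 < T) (hu : u ≠ 0) :
    fejerKer T u ≤ 2 / (T * u ^ 2) := by
  rw [fejerKer_eq hT hu]
  gcongr
  linarith [Real.neg_one_le_cos (T * u)]

theorem fejerKer_ge {T u : ℝ} (hT : 0 < T) (hu : |u| ≤ 1 / T) : T / 5 ≤ fejerKer T u := by
  rcases eq_or_ne u 0 with rfl | h0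
  · rw [fejerKer_zero hT]; linarith
  · rw [fejerKer_eq hT h0, le_div_iff₀ (by positivity)]
    have h1 : |T * u| ≤ 1 := by
      rw [abs_mul, abs_of_pos hT]
      calc T * |u| ≤ T * (1 / T) := by gcongr
        _ = 1 := by field_simp
    have h2 := Real.cos_bound h1
    have h3 := (abs_le.1 h2).2
    have h4 : |T * u| ^ 4 ≤ (T * u) ^ 2 := by
      have : |T * u| ^ 4 = (T * u) ^ 2 * |T * u| ^ 2 := by rw [← sq_abs (T * u)]; ring
      rw [this]
      have : |T * u| ^ 2 ≤ 1 := pow_le_one₀ (abs_nonneg _) h1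
      nlinarith [sq_nonneg (T * u)]
    nlinarith [sq_nonneg (T * u)]

/-- `ζ(s) - 1/(s-1)`, extended continuously to `s = 1`. -/
def zetaReg (s : ℂ) : ℂ :=
  Function.update (fun s => riemannZeta s - 1 / (s - 1)) 1 Real.eulerMascheroniConstant s

theorem continuous_zetaReg : Continuous zetaReg := by
  unfold zetaReg
  rw [continuous_iff_continuousAt]
  intro s
  rcases eq_or_ne s 1 with rfl | hs
  · rw [continuousAt_update_same]
    exact tendsto_riemannZeta_sub_one_div
  · rw [continuousAt_update_of_ne hs]
    have := (differentiableAt_riemannZeta hs).continuousAt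
    have h2 : s - 1 ≠ 0 := sub_ne_zero.2 hs
    fun_prop (disch := assumption)

theorem HasSum.congr_both {ι E : Type*} [AddCommMonoid E] [TopologicalSpace E] {f g : ι → E}
    {a b : E} (h : HasSum f a) (ha : b = a) (hf : ∀ n, g n = f n) : HasSum g b := by
  rw [ha, show g = f from funext hf]
  exact h

open ArithmeticFunction ArithmeticFunction.vonMangoldt in
theorem residueClass_sub_LSeries {q : ℕ} [NeZero q] {a : ZMod q} (ha : IsUnit a) {s : ℂ}
    (hs : 1 < s.re) :
    HasSum (fun n : ℕ => ((residueClass a (n + 1) - (q.totient : ℝ)⁻¹ : ℝ) : ℂ) /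
        ((n + 1 : ℕ) : ℂ) ^ s)
      (LFunctionResidueClassAux a s - (q.totient : ℂ)⁻¹ * zetaReg s) := by
  have hs1 : s ≠ 1 := by rintro rfl; simp at hs
  have hsum : LSeriesSummable (fun n => (residueClass a n : ℂ)) s :=
    LSeriesSummable_of_abscissaOfAbsConv_lt_re
      ((abscissaOfAbsConv_residueClass_le_one a).trans_lt (by exact_mod_cast hs))
  have h1 : HasSum (fun n : ℕ => (residueClass a (n + 1) : ℂ) / ((n + 1 : ℕ) : ℂ) ^ s)
      (LFunctionResidueClassAux a s + (q.totient : ℂ)⁻¹ / (s - 1)) := by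
    have := eqOn_LFunctionResidueClassAux ha hs
    rw [this]
    simp only [sub_add_cancel]
    have h := hsum.hasSum
    rw [← hasSum_nat_add_iff' 1] at h
    simpa [LSeries.term, LSeries] using h
  have h2 : HasSum (fun n : ℕ => (1 : ℂ) / ((n + 1 : ℕ) : ℂ) ^ s) (riemannZeta s) := by
    rw [zeta_eq_tsum_one_div_nat_add_one_cpow hs]
    have : Summable (fun n : ℕ => 1 / (n : ℂ) ^ s) := Complex.summable_one_div_nat_cpow.2 hs
    have := (summable_nat_add_iff 1).2 this
    simpa using this.hasSum
  have h3 := h1.sub (h2.mul_left (q.totient : ℂ)⁻¹)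
  refine h3.congr_both ?_ ?_
  · unfold zetaReg
    rw [Function.update_of_ne hs1]
    ring
  · intro n
    push_cast
    ring

/-- The smoothed explicit identity. -/
theorem fejer_identity {q : ℕ} [NeZero q] {a : ZMod q} (ha : IsUnit a) {σ x T : ℝ}
    (hσ : 1 < σ) (hx : 0 < x) (hT : 0 < T) :
    HasSum (fun n : ℕ => (ArithmeticFunction.vonMangoldt.residueClass a (n + 1)
        - (q.totient : ℝ)⁻¹) * ((n + 1 : ℕ) : ℝ) ^ (-σ) *
        fejerKer T (Real.log (((n + 1 : ℕ) : ℝ) / x)))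
      (∫ t in (0:ℝ)..T, (1 - t / T) * (Complex.exp (t * Real.log x * Complex.I) *
        (ArithmeticFunction.vonMangoldt.LFunctionResidueClassAux a (σ + t * Complex.I)
          - (q.totient : ℂ)⁻¹ * zetaReg (σ + t * Complex.I))).re) := by
  set r : ℕ → ℝ := fun n => ArithmeticFunction.vonMangoldt.residueClass a (n + 1)
        - (q.totient : ℝ)⁻¹ with hr
  have key : ∀ n : ℕ, ∀ t : ℝ, (1 - t / T) * (Complex.exp (t * Real.log x * Complex.I) *
      ((r n : ℂ) / ((n + 1 : ℕ) : ℂ) ^ ((σ : ℂ) + t * Complex.I))).re =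
      r n * ((n + 1 : ℕ) : ℝ) ^ (-σ) *
        ((1 - t / T) * Real.cos (t * Real.log (((n + 1 : ℕ) : ℝ) / x))) := by
    intro n t
    have hn : (0:ℝ) < ((n + 1 : ℕ) : ℝ) := by positivity
    have e1 : (((n + 1 : ℕ) : ℂ)) ^ ((σ : ℂ) + t * Complex.I) =
        ((((n + 1 : ℕ) : ℝ) ^ σ : ℝ) : ℂ) *
          Complex.exp (t * Real.log ((n + 1 : ℕ) : ℝ) * Complex.I) := by
      rw [Complex.cpow_add _ _ (by exact_mod_cast hn.ne'), Complex.ofReal_cpow hn.le]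
      congr 1
      rw [Complex.cpow_def_of_ne_zero (by exact_mod_cast hn.ne'), ← Complex.natCast_log]
      congr 1
      ring
    have e2 : Complex.exp (t * Real.log x * Complex.I) *
      ((r n : ℂ) / ((n + 1 : ℕ) : ℂ) ^ ((σ : ℂ) + t * Complex.I)) =
      ((r n * ((n + 1 : ℕ) : ℝ) ^ (-σ) : ℝ) : ℂ) *
        Complex.exp (((-(t * Real.log (((n + 1 : ℕ) : ℝ) / x)) : ℝ) : ℂ) * Complex.I) := by
      rw [e1, Real.log_div hn.ne' hx.ne', Real.rpow_neg hn.le]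
      have e3 : Complex.exp (((-(t * (Real.log ((n + 1 : ℕ) : ℝ) - Real.log x)) : ℝ) : ℂ) * Complex.I)
        = Complex.exp (t * Real.log x * Complex.I) /
          Complex.exp (t * Real.log ((n + 1 : ℕ) : ℝ) * Complex.I) := by
        rw [← Complex.exp_sub]
        congr 1
        push_cast
        ring
      rw [e3]
      push_cast
      ring
    rw [e2, Complex.re_ofReal_mul, Complex.exp_ofReal_mul_I_re, Real.cos_neg]
    ring
  have hcont : ∀ n : ℕ, Continuous (fun t : ℝ => r n * ((n + 1 : ℕ) : ℝ) ^ (-σ) *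
        ((1 - t / T) * Real.cos (t * Real.log (((n + 1 : ℕ) : ℝ) / x)))) := by
    intro n; fun_prop
  have hsummable : Summable (fun n : ℕ => |r n| * ((n + 1 : ℕ) : ℝ) ^ (-σ)) := by
    have h := (residueClass_sub_LSeries ha (s := (σ : ℂ)) (by simpa using hσ)).summable.norm
    refine h.congr fun n => ?_
    rw [norm_div, Complex.norm_real, Real.norm_eq_abs, Complex.norm_natCast_cpow_of_pos (by omega),
      Complex.ofReal_re, Real.rpow_neg (by positivity)]
    rfl
  have hI := intervalIntegral.hasSum_intervalIntegral_of_summable_norm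
    (f := fun n : ℕ => (⟨_, hcont n⟩ : C(ℝ, ℝ))) (a := 0) (b := T) ?_
  · refine hI.congr_both ?_ ?_
    · apply intervalIntegral.integral_congr
      intro t _
      simp only [ContinuousMap.coe_mk]
      have h := residueClass_sub_LSeries ha (s := (σ : ℂ) + t * Complex.I) (by simpa using hσ)
      have h2 := ((Complex.hasSum_re (h.mul_left (Complex.exp (t * Real.log x * Complex.I)))).mul_left
        (1 - t / T))
      rw [← h2.tsum_eq]
      exact tsum_congr fun n => key n t
    · intro n
      simp only [ContinuousMap.coe_mk]
      rw [intervalIntegral.integral_const_mul]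
      rfl
  · refine Summable.of_nonneg_of_le (fun n => norm_nonneg _) (fun n => ?_) hsummable
    rw [ContinuousMap.norm_le _ (by positivity)]
    rintro ⟨t, ht⟩
    simp only [ContinuousMap.restrict_apply, ContinuousMap.coe_mk]
    rw [norm_mul, norm_mul, norm_mul]
    have ht' : t ∈ Set.uIcc 0 T := ht
    rw [Set.uIcc_of_le hT.le] at ht'
    have h0 : 0 ≤ t / T := div_nonneg ht'.1 hT.le
    have h1 : t / T ≤ 1 := by rw [div_le_one hT]; exact ht'.2
    have h2 : ‖1 - t / T‖ ≤ 1 := by rw [Real.norm_eq_abs, abs_le]; constructor <;> linarith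
    have h3 : ‖Real.cos (t * Real.log (((n + 1 : ℕ) : ℝ) / x))‖ ≤ 1 := Real.abs_cos_le_one _
    have h4 : ‖((n + 1 : ℕ) : ℝ) ^ (-σ)‖ = ((n + 1 : ℕ) : ℝ) ^ (-σ) :=
      Real.norm_of_nonneg (by positivity)
    rw [h4, Real.norm_eq_abs (r n)]
    calc _ ≤ |r n| * ((n + 1 : ℕ) : ℝ) ^ (-σ) * (1 * 1) := by gcongr
      _ = _ := by ring

section

open ArithmeticFunction ArithmeticFunction.vonMangoldt

theorem sum_vonMangoldt_div_le {y : ℝ} (hy : 0 < y) (S : Finset ℕ)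
    (hS : ∀ n ∈ S, y ≤ ((n + 1 : ℕ) : ℝ) ∧ ((n + 1 : ℕ) : ℝ) ≤ Real.exp 1 * y) :
    ∑ n ∈ S, vonMangoldt (n + 1) / ((n + 1 : ℕ) : ℝ) ≤ (Real.log 4 + 4) * Real.exp 1 := by
  calc ∑ n ∈ S, vonMangoldt (n + 1) / ((n + 1 : ℕ) : ℝ)
      ≤ ∑ n ∈ S, vonMangoldt (n + 1) / y := by
        refine Finset.sum_le_sum fun n hn => ?_
        gcongr
        · exact (hS n hn).1
    _ = (∑ n ∈ S.map ⟨(· + 1), add_left_injective 1⟩, vonMangoldt n) / y := by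
        rw [Finset.sum_map, Finset.sum_div]; rfl
    _ ≤ Chebyshev.psi (Real.exp 1 * y) / y := by
        gcongr
        unfold Chebyshev.psi
        refine Finset.sum_le_sum_of_subset_of_nonneg ?_ (fun _ _ _ => vonMangoldt_nonneg)
        intro m hm
        obtain ⟨n, hn, rfl⟩ := Finset.mem_map.1 hm
        rw [Finset.mem_Ioc]
        exact ⟨Nat.succ_pos n, Nat.le_floor (hS n hn).2⟩
    _ ≤ ((Real.log 4 + 4) * (Real.exp 1 * y)) / y := by
        gcongr
        exact Chebyshev.psi_le_const_mul_self (by positivity)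
    _ = _ := by field_simp

theorem Finset.sum_union_le' (A B : Finset ℕ) {f : ℕ → ℝ} (hf : ∀ n, 0 ≤ f n) :
    ∑ n ∈ A ∪ B, f n ≤ ∑ n ∈ A, f n + ∑ n ∈ B, f n := by
  rw [← Finset.sum_union_inter]
  have : 0 ≤ ∑ n ∈ A ∩ B, f n := Finset.sum_nonneg fun n _ => hf n
  linarith

theorem summable_one_div_int_sq_add_one : Summable (fun j : ℤ => 1 / ((j : ℝ) ^ 2 + 1)) := by
  have h1 : Summable (fun j : ℤ => 1 / ((j : ℝ) ^ 2)) := by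
    have := Real.summable_one_div_int_pow (p := 2)
    exact this.2 (by norm_num)
  refine Summable.of_norm_bounded_eventually (g := fun j : ℤ => 1 / ((j : ℝ) ^ 2)) h1 ?_
  have : ∀ᶠ j : ℤ in cofinite, j ≠ 0 := by
    have := (Set.finite_singleton (0:ℤ)).compl_mem_cofinite
    filter_upwards [this] with j hj
    exact hj
  filter_upwards [this] with j hj
  have : (0:ℝ) < (j:ℝ)^2 := by positivity
  rw [Real.norm_of_nonneg (by positivity)]
  gcongr
  linarith

theorem fejer_tail_sum_le {w : ℕ → ℝ} (hw : ∀ n, 0 ≤ w n) {T τ x σ : ℝ}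
    (hT : 0 < T) (hτ : 0 < τ) (hτ1 : τ ≤ 1) (hσ : 1 ≤ σ) {S : Finset ℕ}
    (hS : ∀ n ∈ S, τ < |Real.log (((n + 1 : ℕ) : ℝ) / x)|) {M : ℤ → ℝ}
    (hM : ∀ j : ℤ, ∑ n ∈ S.filter (fun n => ⌊Real.log (((n + 1 : ℕ) : ℝ) / x)⌋ = j),
      w n / ((n + 1 : ℕ) : ℝ) ≤ M j) :
    ∑ n ∈ S, w n * ((n + 1 : ℕ) : ℝ) ^ (-σ) * fejerKer T (Real.log (((n + 1 : ℕ) : ℝ) / x)) ≤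
      10 / (T * τ ^ 2) * ∑ j ∈ S.image (fun n => ⌊Real.log (((n + 1 : ℕ) : ℝ) / x)⌋),
        M j * (1 / ((j : ℝ) ^ 2 + 1)) := by
  set u : ℕ → ℝ := fun n => Real.log (((n + 1 : ℕ) : ℝ) / x) with hu
  set J : Finset ℤ := S.image (fun n => ⌊u n⌋) with hJ
  rw [← Finset.sum_fiberwise_of_maps_to (t := J) (g := fun n => ⌊u n⌋)
    (fun n hn => Finset.mem_image_of_mem _ hn), Finset.mul_sum]
  refine Finset.sum_le_sum fun j _ => ?_
  calc _ ≤ ∑ n ∈ S.filter (fun n => ⌊u n⌋ = j), w n / ((n + 1 : ℕ) : ℝ) *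
          (10 / (T * τ ^ 2) * (1 / ((j : ℝ) ^ 2 + 1))) := by
          refine Finset.sum_le_sum fun n hn => ?_
          obtain ⟨hn, hnj⟩ := Finset.mem_filter.1 hn
          have hn1 : (1:ℝ) ≤ ((n + 1 : ℕ) : ℝ) := by push_cast; linarith [Nat.cast_nonneg (α := ℝ) n]
          have e1 : ((n + 1 : ℕ) : ℝ) ^ (-σ) ≤ 1 / ((n + 1 : ℕ) : ℝ) := by
            rw [one_div, ← Real.rpow_neg_one]
            exact Real.rpow_le_rpow_of_exponent_le hn1 (by linarith)
          have hun := hS n hn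
          have hu0 : u n ≠ 0 := by
            intro h
            change τ < |u n| at hun
            rw [h] at hun; simp at hun; linarith
          have e2 : fejerKer T (u n) ≤ 10 / (T * τ ^ 2) * (1 / ((j : ℝ) ^ 2 + 1)) := by
            refine (fejerKer_le_tail hT hu0).trans ?_
            have l1 : (j : ℝ) ≤ u n := by rw [← hnj]; exact Int.floor_le _
            have l2 : u n < j + 1 := by rw [← hnj]; exact Int.lt_floor_add_one _
            have l3 : τ ^ 2 ≤ u n ^ 2 := by
              rw [← sq_abs (u n)]; exact pow_le_pow_left₀ hτ.le hun.le 2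
            have key : τ ^ 2 * ((j : ℝ) ^ 2 + 1) ≤ 5 * u n ^ 2 := by
              have hτ2 : τ ^ 2 ≤ 1 := pow_le_one₀ hτ.le hτ1
              rcases lt_trichotomy j 0 with hneg | h0 | hpos
              · rcases eq_or_lt_of_le (Int.le_sub_one_of_lt hneg) with h | h
                · have : (j:ℝ) = -1 := by rw [h]; norm_num
                  rw [this]; nlinarith
                · have h' : j ≤ -2 := by omega
                  have : (j:ℝ) ≤ -2 := by exact_mod_cast h'
                  have h5 : (j:ℝ)^2 ≤ 4 * u n ^ 2 := by nlinarith
                  have h6 : (1:ℝ) ≤ u n ^ 2 := by nlinarith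
                  nlinarith [sq_nonneg (j:ℝ)]
              · rw [h0]; norm_num; nlinarith
              · have : (1:ℝ) ≤ j := by exact_mod_cast hpos
                have h5 : (j:ℝ)^2 ≤ u n ^ 2 := by nlinarith
                nlinarith [sq_nonneg (j:ℝ)]
            have hu2 : 0 < u n ^ 2 := by positivity
            rw [div_mul_div_comm, div_le_div_iff₀ (by positivity) (by positivity)]
            nlinarith
          have e4 := hw n
          have e5 := fejerKer_nonneg hT (u n)
          calc _ ≤ w n * (1 / ((n + 1 : ℕ) : ℝ)) *
              (10 / (T * τ ^ 2) * (1 / ((j : ℝ) ^ 2 + 1))) := by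
                gcongr
            _ = _ := by ring
    _ = (∑ n ∈ S.filter (fun n => ⌊u n⌋ = j), w n / ((n + 1 : ℕ) : ℝ)) *
          (10 / (T * τ ^ 2) * (1 / ((j : ℝ) ^ 2 + 1))) := by rw [Finset.sum_mul]
    _ ≤ M j * (10 / (T * τ ^ 2) * (1 / ((j : ℝ) ^ 2 + 1))) := by
          refine mul_le_mul_of_nonneg_right (hM j) (by positivity)
    _ = _ := by ring

theorem floor_log_div_bounds {x : ℝ} (hx : 0 < x) {n : ℕ} {j : ℤ}
    (h : ⌊Real.log (((n + 1 : ℕ) : ℝ) / x)⌋ = j) :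
    x * Real.exp j ≤ ((n + 1 : ℕ) : ℝ) ∧ ((n + 1 : ℕ) : ℝ) ≤ Real.exp 1 * (x * Real.exp j) := by
  have l1 : (j : ℝ) ≤ Real.log (((n + 1 : ℕ) : ℝ) / x) := by rw [← h]; exact Int.floor_le _
  have l2 : Real.log (((n + 1 : ℕ) : ℝ) / x) < j + 1 := by
    rw [← h]; exact Int.lt_floor_add_one _
  have hpos : (0:ℝ) < ((n + 1 : ℕ) : ℝ) / x := by positivity
  have l3 := Real.exp_log hpos
  have l4 := Real.exp_le_exp.2 l1
  have l5 := Real.exp_le_exp.2 l2.le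
  rw [l3, le_div_iff₀ hx] at l4
  rw [l3, div_le_iff₀ hx, Real.exp_add] at l5
  constructor <;> nlinarith

theorem sum_inv_le_exp_one {y : ℝ} (hy : 0 < y) (S : Finset ℕ)
    (hS : ∀ n ∈ S, y ≤ ((n + 1 : ℕ) : ℝ) ∧ ((n + 1 : ℕ) : ℝ) ≤ Real.exp 1 * y) :
    ∑ n ∈ S, 1 / ((n + 1 : ℕ) : ℝ) ≤ Real.exp 1 := by
  have hcard : (S.card : ℝ) ≤ Real.exp 1 * y := by
    have : S ⊆ Finset.range ⌊Real.exp 1 * y⌋₊ := by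
      intro n hn
      exact Finset.mem_range.2 (Nat.le_floor (hS n hn).2)
    have := Finset.card_le_card this
    rw [Finset.card_range] at this
    exact (Nat.cast_le.2 this).trans (Nat.floor_le (by positivity))
  calc ∑ n ∈ S, 1 / ((n + 1 : ℕ) : ℝ) ≤ ∑ n ∈ S, 1 / y := by
        refine Finset.sum_le_sum fun n hn => ?_
        have := (hS n hn).1
        gcongr
    _ = S.card * (1 / y) := by simp
    _ ≤ Real.exp 1 * y * (1 / y) := by gcongr
    _ = _ := by field_simp

theorem fejer_sum_inv_le : ∃ B : ℝ, 0 < B ∧ ∀ x σ : ℝ, 0 < x → 1 ≤ σ → ∀ S : Finset ℕ,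
    ∑ n ∈ S, ((n + 1 : ℕ) : ℝ) ^ (-σ) * fejerKer 1 (Real.log (((n + 1 : ℕ) : ℝ) / x)) ≤ B := by
  set B0 := ∑' j : ℤ, 1 / ((j : ℝ) ^ 2 + 1) with hB0
  have hB00 : 0 ≤ B0 := tsum_nonneg fun j => by positivity
  refine ⟨(Real.exp 1 + Real.exp 1) + 10 * (Real.exp 1 * B0), by positivity, ?_⟩
  intro x σ hx hσ S
  set u : ℕ → ℝ := fun n => Real.log (((n + 1 : ℕ) : ℝ) / x) with hu
  have hb : ∀ (S' : Finset ℕ) (j : ℤ), ∑ n ∈ S'.filter (fun n => ⌊u n⌋ = j),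
      1 / ((n + 1 : ℕ) : ℝ) ≤ Real.exp 1 := fun S' j =>
    sum_inv_le_exp_one (y := x * Real.exp j) (by positivity) _ fun n hn =>
      floor_log_div_bounds hx (Finset.mem_filter.1 hn).2
  rw [← Finset.sum_filter_add_sum_filter_not S (fun n => 1 < |u n|), add_comm]
  refine add_le_add ?_ ?_
  · have hle : ∀ n ∈ S.filter (fun n => ¬ 1 < |u n|), ((n + 1 : ℕ) : ℝ) ^ (-σ) * fejerKer 1 (u n) ≤
        1 / ((n + 1 : ℕ) : ℝ) * (1 / 2) := by
      intro n _
      have hn1 : (1:ℝ) ≤ ((n + 1 : ℕ) : ℝ) := by push_cast; linarith [Nat.cast_nonneg (α := ℝ) n]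
      have e1 : ((n + 1 : ℕ) : ℝ) ^ (-σ) ≤ 1 / ((n + 1 : ℕ) : ℝ) := by
        rw [one_div, ← Real.rpow_neg_one]
        exact Real.rpow_le_rpow_of_exponent_le hn1 (by linarith)
      have := fejerKer_nonneg one_pos (u n)
      have := fejerKer_le one_pos (u n)
      gcongr
    refine (Finset.sum_le_sum hle).trans ?_
    set S1 := S.filter (fun n => ¬ 1 < |u n|)
    have hcov : S1 ⊆ (S1.filter (fun n => ⌊u n⌋ = -1)) ∪ (S1.filter (fun n => ⌊u n⌋ = 0)) ∪
        (S1.filter (fun n => ⌊u n⌋ = 1)) := by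
      intro n hn
      have h1 := (Finset.mem_filter.1 hn).2
      rw [not_lt, abs_le] at h1
      have h2 : -1 ≤ ⌊u n⌋ := Int.le_floor.2 (by push_cast; exact h1.1)
      have h3 : ⌊u n⌋ < 2 := Int.floor_lt.2 (by push_cast; linarith [h1.2])
      simp only [Finset.mem_union, Finset.mem_filter, hn, true_and]
      omega
    have hnn : ∀ n : ℕ, 0 ≤ 1 / ((n + 1 : ℕ) : ℝ) := fun n => by positivity
    rw [← Finset.sum_mul]
    have := Finset.sum_le_sum_of_subset_of_nonneg hcov (f := fun n : ℕ => 1 / ((n + 1 : ℕ) : ℝ))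
      (fun n _ _ => hnn n)
    have h2 := (Finset.sum_union_le' (S1.filter (fun n => ⌊u n⌋ = -1) ∪
      S1.filter (fun n => ⌊u n⌋ = 0)) (S1.filter (fun n => ⌊u n⌋ = 1)) hnn)
    have h3 := (Finset.sum_union_le' (S1.filter (fun n => ⌊u n⌋ = -1))
      (S1.filter (fun n => ⌊u n⌋ = 0)) hnn)
    have := hb S1 (-1)
    have := hb S1 0
    have := hb S1 1
    have : 0 < Real.exp 1 := Real.exp_pos 1
    linarith
  · have h := fejer_tail_sum_le (w := fun _ => 1) (fun _ => zero_le_one) (T := 1) (τ := 1) (x := x)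
      (σ := σ) one_pos one_pos le_rfl hσ (S := S.filter (fun n => 1 < |u n|))
      (fun n hn => (Finset.mem_filter.1 hn).2) (M := fun _ => Real.exp 1) (fun j => hb _ j)
    simp only [one_mul, one_pow, div_one] at h
    refine h.trans ?_
    rw [← Finset.mul_sum]
    gcongr
    exact summable_one_div_int_sq_add_one.sum_le_tsum _ (fun j _ => by positivity)

def analyticSide {q : ℕ} [NeZero q] (a : ZMod q) (T x σ : ℝ) : ℝ :=
  ∫ t in (0:ℝ)..T, (1 - t / T) * (Complex.exp (t * Real.log x * Complex.I) *
        (LFunctionResidueClassAux a (σ + t * Complex.I)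
          - (q.totient : ℂ)⁻¹ * zetaReg (σ + t * Complex.I))).re

theorem continuous_boundary {q : ℕ} [NeZero q] (a : ZMod q) :
    Continuous (fun p : ℝ × ℝ => LFunctionResidueClassAux a ((max p.1 1 : ℝ) + p.2 * Complex.I)
          - (q.totient : ℂ)⁻¹ * zetaReg ((max p.1 1 : ℝ) + p.2 * Complex.I)) := by
  have h1 : Continuous (fun p : ℝ × ℝ => (((max p.1 1 : ℝ) : ℂ) + p.2 * Complex.I)) := by fun_prop
  refine Continuous.sub ?_ (continuous_const.mul (continuous_zetaReg.comp h1))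
  refine (continuousOn_LFunctionResidueClassAux a).comp_continuous h1 ?_
  intro p
  simp

theorem tendsto_analyticSide_one {q : ℕ} [NeZero q] (a : ZMod q) (T x : ℝ) :
    Tendsto (fun σ => analyticSide a T x σ) (nhdsWithin 1 (Set.Ioi 1))
      (nhds (analyticSide a T x 1)) := by
  have hc : Continuous (fun σ : ℝ => ∫ t in (0:ℝ)..T,
      (1 - t / T) * (Complex.exp (t * Real.log x * Complex.I) *
        (LFunctionResidueClassAux a ((max σ 1 : ℝ) + t * Complex.I)
          - (q.totient : ℂ)⁻¹ * zetaReg ((max σ 1 : ℝ) + t * Complex.I))).re) := by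
    refine intervalIntegral.continuous_parametric_intervalIntegral_of_continuous' ?_ _ _
    have := continuous_boundary a
    refine Continuous.mul (by fun_prop) (Complex.continuous_re.comp ?_)
    exact Continuous.mul (by fun_prop) this
  have h2 := (hc.tendsto 1).mono_left (nhdsWithin_le_nhds (s := Set.Ioi 1))
  simp only [max_self] at h2
  refine Tendsto.congr' ?_ h2
  filter_upwards [self_mem_nhdsWithin] with σ hσ
  unfold analyticSide
  rw [max_eq_left (le_of_lt hσ)]

theorem tendsto_analyticSide_atTop {q : ℕ} [NeZero q] (a : ZMod q) {T : ℝ} (hT : 0 < T) :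
    Tendsto (fun x => analyticSide a T x 1) atTop (nhds 0) := by
  set g : ℝ → ℂ := fun t => ((1 - t / T : ℝ) : ℂ) *
    (LFunctionResidueClassAux a ((1 : ℝ) + t * Complex.I)
          - (q.totient : ℂ)⁻¹ * zetaReg ((1 : ℝ) + t * Complex.I)) with hg
  have hgc : Continuous g := by
    have h := (continuous_boundary a).comp (f := fun t : ℝ => ((1 : ℝ), t)) (by fun_prop)
    have h2 : Continuous (fun t : ℝ => ((1 - t / T : ℝ) : ℂ)) := by fun_prop
    refine h2.mul ?_
    refine h.congr fun t => ?_
    simp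
  have hRL := Real.tendsto_integral_exp_smul_cocompact ((Set.Ioc 0 T).indicator g)
  have hlog : Tendsto (fun x : ℝ => -(Real.log x / (2 * Real.pi))) atTop (cocompact ℝ) := by
    have h1 : Tendsto (fun x : ℝ => -(Real.log x / (2 * Real.pi))) atTop atBot :=
      tendsto_neg_atTop_atBot.comp (Real.tendsto_log_atTop.atTop_div_const (by positivity))
    exact h1.mono_right atBot_le_cocompact
  have h := (Complex.continuous_re.tendsto 0).comp (hRL.comp hlog)
  simp only [Complex.zero_re] at h
  refine h.congr fun x => ?_
  simp only [Function.comp]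
  unfold analyticSide
  have e1 : ∀ v : ℝ, Real.fourierChar (-(v * -(Real.log x / (2 * Real.pi)))) •
      (Set.Ioc 0 T).indicator g v = (Set.Ioc 0 T).indicator
        (fun v : ℝ => Complex.exp (v * Real.log x * Complex.I) * g v) v := by
    intro v
    by_cases hv : v ∈ Set.Ioc 0 T
    · rw [Set.indicator_of_mem hv, Set.indicator_of_mem hv, Circle.smul_def,
        Real.fourierChar_apply, smul_eq_mul]
      congr 2
      push_cast
      have : (Real.pi : ℂ) ≠ 0 := by exact_mod_cast Real.pi_ne_zero
      field_simp
    · rw [Set.indicator_of_notMem hv, Set.indicator_of_notMem hv, smul_zero]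
  simp_rw [e1]
  rw [MeasureTheory.integral_indicator measurableSet_Ioc, ← intervalIntegral.integral_of_le hT.le]
  have hker : IntervalIntegrable (fun v : ℝ => Complex.exp (v * Real.log x * Complex.I) * g v)
      MeasureTheory.volume 0 T := by
    apply Continuous.intervalIntegrable
    fun_prop
  have := intervalIntegral.intervalIntegral_eq_integral_uIoc
    (fun v : ℝ => Complex.exp (v * Real.log x * Complex.I) * g v) 0 T MeasureTheory.volume
  have e2 := Complex.reCLM.intervalIntegral_comp_comm hker
  simp only [Complex.reCLM_apply] at e2
  rw [← e2]
  apply intervalIntegral.integral_congr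
  intro t _
  simp only [hg]
  rw [show Complex.exp (t * Real.log x * Complex.I) * (((1 - t / T : ℝ) : ℂ) *
    (LFunctionResidueClassAux a ((1 : ℝ) + t * Complex.I)
          - (q.totient : ℂ)⁻¹ * zetaReg ((1 : ℝ) + t * Complex.I))) = ((1 - t / T : ℝ) : ℂ) *
      (Complex.exp (t * Real.log x * Complex.I) * (LFunctionResidueClassAux a ((1 : ℝ) + t * Complex.I)
          - (q.totient : ℂ)⁻¹ * zetaReg ((1 : ℝ) + t * Complex.I))) by ring, Complex.re_ofReal_mul]

end

section

open ArithmeticFunction ArithmeticFunction.vonMangoldt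

/-- Indices `n` for which `n + 1` lies in the multiplicative window `[x e^{-τ}, x e^τ]`. -/
def logWindow (τ x : ℝ) : Finset ℕ :=
  (Finset.range ⌊x * Real.exp τ⌋₊).filter (fun n => |Real.log (((n + 1 : ℕ) : ℝ) / x)| ≤ τ)

theorem mem_logWindow {τ x : ℝ} (hx : 0 < x) {n : ℕ} :
    n ∈ logWindow τ x ↔ |Real.log (((n + 1 : ℕ) : ℝ) / x)| ≤ τ := by
  unfold logWindow
  rw [Finset.mem_filter, Finset.mem_range, and_iff_right_iff_imp]
  intro h
  have h1 := (abs_le.1 h).2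
  have hpos : (0:ℝ) < ((n + 1 : ℕ) : ℝ) / x := by positivity
  rw [Real.log_le_iff_le_exp hpos, div_le_iff₀ hx, mul_comm] at h1
  exact Nat.succ_le_iff.1 (Nat.le_floor h1)

theorem inv_window_sum {x T : ℝ} (hT : 1 ≤ T) (hx : 2 * T ≤ x) :
    (1 / 20 : ℝ) ≤ ∑ n ∈ Finset.Ico ⌊x⌋₊ ⌊x * (1 + 1 / T)⌋₊, ((n + 1 : ℕ) : ℝ) ^ (-1 : ℝ) *
      fejerKer T (Real.log (((n + 1 : ℕ) : ℝ) / x)) := by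
  have hT0 : 0 < T := by linarith
  have hx0 : 0 < x := by linarith
  have hb : ∀ n ∈ Finset.Ico ⌊x⌋₊ ⌊x * (1 + 1 / T)⌋₊, (1 / (2 * x)) * (T / 5) ≤
      ((n + 1 : ℕ) : ℝ) ^ (-1 : ℝ) * fejerKer T (Real.log (((n + 1 : ℕ) : ℝ) / x)) := by
    intro n hn
    rw [Finset.mem_Ico] at hn
    have l1 : x < ((n + 1 : ℕ) : ℝ) := by
      have := (Nat.floor_lt hx0.le).1 (Nat.lt_succ_of_le hn.1)
      exact_mod_cast this
    have l2 : ((n + 1 : ℕ) : ℝ) ≤ x * (1 + 1 / T) :=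
      (Nat.le_floor_iff (by positivity)).1 (Nat.succ_le_of_lt hn.2)
    have hnp : (0:ℝ) < ((n + 1 : ℕ) : ℝ) := by positivity
    have hT1 : 1 / T ≤ 1 := by rw [div_le_one hT0]; exact hT
    gcongr
    · rw [Real.rpow_neg_one, ← one_div]
      gcongr
      nlinarith
    · apply fejerKer_ge hT0
      have h1 : 1 ≤ ((n + 1 : ℕ) : ℝ) / x := by rw [le_div_iff₀ hx0]; linarith
      rw [abs_of_nonneg (Real.log_nonneg h1)]
      have h2 : ((n + 1 : ℕ) : ℝ) / x ≤ 1 + 1 / T := by rw [div_le_iff₀ hx0]; linarith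
      have h3 := Real.log_le_sub_one_of_pos (show 0 < ((n + 1 : ℕ) : ℝ) / x by positivity)
      linarith
  refine le_trans ?_ (Finset.card_nsmul_le_sum _ _ _ hb)
  rw [nsmul_eq_mul, Nat.card_Ico]
  have hle : ⌊x⌋₊ ≤ ⌊x * (1 + 1 / T)⌋₊ := Nat.floor_mono (by
    have : 0 < x * (1 / T) := by positivity
    nlinarith)
  rw [Nat.cast_sub hle]
  have f1 := Nat.floor_le hx0.le
  have f2 := Nat.lt_floor_add_one (x * (1 + 1 / T))
  have f3 : x / T - 1 ≤ (⌊x * (1 + 1 / T)⌋₊ : ℝ) - ⌊x⌋₊ := by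
    have : x * (1 + 1 / T) = x + x / T := by field_simp
    linarith
  have f4 : x / (2 * T) ≤ x / T - 1 := by
    have : x / T = x / (2 * T) + x / (2 * T) := by field_simp; ring
    have : 1 ≤ x / (2 * T) := by rw [le_div_iff₀ (by positivity)]; linarith
    linarith
  calc (1 / 20 : ℝ) = x / (2 * T) * (1 / (2 * x) * (T / 5)) := by field_simp; norm_num
    _ ≤ _ := by gcongr; linarith

theorem tendsto_rpow_neg_nhdsWithin_one (n : ℕ) :
    Tendsto (fun σ : ℝ => ((n + 1 : ℕ) : ℝ) ^ (-σ)) (nhdsWithin 1 (Set.Ioi 1))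
      (nhds (((n + 1 : ℕ) : ℝ) ^ (-1 : ℝ))) := by
  have hn : (0:ℝ) < ((n + 1 : ℕ) : ℝ) := by positivity
  have : Continuous (fun σ : ℝ => ((n + 1 : ℕ) : ℝ) ^ (-σ)) :=
    Continuous.rpow continuous_const (by fun_prop) (fun _ => Or.inl hn.ne')
  exact (this.tendsto 1).mono_left nhdsWithin_le_nhds

theorem hasSum_residueClass_fejer {q : ℕ} [NeZero q] {a : ZMod q} (ha : IsUnit a) {σ x T : ℝ}
    (hσ : 1 < σ) (hx : 0 < x) (hT : 0 < T) :
    Summable (fun n : ℕ => ((n + 1 : ℕ) : ℝ) ^ (-σ) * fejerKer T (Real.log (((n + 1 : ℕ) : ℝ) / x))) ∧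
    HasSum (fun n : ℕ => residueClass a (n + 1) * ((n + 1 : ℕ) : ℝ) ^ (-σ) *
        fejerKer T (Real.log (((n + 1 : ℕ) : ℝ) / x)))
      (analyticSide a T x σ + ∑' n : ℕ, (q.totient : ℝ)⁻¹ * (((n + 1 : ℕ) : ℝ) ^ (-σ) *
        fejerKer T (Real.log (((n + 1 : ℕ) : ℝ) / x)))) := by
  have hI := fejer_identity ha hσ hx hT
  have hsc : Summable (fun n : ℕ => ((n + 1 : ℕ) : ℝ) ^ (-σ) *
      fejerKer T (Real.log (((n + 1 : ℕ) : ℝ) / x))) := by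
    have h1 : Summable (fun n : ℕ => ((n + 1 : ℕ) : ℝ) ^ (-σ) * (T / 2)) := by
      have := (Real.summable_nat_rpow (p := -σ)).2 (by linarith)
      exact ((summable_nat_add_iff 1).2 this).mul_right _
    refine Summable.of_nonneg_of_le (fun n => mul_nonneg (by positivity) (fejerKer_nonneg hT _))
      (fun n => ?_) h1
    gcongr
    exact fejerKer_le hT _
  refine ⟨hsc, (hI.add ((hsc.mul_left (q.totient : ℝ)⁻¹).hasSum)).congr_both rfl fun n => ?_⟩
  ring

theorem exists_residueClass_window_upper : ∃ C : ℝ, 0 < C ∧ ∀ (q : ℕ) (_ : NeZero q) (a : ZMod q),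
    IsUnit a → ∀ᶠ x : ℝ in atTop, ∀ S : Finset ℕ,
      (∀ n ∈ S, x ≤ ((n + 1 : ℕ) : ℝ) ∧ ((n + 1 : ℕ) : ℝ) ≤ Real.exp 1 * x) →
      ∑ n ∈ S, residueClass a (n + 1) / ((n + 1 : ℕ) : ℝ) ≤ C * (q.totient : ℝ)⁻¹ := by
  obtain ⟨B, hB, hBs⟩ := fejer_sum_inv_le
  refine ⟨5 * (B + 1), by positivity, fun q _ a ha => ?_⟩
  have hq : 0 < (q.totient : ℝ)⁻¹ := by
    have := Nat.totient_pos.2 (Nat.pos_of_ne_zero (NeZero.ne q))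
    positivity
  set c := (q.totient : ℝ)⁻¹ with hc
  have hA2 : ∀ᶠ x in atTop, analyticSide a 1 x 1 < c :=
    (tendsto_analyticSide_atTop a one_pos).eventually (gt_mem_nhds hq)
  filter_upwards [hA2, eventually_gt_atTop 0] with x hxA hx S hS
  have hlim : ∑ n ∈ S, residueClass a (n + 1) * ((n + 1 : ℕ) : ℝ) ^ (-1 : ℝ) *
      fejerKer 1 (Real.log (((n + 1 : ℕ) : ℝ) / x)) ≤ analyticSide a 1 x 1 + c * B := by
    refine le_of_tendsto_of_tendsto (f := fun σ => ∑ n ∈ S, residueClass a (n + 1) *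
      ((n + 1 : ℕ) : ℝ) ^ (-σ) * fejerKer 1 (Real.log (((n + 1 : ℕ) : ℝ) / x)))
      (g := fun σ => analyticSide a 1 x σ + c * B) (b := nhdsWithin 1 (Set.Ioi 1)) ?_ ?_ ?_
    · exact tendsto_finsetSum _ fun n _ =>
        (tendsto_const_nhds.mul (tendsto_rpow_neg_nhdsWithin_one n)).mul tendsto_const_nhds
    · exact (tendsto_analyticSide_one a 1 x).add tendsto_const_nhds
    · filter_upwards [self_mem_nhdsWithin] with σ hσ
      have hσ1 : (1:ℝ) < σ := hσ
      obtain ⟨hsc, hg⟩ := hasSum_residueClass_fejer ha hσ1 hx one_pos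
      have h1 := sum_le_hasSum S (fun n _ => mul_nonneg (mul_nonneg (residueClass_nonneg a (n + 1))
        (by positivity)) (fejerKer_nonneg one_pos _)) hg
      refine h1.trans ?_
      gcongr
      rw [tsum_mul_left]
      gcongr
      exact hsc.tsum_le_of_sum_le fun S => hBs x σ hx hσ1.le S
  have hlow : (∑ n ∈ S, residueClass a (n + 1) / ((n + 1 : ℕ) : ℝ)) * (1 / 5) ≤
      ∑ n ∈ S, residueClass a (n + 1) * ((n + 1 : ℕ) : ℝ) ^ (-1 : ℝ) *
      fejerKer 1 (Real.log (((n + 1 : ℕ) : ℝ) / x)) := by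
    rw [Finset.sum_mul]
    refine Finset.sum_le_sum fun n hn => ?_
    have h0 := residueClass_nonneg a (n + 1)
    rw [Real.rpow_neg_one, ← div_eq_mul_inv]
    gcongr
    refine fejerKer_ge one_pos ?_
    obtain ⟨h1, h2⟩ := hS n hn
    rw [div_one, abs_of_nonneg (Real.log_nonneg ((one_le_div hx).2 h1)),
      Real.log_le_iff_le_exp (by positivity), div_le_iff₀ hx]
    exact h2
  linarith

theorem window_sum_lower {τ : ℝ} (hτ : 0 < τ) (hτ1 : τ ≤ 1) : ∃ δ : ℝ, 0 < δ ∧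
    ∀ (q : ℕ) (_ : NeZero q) (a : ZMod q), IsUnit a → ∀ᶠ x : ℝ in atTop,
      δ * (q.totient : ℝ)⁻¹ ≤
        ∑ n ∈ logWindow τ x, residueClass a (n + 1) * ((n + 1 : ℕ) : ℝ) ^ (-1 : ℝ) := by
  obtain ⟨C1, hC1, hup1⟩ := exists_residueClass_window_upper
  set B0 := ∑' j : ℤ, 1 / ((j : ℝ) ^ 2 + 1) with hB0
  have hB00 : 0 ≤ B0 := tsum_nonneg fun j => by positivity
  obtain ⟨T, hT1, hTB⟩ : ∃ T : ℝ, 1 ≤ T ∧ 10 / (T * τ ^ 2) * (C1 * B0) ≤ 1 / 120 := by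
    refine ⟨max 1 (1200 * (C1 * B0) / τ ^ 2), le_max_left _ _, ?_⟩
    have h := le_max_right 1 (1200 * (C1 * B0) / τ ^ 2)
    have hm : 0 < max 1 (1200 * (C1 * B0) / τ ^ 2) := lt_of_lt_of_le one_pos (le_max_left _ _)
    rw [div_le_iff₀ (by positivity)] at h
    rw [div_mul_eq_mul_div, div_le_div_iff₀ (by positivity) (by positivity)]
    linarith
  have hT : 0 < T := by linarith
  refine ⟨1 / 60 / T, by positivity, fun q _ a ha => ?_⟩
  have hq : 0 < (q.totient : ℝ)⁻¹ := by
    have := Nat.totient_pos.2 (Nat.pos_of_ne_zero (NeZero.ne q))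
    positivity
  set c := (q.totient : ℝ)⁻¹ with hc
  have hA := tendsto_analyticSide_atTop a hT
  have hA2 : ∀ᶠ x in atTop, -(c / 240) < analyticSide a T x 1 :=
    hA.eventually (lt_mem_nhds (by linarith))
  set ML := (Real.log 4 + 4) * Real.exp 1 with hML
  have hML0 : 0 < ML := by
    have : 0 < Real.log 4 := Real.log_pos (by norm_num)
    positivity
  set ε := c / 120 / (10 / (T * τ ^ 2) * ML) with hε
  have hε0 : 0 < ε := by positivity
  obtain ⟨F, hF⟩ := (summable_iff_vanishing_norm.1 summable_one_div_int_sq_add_one) ε hε0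
  have hFx : ∀ᶠ x : ℝ in atTop, ∀ j ∈ F, ∀ S : Finset ℕ,
      (∀ n ∈ S, x * Real.exp (j : ℤ) ≤ ((n + 1 : ℕ) : ℝ) ∧
        ((n + 1 : ℕ) : ℝ) ≤ Real.exp 1 * (x * Real.exp (j : ℤ))) →
      ∑ n ∈ S, residueClass a (n + 1) / ((n + 1 : ℕ) : ℝ) ≤ C1 * c := by
    refine (Filter.eventually_all_finset F).2 fun j _ => ?_
    have t : Tendsto (fun x : ℝ => x * Real.exp (j : ℤ)) atTop atTop :=
      tendsto_id.atTop_mul_const (Real.exp_pos _)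
    exact t.eventually (hup1 q inferInstance a ha)
  filter_upwards [hA2, eventually_ge_atTop (2 * T), hFx] with x hxA hx2 hxF
  have hx : 0 < x := by linarith
  have hBt : ∀ σ : ℝ, 1 ≤ σ → ∀ S : Finset ℕ,
      (∀ n ∈ S, τ < |Real.log (((n + 1 : ℕ) : ℝ) / x)|) →
      ∑ n ∈ S, residueClass a (n + 1) * ((n + 1 : ℕ) : ℝ) ^ (-σ) *
        fejerKer T (Real.log (((n + 1 : ℕ) : ℝ) / x)) ≤ c / 60 := by
    intro σ hσ S hS
    have h := fejer_tail_sum_le (w := fun n => residueClass a (n + 1))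
      (fun n => residueClass_nonneg a (n + 1)) hT hτ hτ1 (x := x) hσ hS
      (M := fun j => if j ∈ F then C1 * c else ML) (fun j => by
        split_ifs with hj
        · exact hxF j hj _ fun n hn => floor_log_div_bounds hx (Finset.mem_filter.1 hn).2
        · refine le_trans (Finset.sum_le_sum fun n _ => ?_) (sum_vonMangoldt_div_le
            (y := x * Real.exp j) (by positivity) _
            fun n hn => floor_log_div_bounds hx (Finset.mem_filter.1 hn).2)
          have := residueClass_le a (n + 1)
          gcongr)
    refine h.trans ?_
    set J := S.image (fun n => ⌊Real.log (((n + 1 : ℕ) : ℝ) / x)⌋)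
    have h2 : ∑ j ∈ J, (if j ∈ F then C1 * c else ML) * (1 / ((j : ℝ) ^ 2 + 1)) ≤
        C1 * c * B0 + ML * ε := by
      rw [← Finset.sum_filter_add_sum_filter_not J (fun j => j ∈ F)]
      refine add_le_add ?_ ?_
      · rw [Finset.sum_congr rfl (g := fun j : ℤ => C1 * c * (1 / ((j : ℝ) ^ 2 + 1)))
          (fun j hj => by rw [if_pos (Finset.mem_filter.1 hj).2]), ← Finset.mul_sum]
        gcongr
        exact summable_one_div_int_sq_add_one.sum_le_tsum _ (fun j _ => by positivity)
      · rw [Finset.sum_congr rfl (g := fun j : ℤ => ML * (1 / ((j : ℝ) ^ 2 + 1)))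
          (fun j hj => by rw [if_neg (Finset.mem_filter.1 hj).2]), ← Finset.mul_sum]
        gcongr
        refine le_trans (le_abs_self _) (hF _ ?_).le
        rw [Finset.disjoint_left]
        intro j hj
        exact (Finset.mem_filter.1 hj).2
    calc _ ≤ 10 / (T * τ ^ 2) * (C1 * c * B0 + ML * ε) := by gcongr
      _ = c * (10 / (T * τ ^ 2) * (C1 * B0)) + 10 / (T * τ ^ 2) * ML * ε := by ring
      _ ≤ c * (1 / 120) + c / 120 := by
        refine add_le_add (by gcongr) (le_of_eq ?_)
        rw [hε, mul_div_cancel₀]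
        positivity
      _ = _ := by ring
  set V := Finset.Ico ⌊x⌋₊ ⌊x * (1 + 1 / T)⌋₊
  set K : ℕ → ℝ := fun n => fejerKer T (Real.log (((n + 1 : ℕ) : ℝ) / x)) with hK
  have hKn : ∀ n, 0 ≤ K n := fun n => fejerKer_nonneg hT _
  have main : ∀ σ : ℝ, 1 < σ → analyticSide a T x σ + c * ∑ n ∈ V, ((n + 1 : ℕ) : ℝ) ^ (-σ) * K n
      ≤ ∑ n ∈ logWindow τ x, residueClass a (n + 1) * ((n + 1 : ℕ) : ℝ) ^ (-σ) * K n +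
        c / 60 := by
    intro σ hσ
    obtain ⟨hsc, hg2⟩ := hasSum_residueClass_fejer ha hσ hx hT
    have hup := hasSum_le_of_sum_le hg2 (c := ∑ n ∈ logWindow τ x, residueClass a (n + 1) *
      ((n + 1 : ℕ) : ℝ) ^ (-σ) * K n + c / 60) (fun S => by
        rw [← Finset.sum_filter_add_sum_filter_not S (fun n => n ∈ logWindow τ x)]
        refine add_le_add ?_ ?_
        · refine Finset.sum_le_sum_of_subset_of_nonneg ?_ ?_
          · intro n hn; exact (Finset.mem_filter.1 hn).2
          · intro n _ _
            have := residueClass_nonneg a (n + 1)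
            have := hKn n
            positivity
        · refine hBt σ hσ.le _ ?_
          intro n hn
          have := (Finset.mem_filter.1 hn).2
          rw [mem_logWindow hx, not_le] at this
          exact this)
    have hlow : c * ∑ n ∈ V, ((n + 1 : ℕ) : ℝ) ^ (-σ) * K n ≤
        ∑' n : ℕ, c * (((n + 1 : ℕ) : ℝ) ^ (-σ) * K n) := by
      rw [Finset.mul_sum]
      exact (hsc.mul_left c).sum_le_tsum V (fun n _ => by
        have := hKn n
        positivity)
    linarith
  have hlim : analyticSide a T x 1 + c * ∑ n ∈ V, ((n + 1 : ℕ) : ℝ) ^ (-1 : ℝ) * K n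
      ≤ ∑ n ∈ logWindow τ x, residueClass a (n + 1) * ((n + 1 : ℕ) : ℝ) ^ (-1 : ℝ) * K n +
        c / 60 := by
    have hp := tendsto_rpow_neg_nhdsWithin_one
    refine le_of_tendsto_of_tendsto ?_ ?_ (f := fun σ => analyticSide a T x σ +
      c * ∑ n ∈ V, ((n + 1 : ℕ) : ℝ) ^ (-σ) * K n) (g := fun σ => ∑ n ∈ logWindow τ x,
        residueClass a (n + 1) * ((n + 1 : ℕ) : ℝ) ^ (-σ) * K n + c / 60)
        (b := nhdsWithin 1 (Set.Ioi 1)) ?_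
    · exact (tendsto_analyticSide_one a T x).add (tendsto_const_nhds.mul
        (tendsto_finsetSum _ fun n _ => (hp n).mul tendsto_const_nhds))
    · exact (tendsto_finsetSum _ fun n _ =>
        (tendsto_const_nhds.mul (hp n)).mul tendsto_const_nhds).add tendsto_const_nhds
    · filter_upwards [self_mem_nhdsWithin] with σ hσ
      exact main σ hσ
  have hV := inv_window_sum hT1 hx2
  have hup : ∑ n ∈ logWindow τ x, residueClass a (n + 1) * ((n + 1 : ℕ) : ℝ) ^ (-1 : ℝ) * K n ≤
      (∑ n ∈ logWindow τ x, residueClass a (n + 1) * ((n + 1 : ℕ) : ℝ) ^ (-1 : ℝ)) * (T / 2) := by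
    rw [Finset.sum_mul]
    refine Finset.sum_le_sum fun n _ => ?_
    have := residueClass_nonneg a (n + 1)
    gcongr
    exact fejerKer_le hT _
  have hV2 : c * (1 / 20) ≤ c * ∑ n ∈ V, ((n + 1 : ℕ) : ℝ) ^ (-1 : ℝ) * K n := by gcongr
  rw [div_mul_eq_mul_div, div_le_iff₀ hT]
  linarith

theorem primes_window {ρ : ℝ} (hρ : 1 < ρ) : ∃ c : ℝ, 0 < c ∧
    ∀ (q : ℕ) (_ : NeZero q) (a : ZMod q), IsUnit a → ∀ᶠ x : ℝ in atTop,
      c * (q.totient : ℝ)⁻¹ * x / Real.log x ≤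
      (((Finset.Ioc ⌊x⌋₊ ⌊ρ * x⌋₊).filter (fun p : ℕ => p.Prime ∧ (p : ZMod q) = a)).card : ℝ) := by
  set τ : ℝ := min 1 (Real.log ρ / 3) with hτdef
  have hlogρ : 0 < Real.log ρ := Real.log_pos hρ
  have hτ : 0 < τ := lt_min one_pos (by positivity)
  obtain ⟨δ₀, hδ₀, hwin₀⟩ := window_sum_lower hτ (min_le_left _ _)
  obtain ⟨D, hD⟩ := Chebyshev.isBigO_psi_sub_theta_sqrt.bound
  have hs : 1 < Real.exp (Real.log ρ / 2) := Real.one_lt_exp_iff.2 (by positivity)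
  set s := Real.exp (Real.log ρ / 2) with hsdef
  have hs0 : 0 < s := by positivity
  have hss : s * s = ρ := by
    rw [hsdef, ← Real.exp_add, add_halves, Real.exp_log (by linarith)]
  have hτs : Real.exp τ ≤ s := Real.exp_le_exp.2 (by
    have := min_le_right 1 (Real.log ρ / 3)
    rw [← hτdef] at this
    linarith)
  have hτs' : 1 < s * Real.exp (-τ) := by
    rw [hsdef, ← Real.exp_add, Real.one_lt_exp_iff]
    have := min_le_right 1 (Real.log ρ / 3)
    rw [← hτdef] at this
    linarith
  have hρ0 : 0 < ρ := by linarith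
  have t1 : Tendsto (fun x : ℝ => s * x) atTop atTop := tendsto_id.const_mul_atTop hs0
  have t2 : Tendsto (fun x : ℝ => ρ * x) atTop atTop := tendsto_id.const_mul_atTop hρ0
  refine ⟨δ₀ / 4, by positivity, fun q _ a ha => ?_⟩
  have hwin := hwin₀ q inferInstance a ha
  have hδ : 0 < δ₀ * (q.totient : ℝ)⁻¹ := by
    have := Nat.totient_pos.2 (Nat.pos_of_ne_zero (NeZero.ne q))
    positivity
  rw [show δ₀ / 4 * (q.totient : ℝ)⁻¹ = δ₀ * (q.totient : ℝ)⁻¹ / 4 by ring]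
  set δ := δ₀ * (q.totient : ℝ)⁻¹
  have t3 : ∀ᶠ x : ℝ in atTop, D * Real.sqrt (ρ * x) ≤ δ / 2 * x := by
    filter_upwards [eventually_ge_atTop (max 1 ((2 * (|D| + 1) / δ) ^ 2 * ρ))] with x hx
    have hx1 : 1 ≤ x := le_trans (le_max_left _ _) hx
    have hx2 := le_trans (le_max_right _ _) hx
    have h1 : 2 * (|D| + 1) / δ * Real.sqrt ρ ≤ Real.sqrt x := by
      apply Real.le_sqrt_of_sq_le
      rw [mul_pow, Real.sq_sqrt hρ0.le]
      exact hx2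
    rw [Real.sqrt_mul hρ0.le]
    have h2 : Real.sqrt x * Real.sqrt x = x := Real.mul_self_sqrt (by linarith)
    have h3 : 0 < Real.sqrt x := Real.sqrt_pos.2 (by linarith)
    have h4 : D ≤ |D| + 1 := by linarith [le_abs_self D]
    have h5 : (|D| + 1) * Real.sqrt ρ ≤ δ / 2 * Real.sqrt x := by
      calc (|D| + 1) * Real.sqrt ρ = δ / 2 * (2 * (|D| + 1) / δ * Real.sqrt ρ) := by
            field_simp
        _ ≤ _ := by gcongr
    calc D * (Real.sqrt ρ * Real.sqrt x) ≤ (|D| + 1) * (Real.sqrt ρ * Real.sqrt x) := by gcongr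
      _ = ((|D| + 1) * Real.sqrt ρ) * Real.sqrt x := by ring
      _ ≤ (δ / 2 * Real.sqrt x) * Real.sqrt x := by gcongr
      _ = _ := by rw [mul_assoc, h2]
  filter_upwards [t1.eventually hwin, t2.eventually hD, t3, eventually_gt_atTop (max 2 ρ)]
    with x hw hd h3 hx
  have hx2 : 2 < x := lt_of_le_of_lt (le_max_left _ _) hx
  have hxρ : ρ < x := lt_of_le_of_lt (le_max_right _ _) hx
  have hx0 : 0 < x := by linarith
  have hsx : 0 < s * x := by positivity
  have hlogx : 0 < Real.log x := Real.log_pos (by linarith)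
  set P := (Finset.Ioc ⌊x⌋₊ ⌊ρ * x⌋₊).filter (fun p : ℕ => p.Prime ∧ (p : ZMod q) = a) with hP
  set W := (logWindow τ (s * x)).map ⟨(· + 1), add_left_injective 1⟩ with hW
  have hWmem : ∀ m ∈ W, s * x * Real.exp (-τ) ≤ m ∧ (m : ℝ) ≤ ρ * x := by
    intro m hm
    obtain ⟨n, hn, rfl⟩ := Finset.mem_map.1 hm
    rw [mem_logWindow hsx, abs_le] at hn
    have hpos : (0:ℝ) < ((n + 1 : ℕ) : ℝ) / (s * x) := by positivity
    have l1 := Real.exp_le_exp.2 hn.1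
    have l2 := Real.exp_le_exp.2 hn.2
    rw [Real.exp_log hpos] at l1 l2
    rw [le_div_iff₀ hsx] at l1
    rw [div_le_iff₀ hsx] at l2
    refine ⟨by simpa [mul_comm] using l1, ?_⟩
    calc (((⟨(· + 1), add_left_injective 1⟩ : ℕ ↪ ℕ) n : ℕ) : ℝ) ≤ Real.exp τ * (s * x) := l2
      _ ≤ s * (s * x) := by gcongr
      _ = ρ * x := by rw [← hss]; ring
  have hWsub : W ⊆ Finset.Ioc ⌊x⌋₊ ⌊ρ * x⌋₊ := by
    intro m hm
    have h := hWmem m hm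
    rw [Finset.mem_Ioc]
    refine ⟨(Nat.floor_lt hx0.le).2 ?_, Nat.le_floor h.2⟩
    calc x < x * (s * Real.exp (-τ)) := lt_mul_of_one_lt_right hx0 hτs'
      _ = s * x * Real.exp (-τ) := by ring
      _ ≤ m := h.1
  have hlower : δ * x ≤ ∑ m ∈ W, residueClass a m := by
    have e1 : ∑ n ∈ logWindow τ (s * x), residueClass a (n + 1) * ((n + 1 : ℕ) : ℝ) ^ (-1 : ℝ) =
        ∑ m ∈ W, residueClass a m * (m : ℝ) ^ (-1 : ℝ) := by
      rw [hW, Finset.sum_map]; rfl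
    rw [e1] at hw
    calc δ * x ≤ (∑ m ∈ W, residueClass a m * (m : ℝ) ^ (-1 : ℝ)) * x := by gcongr
      _ = ∑ m ∈ W, residueClass a m * ((m : ℝ) ^ (-1 : ℝ) * x) := by
        rw [Finset.sum_mul]; exact Finset.sum_congr rfl fun _ _ => by ring
      _ ≤ ∑ m ∈ W, residueClass a m * 1 := by
        refine Finset.sum_le_sum fun m hm => ?_
        have := residueClass_nonneg a m
        gcongr
        have h := (Finset.mem_Ioc.1 (hWsub hm)).1
        have h2 : x < m := (Nat.floor_lt hx0.le).1 h
        rw [Real.rpow_neg_one, inv_mul_le_iff₀ (by linarith)]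
        linarith
      _ = _ := by simp
  have hsplit : ∑ m ∈ W, residueClass a m ≤ ∑ m ∈ Finset.Ioc 0 ⌊ρ * x⌋₊,
      (vonMangoldt m - if m.Prime then Real.log m else 0) + P.card * Real.log (ρ * x) := by
    have hWsub2 : W ⊆ Finset.Ioc 0 ⌊ρ * x⌋₊ :=
      hWsub.trans (Finset.Ioc_subset_Ioc_left (Nat.zero_le _))
    calc ∑ m ∈ W, residueClass a m ≤ ∑ m ∈ W, ((vonMangoldt m - if m.Prime then Real.log m else 0)
          + if m.Prime ∧ (m : ZMod q) = a then Real.log (ρ * x) else 0) := by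
          refine Finset.sum_le_sum fun m hm => ?_
          have hm1 := hWmem m hm
          have hm2 := residueClass_le a m
          have hmpos : 0 < m := (Finset.mem_Ioc.1 (hWsub2 hm)).1
          by_cases hp : m.Prime
          · simp only [hp, if_true, true_and]
            rw [vonMangoldt_apply_prime hp]
            by_cases hma : (m : ZMod q) = a
            · simp only [hma, if_true]
              rw [vonMangoldt_apply_prime hp] at hm2
              have : Real.log m ≤ Real.log (ρ * x) :=
                Real.log_le_log (by exact_mod_cast hmpos) hm1.2
              linarith
            · have : residueClass a m = 0 := by
                unfold residueClass
                rw [Set.indicator_of_notMem]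
                exact hma
              simp [hma]
          · simp only [hp, if_false, false_and]
            linarith
      _ = ∑ m ∈ W, (vonMangoldt m - if m.Prime then Real.log m else 0) +
          (W.filter (fun m : ℕ => m.Prime ∧ (m : ZMod q) = a)).card * Real.log (ρ * x) := by
          rw [Finset.sum_add_distrib, ← Finset.sum_filter, Finset.sum_const, nsmul_eq_mul]
      _ ≤ _ := by
          refine add_le_add ?_ ?_
          · refine Finset.sum_le_sum_of_subset_of_nonneg hWsub2 fun m _ _ => ?_
            by_cases hp : m.Prime
            · simp [hp, vonMangoldt_apply_prime hp]
            · simp only [hp, if_false, sub_zero]; exact vonMangoldt_nonneg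
          · have hl : 0 ≤ Real.log (ρ * x) := Real.log_nonneg (by nlinarith)
            have : (W.filter (fun m : ℕ => m.Prime ∧ (m : ZMod q) = a)).card ≤ P.card :=
              Finset.card_le_card (Finset.filter_subset_filter _ hWsub)
            gcongr
  have hpt : ∑ m ∈ Finset.Ioc 0 ⌊ρ * x⌋₊, (vonMangoldt m - if m.Prime then Real.log m else 0) =
      Chebyshev.psi (ρ * x) - Chebyshev.theta (ρ * x) := by
    rw [Finset.sum_sub_distrib, ← Finset.sum_filter]; rfl
  rw [hpt] at hsplit
  have hd2 : Chebyshev.psi (ρ * x) - Chebyshev.theta (ρ * x) ≤ D * Real.sqrt (ρ * x) := by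
    have := hd
    rw [Real.norm_eq_abs, Real.norm_of_nonneg (Real.sqrt_nonneg _)] at this
    exact le_trans (le_abs_self _) this
  have hlog2 : Real.log (ρ * x) ≤ 2 * Real.log x := by
    rw [Real.log_mul hρ0.ne' hx0.ne']
    have := Real.log_le_log hρ0 hxρ.le
    linarith
  rw [div_le_iff₀ hlogx]
  have hcard : (0:ℝ) ≤ P.card := Nat.cast_nonneg _
  have := mul_le_mul_of_nonneg_left hlog2 hcard
  nlinarith

end

theorem prime_pow_dvd_factorial_le {l m v : ℕ} (hl : l.Prime) (h : l ^ v ∣ m.factorial) : v ≤ m := by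
  by_contra hv
  push Not at hv
  have h2 : l ^ (m + 1) ∣ m.factorial := (pow_dvd_pow l hv).trans h
  have := Fact.mk hl
  have h3 := (padicValNat_dvd_iff_le (Nat.factorial_ne_zero m)).1 h2
  have h4 := sub_one_mul_padicValNat_factorial (p := l) m
  have h5 := hl.two_le
  have : padicValNat l m.factorial ≤ (l - 1) * padicValNat l m.factorial :=
    Nat.le_mul_of_pos_left _ (by omega)
  omega

/-- The part of `m!` coprime to `d` divides any product of `m` terms of a progression mod `d`. -/
theorem exists_factorial_split (d m : ℕ) (hd : 0 < d) : ∃ M N : ℕ, M * N = m.factorial ∧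
    M.Coprime d ∧ N ≤ d ^ m ∧ (∀ l : ℕ, l.Prime → l ∣ M → l ≤ m) := by
  set N := Nat.gcd m.factorial (d ^ m) with hN
  have hNd : N ∣ m.factorial := Nat.gcd_dvd_left _ _
  refine ⟨m.factorial / N, N, Nat.div_mul_cancel hNd, ?_,
    Nat.le_of_dvd (by positivity) (Nat.gcd_dvd_right _ _), ?_⟩
  · refine Nat.coprime_of_dvd fun l hl hlM hld => ?_
    set v := padicValNat l m.factorial with hv
    have := Fact.mk hl
    have h1 : l ^ v ∣ m.factorial := pow_padicValNat_dvd
    have h2 : v ≤ m := prime_pow_dvd_factorial_le hl h1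
    have h3 : l ^ v ∣ N := Nat.dvd_gcd h1 ((pow_dvd_pow_of_dvd hld v).trans (pow_dvd_pow d h2))
    have h4 : l ^ (v + 1) ∣ m.factorial := by
      rw [← Nat.div_mul_cancel hNd, pow_succ, mul_comm]
      exact mul_dvd_mul hlM h3
    have := (padicValNat_dvd_iff_le (Nat.factorial_ne_zero m)).1 h4
    omega
  · intro l hl hlM
    exact hl.dvd_factorial.1 (hlM.trans (Nat.div_dvd_of_dvd hNd))

theorem coprime_factorial_part_dvd_prod {c d m M N : ℕ} (hMN : M * N = m.factorial)
    (hM : M.Coprime d) : M ∣ ∏ i ∈ Finset.range m, (c + d * i) := by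
  rcases Nat.eq_zero_or_pos m with rfl | hm
  · simp at hMN ⊢; exact hMN.1
  have hMpos : 0 < M := by
    rcases Nat.eq_zero_or_pos M with h | h
    · rw [h, zero_mul] at hMN; exact absurd hMN.symm (Nat.factorial_ne_zero m)
    · exact h
  have : NeZero M := ⟨hMpos.ne'⟩
  rw [← ZMod.natCast_eq_zero_iff]
  push_cast
  set u := ZMod.unitOfCoprime d hM.symm
  have hu : ((u⁻¹ : (ZMod M)ˣ) : ZMod M) * d = 1 := by
    have := u.inv_mul
    simpa only [u, ZMod.coe_unitOfCoprime] using this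
  obtain ⟨e, he⟩ : ∃ e : ℕ, (e : ZMod M) = ((u⁻¹ : (ZMod M)ˣ) : ZMod M) * c :=
    ⟨_, ZMod.natCast_zmod_val _⟩
  have h1 : ∏ i ∈ Finset.range m, ((c : ZMod M) + d * i) =
      d ^ m * ((∏ i ∈ Finset.range m, (e + i) : ℕ) : ZMod M) := by
    push_cast
    have : ((d : ZMod M)) ^ m = ∏ i ∈ Finset.range m, (d : ZMod M) := by simp
    rw [this, ← Finset.prod_mul_distrib]
    refine Finset.prod_congr rfl fun i _ => ?_
    rw [he]
    linear_combination -(c : ZMod M) * hu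
  rw [h1]
  have h2 : m.factorial ∣ ∏ i ∈ Finset.range m, (e + i) := by
    rw [← Nat.ascFactorial_eq_prod_range]
    exact Nat.factorial_dvd_ascFactorial e m
  have h3 : M ∣ ∏ i ∈ Finset.range m, (e + i) := (Dvd.intro _ hMN).trans h2
  rw [(ZMod.natCast_eq_zero_iff _ _).2 h3, mul_zero]

theorem primes_progression_le {c d m Z X : ℕ} (hd : 0 < d) (hm : 0 < m) (hmZ : m ≤ Z) (hZ : 1 < Z)
    (hc : Z < c) (hX : c + d * (m - 1) ≤ X) :
    (((Finset.range m).filter (fun i => (c + d * i).Prime)).card : ℝ) * Real.log Z ≤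
      m * Real.log (Real.exp 1 * X * d / m) := by
  obtain ⟨M, N, hMN, hM, hN, hMl⟩ := exists_factorial_split d m hd
  set P := (Finset.range m).filter (fun i => (c + d * i).Prime) with hP
  have h1 := coprime_factorial_part_dvd_prod (c := c) hMN hM
  have h2 : ∏ i ∈ P, (c + d * i) ∣ ∏ i ∈ Finset.range m, (c + d * i) :=
    Finset.prod_dvd_prod_of_subset _ _ _ (Finset.filter_subset _ _)
  have hcop : Nat.Coprime M (∏ i ∈ P, (c + d * i)) := by
    refine Nat.Coprime.prod_right fun i hi => ?_
    have hp := (Finset.mem_filter.1 hi).2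
    rw [Nat.coprime_comm, hp.coprime_iff_not_dvd]
    intro hdiv
    have h := hMl _ hp hdiv
    have : c ≤ c + d * i := Nat.le_add_right _ _
    omega
  have h3 := hcop.mul_dvd_of_dvd_of_dvd h1 h2
  have hpos : 0 < ∏ i ∈ Finset.range m, (c + d * i) :=
    Finset.prod_pos fun i _ => by omega
  have h4 := Nat.le_of_dvd hpos h3
  have h5 : ∏ i ∈ Finset.range m, (c + d * i) ≤ X ^ m := by
    calc _ ≤ ∏ i ∈ Finset.range m, X := by
          refine Finset.prod_le_prod' fun i hi => ?_
          have : i ≤ m - 1 := by have := Finset.mem_range.1 hi; omega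
          exact le_trans (by gcongr) hX
      _ = X ^ m := by simp
  have h6 : Z ^ P.card ≤ ∏ i ∈ P, (c + d * i) := by
    calc Z ^ P.card = ∏ i ∈ P, Z := by simp
      _ ≤ _ := Finset.prod_le_prod' fun i _ => by omega
  have h7 : m.factorial * Z ^ P.card ≤ d ^ m * X ^ m := by
    calc m.factorial * Z ^ P.card ≤ (M * N) * ∏ i ∈ P, (c + d * i) := by rw [hMN]; gcongr
      _ = N * (M * ∏ i ∈ P, (c + d * i)) := by ring
      _ ≤ d ^ m * X ^ m := Nat.mul_le_mul hN (h4.trans h5)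
  have h8 : (m : ℝ) ^ m ≤ m.factorial * Real.exp 1 ^ m := by
    have := Real.pow_div_factorial_le_exp (m : ℝ) (by positivity) m
    rw [div_le_iff₀ (by positivity)] at this
    rw [← Real.exp_nat_mul, mul_one]
    linarith
  have hmR : (0:ℝ) < m := by exact_mod_cast hm
  have hXpos : (0:ℝ) < X := by
    have : 0 < X := by omega
    exact_mod_cast this
  have hdR : (0:ℝ) < d := by exact_mod_cast hd
  have hZR : (0:ℝ) < Z := by
    have : 0 < Z := by omega
    exact_mod_cast this
  have h9 : (Z : ℝ) ^ P.card ≤ (Real.exp 1 * X * d / m) ^ m := by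
    rw [div_pow, le_div_iff₀ (by positivity), mul_pow, mul_pow]
    have h7' : (m.factorial : ℝ) * (Z : ℝ) ^ P.card ≤ (d : ℝ) ^ m * (X : ℝ) ^ m := by
      exact_mod_cast h7
    have hZp : (0:ℝ) < (Z : ℝ) ^ P.card := by positivity
    have he : (0:ℝ) < Real.exp 1 ^ m := by positivity
    calc (Z : ℝ) ^ P.card * m ^ m ≤ (Z : ℝ) ^ P.card * (m.factorial * Real.exp 1 ^ m) := by gcongr
      _ = (m.factorial * (Z : ℝ) ^ P.card) * Real.exp 1 ^ m := by ring
      _ ≤ ((d : ℝ) ^ m * (X : ℝ) ^ m) * Real.exp 1 ^ m := by gcongr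
      _ = _ := by ring
  have h10 := Real.log_le_log (by positivity) h9
  rwa [Real.log_pow, Real.log_pow] at h10

/-- Primes in `(y, y+h]` congruent to `e` mod `d`. -/
def primesIn (y h d : ℕ) (e : ℤ) : Finset ℕ :=
  (Finset.Ioc y (y + h)).filter (fun p : ℕ => p.Prime ∧ (d : ℤ) ∣ (p : ℤ) - e)

theorem primesIn_card_le_trivial (y h d : ℕ) (e : ℤ) :
    (primesIn y h d e).card ≤ h / d + 1 := by
  have : (primesIn y h d e).card ≤ (Finset.range (h / d + 1)).card := by
    rcases (primesIn y h d e).eq_empty_or_nonempty with hE | hE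
    · rw [hE]; simp
    set c := (primesIn y h d e).min' hE with hcdef
    have hcmem := Finset.min'_mem _ hE
    rw [← hcdef] at hcmem
    refine Finset.card_le_card_of_injOn (fun p => (p - c) / d) ?_ ?_
    · intro p hp
      have hp' := (Finset.mem_Ioc.1 (Finset.mem_filter.1 hp).1)
      have hc' := (Finset.mem_Ioc.1 (Finset.mem_filter.1 hcmem).1)
      rw [Finset.coe_range, Set.mem_Iio, Nat.lt_succ_iff]
      exact Nat.div_le_div_right (by omega)
    · intro p hp p' hp' heq
      have hcp := Finset.min'_le _ p hp
      have hcp' := Finset.min'_le _ p' hp'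
      rw [← hcdef] at hcp hcp'
      have d1 : (d : ℤ) ∣ (p : ℤ) - c := by
        have h1 := (Finset.mem_filter.1 hp).2.2
        have h2 := (Finset.mem_filter.1 hcmem).2.2
        simpa only [sub_sub_sub_cancel_right] using dvd_sub h1 h2
      have d2 : (d : ℤ) ∣ (p' : ℤ) - c := by
        have h1 := (Finset.mem_filter.1 hp').2.2
        have h2 := (Finset.mem_filter.1 hcmem).2.2
        simpa only [sub_sub_sub_cancel_right] using dvd_sub h1 h2
      rw [← Nat.cast_sub hcp, Int.natCast_dvd_natCast] at d1
      rw [← Nat.cast_sub hcp', Int.natCast_dvd_natCast] at d2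
      have e1 := Nat.div_mul_cancel d1
      have e2 := Nat.div_mul_cancel d2
      simp only at heq
      rw [heq, e2] at e1
      omega
  simpa using this

theorem primesIn_card_mul_log_le {y h d Z : ℕ} {e : ℤ} (hZ : 1 < Z) (hy : Z ≤ y)
    (hyh : y + h ≤ 2 * Z) (hd : 0 < d) (hdh : d ≤ h) :
    ((primesIn y h d e).card : ℝ) * Real.log Z ≤ 2 * (h / d) * Real.log (9 * Z * d ^ 2 / h) := by
  have hdR : (0:ℝ) < d := by exact_mod_cast hd
  have hhR : (0:ℝ) < h := by exact_mod_cast (by omega : 0 < h)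
  have hdhR : (d:ℝ) ≤ h := by exact_mod_cast hdh
  have hhZ : h ≤ Z := by omega
  have hhZR : (h:ℝ) ≤ Z := by exact_mod_cast hhZ
  have hd1 : (1:ℝ) ≤ d := by exact_mod_cast hd
  rcases (primesIn y h d e).eq_empty_or_nonempty with hE | hE
  · rw [hE]
    simp only [Finset.card_empty, Nat.cast_zero, zero_mul]
    have : 0 ≤ Real.log (9 * Z * d ^ 2 / h) := by
      apply Real.log_nonneg
      rw [le_div_iff₀ hhR]
      nlinarith [mul_le_mul hhZR (one_le_pow₀ hd1 (n := 2)) (by norm_num) (by positivity)]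
    positivity
  set c := (primesIn y h d e).min' hE with hcdef
  have hcmem := Finset.min'_mem _ hE
  rw [← hcdef] at hcmem
  have hc' := (Finset.mem_Ioc.1 (Finset.mem_filter.1 hcmem).1)
  have hmle : (((h - 1) / d + 1 : ℕ) : ℝ) ≤ 2 * (h / d) := by
    have h1 : (((h - 1) / d : ℕ) : ℝ) ≤ ((h - 1 : ℕ) : ℝ) / d := Nat.cast_div_le
    have h2 : ((h - 1 : ℕ) : ℝ) ≤ h := by exact_mod_cast Nat.sub_le _ _
    have h3 : (1:ℝ) ≤ h / d := by rw [le_div_iff₀ hdR]; linarith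
    push_cast
    have : ((h - 1 : ℕ) : ℝ) / d ≤ h / d := by gcongr
    linarith
  set m := (h - 1) / d + 1 with hm
  have hmge : (h : ℝ) / d ≤ m := by
    rw [div_le_iff₀ hdR]
    have : h ≤ m * d := by
      have := Nat.lt_div_mul_add (a := h - 1) hd
      rw [hm, add_mul]
      omega
    exact_mod_cast this
  have hmpos : 0 < m := Nat.succ_pos _
  have hmh : m ≤ h := by
    have : (h - 1) / d ≤ h - 1 := Nat.div_le_self _ _
    omega
  have hX : c + d * (m - 1) ≤ 3 * Z := by
    have : d * (m - 1) ≤ h - 1 := by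
      rw [hm, Nat.add_sub_cancel, mul_comm]; exact Nat.div_mul_le_self _ _
    omega
  have key := primes_progression_le hd hmpos (by omega) hZ (by omega : Z < c) hX
  have hcard : (primesIn y h d e).card ≤
      ((Finset.range m).filter (fun i => (c + d * i).Prime)).card := by
    refine Finset.card_le_card_of_surjOn (fun i => c + d * i) ?_
    intro p hp
    have hp1 := Finset.mem_filter.1 hp
    have hcp := Finset.min'_le _ p hp
    rw [← hcdef] at hcp
    have d1 : (d : ℤ) ∣ (p : ℤ) - c := by
      have h2 := (Finset.mem_filter.1 hcmem).2.2
      simpa only [sub_sub_sub_cancel_right] using dvd_sub hp1.2.2 h2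
    rw [← Nat.cast_sub hcp, Int.natCast_dvd_natCast] at d1
    obtain ⟨i, hi⟩ := d1
    have hpc : c + d * i = p := by omega
    refine ⟨i, ?_, hpc⟩
    have hp2 := Finset.mem_Ioc.1 hp1.1
    have : i < m := by
      rw [hm, Nat.lt_succ_iff, Nat.le_div_iff_mul_le hd, mul_comm]
      omega
    rw [Finset.coe_filter, Set.mem_ofPred_eq, Finset.mem_range, hpc]
    exact ⟨this, hp1.2.1⟩
  have hlogZ : 0 ≤ Real.log Z := Real.log_nonneg (by exact_mod_cast hZ.le)
  have hcardR : ((primesIn y h d e).card : ℝ) ≤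
      ((Finset.range m).filter (fun i => (c + d * i).Prime)).card := by exact_mod_cast hcard
  have hmR : (0:ℝ) < m := by exact_mod_cast hmpos
  have hZR : (0:ℝ) < Z := by linarith
  have hlog : Real.log (Real.exp 1 * (3 * Z : ℕ) * d / m) ≤ Real.log (9 * Z * d ^ 2 / h) := by
    apply Real.log_le_log (by positivity)
    have he : Real.exp 1 ≤ 3 := by linarith [Real.exp_one_lt_d9]
    calc Real.exp 1 * (3 * Z : ℕ) * d / m ≤ 3 * (3 * Z) * d / (h / d) := by
          push_cast; gcongr
      _ = _ := by field_simp; ring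
  have hlog0 : 0 ≤ Real.log (9 * Z * d ^ 2 / h) := by
    apply Real.log_nonneg
    rw [le_div_iff₀ hhR]
    nlinarith [mul_le_mul hhZR (one_le_pow₀ hd1 (n := 2)) (by norm_num) (by positivity)]
  calc _ ≤ (((Finset.range m).filter (fun i => (c + d * i).Prime)).card : ℝ) * Real.log Z := by
        gcongr
    _ ≤ m * Real.log (Real.exp 1 * (3 * Z : ℕ) * d / m) := key
    _ ≤ m * Real.log (9 * Z * d ^ 2 / h) := by gcongr
    _ ≤ _ := by gcongr

/-- The `k`-th roots of unity modulo `d`. -/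
def rootsMod (k d : ℕ) : Set (ZMod d) := {u | u ^ k = 1}

theorem ncard_rootsMod_mul_le (k : ℕ) {a b : ℕ} (ha : 0 < a) (hb : 0 < b) (hab : a.Coprime b) :
    (rootsMod k (a * b)).ncard ≤ (rootsMod k a).ncard * (rootsMod k b).ncard := by
  have := NeZero.of_pos ha
  have := NeZero.of_pos hb
  rw [← Set.ncard_prod]
  refine Set.ncard_le_ncard_of_injOn (ZMod.chineseRemainder hab) ?_
    (ZMod.chineseRemainder hab).injective.injOn (Set.toFinite _)
  intro u hu
  have hu' : u ^ k = 1 := hu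
  have : (ZMod.chineseRemainder hab u) ^ k = 1 := by rw [← map_pow, hu', map_one]
  exact ⟨congrArg Prod.fst this, congrArg Prod.snd this⟩

theorem ncard_rootsMod_odd_prime_pow {k p : ℕ} (e : ℕ) (hk : 0 < k) (hp : p.Prime) (hp2 : p ≠ 2) :
    (rootsMod k (p ^ e)).ncard ≤ k := by
  have hpe : 0 < p ^ e := pow_pos hp.pos e
  have := NeZero.of_pos hpe
  have hcyc : IsCyclic (ZMod (p ^ e))ˣ := ZMod.isCyclic_units_of_prime_pow p hp hp2 e
  have h := IsCyclic.card_pow_eq_one_le (α := (ZMod (p ^ e))ˣ) hk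
  have hsub : rootsMod k (p ^ e) ⊆ (fun u : (ZMod (p ^ e))ˣ => (u : ZMod (p ^ e))) ''
      ((Finset.univ.filter (fun u : (ZMod (p ^ e))ˣ => u ^ k = 1) : Finset _) : Set _) := by
    intro u hu
    have hu' : u ^ k = 1 := hu
    have hunit : IsUnit u := IsUnit.of_pow_eq_one hu' hk.ne'
    refine ⟨hunit.unit, ?_, rfl⟩
    simp only [Finset.coe_filter, Finset.mem_univ, true_and, Set.mem_ofPred_eq]
    ext
    simpa using hu'
  refine (Set.ncard_le_ncard hsub (Set.toFinite _)).trans ?_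
  refine (Set.ncard_image_le (Set.toFinite _)).trans ?_
  rw [Set.ncard_coe_finset]
  exact h

theorem pow_dvd_left_of_not_pow_dvd_right {p : ℤ} (hp : Prime p) {n j : ℕ} {a b : ℤ}
    (h : p ^ (n + j) ∣ a * b) (hb : ¬ p ^ j ∣ b) : p ^ n ∣ a := by
  induction j generalizing b with
  | zero => simp at hb
  | succ j ih =>
    by_cases hpb : p ∣ b
    · obtain ⟨c, rfl⟩ := hpb
      refine ih (b := c) ?_ fun hc => hb ?_
      · rw [← add_assoc, pow_succ, mul_left_comm, mul_comm _ p] at h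
        exact (mul_dvd_mul_iff_left hp.ne_zero).1 h
      · rw [pow_succ, mul_comm]
        exact mul_dvd_mul_left p hc
    · have : IsCoprime (p ^ (n + (j + 1))) b :=
        ((Prime.coprime_iff_not_dvd hp).2 hpb).pow_left
      exact (pow_dvd_pow p (by omega)).trans (this.dvd_of_dvd_mul_right h)

theorem ncard_rootsMod_two_pow {k : ℕ} (e : ℕ) (hk : 0 < k) :
    (rootsMod k (2 ^ e)).ncard ≤ 4 * k ^ 2 := by
  obtain ⟨j, hj1, hj2⟩ : ∃ j : ℕ, k < 2 ^ j ∧ 2 ^ j ≤ 2 * k := by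
    refine ⟨Nat.log 2 k + 1, Nat.lt_pow_succ_log_self (by norm_num) k, ?_⟩
    rw [pow_succ, mul_comm]
    exact Nat.mul_le_mul_left 2 (Nat.pow_log_le_self 2 hk.ne')
  have hpe : 0 < 2 ^ e := by positivity
  have := NeZero.of_pos hpe
  have hj0 : 0 < j := by
    rcases Nat.eq_zero_or_pos j with rfl | h
    · simp at hj1; omega
    · exact h
  have key : ∀ u ∈ rootsMod k (2 ^ e), ∀ w ∈ rootsMod k (2 ^ e), u.val % 2 ^ j = w.val % 2 ^ j →
      u.val % 2 ^ (e - j) = w.val % 2 ^ (e - j) := by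
    intro u hu w hw huw
    rcases Nat.le_total e j with hej | hej
    · rw [Nat.sub_eq_zero_of_le hej]; simp [Nat.mod_one]
    set a : ℤ := (u.val : ℤ) with ha
    set b : ℤ := (w.val : ℤ) with hb
    have h1 : ((2 ^ e : ℕ) : ℤ) ∣ a ^ k - b ^ k := by
      rw [← ZMod.intCast_zmod_eq_zero_iff_dvd]
      have hu' : u ^ k = 1 := hu
      have hw' : w ^ k = 1 := hw
      simp [a, b, hu', hw']
    have h2 : (2 ^ j : ℤ) ∣ a - b := by
      have := (Nat.modEq_iff_dvd.1 huw.symm : ((2 ^ j : ℕ) : ℤ) ∣ (u.val : ℤ) - w.val)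
      push_cast at this
      exact this
    have h2' : (2 : ℤ) ∣ a - b := (dvd_pow_self 2 hj0.ne').trans h2
    have hbodd : Odd b := by
      have h3 : ((2 ^ e : ℕ) : ℤ) ∣ b ^ k - 1 := by
        rw [← ZMod.intCast_zmod_eq_zero_iff_dvd]
        have hw' : w ^ k = 1 := hw
        simp [b, hw']
      have he0 : e ≠ 0 := by omega
      have h4 : (2 : ℤ) ∣ b ^ k - 1 := by
        refine Dvd.dvd.trans ?_ h3
        push_cast
        exact dvd_pow_self 2 he0
      have h5 : Odd (b ^ k) := by
        obtain ⟨c, hc⟩ := h4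
        exact ⟨c, by linarith⟩
      exact (Int.odd_pow.1 h5).resolve_right hk.ne'
    set S : ℤ := ∑ i ∈ Finset.range k, a ^ i * b ^ (k - 1 - i) with hS
    have h3 : S * (a - b) = a ^ k - b ^ k := (Commute.all a b).geom_sum₂_mul k
    have h4 : ¬ (2 ^ j : ℤ) ∣ S := by
      intro hdiv
      have h5 : (2 ^ j : ℤ) ∣ S - k * b ^ (k - 1) := by
        have : (k : ℤ) * b ^ (k - 1) = ∑ i ∈ Finset.range k, b ^ i * b ^ (k - 1 - i) := by
          rw [Finset.sum_congr rfl (g := fun _ => b ^ (k - 1))]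
          · simp
          · intro i hi
            rw [← pow_add]
            congr 1
            have := Finset.mem_range.1 hi
            omega
        rw [this, hS, ← Finset.sum_sub_distrib]
        refine Finset.dvd_sum fun i _ => ?_
        rw [← sub_mul]
        exact Dvd.dvd.mul_right (h2.trans (sub_dvd_pow_sub_pow a b i)) _
      have h6 : (2 ^ j : ℤ) ∣ k * b ^ (k - 1) := by
        have := dvd_sub hdiv h5
        simpa using this
      have h7 : IsCoprime (2 ^ j : ℤ) (b ^ (k - 1)) := by
        apply IsCoprime.pow
        rw [Int.isCoprime_iff_gcd_eq_one]
        exact (Int.isCoprime_iff_gcd_eq_one.1 (by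
          obtain ⟨c, hc⟩ := hbodd
          exact ⟨-c, 1, by linarith⟩))
      have h8 := h7.dvd_of_dvd_mul_right h6
      have h9 : 2 ^ j ∣ k := by exact_mod_cast h8
      exact absurd (Nat.le_of_dvd hk h9) (by omega)
    have h6 : (2 : ℤ) ^ (e - j) ∣ a - b := by
      refine pow_dvd_left_of_not_pow_dvd_right Int.prime_two ?_ h4
      rw [Nat.sub_add_cancel hej, mul_comm, h3]
      push_cast at h1
      exact h1
    have : ((2 ^ (e - j) : ℕ) : ℤ) ∣ (u.val : ℤ) - w.val := by push_cast; exact h6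
    exact (Nat.modEq_iff_dvd.2 this).symm
  have hinj : Set.InjOn (fun u : ZMod (2 ^ e) => (u.val % 2 ^ j, u.val / 2 ^ (e - j)))
      (rootsMod k (2 ^ e)) := by
    intro u hu w hw h
    simp only [Prod.mk.injEq] at h
    have h1 := key u hu w hw h.1
    apply ZMod.val_injective
    rw [← Nat.div_add_mod u.val (2 ^ (e - j)), ← Nat.div_add_mod w.val (2 ^ (e - j)), h1, h.2]
  have hmaps : ∀ u ∈ rootsMod k (2 ^ e), (u.val % 2 ^ j, u.val / 2 ^ (e - j)) ∈
      ((Finset.range (2 ^ j) ×ˢ Finset.range (2 ^ j) : Finset (ℕ × ℕ)) : Set (ℕ × ℕ)) := by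
    intro u _
    simp only [Finset.coe_product, Finset.coe_range, Set.mem_prod, Set.mem_Iio]
    refine ⟨Nat.mod_lt _ (by positivity), ?_⟩
    rw [Nat.div_lt_iff_lt_mul (by positivity), ← pow_add]
    exact lt_of_lt_of_le (ZMod.val_lt u) (Nat.pow_le_pow_right (by norm_num) (by omega))
  have := Set.ncard_le_ncard_of_injOn _ hmaps hinj (Finset.finite_toSet _)
  rw [Set.ncard_coe_finset, Finset.card_product, Finset.card_range] at this
  nlinarith

theorem ncard_rootsMod_le_pow_card {k : ℕ} (hk : 0 < k) (d : ℕ) (hd : 0 < d) :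
    (rootsMod k d).ncard ≤ (4 * k ^ 2) ^ d.primeFactors.card := by
  induction d using Nat.recOnPosPrimePosCoprime with
  | prime_pow p n hp hn =>
    rw [Nat.primeFactors_prime_pow hn.ne' hp]
    simp only [Finset.card_singleton, pow_one]
    rcases eq_or_ne p 2 with rfl | hp2
    · exact ncard_rootsMod_two_pow n hk
    · refine (ncard_rootsMod_odd_prime_pow n hk hp hp2).trans ?_
      nlinarith
  | zero => omega
  | one =>
    have : (rootsMod k 1).ncard ≤ 1 := by
      rw [Set.ncard_le_one (Set.toFinite _)]
      intro a _ b _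
      exact Subsingleton.elim (α := ZMod 1) a b
    simpa using this
  | coprime a b ha hb hab iha ihb =>
    have h1 := ncard_rootsMod_mul_le k (by omega : 0 < a) (by omega : 0 < b) hab
    rw [hab.primeFactors_mul, Finset.card_union_of_disjoint hab.disjoint_primeFactors, pow_add]
    exact h1.trans (Nat.mul_le_mul (iha (by omega)) (ihb (by omega)))

theorem pow_card_primeFactors_le {K : ℕ} (hK : 1 ≤ K) {ε : ℝ} (hε : 0 < ε) :
    ∃ C : ℝ, 1 ≤ C ∧ ∀ d : ℕ, 0 < d → (K : ℝ) ^ d.primeFactors.card ≤ C * (d : ℝ) ^ ε := by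
  obtain ⟨P, hP⟩ := exists_nat_ge ((K : ℝ) ^ (1 / ε))
  have hK1 : (1:ℝ) ≤ K := by exact_mod_cast hK
  refine ⟨(K : ℝ) ^ P, one_le_pow₀ hK1, fun d hd => ?_⟩
  set A := d.primeFactors.filter (fun p => p < P)
  set B := d.primeFactors.filter (fun p => ¬ p < P)
  have hcard : d.primeFactors.card = A.card + B.card :=
    (Finset.card_filter_add_card_filter_not (fun p => p < P)).symm
  rw [hcard, pow_add]
  have h1 : (K : ℝ) ^ A.card ≤ (K : ℝ) ^ P := by
    refine pow_le_pow_right₀ hK1 ?_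
    have : A ⊆ Finset.range P := fun p hp => Finset.mem_range.2 (Finset.mem_filter.1 hp).2
    simpa using Finset.card_le_card this
  have h2 : (K : ℝ) ^ B.card ≤ (d : ℝ) ^ ε := by
    have hB : ∏ p ∈ B, p ≤ d := by
      refine Nat.le_of_dvd hd (Dvd.dvd.trans ?_ (Nat.prod_primeFactors_dvd d))
      exact Finset.prod_dvd_prod_of_subset _ _ _ (Finset.filter_subset _ _)
    calc (K : ℝ) ^ B.card = ∏ p ∈ B, (K : ℝ) := by simp
      _ ≤ ∏ p ∈ B, ((p : ℝ) ^ ε) := by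
        refine Finset.prod_le_prod (fun _ _ => by positivity) fun p hp => ?_
        have hp2 : (P : ℝ) ≤ p := by exact_mod_cast not_lt.1 (Finset.mem_filter.1 hp).2
        calc (K : ℝ) = ((K : ℝ) ^ (1 / ε)) ^ ε := by
              rw [← Real.rpow_mul (by positivity)]
              field_simp
              simp
          _ ≤ (p : ℝ) ^ ε := Real.rpow_le_rpow (by positivity) (hP.trans hp2) hε.le
      _ = ((∏ p ∈ B, p : ℕ) : ℝ) ^ ε := by
        push_cast
        rw [Real.finsetProd_rpow _ _ (fun _ _ => by positivity)]
      _ ≤ _ := Real.rpow_le_rpow (by positivity) (by exact_mod_cast hB) hε.le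
  gcongr

theorem exists_ncard_rootsMod_le {k : ℕ} (hk : 0 < k) {ε : ℝ} (hε : 0 < ε) :
    ∃ C : ℝ, 1 ≤ C ∧ ∀ d : ℕ, 0 < d → ((rootsMod k d).ncard : ℝ) ≤ C * (d : ℝ) ^ ε := by
  have hk2 : 1 ≤ 4 * k ^ 2 := by have := Nat.pow_pos (n := 2) hk; omega
  obtain ⟨C, hC1, hC⟩ := pow_card_primeFactors_le hk2 hε
  refine ⟨C, hC1, fun d hd => le_trans ?_ (hC d hd)⟩
  exact_mod_cast ncard_rootsMod_le_pow_card hk d hd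

/-- The primes in `(Z, 2 Z]`. -/
def dyadicPrimes (Z : ℕ) : Finset ℕ := (Finset.Ioc Z (2 * Z)).filter (fun p : ℕ => p.Prime)

theorem mem_dyadicPrimes {Z p : ℕ} : p ∈ dyadicPrimes Z ↔ (Z < p ∧ p ≤ 2 * Z) ∧ p.Prime := by
  simp [dyadicPrimes]

theorem card_powers_congr_le {k : ℕ} (hk : 0 < k) {Z d : ℕ} (hd : 0 < d) {c : ℤ} {M : ℝ}
    (hM1 : 1 ≤ M) (hM : ∀ e : ℤ, ((primesIn Z Z d e).card : ℝ) ≤ M) :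
    (((dyadicPrimes Z).filter (fun p : ℕ => (d : ℤ) ∣ (p : ℤ) ^ k - c)).card : ℝ) ≤
      ((rootsMod k d).ncard + 1) * M := by
  set F := (dyadicPrimes Z).filter (fun p : ℕ => (d : ℤ) ∣ (p : ℤ) ^ k - c) with hF
  have : NeZero d := NeZero.of_pos hd
  have hMn : (0:ℝ) ≤ ((rootsMod k d).ncard : ℝ) * M := by positivity
  by_cases hcop : Int.gcd c d = 1
  · rcases F.eq_empty_or_nonempty with he | ⟨p0, hp0⟩
    · rw [he]; simp; nlinarith
    have hcong : ∀ p ∈ F, ((p : ZMod d)) ^ k = (c : ZMod d) := by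
      intro p hp
      have h := (Finset.mem_filter.1 hp).2
      rw [← ZMod.intCast_zmod_eq_zero_iff_dvd] at h
      push_cast at h
      exact sub_eq_zero.1 h
    have hcu : IsUnit (c : ZMod d) := by
      rw [ZMod.coe_int_isUnit_iff_isCoprime]
      exact (Int.isCoprime_iff_gcd_eq_one.2 hcop).symm
    have hp0u : IsUnit (p0 : ZMod d) := by
      rw [← isUnit_pow_iff hk.ne', hcong p0 hp0]
      exact hcu
    obtain ⟨u0, hu0⟩ := hp0u
    set R : Finset (ZMod d) := (Set.toFinite (rootsMod k d)).toFinset with hR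
    have hsub : F ⊆ R.biUnion (fun u => primesIn Z Z d ((u0 * u : ZMod d).val)) := by
      intro p hp
      rw [Finset.mem_biUnion]
      refine ⟨(↑u0⁻¹ : ZMod d) * p, ?_, ?_⟩
      · rw [hR, Set.Finite.mem_toFinset]
        change ((↑u0⁻¹ : ZMod d) * p) ^ k = 1
        rw [mul_pow, hcong p hp, ← hcong p0 hp0, ← hu0, ← mul_pow, Units.inv_mul, one_pow]
      · have h1 := (mem_dyadicPrimes.1 (Finset.mem_filter.1 hp).1)
        unfold primesIn
        rw [Finset.mem_filter, Finset.mem_Ioc]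
        refine ⟨⟨h1.1.1, by omega⟩, h1.2, ?_⟩
        rw [← ZMod.intCast_zmod_eq_zero_iff_dvd]
        simp
    have h1 := (Finset.card_le_card hsub).trans Finset.card_biUnion_le
    have h2 : (F.card : ℝ) ≤ ∑ u ∈ R, M := by
      refine (Nat.cast_le.2 h1).trans ?_
      push_cast
      exact Finset.sum_le_sum fun u _ => hM _
    rw [Finset.sum_const, nsmul_eq_mul] at h2
    have h3 : (R.card : ℝ) = (rootsMod k d).ncard := by
      rw [Set.ncard_eq_toFinset_card _ (Set.toFinite _)]
    rw [h3] at h2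
    nlinarith
  · obtain ⟨l, hl, hld⟩ := Nat.exists_prime_and_dvd hcop
    have hlc : (l : ℤ) ∣ c := (Int.natCast_dvd_natCast.2 hld).trans (Int.gcd_dvd_left ..)
    have hldd : (l : ℤ) ∣ d := (Int.natCast_dvd_natCast.2 hld).trans (Int.gcd_dvd_right ..)
    have hsub : F ⊆ {l} := by
      intro p hp
      obtain ⟨h1, h2⟩ := Finset.mem_filter.1 hp
      have h3 : (l : ℤ) ∣ (p : ℤ) ^ k := by
        have := dvd_add (hldd.trans h2) hlc
        simpa using this
      have h4 : l ∣ p := by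
        have : l ∣ p ^ k := by exact_mod_cast h3
        exact hl.dvd_of_dvd_pow this
      rw [Finset.mem_singleton]
      exact ((Nat.prime_dvd_prime_iff_eq hl (mem_dyadicPrimes.1 h1).2).1 h4).symm
    have := Finset.card_le_card hsub
    rw [Finset.card_singleton] at this
    have : (F.card : ℝ) ≤ 1 := by exact_mod_cast this
    nlinarith

theorem rpow_le_of_le_pow {k Z d : ℕ} {θ : ℝ} (hθ : 0 ≤ θ) (hdZ : d ≤ Z ^ (3 * k)) :
    (d : ℝ) ^ θ ≤ (Z : ℝ) ^ (3 * k * θ) := by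
  calc (d : ℝ) ^ θ ≤ ((Z : ℝ) ^ (3 * k)) ^ θ := by
        apply Real.rpow_le_rpow (by positivity) _ hθ
        exact_mod_cast hdZ
    _ = _ := by
        rw [← Real.rpow_natCast, ← Real.rpow_mul (by positivity)]
        push_cast
        rfl

theorem exists_card_powers_congr {k : ℕ} (hk : 0 < k) : ∃ C : ℝ, 0 < C ∧ ∀ Z : ℕ, 2 ≤ Z →
    ∀ d : ℕ, 0 < d → d ≤ Z ^ (3 * k) → ∀ c : ℤ,
      (((dyadicPrimes Z).filter (fun p : ℕ => (d : ℤ) ∣ (p : ℤ) ^ k - c)).card : ℝ) * Real.log Z ≤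
        C * (d : ℝ) ^ (-(1 / (48 * k) : ℝ)) * Z := by
  have hkR : (1:ℝ) ≤ k := by exact_mod_cast hk
  set θ : ℝ := 1 / (48 * k) with hθdef
  have hθ : 0 < θ := by positivity
  have hθ1 : θ ≤ 1 / 48 := by
    rw [hθdef]
    apply one_div_le_one_div_of_le (by norm_num)
    linarith
  obtain ⟨C1, hC1, hroots⟩ := exists_ncard_rootsMod_le hk hθ
  refine ⟨2 * C1 * (36 / θ) + 2 * C1 * 32, by positivity, fun Z hZ d hd hdZ c => ?_⟩
  have hZ1 : (1:ℝ) < Z := by exact_mod_cast hZ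
  have hZ0 : (0:ℝ) < Z := by linarith
  have hd1 : (1:ℝ) ≤ d := by exact_mod_cast hd
  have hd0 : (0:ℝ) < d := by linarith
  have hlogZ : 0 < Real.log Z := Real.log_pos hZ1
  have hdθ : (1:ℝ) ≤ (d:ℝ) ^ θ := Real.one_le_rpow hd1 hθ.le
  have hr : ((rootsMod k d).ncard : ℝ) + 1 ≤ 2 * C1 * (d:ℝ) ^ θ := by
    have := hroots d hd
    nlinarith
  have hdpow : (d : ℝ) ^ θ ≤ (Z : ℝ) ^ (1 / 16 : ℝ) := by
    refine (rpow_le_of_le_pow hθ.le hdZ).trans (le_of_eq ?_)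
    congr 1
    rw [hθdef]; field_simp; norm_num
  have hd2 : (d : ℝ) ^ θ * (d : ℝ) ^ θ * (d : ℝ) ^ (-θ) = (d:ℝ) ^ θ := by
    rw [← Real.rpow_add hd0, ← Real.rpow_add hd0]; congr 1; ring
  have hlog8 : Real.log Z ≤ 8 * (Z : ℝ) ^ (1 / 8 : ℝ) := by
    have := Real.log_le_rpow_div hZ0.le (ε := 1 / 8) (by norm_num)
    linarith
  by_cases hcase : (d : ℝ) ≤ (Z : ℝ) ^ (1 / 4 : ℝ)
  · have hdZ' : d ≤ Z := by
      have : (d : ℝ) ≤ Z := hcase.trans (Real.rpow_le_self_of_one_le hZ1.le (by norm_num))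
      exact_mod_cast this
    set M : ℝ := 36 / θ * (Z / d) * (d:ℝ) ^ θ / Real.log Z with hM
    have hMle : ∀ e : ℤ, ((primesIn Z Z d e).card : ℝ) ≤ M := by
      intro e
      have h := primesIn_card_mul_log_le (y := Z) (h := Z) (Z := Z) (e := e) (by omega) le_rfl
        (by omega) hd hdZ'
      rw [hM, le_div_iff₀ hlogZ]
      refine h.trans ?_
      have h2 : Real.log (9 * Z * d ^ 2 / Z) ≤ 18 / θ * (d:ℝ) ^ θ := by
        rw [show (9 * Z * d ^ 2 / Z : ℝ) = 9 * d ^ 2 by field_simp]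
        refine (Real.log_le_rpow_div (by positivity) (ε := θ / 2) (by positivity)).trans ?_
        rw [Real.mul_rpow (by norm_num) (by positivity), ← Real.rpow_natCast, ← Real.rpow_mul hd0.le]
        have : ((2:ℕ) : ℝ) * (θ / 2) = θ := by push_cast; ring
        rw [this]
        have h9 : (9:ℝ) ^ (θ / 2) ≤ 9 := Real.rpow_le_self_of_one_le (by norm_num) (by linarith)
        rw [div_le_iff₀ (by positivity)]
        calc (9:ℝ) ^ (θ / 2) * (d:ℝ) ^ θ ≤ 9 * (d:ℝ) ^ θ := by gcongr
          _ = _ := by field_simp; norm_num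
      calc 2 * ((Z : ℝ) / d) * Real.log (9 * Z * d ^ 2 / Z) ≤ 2 * ((Z : ℝ) / d) * (18 / θ * (d:ℝ) ^ θ) := by
            gcongr
        _ = _ := by ring
    have hM1 : 1 ≤ M := by
      rw [hM, le_div_iff₀ hlogZ, one_mul]
      have h1 : (Z : ℝ) ^ (3 / 4 : ℝ) ≤ Z / d := by
        rw [le_div_iff₀ hd0]
        calc _ ≤ (Z : ℝ) ^ (3 / 4 : ℝ) * (Z : ℝ) ^ (1 / 4 : ℝ) := by gcongr
          _ = Z := by rw [← Real.rpow_add hZ0]; norm_num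
      have h2 : (Z : ℝ) ^ (1 / 8 : ℝ) ≤ (Z : ℝ) ^ (3 / 4 : ℝ) :=
        Real.rpow_le_rpow_of_exponent_le hZ1.le (by norm_num)
      have h3 : (8:ℝ) ≤ 36 / θ := by
        rw [le_div_iff₀ hθ]; linarith
      calc Real.log Z ≤ 8 * (Z : ℝ) ^ (1 / 8 : ℝ) := hlog8
        _ ≤ 36 / θ * (Z / d) * 1 := by
          rw [mul_one]
          exact mul_le_mul h3 (h2.trans h1) (by positivity) (by positivity)
        _ ≤ _ := by gcongr
    have h := card_powers_congr_le hk hd (c := c) hM1 hMle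
    have hdm : (d:ℝ) ^ θ * (d : ℝ) ^ θ / d ≤ (d:ℝ) ^ (-θ) := by
      rw [div_le_iff₀ hd0, ← Real.rpow_add hd0]
      calc (d:ℝ) ^ (θ + θ) ≤ (d:ℝ) ^ (-θ + 1) :=
            Real.rpow_le_rpow_of_exponent_le hd1 (by linarith)
        _ = _ := by rw [Real.rpow_add hd0, Real.rpow_one]
    calc _ ≤ (2 * C1 * (d:ℝ) ^ θ * M) * Real.log Z := by
          gcongr
          exact h.trans (by gcongr)
      _ = 2 * C1 * (36 / θ) * ((d:ℝ) ^ θ * (d : ℝ) ^ θ / d) * Z := by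
          rw [hM]; field_simp
      _ ≤ 2 * C1 * (36 / θ) * (d:ℝ) ^ (-θ) * Z := by gcongr
      _ ≤ _ := by
          gcongr
          have : 0 < 2 * C1 * 32 := by positivity
          linarith
  · rw [not_le] at hcase
    have h := card_powers_congr_le hk hd (c := c) (M := Z / d + 1) (by
      have : (0:ℝ) ≤ (Z:ℝ) / d := by positivity
      linarith) (fun e => by
        have := primesIn_card_le_trivial Z Z d e
        have h2 : ((primesIn Z Z d e).card : ℝ) ≤ ((Z / d : ℕ) : ℝ) + 1 := by exact_mod_cast this
        exact h2.trans (by gcongr; exact Nat.cast_div_le))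
    have k1 : (d:ℝ) ^ θ * (d:ℝ) ^ θ * Real.log Z ≤ 8 * Z := by
      calc _ ≤ (Z : ℝ) ^ (1 / 16 : ℝ) * (Z : ℝ) ^ (1 / 16 : ℝ) * (8 * (Z : ℝ) ^ (1 / 8 : ℝ)) := by
            gcongr
        _ = 8 * (Z:ℝ) ^ (1 / 4 : ℝ) := by
            rw [← Real.rpow_add hZ0, mul_left_comm, ← Real.rpow_add hZ0]; norm_num
        _ ≤ 8 * Z := by
            gcongr
            exact Real.rpow_le_self_of_one_le hZ1.le (by norm_num)
    have k2 : (d:ℝ) ^ θ * (d:ℝ) ^ θ * Real.log Z ≤ 8 * d := by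
      have e1 : (Z : ℝ) ^ (1 / 8 : ℝ) ≤ (d:ℝ) ^ (1 / 2 : ℝ) := by
        calc (Z : ℝ) ^ (1 / 8 : ℝ) = ((Z : ℝ) ^ (1 / 4 : ℝ)) ^ (1 / 2 : ℝ) := by
              rw [← Real.rpow_mul hZ0.le]; norm_num
          _ ≤ _ := Real.rpow_le_rpow (by positivity) hcase.le (by norm_num)
      have e2 : (d:ℝ) ^ θ * (d:ℝ) ^ θ ≤ (d:ℝ) ^ (1 / 2 : ℝ) := by
        rw [← Real.rpow_add hd0]
        exact Real.rpow_le_rpow_of_exponent_le hd1 (by linarith)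
      calc _ ≤ (d:ℝ) ^ (1 / 2 : ℝ) * (8 * (d:ℝ) ^ (1 / 2 : ℝ)) := by
            gcongr
            exact hlog8.trans (by gcongr)
        _ = 8 * d := by rw [mul_left_comm, ← Real.rpow_add hd0]; norm_num
    have k3 : (d:ℝ) ^ θ * (Z / d + 1) * Real.log Z ≤ 32 * (d:ℝ) ^ (-θ) * Z := by
      have e3 : (d:ℝ) ^ θ * (d:ℝ) ^ (-θ) = 1 := by
        rw [← Real.rpow_add hd0]; simp
      have e4 : (0:ℝ) < (d:ℝ) ^ (-θ) := by positivity
      calc (d:ℝ) ^ θ * (Z / d + 1) * Real.log Z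
          = (d:ℝ) ^ θ * ((d:ℝ) ^ θ * (d:ℝ) ^ (-θ)) * (Z / d + 1) * Real.log Z := by
            rw [e3, mul_one]
        _ = (d:ℝ) ^ (-θ) * ((d:ℝ) ^ θ * (d:ℝ) ^ θ * Real.log Z) * (Z / d) +
            (d:ℝ) ^ (-θ) * ((d:ℝ) ^ θ * (d:ℝ) ^ θ * Real.log Z) := by ring
        _ ≤ (d:ℝ) ^ (-θ) * (8 * d) * (Z / d) + (d:ℝ) ^ (-θ) * (8 * Z) := by gcongr
        _ = 16 * (d:ℝ) ^ (-θ) * Z := by field_simp; ring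
        _ ≤ _ := by gcongr; norm_num
    calc _ ≤ (2 * C1 * (d:ℝ) ^ θ * (Z / d + 1)) * Real.log Z := by
          gcongr
          exact h.trans (by gcongr)
      _ = 2 * C1 * ((d:ℝ) ^ θ * (Z / d + 1) * Real.log Z) := by ring
      _ ≤ 2 * C1 * (32 * (d:ℝ) ^ (-θ) * Z) := by gcongr
      _ = 2 * C1 * 32 * (d:ℝ) ^ (-θ) * Z := by ring
      _ ≤ _ := by
          gcongr
          have : 0 < 2 * C1 * (36 / θ) := by positivity
          linarith

theorem exists_card_powers_interval {k : ℕ} (hk : 0 < k) : ∃ C : ℝ, 0 < C ∧ ∀ Z : ℕ, 2 ≤ Z →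
    ∀ D : ℕ, 0 < D → D ≤ Z ^ (3 * k) → ∀ y : ℝ,
      (((dyadicPrimes Z).filter (fun p : ℕ => y ≤ (p : ℝ) ^ k ∧
        (p : ℝ) ^ k ≤ y + 3 * 2 ^ k * Z ^ k / D)).card : ℝ) * Real.log Z ≤
        C * (D : ℝ) ^ (-(1 / (48 * k) : ℝ)) * Z := by
  have hkR : (1:ℝ) ≤ k := by exact_mod_cast hk
  set θ : ℝ := 1 / (48 * k) with hθdef
  have hθ : 0 < θ := by positivity
  have hθ1 : θ ≤ 1 / 48 := by
    rw [hθdef]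
    apply one_div_le_one_div_of_le (by norm_num)
    linarith
  set E : ℝ := 3 * 2 ^ k with hE
  have hE3 : 3 ≤ E := by
    rw [hE]
    have : (1:ℝ) ≤ 2 ^ k := one_le_pow₀ (by norm_num)
    linarith
  refine ⟨24 * E, by positivity, fun Z hZ D hD hDZ y => ?_⟩
  have hZ1 : (1:ℝ) < Z := by exact_mod_cast hZ
  have hZ0 : (0:ℝ) < Z := by linarith
  have hD1 : (1:ℝ) ≤ D := by exact_mod_cast hD
  have hD0 : (0:ℝ) < D := by linarith
  have hlogZ : 0 < Real.log Z := Real.log_pos hZ1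
  set F := (dyadicPrimes Z).filter (fun p : ℕ => y ≤ (p : ℝ) ^ k ∧
        (p : ℝ) ^ k ≤ y + E * Z ^ k / D) with hF
  rcases F.eq_empty_or_nonempty with he | hne
  · rw [he]; simp; positivity
  obtain ⟨p0, hp0, hmin⟩ := F.exists_min_image id hne
  have hp0' := mem_dyadicPrimes.1 (Finset.mem_filter.1 hp0).1
  have hclose : ∀ p ∈ F, ((p : ℝ) - p0) ≤ E * Z / D := by
    intro p hp
    obtain ⟨h1, h2⟩ := Finset.mem_filter.1 hp
    have h3 : p0 ≤ p := hmin p hp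
    have h3R : (p0 : ℝ) ≤ p := by exact_mod_cast h3
    have h4 : (p : ℝ) ^ k - (p0 : ℝ) ^ k ≤ E * Z ^ k / D := by
      have := (Finset.mem_filter.1 hp0).2.1
      linarith [h2.2]
    have h5 : ((p : ℝ) - p0) * (Z : ℝ) ^ (k - 1) ≤ (p : ℝ) ^ k - (p0 : ℝ) ^ k := by
      have hZp0 : (Z : ℝ) ≤ p0 := by exact_mod_cast hp0'.1.1.le
      obtain ⟨j, rfl⟩ : ∃ j, k = j + 1 := ⟨k - 1, by omega⟩
      simp only [Nat.add_sub_cancel]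
      have a1 : (p0 : ℝ) ^ j ≤ (p : ℝ) ^ j := pow_le_pow_left₀ (by positivity) h3R j
      have a2 : (Z : ℝ) ^ j ≤ (p : ℝ) ^ j := pow_le_pow_left₀ (by positivity) (hZp0.trans h3R) j
      rw [pow_succ, pow_succ]
      have a3 : (0:ℝ) ≤ p0 := by positivity
      nlinarith [mul_nonneg (sub_nonneg.2 a1) a3, mul_nonneg (sub_nonneg.2 a2) (sub_nonneg.2 h3R)]
    have h6 : ((p : ℝ) - p0) * (Z : ℝ) ^ (k - 1) ≤ (E * Z / D) * (Z : ℝ) ^ (k - 1) := by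
      refine (h5.trans h4).trans (le_of_eq ?_)
      have : (Z : ℝ) ^ k = Z * (Z : ℝ) ^ (k - 1) := by
        rw [← pow_succ']; congr 1; omega
      rw [this]; ring
    exact le_of_mul_le_mul_right h6 (by positivity)
  set h' := ⌊E * Z / D⌋₊ with hh'
  set h := min (h' + 1) (2 * Z - (p0 - 1)) with hh
  have hh1 : 1 ≤ h := by
    rw [hh, le_min_iff]; omega
  have hsub : F ⊆ primesIn (p0 - 1) h 1 0 := by
    intro p hp
    have h1 := mem_dyadicPrimes.1 (Finset.mem_filter.1 hp).1
    have h3 : p0 ≤ p := hmin p hp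
    have h4 : p - p0 ≤ h' := by
      apply Nat.le_floor
      rw [Nat.cast_sub h3]
      exact hclose p hp
    unfold primesIn
    rw [Finset.mem_filter, Finset.mem_Ioc]
    refine ⟨⟨by omega, ?_⟩, h1.2, by simp⟩
    rw [hh]
    rcases le_total (h' + 1) (2 * Z - (p0 - 1)) with hle | hle
    · rw [min_eq_left hle]; omega
    · rw [min_eq_right hle]; omega
  have hbt := primesIn_card_mul_log_le (y := p0 - 1) (h := h) (d := 1) (Z := Z) (e := 0) (by omega)
    (by omega) (by
      have : h ≤ 2 * Z - (p0 - 1) := min_le_right _ _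
      omega) one_pos hh1
  have hcard : (F.card : ℝ) ≤ (primesIn (p0 - 1) h 1 0).card := by
    exact_mod_cast Finset.card_le_card hsub
  have hhR : (1:ℝ) ≤ h := by exact_mod_cast hh1
  have hh0 : (0:ℝ) < h := by linarith
  have hle : (h : ℝ) ≤ E * Z / D + 1 := by
    have h1 : h ≤ h' + 1 := min_le_left _ _
    have h2 : (h : ℝ) ≤ (h' : ℝ) + 1 := by exact_mod_cast h1
    have h3 : (h' : ℝ) ≤ E * Z / D := Nat.floor_le (by positivity)
    linarith
  have hlog : Real.log (9 * Z * ((1:ℕ):ℝ) ^ 2 / h) ≤ 6 * Real.sqrt (Z / h) := by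
    have := Real.log_le_rpow_div (x := 9 * Z * ((1:ℕ):ℝ) ^ 2 / h) (by positivity) (ε := 1 / 2)
      (by norm_num)
    refine this.trans ?_
    rw [← Real.sqrt_eq_rpow]
    have e : (9 * Z * ((1:ℕ):ℝ) ^ 2 / h : ℝ) = 3 ^ 2 * (Z / h) := by push_cast; ring
    rw [e, Real.sqrt_mul (by norm_num), Real.sqrt_sq (by norm_num)]
    linarith
  have hsq : (h : ℝ) * Real.sqrt (Z / h) = Real.sqrt (Z * h) := by
    have : (h : ℝ) = Real.sqrt (h ^ 2) := (Real.sqrt_sq hh0.le).symm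
    conv_lhs => rw [this, ← Real.sqrt_mul (by positivity), Real.sqrt_sq hh0.le]
    congr 1
    field_simp
  have hDpow : (D : ℝ) ^ θ ≤ (Z : ℝ) ^ (1 / 16 : ℝ) := by
    refine (rpow_le_of_le_pow hθ.le hDZ).trans (le_of_eq ?_)
    congr 1
    rw [hθdef]; field_simp; norm_num
  have hfin : Real.sqrt (Z * h) ≤ 2 * E * (D:ℝ) ^ (-θ) * Z := by
    have b1 : Real.sqrt (Z * h) ≤ Real.sqrt (Z * (E * Z / D)) + Real.sqrt Z := by
      calc Real.sqrt (Z * h) ≤ Real.sqrt (Z * (E * Z / D) + Z) := by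
            apply Real.sqrt_le_sqrt
            nlinarith
        _ ≤ _ := by
            rw [Real.sqrt_le_left (by positivity)]
            have h1 := Real.sq_sqrt (show 0 ≤ (Z:ℝ) * (E * Z / D) by positivity)
            have h2 := Real.sq_sqrt hZ0.le
            have h3 : 0 ≤ Real.sqrt ((Z:ℝ) * (E * Z / D)) * Real.sqrt Z := by positivity
            nlinarith
    have b2 : Real.sqrt (Z * (E * Z / D)) ≤ E * (D:ℝ) ^ (-θ) * Z := by
      rw [Real.sqrt_le_left (by positivity)]
      have e1 : (E * (D:ℝ) ^ (-θ) * Z) ^ 2 = E ^ 2 * ((D:ℝ) ^ (-θ) * (D:ℝ) ^ (-θ)) * Z ^ 2 := by ring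
      rw [e1, ← Real.rpow_add hD0]
      have e2 : (D:ℝ)⁻¹ ≤ (D:ℝ) ^ (-θ + -θ) := by
        rw [← Real.rpow_neg_one]
        exact Real.rpow_le_rpow_of_exponent_le hD1 (by linarith)
      calc (Z : ℝ) * (E * Z / D) = E * (D:ℝ)⁻¹ * Z ^ 2 := by ring
        _ ≤ E ^ 2 * (D:ℝ) ^ (-θ + -θ) * Z ^ 2 := by
            gcongr
            nlinarith
    have b3 : Real.sqrt Z ≤ E * (D:ℝ) ^ (-θ) * Z := by
      have e1 : (1:ℝ) = (D:ℝ) ^ θ * (D:ℝ) ^ (-θ) := by rw [← Real.rpow_add hD0]; simp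
      have e2 : (0:ℝ) < (D:ℝ) ^ (-θ) := by positivity
      calc Real.sqrt Z = (Z:ℝ) ^ (1 / 2 : ℝ) * ((D:ℝ) ^ θ * (D:ℝ) ^ (-θ)) := by
            rw [← e1, mul_one, Real.sqrt_eq_rpow]
        _ ≤ (Z:ℝ) ^ (1 / 2 : ℝ) * ((Z : ℝ) ^ (1 / 16 : ℝ) * (D:ℝ) ^ (-θ)) := by gcongr
        _ = (D:ℝ) ^ (-θ) * (Z:ℝ) ^ (1 / 2 + 1 / 16 : ℝ) := by rw [Real.rpow_add hZ0]; ring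
        _ ≤ (D:ℝ) ^ (-θ) * Z := by
            gcongr
            exact Real.rpow_le_self_of_one_le hZ1.le (by norm_num)
        _ ≤ _ := by nlinarith [mul_pos e2 hZ0]
    linarith
  calc (F.card : ℝ) * Real.log Z ≤ (primesIn (p0 - 1) h 1 0).card * Real.log Z := by gcongr
    _ ≤ 2 * (h / (1:ℕ)) * Real.log (9 * Z * ((1:ℕ):ℝ) ^ 2 / h) := hbt
    _ ≤ 2 * (h / (1:ℕ)) * (6 * Real.sqrt (Z / h)) := by gcongr
    _ = 12 * (h * Real.sqrt (Z / h)) := by push_cast; ring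
    _ ≤ 12 * (2 * E * (D:ℝ) ^ (-θ) * Z) := by rw [hsq]; gcongr
    _ = _ := by ring

def modL (k : ℕ) : ℕ := (k + 1).factorial ^ 2

def modH (k : ℕ) : ℕ := k * modL k

theorem modL_pos (k : ℕ) : 0 < modL k := by unfold modL; positivity

theorem modH_pos {k : ℕ} (hk : 0 < k) : 0 < modH k := Nat.mul_pos hk (modL_pos k)

theorem modL_dvd_modH (k : ℕ) : modL k ∣ modH k := Dvd.intro_left k rfl

theorem one_add_modL_mul_pow {k : ℕ} (u : ℤ) :
    ∃ s : ℤ, (1 + modL k * u) ^ k = 1 + modH k * (u + (k + 1).factorial * s) := by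
  rcases Nat.eq_zero_or_pos k with rfl | hk
  · exact ⟨0, by simp [modH]⟩
  obtain ⟨m, rfl⟩ : ∃ m, k = m + 1 := ⟨k - 1, by omega⟩
  set F : ℤ := ((m + 1 + 1).factorial : ℤ) with hF
  have hL : (modL (m + 1) : ℤ) = F ^ 2 := by simp [modL, hF]
  have hterm : ∀ i ∈ Finset.range m, ∃ s : ℤ,
      (F ^ 2 * u) ^ (i + 2) * ((m + 1).choose (i + 2) : ℤ) =
        ((m + 1 : ℕ) : ℤ) * F ^ 2 * (F * s) := by
    intro i hi
    rw [Finset.mem_range] at hi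
    obtain ⟨e, he⟩ : (i + 2) ∣ (m + 1 + 1).factorial :=
      Nat.dvd_factorial (by omega) (by omega)
    have he' : F = ((i + 2 : ℕ) : ℤ) * e := by rw [hF, he]; push_cast; ring
    have hc : ((m + 1 : ℕ) : ℤ) * (m.choose (i + 1) : ℤ) =
        ((m + 1).choose (i + 2) : ℤ) * ((i + 2 : ℕ) : ℤ) := by
      exact_mod_cast Nat.add_one_mul_choose_eq m (i + 1)
    refine ⟨F ^ (2 * i) * u ^ (i + 2) * e * m.choose (i + 1), ?_⟩
    calc (F ^ 2 * u) ^ (i + 2) * ((m + 1).choose (i + 2) : ℤ)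
        = F ^ 3 * F ^ (2 * i) * u ^ (i + 2) * F * ((m + 1).choose (i + 2) : ℤ) := by ring
      _ = F ^ 3 * F ^ (2 * i) * u ^ (i + 2) * (((i + 2 : ℕ) : ℤ) * e) *
            ((m + 1).choose (i + 2) : ℤ) := by rw [← he']
      _ = F ^ 3 * F ^ (2 * i) * u ^ (i + 2) * e *
            (((m + 1).choose (i + 2) : ℤ) * ((i + 2 : ℕ) : ℤ)) := by ring
      _ = _ := by rw [← hc]; ring
  choose! s hs using hterm
  refine ⟨∑ i ∈ Finset.range m, s i, ?_⟩
  rw [add_comm, add_pow, hL]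
  simp only [one_pow, mul_one]
  rw [Finset.sum_range_succ', Finset.sum_range_succ', Finset.sum_congr rfl hs,
    ← Finset.mul_sum, ← Finset.mul_sum]
  simp [modH, hL]
  ring

theorem modH_dvd_pow_sub_one {k : ℕ} {x : ℤ} (hx : (modL k : ℤ) ∣ x - 1) :
    (modH k : ℤ) ∣ x ^ k - 1 := by
  obtain ⟨u, hu⟩ := hx
  obtain ⟨s, hs⟩ := one_add_modL_mul_pow (k := k) u
  have : x = 1 + modL k * u := by linarith
  exact ⟨u + (k + 1).factorial * s, by rw [this, hs]; ring⟩

theorem prime_dvd_modL {k p : ℕ} (hp : p.Prime) (h : p ≤ k + 1) : p ∣ modL k :=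
  dvd_pow ((hp.dvd_factorial).2 h) two_ne_zero

theorem prime_le_of_dvd_modH {k p : ℕ} (hk : 0 < k) (hp : p.Prime) (h : p ∣ modH k) :
    p ≤ k + 1 := by
  rcases (hp.dvd_mul).1 h with h | h
  · exact (Nat.le_of_dvd hk h).trans (by omega)
  · exact (hp.dvd_factorial).1 (hp.dvd_of_dvd_pow h)

/-- `(1 + L)^k = 1 + H t` with `t` congruent to `1` modulo `(k+1)!`. -/
theorem one_add_modL_pow (k : ℕ) :
    ∃ t : ℤ, (1 + modL k : ℤ) ^ k = 1 + modH k * t ∧ ((k + 1).factorial : ℤ) ∣ t - 1 := by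
  obtain ⟨s, hs⟩ := one_add_modL_mul_pow (k := k) 1
  exact ⟨_, by rw [← hs]; ring, ⟨s, by ring⟩⟩

theorem isCoprime_modH_of_dvd {k : ℕ} (hk : 0 < k) {t : ℤ}
    (ht : ((k + 1).factorial : ℤ) ∣ t - 1) : IsCoprime t (modH k : ℤ) := by
  rw [Int.isCoprime_iff_gcd_eq_one]
  by_contra hne
  obtain ⟨p, hp, hpd⟩ := Nat.exists_prime_and_dvd hne
  have h1 : (p : ℤ) ∣ t := (Int.natCast_dvd_natCast.2 hpd).trans (Int.gcd_dvd_left ..)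
  have h2 : (p : ℤ) ∣ modH k := (Int.natCast_dvd_natCast.2 hpd).trans (Int.gcd_dvd_right ..)
  have h3 : p ≤ k + 1 := prime_le_of_dvd_modH hk hp (Int.natCast_dvd_natCast.1 h2)
  have h4 : (p : ℤ) ∣ t - 1 := (Int.natCast_dvd_natCast.2 ((hp.dvd_factorial).2 h3)).trans ht
  have h5 : (p : ℤ) ∣ 1 := by simpa using dvd_sub h1 h4
  exact hp.one_lt.ne' (by exact_mod_cast Int.eq_one_of_dvd_one (by positivity) h5)

/-- Residue classes modulo `Q` that are units and congruent to `1` modulo `L`. -/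
def unitClasses (k Q : ℕ) : Finset ((ZMod Q)ˣ) :=
  if h : Q = 0 then ∅ else
    haveI : NeZero Q := ⟨h⟩
    Finset.univ.filter (fun r : (ZMod Q)ˣ => (modL k : ℤ) ∣ ((r : ZMod Q).val : ℤ) - 1)

theorem mem_unitClasses {k Q : ℕ} [NeZero Q] {r : (ZMod Q)ˣ} :
    r ∈ unitClasses k Q ↔ (modL k : ℤ) ∣ ((r : ZMod Q).val : ℤ) - 1 := by
  simp [unitClasses, NeZero.ne Q]

theorem dvd_of_zmod_eq {Q M : ℕ} (h : M ∣ Q) {a b : ℤ} (hab : (a : ZMod Q) = b) :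
    (M : ℤ) ∣ a - b := by
  have : (Q : ℤ) ∣ a - b := by
    rw [← ZMod.intCast_zmod_eq_zero_iff_dvd]; push_cast; rw [hab, sub_self]
  exact (Int.natCast_dvd_natCast.2 h).trans this

theorem unitClasses_mul_mem {k Q : ℕ} [NeZero Q] (hQ : modL k ∣ Q) {r g : (ZMod Q)ˣ}
    (hr : r ∈ unitClasses k Q) (hg : g ∈ unitClasses k Q) : g * r ∈ unitClasses k Q := by
  rw [mem_unitClasses] at *
  have h1 : (modL k : ℤ) ∣ (((g * r : (ZMod Q)ˣ) : ZMod Q).val : ℤ) -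
      ((g : ZMod Q).val : ℤ) * ((r : ZMod Q).val : ℤ) := by
    apply dvd_of_zmod_eq hQ
    simp
  have h2 : ((((g * r : (ZMod Q)ˣ) : ZMod Q).val : ℤ) - 1) =
      ((((g * r : (ZMod Q)ˣ) : ZMod Q).val : ℤ) -
      ((g : ZMod Q).val : ℤ) * ((r : ZMod Q).val : ℤ)) +
      (((g : ZMod Q).val : ℤ) - 1) * ((r : ZMod Q).val : ℤ) +
      (((r : ZMod Q).val : ℤ) - 1) := by ring
  rw [h2]
  exact dvd_add (dvd_add h1 (Dvd.dvd.mul_right hg _)) hr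

/-- An integer prime to `M` and congruent to `1` modulo `L ∣ M` lifts to a class modulo `Q`. -/
theorem exists_mem_unitClasses {k Q M : ℕ} [NeZero Q] (hLM : modL k ∣ M) (hMQ : M ∣ Q)
    {w : ℤ} (hw : IsCoprime w (M : ℤ)) (hw1 : (modL k : ℤ) ∣ w - 1) :
    ∃ g ∈ unitClasses k Q, (M : ℤ) ∣ ((g : ZMod Q).val : ℤ) - w := by
  have hu : IsUnit ((w : ℤ) : ZMod M) := (ZMod.coe_int_isUnit_iff_isCoprime w M).2 hw.symm
  obtain ⟨g, hg⟩ := ZMod.unitsMap_surjective hMQ hu.unit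
  have h1 : (M : ℤ) ∣ ((g : ZMod Q).val : ℤ) - w := by
    have h2 := congrArg Units.val hg
    simp only [ZMod.unitsMap_def, Units.coe_map, IsUnit.unit_spec, MonoidHom.coe_coe] at h2
    rw [← ZMod.intCast_zmod_eq_zero_iff_dvd]
    push_cast
    rw [sub_eq_zero, ← h2, ZMod.castHom_apply, ZMod.cast_eq_val]
  refine ⟨g, ?_, h1⟩
  rw [mem_unitClasses]
  have : ((g : ZMod Q).val : ℤ) - 1 = (((g : ZMod Q).val : ℤ) - w) + (w - 1) := by ring
  rw [this]
  exact dvd_add ((Int.natCast_dvd_natCast.2 hLM).trans h1) hw1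


theorem isCoprime_val_unit {Q d : ℕ} [NeZero Q] (hd : d ∣ Q) (r : (ZMod Q)ˣ) :
    IsCoprime (d : ℤ) ((r : ZMod Q).val : ℤ) := by
  have h := ZMod.val_coe_unit_coprime r
  exact ((Nat.isCoprime_iff_coprime.2 h).symm).of_isCoprime_of_dvd_left
    (Int.natCast_dvd_natCast.2 hd)

theorem dvd_val_mul_sub {Q d : ℕ} [NeZero Q] (hd : d ∣ Q) (r g : (ZMod Q)ˣ) (k : ℕ) :
    (d : ℤ) ∣ ((((g * r : (ZMod Q)ˣ) : ZMod Q).val : ℤ)) ^ k -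
      ((g : ZMod Q).val : ℤ) ^ k * ((r : ZMod Q).val : ℤ) ^ k := by
  rw [← mul_pow]
  refine dvd_trans ?_ (sub_dvd_pow_sub_pow _ _ k)
  apply dvd_of_zmod_eq hd
  simp

theorem card_unitClasses_filter_le_half {k Q d : ℕ} [NeZero Q] (hQ : modL k ∣ Q) (hd : d ∣ Q)
    {g : (ZMod Q)ˣ} (hg : g ∈ unitClasses k Q)
    (hgd : ¬ (d : ℤ) ∣ ((g : ZMod Q).val : ℤ) ^ k - 1) (c : ℤ) :
    2 * ((unitClasses k Q).filter
      (fun r : (ZMod Q)ˣ => (d : ℤ) ∣ ((r : ZMod Q).val : ℤ) ^ k - c)).card ≤ (unitClasses k Q).card := by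
  set F := (unitClasses k Q).filter (fun r : (ZMod Q)ˣ => (d : ℤ) ∣ ((r : ZMod Q).val : ℤ) ^ k - c) with hF
  have hdis : Disjoint F (F.image (fun r => g * r)) := by
    rw [Finset.disjoint_left]
    intro r' h1 h2
    obtain ⟨r, hr, rfl⟩ := Finset.mem_image.1 h2
    have e1 := (Finset.mem_filter.1 h1).2
    have e2 := (Finset.mem_filter.1 hr).2
    have e3 := dvd_val_mul_sub hd r g k
    apply hgd
    have e4 : (d : ℤ) ∣ ((r : ZMod Q).val : ℤ) ^ k * (((g : ZMod Q).val : ℤ) ^ k - 1) := by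
      have := dvd_sub (dvd_sub e1 e2) e3
      refine this.trans (dvd_of_eq ?_)
      ring
    exact (((isCoprime_val_unit hd r).pow_right (n := k))).dvd_of_dvd_mul_left e4
  have hcard : (F.image (fun r => g * r)).card = F.card :=
    Finset.card_image_of_injective _ (mul_right_injective g)
  have hsub : F ∪ F.image (fun r => g * r) ⊆ unitClasses k Q := by
    intro r hr
    rcases Finset.mem_union.1 hr with h | h
    · exact (Finset.mem_filter.1 h).1
    · obtain ⟨r', hr', rfl⟩ := Finset.mem_image.1 h
      exact unitClasses_mul_mem hQ (Finset.mem_filter.1 hr').1 hg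
  have := Finset.card_le_card hsub
  rw [Finset.card_union_of_disjoint hdis, hcard] at this
  omega

theorem one_add_mul_pow_dvd (h t : ℤ) (j : ℕ) : h ^ 2 ∣ (1 + h * t) ^ j - 1 - h * (j * t) := by
  induction j with
  | zero => simp
  | succ j ih =>
    have : (1 + h * t) ^ (j + 1) - 1 - h * ((j + 1 : ℕ) * t) =
        ((1 + h * t) ^ j - 1 - h * (j * t)) * (1 + h * t) + h ^ 2 * (j * t ^ 2) := by
      push_cast; ring
    rw [this]
    exact dvd_add (Dvd.dvd.mul_right ih _) (Dvd.intro _ rfl)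

theorem isCoprime_one_add_modL_modH {k : ℕ} (hk : 0 < k) :
    IsCoprime (1 + modL k : ℤ) (modH k : ℤ) := by
  apply isCoprime_modH_of_dvd hk
  exact ⟨((k + 1).factorial : ℤ), by simp [modL]; ring⟩

theorem exists_unitClass_pow {k Q : ℕ} [NeZero Q] (hk : 0 < k) (hQ : modH k ^ 2 ∣ Q) (e : ℤ) :
    ∃ g ∈ unitClasses k Q,
      ((modH k : ℤ) ^ 2) ∣ ((g : ZMod Q).val : ℤ) ^ k - 1 - modH k * e := by
  obtain ⟨t, ht, ht1⟩ := one_add_modL_pow k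
  obtain ⟨a, b, hab⟩ := isCoprime_modH_of_dvd hk ht1
  have hHpos : (0 : ℤ) < modH k := by exact_mod_cast modH_pos hk
  set j : ℕ := ((e * a) % (modH k : ℤ)).toNat with hj
  have hjc : (j : ℤ) = (e * a) % (modH k : ℤ) :=
    Int.toNat_of_nonneg (Int.emod_nonneg _ hHpos.ne')
  have hjd : (modH k : ℤ) ∣ j * t - e := by
    have h1 : (modH k : ℤ) ∣ e * a - j := by
      rw [hjc]; exact Int.dvd_self_sub_emod
    have h2 : (j * t - e : ℤ) = -((e * a - j) * t) - e * b * modH k := by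
      linear_combination (e) * hab
    rw [h2]
    exact dvd_sub (dvd_neg.2 (Dvd.dvd.mul_right h1 _)) (Dvd.intro_left _ rfl)
  have hcop : IsCoprime ((1 + modL k : ℤ) ^ j) ((modH k ^ 2 : ℕ) : ℤ) := by
    push_cast
    exact (isCoprime_one_add_modL_modH hk).pow
  obtain ⟨g, hg, hgd⟩ := exists_mem_unitClasses (k := k)
    ((modL_dvd_modH k).trans (dvd_pow_self _ two_ne_zero)) hQ hcop (by
      have := sub_dvd_pow_sub_pow (1 + modL k : ℤ) 1 j
      simpa using this)
  refine ⟨g, hg, ?_⟩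
  have h1 : ((modH k : ℤ) ^ 2) ∣ ((g : ZMod Q).val : ℤ) ^ k - ((1 + modL k : ℤ) ^ j) ^ k := by
    refine dvd_trans ?_ (sub_dvd_pow_sub_pow _ _ k)
    exact_mod_cast hgd
  have h2 : ((1 + modL k : ℤ) ^ j) ^ k = (1 + modH k * t) ^ j := by
    rw [← ht, ← pow_mul, ← pow_mul, mul_comm]
  have h3 := one_add_mul_pow_dvd (modH k : ℤ) t j
  obtain ⟨v, hv⟩ := hjd
  have h4 : ((g : ZMod Q).val : ℤ) ^ k - 1 - modH k * e =
      (((g : ZMod Q).val : ℤ) ^ k - ((1 + modL k : ℤ) ^ j) ^ k) +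
      ((1 + modH k * t) ^ j - 1 - modH k * (j * t)) + (modH k : ℤ) ^ 2 * v := by
    rw [h2]; linear_combination (modH k : ℤ) * hv
  rw [h4]
  exact dvd_add (dvd_add h1 h3) (Dvd.intro _ rfl)

theorem unitClasses_pow_sub_one {k Q : ℕ} [NeZero Q] {r : (ZMod Q)ˣ} (hr : r ∈ unitClasses k Q) :
    (modH k : ℤ) ∣ ((r : ZMod Q).val : ℤ) ^ k - 1 :=
  modH_dvd_pow_sub_one (mem_unitClasses.1 hr)

theorem card_unitClasses_filter_eq {k Q : ℕ} [NeZero Q] (hk : 0 < k) (hQ : modH k ^ 2 ∣ Q)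
    (z : ℤ) :
    modH k * ((unitClasses k Q).filter (fun r : (ZMod Q)ˣ =>
      ((modH k : ℤ) ^ 2) ∣ ((r : ZMod Q).val : ℤ) ^ k - 1 - modH k * z)).card =
      (unitClasses k Q).card := by
  have hHpos : (0 : ℤ) < modH k := by exact_mod_cast modH_pos hk
  have hLQ : modL k ∣ Q := ((modL_dvd_modH k).trans (dvd_pow_self _ two_ne_zero)).trans hQ
  set F : ℤ → Finset ((ZMod Q)ˣ) := fun z => (unitClasses k Q).filter (fun r : (ZMod Q)ˣ =>
      ((modH k : ℤ) ^ 2) ∣ ((r : ZMod Q).val : ℤ) ^ k - 1 - modH k * z) with hF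
  have hle : ∀ z e : ℤ, (F z).card ≤ (F (z + e)).card := by
    intro z e
    obtain ⟨g, hg, hge⟩ := exists_unitClass_pow hk hQ e
    apply Finset.card_le_card_of_injOn (fun r => g * r) _ (mul_right_injective g).injOn
    intro r hr
    have hr' := Finset.mem_filter.1 hr
    refine Finset.mem_filter.2 ⟨unitClasses_mul_mem hLQ hr'.1 hg, ?_⟩
    have h1 := dvd_val_mul_sub hQ r g k
    push_cast at h1
    have h2 : ∀ (p G R : ℤ), p - 1 - modH k * (z + e) = (p - G * R) +
        (G - 1 - modH k * e) * R + (R - 1 - modH k * z) * (1 + modH k * e) +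
        (modH k : ℤ) ^ 2 * (z * e) := by intros; ring
    rw [h2 _ (((g : ZMod Q).val : ℤ) ^ k) (((r : ZMod Q).val : ℤ) ^ k)]
    exact dvd_add (dvd_add (dvd_add h1 (Dvd.dvd.mul_right hge _)) (Dvd.dvd.mul_right hr'.2 _))
      (Dvd.intro _ rfl)
  have heq : ∀ z' : ℤ, (F z').card = (F z).card := by
    intro z'
    apply le_antisymm
    · simpa using hle z' (z - z')
    · simpa using hle z (z' - z)
  have hsum : ∑ i ∈ Finset.range (modH k), (F i).card = (unitClasses k Q).card := by
    rw [← Finset.card_biUnion]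
    · congr 1
      ext r
      simp only [Finset.mem_biUnion, Finset.mem_range, hF, Finset.mem_filter]
      constructor
      · rintro ⟨i, _, h, _⟩; exact h
      · intro h
        obtain ⟨y, hy⟩ := unitClasses_pow_sub_one h
        refine ⟨(y % (modH k : ℤ)).toNat, ?_, h, ?_⟩
        · have := Int.emod_lt_of_pos y hHpos
          have := Int.emod_nonneg y hHpos.ne'
          omega
        · rw [Int.toNat_of_nonneg (Int.emod_nonneg _ hHpos.ne'), hy, ← mul_sub, sq]
          exact mul_dvd_mul_left _ Int.dvd_self_sub_emod
    · intro i hi j hj hij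
      rw [Function.onFun, Finset.disjoint_left]
      intro r h1 h2
      have e1 := (Finset.mem_filter.1 h1).2
      have e2 := (Finset.mem_filter.1 h2).2
      apply hij
      have e3 := dvd_sub e1 e2
      have e4 : (modH k : ℤ) ∣ (j : ℤ) - i := by
        have : ((modH k : ℤ) * modH k) ∣ modH k * ((j : ℤ) - i) := by
          rw [← sq]
          refine e3.trans (dvd_of_eq ?_); ring
        exact (mul_dvd_mul_iff_left hHpos.ne').1 this
      simp only [Finset.coe_range, Set.mem_Iio] at hi hj
      have := Int.eq_zero_of_abs_lt_dvd e4 (by rw [abs_lt]; constructor <;> omega)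
      omega
  rw [← hsum, Finset.sum_const_nat (fun (i : ℕ) _ => heq (i : ℤ)), Finset.card_range]

theorem totient_le_card_unitClasses {k Q : ℕ} [NeZero Q] (hQ : modL k ∣ Q) :
    Q.totient ≤ (unitClasses k Q).card * modL k := by
  have hLpos : (0 : ℤ) < modL k := by exact_mod_cast modL_pos k
  have h1 : (Finset.univ : Finset ((ZMod Q)ˣ)).card = Q.totient := by
    rw [Finset.card_univ, ZMod.card_units_eq_totient]
  rw [← h1]
  have hmaps : ((Finset.univ : Finset ((ZMod Q)ˣ)).image
      (fun r : (ZMod Q)ˣ => (r : ZMod Q).val % modL k)) ⊆ Finset.range (modL k) := by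
    intro y hy
    obtain ⟨r, _, rfl⟩ := Finset.mem_image.1 hy
    exact Finset.mem_range.2 (Nat.mod_lt _ (modL_pos k))
  refine (Finset.card_le_mul_card_image (f := fun r : (ZMod Q)ˣ => (r : ZMod Q).val % modL k)
    Finset.univ (unitClasses k Q).card ?_).trans
    (Nat.mul_le_mul_left _ ((Finset.card_le_card hmaps).trans (by simp)))
  intro y hy
  obtain ⟨r0, _, rfl⟩ := Finset.mem_image.1 hy
  apply Finset.card_le_card_of_injOn (fun r => r * r0⁻¹) _ (mul_left_injective _).injOn
  intro r hr
  have hr' := (Finset.mem_filter.1 hr).2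
  simp only [Finset.mem_coe, mem_unitClasses]
  have e1 : (modL k : ℤ) ∣ (((r * r0⁻¹ : (ZMod Q)ˣ) : ZMod Q).val : ℤ) *
      ((r0 : ZMod Q).val : ℤ) - ((r : ZMod Q).val : ℤ) := by
    apply dvd_of_zmod_eq hQ
    simp
  have e2 : (modL k : ℤ) ∣ ((r : ZMod Q).val : ℤ) - ((r0 : ZMod Q).val : ℤ) :=
    (Nat.modEq_iff_dvd.1 (show ((r0 : ZMod Q).val) ≡ ((r : ZMod Q).val) [MOD modL k] from hr'.symm))
  have e3 : (modL k : ℤ) ∣ ((r0 : ZMod Q).val : ℤ) *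
      ((((r * r0⁻¹ : (ZMod Q)ˣ) : ZMod Q).val : ℤ) - 1) := by
    refine (dvd_add e1 e2).trans (dvd_of_eq ?_); ring
  exact (isCoprime_val_unit hQ r0).dvd_of_dvd_mul_left e3

theorem exists_unit_pow_ne_one {k p : ℕ} (hk : 0 < k) (hp : p.Prime) (h : k + 1 < p) :
    ∃ u : ℤ, IsCoprime u (p : ℤ) ∧ ¬ (p : ℤ) ∣ u ^ k - 1 := by
  have : Fact p.Prime := ⟨hp⟩
  obtain ⟨g, hg⟩ := IsCyclic.exists_generator (α := (ZMod p)ˣ)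
  have ho : orderOf g = p - 1 := by
    rw [orderOf_eq_card_of_forall_mem_zpowers hg, Nat.card_eq_fintype_card,
      ZMod.card_units_eq_totient, Nat.totient_prime hp]
  refine ⟨((g : ZMod p).val : ℤ), (isCoprime_val_unit dvd_rfl g).symm, fun hd => ?_⟩
  have h1 : g ^ k = 1 := by
    rw [Units.ext_iff]
    rw [← ZMod.intCast_zmod_eq_zero_iff_dvd] at hd
    push_cast at hd
    rw [ZMod.natCast_zmod_val] at hd
    push_cast
    exact sub_eq_zero.1 hd
  have h2 := orderOf_dvd_of_pow_eq_one h1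
  rw [ho] at h2
  have := Nat.le_of_dvd hk h2
  omega

theorem exists_unitClass_pow_not_dvd {k Q f₀ p : ℕ} [NeZero Q] (hk : 0 < k)
    (hQ : modH k ^ 2 * f₀.factorial ∣ Q) (hp : p.Prime) (hpf : p ≤ f₀) :
    ∃ g ∈ unitClasses k Q, ¬ ((modH k * p : ℕ) : ℤ) ∣ ((g : ZMod Q).val : ℤ) ^ k - 1 := by
  have hHpos : (0 : ℤ) < modH k := by exact_mod_cast modH_pos hk
  have hH2 : modH k ^ 2 ∣ Q := (Dvd.intro _ rfl).trans hQ
  rcases le_or_gt p (k + 1) with h | h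
  · obtain ⟨t, ht, ht1⟩ := one_add_modL_pow k
    have hpH : p ∣ modH k := (prime_dvd_modL hp h).trans (modL_dvd_modH k)
    obtain ⟨g, hg, hgd⟩ := exists_mem_unitClasses (k := k) (Q := Q) (M := modH k ^ 2)
      (w := 1 + modL k) ((modL_dvd_modH k).trans (dvd_pow_self _ two_ne_zero)) hH2
      (by push_cast; exact (isCoprime_one_add_modL_modH hk).pow_right) (by simp)
    refine ⟨g, hg, fun hd => ?_⟩
    have h1 : ((modH k * p : ℕ) : ℤ) ∣ ((g : ZMod Q).val : ℤ) ^ k - (1 + modL k : ℤ) ^ k := by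
      refine dvd_trans ?_ (hgd.trans (sub_dvd_pow_sub_pow _ _ k))
      apply Int.natCast_dvd_natCast.2
      rw [sq]; exact mul_dvd_mul_left _ hpH
    have h2 : ((modH k : ℤ) * p) ∣ modH k * t := by
      have := dvd_sub hd h1
      push_cast at this
      refine this.trans (dvd_of_eq ?_)
      rw [ht]; ring
    have h3 : (p : ℤ) ∣ t := (mul_dvd_mul_iff_left hHpos.ne').1 h2
    have h4 : (p : ℤ) ∣ t - 1 := (Int.natCast_dvd_natCast.2 ((hp.dvd_factorial).2 h)).trans ht1
    have h5 : (p : ℤ) ∣ 1 := by simpa using dvd_sub h3 h4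
    exact hp.one_lt.ne' (by exact_mod_cast Int.eq_one_of_dvd_one (by positivity) h5)
  · obtain ⟨u, hu, hud⟩ := exists_unit_pow_ne_one hk hp h
    have hcop : IsCoprime (modH k : ℤ) (p : ℤ) := by
      rw [Nat.isCoprime_iff_coprime, Nat.coprime_comm, hp.coprime_iff_not_dvd]
      intro hd
      have := prime_le_of_dvd_modH hk hp hd
      omega
    obtain ⟨a, b, hab⟩ := id hcop
    set w : ℤ := u * (a * modH k) + b * p with hw
    have hwH : (modH k : ℤ) ∣ w - 1 := ⟨(u - 1) * a, by rw [hw]; linear_combination hab⟩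
    have hwp : (p : ℤ) ∣ w - u := ⟨b - u * b, by rw [hw]; linear_combination u * hab⟩
    have hc1 : IsCoprime w (modH k : ℤ) := by
      obtain ⟨v, hv⟩ := hwH
      exact ⟨1, -v, by linear_combination hv⟩
    have hc2 : IsCoprime w (p : ℤ) := by
      obtain ⟨v, hv⟩ := hwp
      have : w = u + p * v := by linarith
      rw [this]
      exact (IsCoprime.add_mul_left_left_iff (x := u) (y := (p : ℤ)) (z := v)).2 hu
    obtain ⟨g, hg, hgd⟩ := exists_mem_unitClasses (k := k) (Q := Q) (M := modH k * p)
      (w := w) ((modL_dvd_modH k).trans (Dvd.intro _ rfl))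
      (dvd_trans (by
        rw [sq]
        exact mul_dvd_mul (Dvd.intro _ rfl) (Nat.dvd_factorial hp.pos hpf)) hQ)
      (by push_cast; exact IsCoprime.mul_right hc1 hc2)
      ((Int.natCast_dvd_natCast.2 (modL_dvd_modH k)).trans hwH)
    refine ⟨g, hg, fun hd => hud ?_⟩
    have hpd : (p : ℤ) ∣ ((modH k * p : ℕ) : ℤ) := Int.natCast_dvd_natCast.2 (Dvd.intro_left _ rfl)
    have h1 : (p : ℤ) ∣ ((g : ZMod Q).val : ℤ) ^ k - w ^ k :=
      (hpd.trans hgd).trans (sub_dvd_pow_sub_pow _ _ k)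
    have h2 : (p : ℤ) ∣ w ^ k - u ^ k := hwp.trans (sub_dvd_pow_sub_pow _ _ k)
    have h3 := dvd_sub (dvd_sub (hpd.trans hd) h1) h2
    refine h3.trans (dvd_of_eq ?_); ring

/-- Mixture of the uniform probability weights on the finite sets `T i`, `i ∈ I`. -/
def mixWeight {ι : Type*} (I : Finset ι) (T : ι → Finset ℕ) (x : ℕ) : ℝ :=
  ∑ i ∈ I, if x ∈ T i then ((I.card : ℝ) * (T i).card)⁻¹ else 0

theorem mixWeight_nonneg {ι : Type*} (I : Finset ι) (T : ι → Finset ℕ) (x : ℕ) :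
    0 ≤ mixWeight I T x := by
  refine Finset.sum_nonneg fun i _ => ?_
  split_ifs <;> positivity

theorem sum_mixWeight {ι : Type*} (I : Finset ι) (T : ι → Finset ℕ) (P : ℕ → Prop)
    [DecidablePred P] :
    ∑ x ∈ (I.biUnion T).filter P, mixWeight I T x =
      ∑ i ∈ I, ((I.card : ℝ) * (T i).card)⁻¹ * (((T i).filter P).card : ℝ) := by
  unfold mixWeight
  rw [Finset.sum_comm]
  refine Finset.sum_congr rfl fun i hi => ?_
  rw [← Finset.sum_filter, Finset.sum_const, nsmul_eq_mul, mul_comm]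
  congr 3
  ext x
  simp only [Finset.mem_filter, Finset.mem_biUnion]
  exact ⟨fun h => ⟨h.2, h.1.2⟩, fun h => ⟨⟨⟨i, hi, h.1⟩, h.2⟩, h.1⟩⟩

theorem sum_mixWeight_of_const {ι : Type*} (I : Finset ι) (T : ι → Finset ℕ) (P : ℕ → Prop)
    [DecidablePred P] (R : ι → Prop) [DecidablePred R] (hT : ∀ i ∈ I, (T i).Nonempty) (hP : ∀ i ∈ I, ∀ x ∈ T i, (P x ↔ R i)) :
    ∑ x ∈ (I.biUnion T).filter P, mixWeight I T x = ((I.filter R).card : ℝ) / I.card := by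
  rw [sum_mixWeight, Finset.card_filter, Nat.cast_sum, Finset.sum_div]
  refine Finset.sum_congr rfl fun i hi => ?_
  have hpos : (0 : ℝ) < (T i).card := by exact_mod_cast Finset.card_pos.2 (hT i hi)
  have hIpos : (0 : ℝ) < I.card := by exact_mod_cast Finset.card_pos.2 ⟨i, hi⟩
  by_cases h : R i
  · rw [Finset.filter_true_of_mem fun x hx => (hP i hi x hx).2 h]
    simp only [h, if_true]
    field_simp
    simp
  · rw [Finset.filter_false_of_mem fun x hx hx' => h ((hP i hi x hx).1 hx')]
    simp [h]

theorem mixWeight_le {ι : Type*} {I : Finset ι} {T : ι → Finset ℕ} {b : ℝ} (hb : 0 ≤ b)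
    (hT : ∀ i ∈ I, ((I.card : ℝ) * (T i).card)⁻¹ ≤ b)
    (hd : ∀ i ∈ I, ∀ j ∈ I, ∀ x, x ∈ T i → x ∈ T j → i = j) (x : ℕ) : mixWeight I T x ≤ b := by
  unfold mixWeight
  by_cases h : ∃ i ∈ I, x ∈ T i
  · obtain ⟨i, hi, hx⟩ := h
    rw [Finset.sum_eq_single i]
    · rw [if_pos hx]; exact hT i hi
    · intro j hj hji
      rw [if_neg]
      exact fun hxj => hji (hd j hj i hi x hxj hx)
    · exact fun h => absurd hi h
  · push Not at h
    rw [Finset.sum_eq_zero]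
    · exact hb
    · intro i hi
      rw [if_neg (h i hi)]

/-- A probability weight on primes of size `Z` which is well distributed in residue classes
and short intervals after raising to the `k`-th power. -/
structure GoodWeight (k : ℕ) (C θ : ℝ) (Z : ℕ) (S : Finset ℕ) (π : ℕ → ℝ) : Prop where
  prime : ∀ x ∈ S, x.Prime
  lt : ∀ x ∈ S, Z < x
  le : ∀ x ∈ S, x ≤ 2 * Z
  congr : ∀ x ∈ S, (modH k : ℤ) ∣ (x : ℤ) ^ k - 1
  nonneg : ∀ x, 0 ≤ π x
  sum_eq_one : ∑ x ∈ S, π x = 1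
  le_sup : ∀ x, π x ≤ C * (Z : ℝ) ^ (-(1 / 2 : ℝ))
  unif : ∀ z : ℤ, ∑ x ∈ S.filter (fun x : ℕ => ((modH k : ℤ) ^ 2) ∣ (x : ℤ) ^ k - 1 - modH k * z),
    π x = (modH k : ℝ)⁻¹
  half : ∀ f : ℕ, 2 ≤ f → modH k * f ≤ Z ^ (3 * k) → ∀ c : ℤ,
    ∑ x ∈ S.filter (fun x : ℕ => ((modH k * f : ℕ) : ℤ) ∣ (x : ℤ) ^ k - c), π x ≤ 1 / 2
  dvd_le : ∀ d : ℕ, 0 < d → d ≤ Z ^ (3 * k) → ∀ c : ℤ,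
    ∑ x ∈ S.filter (fun x : ℕ => (d : ℤ) ∣ (x : ℤ) ^ k - c), π x ≤ C * (d : ℝ) ^ (-θ)
  interval_le : ∀ D : ℕ, 0 < D → D ≤ Z ^ (3 * k) → ∀ y : ℝ,
    ∑ x ∈ S.filter (fun x : ℕ => y ≤ (x : ℝ) ^ k ∧ (x : ℝ) ^ k ≤ y + 3 * 2 ^ k * Z ^ k / D), π x ≤
      C * (D : ℝ) ^ (-θ)

theorem log_le_two_mul_sqrt {x : ℝ} (hx : 0 < x) : Real.log x ≤ 2 * x ^ (1 / 2 : ℝ) := by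
  have := Real.log_le_rpow_div hx.le (show (0 : ℝ) < 1 / 2 by norm_num)
  linarith

theorem exists_goodWeight {k : ℕ} (hk : 0 < k) :
    ∃ C θ : ℝ, 0 < C ∧ 0 < θ ∧ ∃ Z₀ : ℕ, ∀ Z, Z₀ ≤ Z → ∃ S π, GoodWeight k C θ Z S π := by
  obtain ⟨c, hc, hwin⟩ := primes_window (show (1 : ℝ) < 2 by norm_num)
  obtain ⟨C1, hC1, hcong⟩ := exists_card_powers_congr hk
  obtain ⟨C2, hC2, hker⟩ := exists_card_powers_interval hk
  set θ : ℝ := 1 / (48 * k) with hθ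
  have hk0 : (0 : ℝ) < k := by exact_mod_cast hk
  have hθ0 : 0 < θ := by positivity
  have hLpos : (0 : ℝ) < modL k := by exact_mod_cast modL_pos k
  set K : ℝ := modL k / c with hK
  have hK0 : 0 < K := by positivity
  set C : ℝ := max (2 * K) (max (K * C1) (K * C2)) with hC
  have hC0 : 0 < C := lt_of_lt_of_le (by positivity) (le_max_left _ _)
  have hKC1 : K * C1 ≤ C := (le_max_left _ _).trans (le_max_right _ _)
  have hKC2 : K * C2 ≤ C := (le_max_right _ _).trans (le_max_right _ _)
  obtain ⟨f₀, hf₀⟩ : ∃ f₀ : ℕ, ∀ f : ℕ, f₀ ≤ f → C * (f : ℝ) ^ (-θ) ≤ 1 / 2 := by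
    have h1 : Tendsto (fun f : ℕ => C * (f : ℝ) ^ (-θ)) atTop (nhds (C * 0)) :=
      ((tendsto_rpow_neg_atTop hθ0).comp tendsto_natCast_atTop_atTop).const_mul C
    rw [mul_zero] at h1
    exact eventually_atTop.1 (h1.eventually (ge_mem_nhds (by norm_num)))
  set Q : ℕ := modH k ^ 2 * f₀.factorial with hQ
  have hQ0 : 0 < Q := Nat.mul_pos (pow_pos (modH_pos hk) _) (Nat.factorial_pos _)
  have hQne : NeZero Q := ⟨hQ0.ne'⟩
  have hH2 : modH k ^ 2 ∣ Q := Dvd.intro _ rfl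
  have hLQ : modL k ∣ Q := ((modL_dvd_modH k).trans (dvd_pow_self _ two_ne_zero)).trans hH2
  have hev : ∀ᶠ x : ℝ in atTop, ∀ r : (ZMod Q)ˣ, c * (Q.totient : ℝ)⁻¹ * x / Real.log x ≤
      (((Finset.Ioc ⌊x⌋₊ ⌊2 * x⌋₊).filter
        (fun p : ℕ => p.Prime ∧ (p : ZMod Q) = r)).card : ℝ) :=
    eventually_all.2 fun r => hwin Q hQne r r.isUnit
  obtain ⟨Z₀, hZ₀⟩ := eventually_atTop.1 (tendsto_natCast_atTop_atTop.eventually hev)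
  refine ⟨C, θ, hC0, hθ0, max Z₀ 2, fun Z hZ => ?_⟩
  have hZ2 : 2 ≤ Z := (le_max_right _ _).trans hZ
  have hZr : (2 : ℝ) ≤ Z := by exact_mod_cast hZ2
  have hlog : 0 < Real.log Z := Real.log_pos (by linarith)
  have hφ : (0 : ℝ) < Q.totient := by exact_mod_cast Nat.totient_pos.2 hQ0
  set I := unitClasses k Q with hI
  set T : (ZMod Q)ˣ → Finset ℕ := fun r => (dyadicPrimes Z).filter (fun p : ℕ => (p : ZMod Q) = r)
    with hT
  have hTcard : ∀ r, c * (Q.totient : ℝ)⁻¹ * Z / Real.log Z ≤ ((T r).card : ℝ) := by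
    intro r
    refine (hZ₀ Z ((le_max_left _ _).trans hZ) r).trans ?_
    rw [Nat.floor_natCast, show ((2 : ℝ) * Z) = ((2 * Z : ℕ) : ℝ) by push_cast; ring,
      Nat.floor_natCast]
    gcongr
    intro p hp
    simp only [Finset.mem_filter, Finset.mem_Ioc] at hp
    simp only [hT, Finset.mem_filter, mem_dyadicPrimes]
    exact ⟨⟨hp.1, hp.2.1⟩, hp.2.2⟩
  have hTne : ∀ r ∈ I, (T r).Nonempty := by
    intro r _
    rw [← Finset.card_pos]
    have : (0 : ℝ) < (T r).card := lt_of_lt_of_le (by positivity) (hTcard r)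
    exact_mod_cast this
  have hIcard : (Q.totient : ℝ) ≤ I.card * modL k := by
    exact_mod_cast totient_le_card_unitClasses hLQ
  have hIpos : (0 : ℝ) < I.card := by
    by_contra h
    have : (I.card : ℝ) = 0 := le_antisymm (not_lt.1 h) (by positivity)
    rw [this] at hIcard; linarith
  set b : ℝ := K * Real.log Z / Z with hb
  have hb0 : 0 ≤ b := by positivity
  have hTb : ∀ r ∈ I, ((I.card : ℝ) * (T r).card)⁻¹ ≤ b := by
    intro r _
    rw [hb, hK, ← inv_inv (modL k / c * Real.log Z / Z)]
    apply inv_anti₀ (by positivity)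
    calc (modL k / c * Real.log Z / Z)⁻¹ = c * Z / Real.log Z * (1 / modL k) := by field_simp
      _ ≤ c * Z / Real.log Z * (I.card * (Q.totient : ℝ)⁻¹) := by
          gcongr
          rw [div_le_iff₀ hLpos]
          rw [← div_eq_mul_inv, div_mul_eq_mul_div, le_div_iff₀ hφ]
          linarith
      _ = I.card * (c * (Q.totient : ℝ)⁻¹ * Z / Real.log Z) := by ring
      _ ≤ _ := by gcongr; exact hTcard r
  have hdis : ∀ i ∈ I, ∀ j ∈ I, ∀ x, x ∈ T i → x ∈ T j → i = j := by
    intro i _ j _ x hi hj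
    exact Units.ext ((Finset.mem_filter.1 hi).2.symm.trans (Finset.mem_filter.1 hj).2)
  have hle : ∀ x, mixWeight I T x ≤ b := mixWeight_le hb0 hTb hdis
  have hmem : ∀ x ∈ I.biUnion T, ∃ r ∈ I, x ∈ T r := fun x hx => Finset.mem_biUnion.1 hx
  have hsub : I.biUnion T ⊆ dyadicPrimes Z := by
    intro x hx
    obtain ⟨r, _, hx⟩ := hmem x hx
    exact (Finset.mem_filter.1 hx).1
  have hcls : ∀ d : ℕ, d ∣ Q → ∀ c' : ℤ, ∀ r ∈ I, ∀ x ∈ T r,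
      ((d : ℤ) ∣ (x : ℤ) ^ k - c' ↔ (d : ℤ) ∣ ((r : ZMod Q).val : ℤ) ^ k - c') := by
    intro d hd c' r _ x hx
    have h1 : (d : ℤ) ∣ (x : ℤ) - ((r : ZMod Q).val : ℤ) := by
      apply dvd_of_zmod_eq hd
      simpa using (Finset.mem_filter.1 hx).2
    have h2 := h1.trans (sub_dvd_pow_sub_pow _ _ k)
    constructor
    · intro h; have := dvd_sub h h2; simpa using this
    · intro h; have := dvd_add h h2; simpa using this
  have hsumle : ∀ (P : ℕ → Prop) [DecidablePred P], ∑ x ∈ (I.biUnion T).filter P, mixWeight I T x ≤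
      b * (((dyadicPrimes Z).filter P).card : ℝ) := by
    intro P _
    calc ∑ x ∈ (I.biUnion T).filter P, mixWeight I T x
        ≤ ((I.biUnion T).filter P).card • b := Finset.sum_le_card_nsmul _ _ _ fun x _ => hle x
      _ = b * (((I.biUnion T).filter P).card : ℝ) := by rw [nsmul_eq_mul, mul_comm]
      _ ≤ _ := by gcongr
  have hdvd : ∀ d : ℕ, 0 < d → d ≤ Z ^ (3 * k) → ∀ c : ℤ,
      ∑ x ∈ (I.biUnion T).filter (fun x : ℕ => (d : ℤ) ∣ (x : ℤ) ^ k - c), mixWeight I T x ≤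
        C * (d : ℝ) ^ (-θ) := by
    intro d hd0 hd c'
    refine (hsumle _).trans ?_
    calc b * _ = K / Z * ((((dyadicPrimes Z).filter
          (fun p : ℕ => (d:ℤ) ∣ (p:ℤ)^k - c')).card:ℝ) * Real.log Z) := by rw [hb]; ring
      _ ≤ K / Z * (C1 * (d : ℝ) ^ (-θ) * Z) := by exact mul_le_mul_of_nonneg_left (hcong Z hZ2 d hd0 hd c') (by positivity)
      _ = K * C1 * (d : ℝ) ^ (-θ) := by field_simp
      _ ≤ _ := by gcongr
  refine ⟨I.biUnion T, mixWeight I T, ?_, ?_, ?_, ?_, mixWeight_nonneg I T, ?_, ?_, ?_, ?_, hdvd, ?_⟩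
  · exact fun x hx => (mem_dyadicPrimes.1 (hsub hx)).2
  · exact fun x hx => (mem_dyadicPrimes.1 (hsub hx)).1.1
  · exact fun x hx => (mem_dyadicPrimes.1 (hsub hx)).1.2
  · intro x hx
    obtain ⟨r, hr, hx⟩ := hmem x hx
    exact (hcls (modH k) ((dvd_pow_self _ two_ne_zero).trans hH2) 1 r hr x hx).2
      (unitClasses_pow_sub_one hr)
  · have := sum_mixWeight_of_const I T (fun _ => True) (fun _ => True) hTne (by simp)
    simpa [hIpos.ne'] using this
  · intro x
    refine (hle x).trans ?_
    have h1 : (Z : ℝ) ^ (-(1 / 2 : ℝ)) = (Z : ℝ) ^ (1 / 2 : ℝ) / Z := by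
      rw [← Real.rpow_sub_one (by positivity)]; norm_num
    calc b ≤ K * (2 * (Z : ℝ) ^ (1 / 2 : ℝ)) / Z := by
          rw [hb]; gcongr; exact log_le_two_mul_sqrt (by positivity)
      _ = 2 * K * (Z : ℝ) ^ (-(1 / 2 : ℝ)) := by rw [h1]; ring
      _ ≤ _ := by gcongr; exact le_max_left _ _
  · intro z
    have h1 := sum_mixWeight_of_const I T
      (fun x : ℕ => ((modH k : ℤ) ^ 2) ∣ (x : ℤ) ^ k - 1 - modH k * z)
      (fun r : (ZMod Q)ˣ => ((modH k : ℤ) ^ 2) ∣ ((r : ZMod Q).val : ℤ) ^ k - 1 - modH k * z) hTne (by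
        intro r hr x hx
        have := hcls (modH k ^ 2) hH2 (1 + modH k * z) r hr x hx
        push_cast at this
        simpa only [sub_sub] using this)
    rw [h1]
    have h2 := card_unitClasses_filter_eq hk hH2 z
    have hHpos : (0 : ℝ) < modH k := by exact_mod_cast modH_pos hk
    rw [div_eq_iff hIpos.ne', hI, ← h2]
    push_cast
    field_simp
  · intro f hf hfZ c'
    by_cases hp : ∃ p, p.Prime ∧ p ∣ f ∧ p ≤ f₀
    · obtain ⟨p, hp, hpf, hpf₀⟩ := hp
      have hdQ : modH k * p ∣ Q := by
        rw [hQ, sq]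
        exact mul_dvd_mul (Dvd.intro _ rfl) (Nat.dvd_factorial hp.pos hpf₀)
      obtain ⟨g, hg, hgd⟩ := exists_unitClass_pow_not_dvd (k := k) (Q := Q) hk dvd_rfl hp hpf₀
      have h1 := sum_mixWeight_of_const I T
        (fun x : ℕ => ((modH k * p : ℕ) : ℤ) ∣ (x : ℤ) ^ k - c')
        (fun r : (ZMod Q)ˣ => ((modH k * p : ℕ) : ℤ) ∣ ((r : ZMod Q).val : ℤ) ^ k - c') hTne
        (hcls _ hdQ c')
      have h2 := card_unitClasses_filter_le_half hLQ hdQ hg hgd c'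
      calc _ ≤ ∑ x ∈ (I.biUnion T).filter
            (fun x : ℕ => ((modH k * p : ℕ) : ℤ) ∣ (x : ℤ) ^ k - c'), mixWeight I T x := by
            apply Finset.sum_le_sum_of_subset_of_nonneg
            · intro x hx
              rw [Finset.mem_filter] at hx ⊢
              exact ⟨hx.1, (Int.natCast_dvd_natCast.2 (mul_dvd_mul_left _ hpf)).trans hx.2⟩
            · exact fun _ _ _ => mixWeight_nonneg _ _ _
        _ ≤ 1 / 2 := by
            rw [h1, div_le_div_iff₀ hIpos two_pos]
            have h3 : (2 : ℝ) * ((I.filter (fun r : (ZMod Q)ˣ => ((modH k * p : ℕ) : ℤ) ∣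
              ((r : ZMod Q).val : ℤ) ^ k - c')).card : ℝ) ≤ I.card := by exact_mod_cast h2
            linarith
    · push Not at hp
      have hff : f₀ ≤ f := by
        have h1 := hp f.minFac (Nat.minFac_prime (by omega)) (Nat.minFac_dvd f)
        exact h1.le.trans (Nat.minFac_le (by omega))
      refine (hdvd _ (Nat.mul_pos (modH_pos hk) (by omega)) hfZ c').trans (hf₀ _ ?_)
      exact hff.trans (Nat.le_mul_of_pos_left _ (modH_pos hk))
  · intro D hD0 hD y
    refine (hsumle _).trans ?_
    calc b * _ = K / Z * ((((dyadicPrimes Z).filter (fun x : ℕ =>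
          y ≤ (x : ℝ) ^ k ∧ (x : ℝ) ^ k ≤ y + 3 * 2 ^ k * Z ^ k / D)).card : ℝ) * Real.log Z) := by
            rw [hb]; ring
      _ ≤ K / Z * (C2 * (D : ℝ) ^ (-θ) * Z) := by exact mul_le_mul_of_nonneg_left (hker Z hZ2 D hD0 hD y) (by positivity)
      _ = K * C2 * (D : ℝ) ^ (-θ) := by field_simp
      _ ≤ _ := by gcongr

/-- A probability weight on primes whose `k`-th powers are nearly equidistributed in
`[c Z^k, c' Z^k]`, also jointly with residue classes modulo `H^2`. -/
structure FlatWeight (k : ℕ) (c c' : ℝ) (N Z : ℕ) (S : Finset ℕ) (π : ℕ → ℝ) : Prop where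
  prime : ∀ x ∈ S, x.Prime
  congr : ∀ x ∈ S, (modH k : ℤ) ∣ (x : ℤ) ^ k - 1
  nonneg : ∀ x, 0 ≤ π x
  sum_eq_one : ∑ x ∈ S, π x = 1
  upper : ∀ y h : ℝ, 0 ≤ h → ∀ z : ℤ,
    ∑ x ∈ S.filter (fun x : ℕ => ((modH k : ℤ) ^ 2) ∣ (x : ℤ) ^ k - 1 - modH k * z ∧
      y ≤ (x : ℝ) ^ k ∧ (x : ℝ) ^ k < y + h), π x ≤
      (modH k : ℝ)⁻¹ * (h / ((c' - c) * Z ^ k) + 2 / N)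
  lower : ∀ y h : ℝ, c * Z ^ k ≤ y → y + h ≤ c' * Z ^ k →
    h / ((c' - c) * Z ^ k) - 2 / N ≤
      ∑ x ∈ S.filter (fun x : ℕ => y ≤ (x : ℝ) ^ k ∧ (x : ℝ) ^ k < y + h), π x

theorem card_range_filter_le (N : ℕ) {a b : ℝ} (h : a ≤ b + 1) :
    (((Finset.range N).filter (fun i : ℕ => a ≤ i ∧ (i : ℝ) < b)).card : ℝ) ≤ b - a + 1 := by
  rcases le_or_gt b 0 with hb | hb
  · rw [Finset.filter_false_of_mem]
    · simp; linarith
    · intro i _ hi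
      have : (0 : ℝ) ≤ i := by positivity
      linarith [hi.2]
  have hsub : (Finset.range N).filter (fun i : ℕ => a ≤ i ∧ (i : ℝ) < b) ⊆
      Finset.Ico ⌈a⌉₊ ⌈b⌉₊ := by
    intro i hi
    obtain ⟨_, h1, h2⟩ := Finset.mem_filter.1 hi
    rw [Finset.mem_Ico]
    exact ⟨Nat.ceil_le.2 h1, Nat.lt_ceil.2 h2⟩
  have h1 := Finset.card_le_card hsub
  rw [Nat.card_Ico] at h1
  rcases le_total ⌈a⌉₊ ⌈b⌉₊ with h2 | h2
  · have h3 : (((Finset.range N).filter (fun i : ℕ => a ≤ i ∧ (i : ℝ) < b)).card : ℝ) ≤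
        (⌈b⌉₊ : ℝ) - ⌈a⌉₊ := by
      rw [← Nat.cast_sub h2]; exact_mod_cast h1
    have h4 := Nat.ceil_lt_add_one hb.le
    have h5 := Nat.le_ceil a
    linarith
  · rw [Nat.sub_eq_zero_of_le h2] at h1
    have : ((Finset.range N).filter (fun i : ℕ => a ≤ i ∧ (i : ℝ) < b)).card = 0 := by omega
    rw [this]; simp; linarith

theorem le_card_range_filter {N : ℕ} {a b : ℝ} (ha : 0 ≤ a) (hb : b ≤ N) :
    b - a - 1 ≤ (((Finset.range N).filter (fun i : ℕ => a ≤ i ∧ (i : ℝ) < b)).card : ℝ) := by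
  have hsub : Finset.Ico ⌈a⌉₊ ⌈b⌉₊ ⊆
      (Finset.range N).filter (fun i : ℕ => a ≤ i ∧ (i : ℝ) < b) := by
    intro i hi
    rw [Finset.mem_Ico] at hi
    have h2 : (i : ℝ) < b := Nat.lt_ceil.1 hi.2
    refine Finset.mem_filter.2 ⟨Finset.mem_range.2 ?_, Nat.ceil_le.1 hi.1, h2⟩
    exact_mod_cast h2.trans_le hb
  have h1 := Finset.card_le_card hsub
  rw [Nat.card_Ico] at h1
  have h2 : (⌈b⌉₊ : ℝ) ≤ (((Finset.range N).filter
      (fun i : ℕ => a ≤ i ∧ (i : ℝ) < b)).card : ℝ) + ⌈a⌉₊ := by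
    exact_mod_cast (by omega)
  have h3 := Nat.le_ceil b
  have h4 := Nat.ceil_lt_add_one ha
  linarith

set_option maxHeartbeats 1000000 in
theorem exists_flatWeight {k : ℕ} (hk : 0 < k) {c c' : ℝ} (hc : 0 < c) (hcc : c < c') {N : ℕ}
    (hN : 0 < N) : ∃ Z₀ : ℕ, ∀ Z, Z₀ ≤ Z → ∃ S π, FlatWeight k c c' N Z S π := by
  have hNr : (0 : ℝ) < N := by exact_mod_cast hN
  have hd : 0 < c' - c := sub_pos.2 hcc
  set Q : ℕ := modH k ^ 2 with hQ
  have hQ0 : 0 < Q := pow_pos (modH_pos hk) _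
  have hQZ : (Q : ℤ) = (modH k : ℤ) ^ 2 := by rw [hQ]; push_cast; rfl
  have hQne : NeZero Q := ⟨hQ0.ne'⟩
  have hLQ : modL k ∣ Q := (modL_dvd_modH k).trans (dvd_pow_self _ two_ne_zero)
  set e : ℕ → ℝ := fun i => c + (c' - c) * i / N with he
  have hepos : ∀ i, 0 < e i := fun i => by positivity
  have helt : ∀ i, e i < e (i + 1) := fun i => by
    simp only [he]; push_cast
    gcongr; linarith
  set g : ℕ → ℝ := fun i => (e i) ^ (1 / k : ℝ) with hg
  have hgpos : ∀ i, 0 < g i := fun i => by have := hepos i; positivity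
  have hk0 : (0 : ℝ) < k := by exact_mod_cast hk
  have hgk : ∀ i, g i ^ k = e i := fun i => by
    simp only [hg]
    rw [← Real.rpow_natCast, ← Real.rpow_mul (hepos i).le, one_div_mul_cancel hk0.ne', Real.rpow_one]
  have hglt : ∀ i, g i < g (i + 1) := fun i =>
    Real.rpow_lt_rpow (hepos i).le (helt i) (by positivity)
  set T : ℕ → ℕ × (ZMod Q)ˣ → Finset ℕ := fun Z ir =>
    (Finset.Ioc ⌊g ir.1 * Z⌋₊ ⌊g (ir.1 + 1) * Z⌋₊).filter
      (fun p : ℕ => p.Prime ∧ (p : ZMod Q) = ir.2) with hT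
  set I : Finset (ℕ × (ZMod Q)ˣ) := Finset.range N ×ˢ unitClasses k Q with hI
  have hev : ∀ᶠ Z : ℕ in atTop, ∀ ir ∈ I, (T Z ir).Nonempty := by
    rw [eventually_all_finset]
    rintro ⟨i, r⟩ _
    have hρ : 1 < g (i + 1) / g i := (one_lt_div (hgpos i)).2 (hglt i)
    obtain ⟨c0, hc0, hw⟩ := primes_window hρ
    have h1 := hw Q hQne r r.isUnit
    have h2 : Tendsto (fun Z : ℕ => g i * (Z : ℝ)) atTop atTop :=
      tendsto_natCast_atTop_atTop.const_mul_atTop (hgpos i)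
    filter_upwards [h2.eventually h1, h2.eventually (eventually_gt_atTop 1)] with Z hZ hZ1
    rw [← Finset.card_pos]
    have h3 : g (i + 1) / g i * (g i * Z) = g (i + 1) * Z := by
      have := hgpos i
      field_simp
    rw [h3] at hZ
    have h4 : 0 < Real.log (g i * Z) := Real.log_pos hZ1
    have h5 : (0 : ℝ) < Q.totient := by exact_mod_cast Nat.totient_pos.2 hQ0
    have h6 := lt_of_lt_of_le (by have := hgpos i; positivity) hZ
    exact_mod_cast h6
  obtain ⟨Z₀, hZ₀⟩ := eventually_atTop.1 hev
  refine ⟨max Z₀ 1, fun Z hZ => ?_⟩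
  have hTne := hZ₀ Z ((le_max_left _ _).trans hZ)
  have hZpos : (0 : ℝ) < Z := by exact_mod_cast (le_max_right _ _).trans hZ
  have hZk : (0 : ℝ) < (Z : ℝ) ^ k := by positivity
  have hcell : ∀ ir, ∀ x ∈ T Z ir, e ir.1 * Z ^ k < (x : ℝ) ^ k ∧
      (x : ℝ) ^ k ≤ e (ir.1 + 1) * Z ^ k := by
    intro ir x hx
    obtain ⟨h1, _⟩ := Finset.mem_filter.1 hx
    rw [Finset.mem_Ioc] at h1
    have hg0 := hgpos ir.1
    have hg1 := hgpos (ir.1 + 1)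
    have h2 : g ir.1 * Z < x := (Nat.floor_lt (by positivity)).1 h1.1
    have h3 : (x : ℝ) ≤ g (ir.1 + 1) * Z := (Nat.le_floor_iff (by positivity)).1 h1.2
    rw [← hgk, ← hgk, ← mul_pow, ← mul_pow]
    exact ⟨pow_lt_pow_left₀ h2 (by positivity) hk.ne', pow_le_pow_left₀ (by positivity) h3 _⟩
  have hcls : ∀ c' : ℤ, ∀ ir ∈ I, ∀ x ∈ T Z ir,
      ((Q : ℤ) ∣ (x : ℤ) ^ k - c' ↔ (Q : ℤ) ∣ (((ir.2 : ZMod Q)).val : ℤ) ^ k - c') := by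
    intro c' r _ x hx
    have h1 : (Q : ℤ) ∣ (x : ℤ) - ((r.2 : ZMod Q).val : ℤ) := by
      apply dvd_of_zmod_eq dvd_rfl
      simpa using (Finset.mem_filter.1 hx).2.2
    have h2 := h1.trans (sub_dvd_pow_sub_pow _ _ k)
    constructor
    · intro h; have := dvd_sub h h2; simpa using this
    · intro h; have := dvd_add h h2; simpa using this
  have hIcard : (I.card : ℝ) = N * (unitClasses k Q).card := by
    rw [hI, Finset.card_product, Finset.card_range]; push_cast; ring
  have hGpos : (0 : ℝ) < (unitClasses k Q).card := by
    have h1 : 0 < (unitClasses k Q).card * modL k :=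
      lt_of_lt_of_le (Nat.totient_pos.2 hQ0) (totient_le_card_unitClasses hLQ)
    exact_mod_cast Nat.pos_of_mul_pos_right h1
  have hIpos : (0 : ℝ) < I.card := by rw [hIcard]; positivity
  have hTpos : ∀ ir ∈ I, (0 : ℝ) < (T Z ir).card := fun ir h => by
    exact_mod_cast Finset.card_pos.2 (hTne ir h)
  refine ⟨I.biUnion (T Z), mixWeight I (T Z), ?_, ?_, mixWeight_nonneg _ _, ?_, ?_, ?_⟩
  · intro x hx
    obtain ⟨r, hr, hx⟩ := Finset.mem_biUnion.1 hx
    exact (Finset.mem_filter.1 hx).2.1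
  · intro x hx
    obtain ⟨ir, hr, hx⟩ := Finset.mem_biUnion.1 hx
    have hr2 : ir.2 ∈ unitClasses k Q := (Finset.mem_product.1 hr).2
    have h1 := unitClasses_pow_sub_one hr2
    obtain ⟨y, hy⟩ := h1
    have h2 := (hcls (1 + modH k * y) ir hr x hx).2 (by rw [← sub_sub, hy]; simp)
    have h3 : (modH k : ℤ) ∣ (x : ℤ) ^ k - (1 + modH k * y) :=
      (Int.natCast_dvd_natCast.2 (dvd_pow_self _ two_ne_zero)).trans h2
    have h4 := dvd_add h3 (Dvd.intro y rfl : (modH k : ℤ) ∣ modH k * y)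
    refine h4.trans (dvd_of_eq ?_); ring
  · have := sum_mixWeight_of_const I (T Z) (fun _ => True) (fun _ => True) hTne (by simp)
    simpa [hIpos.ne'] using this
  · intro y h hh z
    set u : ℝ := (y / Z ^ k - c) * N / (c' - c) with hu
    set v : ℝ := h * N / ((c' - c) * Z ^ k) with hv
    have hv0 : 0 ≤ v := by positivity
    set F := (unitClasses k Q).filter (fun r : (ZMod Q)ˣ =>
      ((modH k : ℤ) ^ 2) ∣ ((r : ZMod Q).val : ℤ) ^ k - 1 - modH k * z) with hF
    set J := (Finset.range N).filter (fun i : ℕ => u - 1 ≤ i ∧ (i : ℝ) < u + v) with hJ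
    rw [sum_mixWeight]
    calc _ ≤ ∑ ir ∈ I, if ir ∈ J ×ˢ F then (I.card : ℝ)⁻¹ else 0 := by
          refine Finset.sum_le_sum fun ir hir => ?_
          split_ifs with hin
          · rw [mul_inv, mul_assoc]
            refine mul_le_of_le_one_right (by positivity) ?_
            rw [inv_mul_le_iff₀ (hTpos ir hir), mul_one]
            exact_mod_cast Finset.card_filter_le _ _
          · rw [Finset.filter_false_of_mem]
            · simp
            · rintro x hx ⟨h1, h2, h3⟩
              apply hin
              obtain ⟨hi, hr⟩ := Finset.mem_product.1 hir
              obtain ⟨h4, h5⟩ := hcell ir x hx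
              refine Finset.mem_product.2 ⟨Finset.mem_filter.2 ⟨hi, ?_, ?_⟩,
                Finset.mem_filter.2 ⟨hr, ?_⟩⟩
              · have h6 : y / Z ^ k ≤ e (ir.1 + 1) := by
                  rw [div_le_iff₀ hZk]; linarith
                simp only [he] at h6
                push_cast at h6
                rw [hu, sub_le_iff_le_add, div_le_iff₀ hd]
                have h7 : y / (Z : ℝ) ^ k - c ≤ (c' - c) * (ir.1 + 1) / N := by linarith
                rw [le_div_iff₀ hNr] at h7
                linarith
              · have h6 : e ir.1 < (y + h) / Z ^ k := by
                  rw [lt_div_iff₀ hZk]; linarith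
                simp only [he] at h6
                have h8 : u + v = ((y + h) / Z ^ k - c) * N / (c' - c) := by
                  rw [hu, hv]; field_simp; ring
                rw [h8, lt_div_iff₀ hd]
                have h7 : (c' - c) * ir.1 / N < (y + h) / (Z : ℝ) ^ k - c := by linarith
                rw [div_lt_iff₀ hNr] at h7
                linarith
              · have := (hcls (1 + modH k * z) ir hir x hx).1 (by
                  rw [hQZ, ← sub_sub]; exact h1)
                rw [← hQZ, sub_sub]
                exact this
      _ = ((J ×ˢ F).card : ℝ) * (I.card : ℝ)⁻¹ := by
          rw [← Finset.sum_filter, Finset.sum_const, nsmul_eq_mul]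
          congr 3
          ext ir
          simp only [Finset.mem_filter, Finset.mem_product, hJ, hF, hI]
          tauto
      _ = (J.card : ℝ) / N * ((F.card : ℝ) / (unitClasses k Q).card) := by
          rw [Finset.card_product, hIcard]; push_cast; field_simp
      _ = (J.card : ℝ) / N * (modH k : ℝ)⁻¹ := by
          congr 1
          have hHpos : (0 : ℝ) < modH k := by exact_mod_cast modH_pos hk
          have h2 := card_unitClasses_filter_eq (Q := Q) hk dvd_rfl z
          rw [div_eq_iff hGpos.ne', ← h2]
          push_cast
          field_simp
          rfl
      _ ≤ (v + 2) / N * (modH k : ℝ)⁻¹ := by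
          gcongr
          have := card_range_filter_le N (a := u - 1) (b := u + v) (by linarith)
          linarith
      _ = _ := by rw [hv]; field_simp
  · intro y h hy hyh
    set u : ℝ := (y / Z ^ k - c) * N / (c' - c) with hu
    set v : ℝ := h * N / ((c' - c) * Z ^ k) with hv
    have hu0 : 0 ≤ u := by
      have : c ≤ y / Z ^ k := by rw [le_div_iff₀ hZk]; exact hy
      have : 0 ≤ y / Z ^ k - c := by linarith
      positivity
    have huv : u + v = ((y + h) / Z ^ k - c) * N / (c' - c) := by
      rw [hu, hv]; field_simp; ring
    have huvN : u + v - 1 ≤ N := by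
      have h1 : (y + h) / Z ^ k ≤ c' := by rw [div_le_iff₀ hZk]; exact hyh
      have h2 : u + v ≤ N := by
        rw [huv, div_le_iff₀ hd, mul_comm]
        gcongr
      linarith
    set J := (Finset.range N).filter (fun i : ℕ => u ≤ i ∧ (i : ℝ) < u + v - 1) with hJ
    rw [sum_mixWeight]
    calc _ = (v - 2) / N := by rw [hv]; field_simp
      _ ≤ (J.card : ℝ) / N := by
          gcongr
          have := le_card_range_filter (N := N) hu0 huvN
          linarith
      _ = ((J ×ˢ unitClasses k Q).card : ℝ) * (I.card : ℝ)⁻¹ := by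
          rw [Finset.card_product, hIcard]; push_cast; field_simp
      _ = ∑ ir ∈ I, if ir ∈ J ×ˢ unitClasses k Q then (I.card : ℝ)⁻¹ else 0 := by
          rw [← Finset.sum_filter, Finset.sum_const, nsmul_eq_mul]
          congr 3
          ext ir
          simp only [Finset.mem_filter, Finset.mem_product, hJ, hI]
          tauto
      _ ≤ _ := by
          refine Finset.sum_le_sum fun ir hir => ?_
          split_ifs with hin
          · have h0 := hTpos ir hir
            rw [Finset.filter_true_of_mem]
            · rw [mul_inv, mul_assoc, inv_mul_cancel₀ h0.ne', mul_one]
            · intro x hx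
              obtain ⟨h4, h5⟩ := hcell ir x hx
              obtain ⟨_, h6, h7⟩ := Finset.mem_filter.1 (Finset.mem_product.1 hin).1
              rw [hu, div_le_iff₀ hd] at h6
              rw [lt_sub_iff_add_lt, huv, lt_div_iff₀ hd] at h7
              constructor
              · refine le_trans ?_ h4.le
                rw [← div_le_iff₀ hZk]
                simp only [he]
                rw [← sub_le_iff_le_add', le_div_iff₀ hNr]
                linarith
              · refine lt_of_le_of_lt h5 ?_
                rw [← lt_div_iff₀ hZk]
                simp only [he]
                push_cast
                rw [← lt_sub_iff_add_lt', div_lt_iff₀ hNr]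
                linarith
          · positivity

/-- Integer vectors in the box `[-A, A]^t` lying in a fixed residue class modulo `H`. -/
def boxClass {t : ℕ} (H : ℕ) (α : Fin t → ℤ) (A : ℤ) : Finset (Fin t → ℤ) :=
  Fintype.piFinset fun l => (Finset.Icc (-A) A).filter (fun b : ℤ => (H : ℤ) ∣ b - α l)

theorem mem_boxClass {t : ℕ} {H : ℕ} {α : Fin t → ℤ} {A : ℤ} {a : Fin t → ℤ} :
    a ∈ boxClass H α A ↔ ∀ l, |a l| ≤ A ∧ (H : ℤ) ∣ a l - α l := by
  simp [boxClass, abs_le]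

theorem add_mem_boxClass {t : ℕ} {H : ℕ} {α : Fin t → ℤ} {A B V : ℤ} {a v : Fin t → ℤ}
    (ha : a ∈ boxClass H α A) (hv : ∀ l, |v l| ≤ V) (hB : A + H * V ≤ B) :
    (fun l => a l + H * v l) ∈ boxClass H α B := by
  rw [mem_boxClass] at ha ⊢
  intro l
  refine ⟨?_, ?_⟩
  · calc |a l + H * v l| ≤ |a l| + |H * v l| := abs_add_le _ _
      _ = |a l| + H * |v l| := by rw [abs_mul, Nat.abs_cast]
      _ ≤ A + H * V := by
        have := mul_le_mul_of_nonneg_left (hv l) (by positivity : (0 : ℤ) ≤ H)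
        linarith [(ha l).1]
      _ ≤ B := hB
  · have h := (ha l).2
    have : a l + H * v l - α l = (a l - α l) + H * v l := by ring
    rw [this]
    exact dvd_add h (dvd_mul_right _ _)

theorem card_residue_Icc {H : ℕ} (hH : 0 < H) (α : ℤ) {A : ℤ} :
    (((Finset.Icc (-A) A).filter (fun b : ℤ => (H : ℤ) ∣ b - α)).card : ℝ) =
      max ((⌊((A - α : ℤ) : ℝ) / H⌋ - ⌊((-A - 1 - α : ℤ) : ℝ) / H⌋ : ℤ) : ℝ) 0 := by
  have h := Int.Ioc_filter_modEq_card (-A - 1) A (r := (H : ℤ)) (by exact_mod_cast hH) α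
  have h2 : (Finset.Icc (-A) A).filter (fun b : ℤ => (H : ℤ) ∣ b - α) =
      (Finset.Ioc (-A - 1) A).filter (fun b : ℤ => b ≡ α [ZMOD H]) := by
    ext b
    simp only [Finset.mem_filter, Finset.mem_Icc, Finset.mem_Ioc]
    rw [Int.modEq_comm, Int.modEq_iff_dvd]
    constructor
    · rintro ⟨⟨h1, h2⟩, h3⟩; exact ⟨⟨by omega, h2⟩, h3⟩
    · rintro ⟨⟨h1, h2⟩, h3⟩; exact ⟨⟨by omega, h2⟩, h3⟩
  rw [h2]
  have h3 := congrArg (fun z : ℤ => (z : ℝ)) h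
  simp only [Int.cast_natCast, Int.cast_max, Int.cast_zero] at h3
  have e1 : ∀ z : ℤ, ⌊((z : ℤ) : ℝ) / H⌋ = ⌊(z : ℚ) / (H : ℚ)⌋ := by
    intro z
    rw [← Rat.floor_cast (α := ℝ)]
    push_cast
    rfl
  rw [e1, e1]
  push_cast at h3 ⊢
  exact h3

theorem card_residue_Icc_le {H : ℕ} (hH : 0 < H) (α : ℤ) {A : ℤ} (hA : 0 ≤ A) :
    (((Finset.Icc (-A) A).filter (fun b : ℤ => (H : ℤ) ∣ b - α)).card : ℝ) ≤
      (2 * A + 1) / H + 1 := by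
  rw [card_residue_Icc hH]
  have hH' : (0 : ℝ) < H := by exact_mod_cast hH
  have hA' : (0 : ℝ) ≤ A := by exact_mod_cast hA
  apply max_le
  · have h1 := Int.floor_le (((A - α : ℤ) : ℝ) / H)
    have h2 := Int.lt_floor_add_one (((-A - 1 - α : ℤ) : ℝ) / H)
    have h3 : (2 * (A : ℝ) + 1) / H = ((A - α : ℤ) : ℝ) / H - ((-A - 1 - α : ℤ) : ℝ) / H := by
      push_cast; ring
    rw [h3]; push_cast at h1 h2 ⊢; linarith
  · positivity

theorem le_card_residue_Icc {H : ℕ} (hH : 0 < H) (α : ℤ) {A : ℤ} :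
    (2 * A + 1) / H - 1 ≤
    (((Finset.Icc (-A) A).filter (fun b : ℤ => (H : ℤ) ∣ b - α)).card : ℝ) := by
  rw [card_residue_Icc hH]
  refine le_max_of_le_left ?_
  have h1 := Int.lt_floor_add_one (((A - α : ℤ) : ℝ) / H)
  have h2 := Int.floor_le (((-A - 1 - α : ℤ) : ℝ) / H)
  have h3 : (2 * (A : ℝ) + 1) / H = ((A - α : ℤ) : ℝ) / H - ((-A - 1 - α : ℤ) : ℝ) / H := by
    push_cast; ring
  rw [h3]; push_cast at h1 h2 ⊢; linarith

theorem card_boxClass_le {t : ℕ} {H : ℕ} (hH : 0 < H) (α : Fin t → ℤ) {A : ℤ} (hA : 0 ≤ A) :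
    ((boxClass H α A).card : ℝ) ≤ ((2 * A + 1) / H + 1) ^ t := by
  rw [boxClass, Fintype.card_piFinset, Nat.cast_prod]
  calc _ ≤ ∏ _l : Fin t, ((2 * A + 1) / H + 1 : ℝ) :=
        Finset.prod_le_prod (fun _ _ => by positivity) fun l _ => card_residue_Icc_le hH _ hA
    _ = _ := by simp

theorem le_card_boxClass {t : ℕ} {H : ℕ} (hH : 0 < H) (α : Fin t → ℤ) {A : ℤ} (hA : (H : ℤ) ≤ A) :
    ((2 * A + 1) / H - 1 : ℝ) ^ t ≤ ((boxClass H α A).card : ℝ) := by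
  rw [boxClass, Fintype.card_piFinset, Nat.cast_prod]
  have hH' : (0 : ℝ) < H := by exact_mod_cast hH
  have hA' : (H : ℝ) ≤ A := by exact_mod_cast hA
  calc _ = ∏ _l : Fin t, ((2 * A + 1) / H - 1 : ℝ) := by simp
    _ ≤ _ := Finset.prod_le_prod
        (fun _ _ => by rw [sub_nonneg, le_div_iff₀ hH']; linarith)
        fun l _ => le_card_residue_Icc hH _

theorem sum_add_mul_mul {t : ℕ} (a v X : Fin t → ℤ) (H : ℤ) :
    ∑ l, (a l + H * v l) * X l = ∑ l, a l * X l + H * ∑ l, v l * X l := by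
  rw [Finset.mul_sum, ← Finset.sum_add_distrib]
  exact Finset.sum_congr rfl fun l _ => by ring

theorem card_shift_single {t : ℕ} {H : ℕ} {α : Fin t → ℤ} {A B V : ℤ} {X : Fin t → ℤ} {w : ℕ}
    (h : ∀ m : ℕ, m < w → ∃ v : Fin t → ℤ, ∑ l, v l * X l = m ∧ ∀ l, |v l| ≤ V)
    (hB : A + H * V ≤ B) (r : ℤ) :
    ((boxClass H α A).filter (fun a => ∃ m : ℕ, m < w ∧ ∑ l, a l * X l = r + H * m)).card ≤
      w * ((boxClass H α B).filter (fun a => ∑ l, a l * X l = r)).card := by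
  choose! v hv1 hv2 using h
  set T := (boxClass H α B).filter (fun a => ∑ l, a l * X l = r)
  have hsub : (boxClass H α A).filter (fun a => ∃ m : ℕ, m < w ∧ ∑ l, a l * X l = r + H * m) ⊆
      (Finset.range w).biUnion fun m => T.image fun a l => a l + H * v m l := by
    intro a ha
    rw [Finset.mem_filter] at ha
    obtain ⟨ha, m, hm, hr⟩ := ha
    rw [Finset.mem_biUnion]
    refine ⟨m, Finset.mem_range.2 hm, ?_⟩
    rw [Finset.mem_image]
    refine ⟨fun l => a l + H * (-v m l), ?_, ?_⟩
    · rw [Finset.mem_filter]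
      refine ⟨add_mem_boxClass (v := fun l => -v m l) ha (fun l => ?_) hB, ?_⟩
      · rw [abs_neg]; exact hv2 m hm l
      · rw [sum_add_mul_mul, hr]
        simp only [neg_mul, Finset.sum_neg_distrib]
        rw [hv1 m hm]; ring
    · funext l; ring
  refine (Finset.card_le_card hsub).trans ?_
  have := Finset.card_biUnion_le_card_mul (Finset.range w)
    (fun m => T.image fun a l => a l + H * v m l) T.card (fun m _ => Finset.card_image_le)
  simpa using this

theorem card_shift_pair {t : ℕ} {H : ℕ} (hH : 0 < H) {α : Fin t → ℤ} {A B V : ℤ}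
    {X Y : Fin t → ℤ} {P : Finset (ℕ × ℕ)}
    (h : ∀ p ∈ P, ∃ v : Fin t → ℤ, ∑ l, v l * X l = p.1 ∧ ∑ l, v l * Y l = p.2 ∧ ∀ l, |v l| ≤ V)
    (hB : A + H * V ≤ B) (r r' : ℤ) :
    P.card * ((boxClass H α A).filter
        (fun a => ∑ l, a l * X l = r ∧ ∑ l, a l * Y l = r')).card ≤
      ((boxClass H α B).filter (fun a => ∃ p ∈ P, ∑ l, a l * X l = r + H * p.1 ∧
        ∑ l, a l * Y l = r' + H * p.2)).card := by
  choose! v hv1 hv2 hv3 using h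
  rw [← Finset.card_product]
  refine Finset.card_le_card_of_injOn (fun q l => q.2 l + H * v q.1 l) ?_ ?_
  · intro q hq
    have hq := Finset.mem_product.1 (Finset.mem_coe.1 hq)
    obtain ⟨hq1, hq2⟩ := hq
    rw [Finset.mem_filter] at hq2
    refine Finset.mem_coe.2 (Finset.mem_filter.2 ⟨?_, q.1, hq1, ?_, ?_⟩)
    · exact add_mem_boxClass (v := v q.1) hq2.1 (hv3 _ hq1) hB
    · rw [sum_add_mul_mul, hq2.2.1, hv1 _ hq1]
    · rw [sum_add_mul_mul, hq2.2.2, hv2 _ hq1]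
  · intro q hq q' hq' he
    have hq := Finset.mem_product.1 (Finset.mem_coe.1 hq)
    have hq' := Finset.mem_product.1 (Finset.mem_coe.1 hq')
    obtain ⟨hq1, hq2⟩ := hq
    obtain ⟨hq1', hq2'⟩ := hq'
    rw [Finset.mem_filter] at hq2 hq2'
    have he' : ∀ l, q.2 l + H * v q.1 l = q'.2 l + H * v q'.1 l := fun l => congrFun he l
    have hH' : (H : ℤ) ≠ 0 := by exact_mod_cast hH.ne'
    have e1 : r + H * (q.1.1 : ℤ) = r + H * (q'.1.1 : ℤ) := by
      rw [← hv1 _ hq1, ← hv1 _ hq1', ← hq2.2.1, ← sum_add_mul_mul, hq2.2.1, ← hq2'.2.1,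
        ← sum_add_mul_mul]
      exact Finset.sum_congr rfl fun l _ => by rw [he' l]
    have e2 : r' + H * (q.1.2 : ℤ) = r' + H * (q'.1.2 : ℤ) := by
      rw [← hv2 _ hq1, ← hv2 _ hq1', ← hq2.2.2, ← sum_add_mul_mul, hq2.2.2, ← hq2'.2.2,
        ← sum_add_mul_mul]
      exact Finset.sum_congr rfl fun l _ => by rw [he' l]
    have f1 : q.1.1 = q'.1.1 := by
      have := mul_left_cancel₀ hH' (add_left_cancel e1); exact_mod_cast this
    have f2 : q.1.2 = q'.1.2 := by
      have := mul_left_cancel₀ hH' (add_left_cancel e2); exact_mod_cast this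
    have f : q.1 = q'.1 := Prod.ext f1 f2
    refine Prod.ext f ?_
    funext l
    have := he' l
    rw [f] at this
    linarith

theorem exists_small_single {t : ℕ} {X : Fin t → ℤ} {j l : Fin t} (hjl : j ≠ l)
    (hco : IsCoprime (X j) (X l)) {K B U : ℤ} (hK : 0 < K) (hX : ∀ i, K ≤ X i ∧ X i ≤ B)
    {m : ℤ} (hm : 0 ≤ m) (hmU : m ≤ U * K) :
    ∃ v : Fin t → ℤ, ∑ i, v i * X i = m ∧ ∀ i, |v i| ≤ U + B := by
  obtain ⟨p, q, hpq⟩ := hco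
  have hXj : 0 < X j := hK.trans_le (hX j).1
  have hXl : 0 < X l := hK.trans_le (hX l).1
  set y := (m * q) % X j with hy
  have hy0 : 0 ≤ y := Int.emod_nonneg _ hXj.ne'
  have hy1 : y < X j := Int.emod_lt_of_pos _ hXj
  have hdiv : X j ∣ m - y * X l := by
    have e : m * q = y + X j * (m * q / X j) := by rw [hy]; exact (Int.emod_add_mul_ediv _ _).symm
    refine ⟨m * p + (m * q / X j) * X l, ?_⟩
    have : m * (p * X j + q * X l) = m := by rw [hpq, mul_one]
    linear_combination (-1 : ℤ) * this + X l * e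
  obtain ⟨z, hz⟩ := hdiv
  have hU : 0 ≤ U := by
    by_contra hU
    have : U * K < 0 := mul_neg_of_neg_of_pos (by omega) hK
    omega
  have hB : 0 < B := hXj.trans_le (hX j).2
  have hz1 : z ≤ U := by
    by_contra hc
    have h1 : (U + 1) * X j ≤ z * X j := mul_le_mul_of_nonneg_right (by omega) hXj.le
    have h2 : U * K ≤ U * X j := mul_le_mul_of_nonneg_left (hX j).1 hU
    have h3 : 0 ≤ y * X l := mul_nonneg hy0 hXl.le
    nlinarith
  have hz2 : -B ≤ z := by
    by_contra hc
    have h1 : z * X j ≤ (-B - 1) * X j := mul_le_mul_of_nonneg_right (by omega) hXj.le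
    have h2 : y * X l ≤ X j * B := mul_le_mul hy1.le (hX l).2 hXl.le hXj.le
    nlinarith
  refine ⟨Pi.single j z + Pi.single l y, ?_, ?_⟩
  · simp only [Pi.add_apply, add_mul, Finset.sum_add_distrib, Pi.single_apply, ite_mul, zero_mul,
      Finset.sum_ite_eq', Finset.mem_univ, if_true]
    linarith
  · intro i
    have hyB : y ≤ B := hy1.le.trans (hX j).2
    rw [Pi.add_apply, Pi.single_apply, Pi.single_apply]
    by_cases h1 : i = j
    · subst h1
      rw [if_pos rfl, if_neg hjl, add_zero, abs_le]
      constructor <;> linarith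
    · rw [if_neg h1, zero_add]
      split_ifs
      · rw [abs_le]; constructor <;> linarith
      · simp; linarith

theorem exists_small_combination {t : ℕ} {Δ : Fin t → ℤ} {s : Fin t} (hs : Δ s ≠ 0)
    (hmax : ∀ l, |Δ l| ≤ |Δ s|) {M W U : ℤ} (hM : Finset.univ.gcd Δ ∣ M) (hMW : |M| ≤ W)
    (hW : W ≤ U * |Δ s|) :
    ∃ v : Fin t → ℤ, ∑ i, v i * Δ i = M ∧ ∀ i, |v i| ≤ U + t * |Δ s| := by
  obtain ⟨g, hg⟩ := Finset.gcd_eq_sum_mul Finset.univ Δ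
  obtain ⟨e, he⟩ := hM
  set u : Fin t → ℤ := fun i => e * g i with hu
  have hsum : ∑ i, u i * Δ i = M := by
    rw [he, hg, Finset.sum_mul]
    exact Finset.sum_congr rfl fun i _ => by rw [hu]; ring
  set D := |Δ s| with hD
  have hD0 : 0 < D := abs_pos.2 hs
  set v : Fin t → ℤ := fun l => if l = s then
    u s + ∑ i ∈ Finset.univ.erase s, (u i / Δ s) * Δ i else u l % Δ s with hv
  have hvs : v s = u s + ∑ i ∈ Finset.univ.erase s, (u i / Δ s) * Δ i := by simp [hv]
  have hvn : ∀ l ∈ Finset.univ.erase s, v l = u l % Δ s := by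
    intro l hl; simp [hv, Finset.ne_of_mem_erase hl]
  have hb : ∀ l ∈ Finset.univ.erase s, |v l| ≤ D := by
    intro l hl
    rw [hvn l hl, abs_of_nonneg (Int.emod_nonneg _ hs)]
    exact (Int.emod_lt_abs _ hs).le
  have hvsum : ∑ i, v i * Δ i = M := by
    rw [← hsum, ← Finset.add_sum_erase _ _ (Finset.mem_univ s),
      ← Finset.add_sum_erase _ (fun i => u i * Δ i) (Finset.mem_univ s), hvs, add_mul,
      Finset.sum_mul, add_assoc, ← Finset.sum_add_distrib]
    congr 1
    refine Finset.sum_congr rfl fun i hi => ?_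
    rw [hvn i hi]
    have := Int.emod_add_mul_ediv (u i) (Δ s)
    linear_combination Δ i * this
  have ht : ((Finset.univ.erase s).card : ℤ) ≤ t := by
    have := Finset.card_le_univ (Finset.univ.erase s)
    rw [Fintype.card_fin] at this
    exact_mod_cast this
  have ht1 : (1 : ℤ) ≤ t := by
    have := s.pos
    omega
  have hU : 0 ≤ U := by
    by_contra hU
    have : U * D < 0 := mul_neg_of_neg_of_pos (by omega) hD0
    linarith [abs_nonneg M]
  have hbs : |v s| ≤ U + t * D := by
    have h1 : v s * Δ s = M - ∑ i ∈ Finset.univ.erase s, v i * Δ i := by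
      rw [← hvsum, ← Finset.add_sum_erase _ _ (Finset.mem_univ s)]; ring
    have h2 : |∑ i ∈ Finset.univ.erase s, v i * Δ i| ≤ t * (D * D) := by
      calc _ ≤ ∑ i ∈ Finset.univ.erase s, |v i * Δ i| := Finset.abs_sum_le_sum_abs _ _
        _ ≤ ∑ i ∈ Finset.univ.erase s, D * D := Finset.sum_le_sum fun i hi => by
            rw [abs_mul]
            exact mul_le_mul (hb i hi) (hmax i) (abs_nonneg _) hD0.le
        _ = (Finset.univ.erase s).card * (D * D) := by simp
        _ ≤ _ := mul_le_mul_of_nonneg_right ht (by positivity)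
    have h3 : |v s| * D ≤ (U + t * D) * D := by
      rw [hD, ← abs_mul, h1]
      calc _ ≤ |M| + |∑ i ∈ Finset.univ.erase s, v i * Δ i| := abs_sub _ _
        _ ≤ U * D + t * (D * D) := add_le_add (hMW.trans hW) h2
        _ = _ := by ring
    exact le_of_mul_le_mul_right h3 hD0
  refine ⟨v, hvsum, fun i => ?_⟩
  by_cases hi : i = s
  · rw [hi]; exact hbs
  · refine (hb i (Finset.mem_erase.2 ⟨hi, Finset.mem_univ _⟩)).trans ?_
    nlinarith

theorem exists_small_pair {t : ℕ} {X Y : Fin t → ℤ} {j s : Fin t}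
    (hco : IsCoprime (X j) (Y j)) {K B b U U' W : ℤ} (hK : 0 < K) (hX : ∀ i, K ≤ X i ∧ X i ≤ B)
    (hY : K ≤ Y j ∧ Y j ≤ B) (hB : B ≤ b * K)
    (hs : X j * Y s - X s * Y j ≠ 0)
    (hmax : ∀ l, |X j * Y l - X l * Y j| ≤ |X j * Y s - X s * Y j|) {m m' : ℤ}
    (hm : 0 ≤ m ∧ m ≤ W) (hm' : 0 ≤ m' ∧ m' ≤ W)
    (hg : (Finset.univ.gcd fun l => X j * Y l - X l * Y j) ∣ X j * m' - Y j * m)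
    (hW : W * B ≤ U * |X j * Y s - X s * Y j|) (hW' : W ≤ U' * K) :
    ∃ v : Fin t → ℤ, ∑ i, v i * X i = m ∧ ∑ i, v i * Y i = m' ∧
      ∀ i, |v i| ≤ U' + (1 + t * b) * (U + t * |X j * Y s - X s * Y j|) := by
  have hXj : 0 < X j := hK.trans_le (hX j).1
  have hYj : 0 < Y j := hK.trans_le hY.1
  have hB0 : 0 < B := hXj.trans_le (hX j).2
  have hMW : |X j * m' - Y j * m| ≤ W * B := by
    have h1 : X j * m' ≤ B * W := mul_le_mul (hX j).2 hm'.2 hm'.1 hB0.le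
    have h2 : Y j * m ≤ B * W := mul_le_mul hY.2 hm.2 hm.1 hB0.le
    have h3 : 0 ≤ X j * m' := mul_nonneg hXj.le hm'.1
    have h4 : 0 ≤ Y j * m := mul_nonneg hYj.le hm.1
    rw [abs_le]; constructor <;> linarith
  obtain ⟨v, hv1, hv2⟩ := exists_small_combination hs hmax hg hMW hW
  set V := U + t * |X j * Y s - X s * Y j| with hV
  have hV0 : 0 ≤ V := (abs_nonneg _).trans (hv2 s)
  set P := m - ∑ i ∈ Finset.univ.erase j, v i * X i with hP
  set Q := m' - ∑ i ∈ Finset.univ.erase j, v i * Y i with hQ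
  have hPQ : X j * Q = Y j * P := by
    have h1 : ∑ i ∈ Finset.univ.erase j, v i * (X j * Y i - X i * Y j) = X j * m' - Y j * m := by
      rw [← hv1, ← Finset.add_sum_erase _ _ (Finset.mem_univ j)]; ring
    have h2 : ∑ i ∈ Finset.univ.erase j, v i * (X j * Y i - X i * Y j) =
        X j * ∑ i ∈ Finset.univ.erase j, v i * Y i -
          Y j * ∑ i ∈ Finset.univ.erase j, v i * X i := by
      rw [Finset.mul_sum, Finset.mul_sum, ← Finset.sum_sub_distrib]
      exact Finset.sum_congr rfl fun i _ => by ring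
    rw [hP, hQ]
    linear_combination h2 - h1
  obtain ⟨z, hz⟩ : X j ∣ P := by
    refine hco.dvd_of_dvd_mul_left ?_
    exact ⟨Q, hPQ.symm⟩
  have hzQ : Q = Y j * z := by
    have : X j * Q = X j * (Y j * z) := by rw [hPQ, hz]; ring
    exact mul_left_cancel₀ hXj.ne' this
  have ht : ((Finset.univ.erase j).card : ℤ) ≤ t := by
    have := Finset.card_le_univ (Finset.univ.erase j)
    rw [Fintype.card_fin] at this
    exact_mod_cast this
  have hz1 : |z| ≤ U' + t * b * V := by
    have h2 : |∑ i ∈ Finset.univ.erase j, v i * X i| ≤ t * (V * B) := by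
      calc _ ≤ ∑ i ∈ Finset.univ.erase j, |v i * X i| := Finset.abs_sum_le_sum_abs _ _
        _ ≤ ∑ i ∈ Finset.univ.erase j, V * B := Finset.sum_le_sum fun i hi => by
            rw [abs_mul, abs_of_pos (hK.trans_le (hX i).1)]
            exact mul_le_mul (hv2 i) (hX i).2 (hK.le.trans (hX i).1) hV0
        _ = (Finset.univ.erase j).card * (V * B) := by simp
        _ ≤ _ := mul_le_mul_of_nonneg_right ht (by positivity)
    have h3 : |z| * K ≤ (U' + t * b * V) * K := by
      calc |z| * K ≤ |z| * X j := mul_le_mul_of_nonneg_left (hX j).1 (abs_nonneg _)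
        _ = |P| := by rw [hz, abs_mul, abs_of_pos hXj]; ring
        _ ≤ |m| + |∑ i ∈ Finset.univ.erase j, v i * X i| := abs_sub _ _
        _ ≤ U' * K + t * (V * (b * K)) := by
          refine add_le_add ?_ (h2.trans ?_)
          · rw [abs_of_nonneg hm.1]; exact hm.2.trans hW'
          · exact mul_le_mul_of_nonneg_left (mul_le_mul_of_nonneg_left hB hV0) (by positivity)
        _ = _ := by ring
    exact le_of_mul_le_mul_right h3 hK
  have hU' : 0 ≤ U' := by
    by_contra hU
    have : U' * K < 0 := mul_neg_of_neg_of_pos (by omega) hK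
    linarith [hm.1, hm.2]
  have hb0 : 0 ≤ b := by
    by_contra hU
    have : b * K < 0 := mul_neg_of_neg_of_pos (by omega) hK
    linarith
  have hupd : ∀ F : Fin t → ℤ, ∑ i, Function.update v j z i * F i =
      z * F j + ∑ i ∈ Finset.univ.erase j, v i * F i := by
    intro F
    rw [← Finset.add_sum_erase _ _ (Finset.mem_univ j), Function.update_self]
    congr 1
    refine Finset.sum_congr rfl fun i hi => ?_
    rw [Function.update_of_ne (Finset.ne_of_mem_erase hi)]
  refine ⟨Function.update v j z, ?_, ?_, fun i => ?_⟩
  · rw [hupd]; linarith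
  · rw [hupd]; linarith
  · have h0 : (0 : ℤ) ≤ t * b * V := by positivity
    by_cases hi : i = j
    · rw [hi, Function.update_self]; linarith
    · rw [Function.update_of_ne hi]
      have := hv2 i
      linarith

/-- Divisibility and size data attached to a pair of prime vectors, controlling how many integer
vectors `a` satisfy two simultaneous linear equations with these coefficients. -/
structure PairStat (k Z H : ℕ) {t : ℕ} (x y : Fin t → ℕ) (f D : ℕ) : Prop where
  f_pos : 0 < f
  D_pos : 0 < D
  D_le : D ≤ 2 * ((2 * Z) ^ k) ^ 2
  mul_le : H * f ≤ D
  cong : ∃ c : ℤ, ∀ l, ((H * f : ℕ) : ℤ) ∣ (y l : ℤ) ^ k - c * (x l : ℤ) ^ k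
  near : ∃ ρ : ℝ, 0 ≤ ρ ∧ ρ ≤ 2 ^ k ∧ ∀ l, |(y l : ℝ) ^ k - ρ * (x l : ℝ) ^ k| * (Z : ℝ) ^ (2 * k) ≤
    (x l : ℝ) ^ k * D
  count : ∀ (α : Fin t → ℤ) (A B : ℤ) (U w : ℕ) (r r' : ℤ), w * (2 * Z) ^ k ≤ U * D →
    A + H * (2 * 2 ^ k * U + (1 + t * 2 ^ k) * (U + t * D)) ≤ B →
    w * (w / (H * f)) * ((boxClass H α A).filter (fun a => ∑ l, a l * (x l : ℤ) ^ k = r ∧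
      ∑ l, a l * (y l : ℤ) ^ k = r')).card ≤
    ((boxClass H α B).filter (fun a => ∃ m m' : ℕ, m < w ∧ m' < w ∧ (H : ℤ) ∣ (m' : ℤ) - m ∧
      ∑ l, a l * (x l : ℤ) ^ k = r + H * m ∧ ∑ l, a l * (y l : ℤ) ^ k = r' + H * m')).card

theorem mul_div_le_card_pairs {g : ℕ} (hg : 0 < g) {p q : ℤ} (hco : IsCoprime p g) (w : ℕ) :
    w * (w / g) ≤ ((Finset.range w ×ˢ Finset.range w).filter
      (fun z : ℕ × ℕ => (g : ℤ) ∣ p * z.2 - q * z.1)).card := by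
  obtain ⟨u, u', huu⟩ := hco
  have hg' : (0 : ℤ) < g := by exact_mod_cast hg
  set ρ : ℕ → ℕ := fun m => ((u * q * m) % (g : ℤ)).toNat with hρ
  have hρe : ∀ m, (ρ m : ℤ) = (u * q * m) % (g : ℤ) := fun m =>
    Int.toNat_of_nonneg (Int.emod_nonneg _ hg'.ne')
  have hρl : ∀ m, ρ m < g := by
    intro m
    have := Int.emod_lt_of_pos (u * q * m) hg'
    have h2 := hρe m
    omega
  have hcard : w * (w / g) = (Finset.range w ×ˢ Finset.range (w / g)).card := by simp
  rw [hcard]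
  refine Finset.card_le_card_of_injOn (fun z => (z.1, ρ z.1 + g * z.2)) ?_ ?_
  · intro z hz
    have hz := Finset.mem_coe.1 hz
    rw [Finset.mem_product, Finset.mem_range, Finset.mem_range] at hz
    refine Finset.mem_coe.2 (Finset.mem_filter.2 ⟨Finset.mem_product.2 ⟨?_, ?_⟩, ?_⟩)
    · exact Finset.mem_range.2 hz.1
    · rw [Finset.mem_range]
      calc ρ z.1 + g * z.2 < g + g * z.2 := by have := hρl z.1; omega
        _ = g * (z.2 + 1) := by ring
        _ ≤ g * (w / g) := Nat.mul_le_mul_left _ hz.2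
        _ ≤ w := Nat.mul_div_le _ _
    · have h1 := Int.emod_add_mul_ediv (u * q * z.1) (g : ℤ)
      rw [← hρe] at h1
      push_cast
      refine ⟨-p * (u * q * z.1 / g) + p * z.2 - u' * q * z.1, ?_⟩
      linear_combination p * h1 + q * z.1 * huu
  · intro z hz z' hz' h
    obtain ⟨h1, h2⟩ := Prod.mk.inj h
    rw [h1] at h2
    have h3 : z.2 = z'.2 := Nat.eq_of_mul_eq_mul_left hg (by omega)
    exact Prod.ext h1 h3

theorem exists_pairStat {k Z H t : ℕ} (hk : 0 < k) (hZ : 0 < Z) (hH : 0 < H) {x y : Fin t → ℕ}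
    (hxp : ∀ l, (x l).Prime) (hyp : ∀ l, (y l).Prime) (hx : ∀ l, Z < x l ∧ x l ≤ 2 * Z)
    (hy : ∀ l, Z < y l ∧ y l ≤ 2 * Z) (hxH : ∀ l, (H : ℤ) ∣ (x l : ℤ) ^ k - 1)
    (hyH : ∀ l, (H : ℤ) ∣ (y l : ℤ) ^ k - 1) (hxc : ¬ ∃ v, ∀ l, x l = v) (hxy : x ≠ y) :
    ∃ f D, PairStat k Z H x y f D := by
  obtain ⟨j, hj⟩ : ∃ j, x j ≠ y j := by
    by_contra h; push Not at h; exact hxy (funext h)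
  obtain ⟨l, hl⟩ : ∃ l, x l ≠ x j := by
    by_contra h; push Not at h; exact hxc ⟨x j, h⟩
  set X : Fin t → ℤ := fun l => (x l : ℤ) ^ k with hX
  set Y : Fin t → ℤ := fun l => (y l : ℤ) ^ k with hY
  set Δ : Fin t → ℤ := fun l => X j * Y l - X l * Y j with hΔ
  set K : ℤ := (Z : ℤ) ^ k with hKdef
  set B : ℤ := (2 * Z : ℤ) ^ k with hBdef
  have hK : 0 < K := by positivity
  have hXb : ∀ i, K ≤ X i ∧ X i ≤ B := fun i =>
    ⟨pow_le_pow_left₀ (by positivity) (by exact_mod_cast (hx i).1.le) _,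
     pow_le_pow_left₀ (by positivity) (by exact_mod_cast (hx i).2) _⟩
  have hYb : ∀ i, K ≤ Y i ∧ Y i ≤ B := fun i =>
    ⟨pow_le_pow_left₀ (by positivity) (by exact_mod_cast (hy i).1.le) _,
     pow_le_pow_left₀ (by positivity) (by exact_mod_cast (hy i).2) _⟩
  have hBK : B = 2 ^ k * K := by rw [hBdef, hKdef, mul_pow]
  have hpj : Prime (x j : ℤ) := Nat.prime_iff_prime_int.1 (hxp j)
  have hnd : ¬ (x j : ℤ) ∣ Δ l := by
    intro h
    have h1 : (x j : ℤ) ∣ X j * Y l := dvd_mul_of_dvd_left (dvd_pow_self _ hk.ne') _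
    have h2 : (x j : ℤ) ∣ X l * Y j := by
      have := dvd_sub h1 h
      simpa [hΔ] using this
    rcases hpj.dvd_or_dvd h2 with h3 | h3
    · have := Int.natCast_dvd_natCast.1 (hpj.dvd_of_dvd_pow h3)
      exact hl (((Nat.prime_dvd_prime_iff_eq (hxp j) (hxp l)).1 this).symm)
    · have := Int.natCast_dvd_natCast.1 (hpj.dvd_of_dvd_pow h3)
      exact hj ((Nat.prime_dvd_prime_iff_eq (hxp j) (hyp j)).1 this)
  have hΔl : Δ l ≠ 0 := fun h => hnd (h ▸ dvd_zero _)
  obtain ⟨s, -, hs⟩ := Finset.exists_max_image Finset.univ (fun i => |Δ i|) ⟨l, Finset.mem_univ _⟩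
  have hmax : ∀ i, |Δ i| ≤ |Δ s| := fun i => hs i (Finset.mem_univ _)
  have hs0 : Δ s ≠ 0 := by
    have := hmax l
    have h2 := abs_pos.2 hΔl
    exact abs_pos.1 (h2.trans_le this)
  set G : ℤ := Finset.univ.gcd Δ with hG
  have hHG : (H : ℤ) ∣ G := by
    refine Finset.dvd_gcd fun i _ => ?_
    have e : Δ i = (X j - 1) * Y i + (Y i - 1) - ((X i - 1) * Y j + (Y j - 1)) := by
      simp only [hΔ]; ring
    rw [e]
    exact dvd_sub (dvd_add (dvd_mul_of_dvd_left (hxH j) _) (hyH i))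
      (dvd_add (dvd_mul_of_dvd_left (hxH i) _) (hyH j))
  have hG0 : G ≠ 0 := fun h => hs0 (by
    have := Finset.gcd_dvd (f := Δ) (Finset.mem_univ s)
    rw [← hG, h] at this
    exact zero_dvd_iff.1 this)
  obtain ⟨f, hf⟩ : H ∣ G.natAbs := Int.natCast_dvd.1 hHG
  have hGp : 0 < G.natAbs := Int.natAbs_pos.2 hG0
  have hf0 : 0 < f := Nat.pos_of_ne_zero fun h => by rw [h, mul_zero] at hf; omega
  have hdvdG : ∀ z : ℤ, ((H * f : ℕ) : ℤ) ∣ z ↔ G ∣ z := by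
    intro z; rw [← hf, Int.natAbs_dvd]
  have hcoG : IsCoprime (x j : ℤ) G := by
    rw [hpj.irreducible.coprime_iff_not_dvd]
    exact fun h => hnd (h.trans (Finset.gcd_dvd (Finset.mem_univ l)))
  have hcoXG : IsCoprime (X j) ((H * f : ℕ) : ℤ) := by
    have h1 : IsCoprime (X j) G := hcoG.pow_left
    rw [← hf]
    exact (Int.isCoprime_iff_gcd_eq_one.2 (by
      have := Int.isCoprime_iff_gcd_eq_one.1 h1
      unfold Int.gcd at this ⊢
      rwa [Int.natAbs_natCast]))
  have hcoXY : IsCoprime (X j) (Y j) := by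
    refine IsCoprime.pow ?_
    rw [Nat.isCoprime_iff_coprime]
    exact (Nat.coprime_primes (hxp j) (hyp j)).2 hj
  have hDs : ((Δ s).natAbs : ℤ) = |Δ s| := Int.natCast_natAbs _
  refine ⟨f, (Δ s).natAbs, hf0, Int.natAbs_pos.2 hs0, ?_, ?_, ?_, ?_, ?_⟩
  · have h1 : |Δ s| ≤ 2 * (B ^ 2) := by
      have a1 : X j * Y s ≤ B * B := mul_le_mul (hXb j).2 (hYb s).2 (hK.le.trans (hYb s).1)
        (hK.le.trans ((hXb j).1.trans (hXb j).2))
      have a2 : X s * Y j ≤ B * B := mul_le_mul (hXb s).2 (hYb j).2 (hK.le.trans (hYb j).1)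
        (hK.le.trans ((hXb j).1.trans (hXb j).2))
      have a3 : 0 ≤ X j * Y s := mul_nonneg (hK.le.trans (hXb j).1) (hK.le.trans (hYb s).1)
      have a4 : 0 ≤ X s * Y j := mul_nonneg (hK.le.trans (hXb s).1) (hK.le.trans (hYb j).1)
      have a5 : Δ s = X j * Y s - X s * Y j := rfl
      rw [a5, abs_le]
      constructor <;> nlinarith
    rw [← hDs, hBdef] at h1
    exact_mod_cast h1
  · refine Nat.le_of_dvd (Int.natAbs_pos.2 hs0) ?_
    rw [← hf]
    exact Int.natAbs_dvd_natAbs.2 (Finset.gcd_dvd (Finset.mem_univ s))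
  · obtain ⟨p, q, hpq⟩ := hcoXG
    refine ⟨p * Y j, fun i => ?_⟩
    have h1 : ((H * f : ℕ) : ℤ) ∣ Δ i := (hdvdG _).2 (Finset.gcd_dvd (Finset.mem_univ i))
    have e : (y i : ℤ) ^ k - p * Y j * (x i : ℤ) ^ k = p * Δ i + ((H * f : ℕ) : ℤ) * (q * Y i) := by
      have : Δ i = X j * Y i - X i * Y j := rfl
      rw [this]
      simp only [hX, hY] at hpq ⊢
      linear_combination (-(y i : ℤ) ^ k) * hpq
    rw [e]
    exact dvd_add (dvd_mul_of_dvd_right h1 _) (dvd_mul_right _ _)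
  · have hxj0 : (0 : ℝ) < (x j : ℝ) ^ k := by have := (hxp j).pos; positivity
    have hZx : ∀ i, (Z : ℝ) ^ k ≤ (x i : ℝ) ^ k := fun i =>
      pow_le_pow_left₀ (by positivity) (by exact_mod_cast (hx i).1.le) _
    refine ⟨(y j : ℝ) ^ k / (x j : ℝ) ^ k, by positivity, ?_, fun i => ?_⟩
    · rw [div_le_iff₀ hxj0]
      calc (y j : ℝ) ^ k ≤ (2 * Z : ℝ) ^ k := 
            pow_le_pow_left₀ (by positivity) (by exact_mod_cast (hy j).2) _
        _ = 2 ^ k * (Z : ℝ) ^ k := mul_pow _ _ _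
        _ ≤ _ := mul_le_mul_of_nonneg_left (hZx j) (by positivity)
    · have h1 : (|Δ i| : ℝ) ≤ ((Δ s).natAbs : ℝ) := by
        have := hmax i
        rw [← hDs] at this
        have h3 : ((|Δ i| : ℤ) : ℝ) ≤ (((Δ s).natAbs : ℤ) : ℝ) := Int.cast_le.2 this
        rwa [Int.cast_abs, Int.cast_natCast] at h3
      have e : (y i : ℝ) ^ k - (y j : ℝ) ^ k / (x j : ℝ) ^ k * (x i : ℝ) ^ k =
          (Δ i : ℝ) / (x j : ℝ) ^ k := by
        have : Δ i = X j * Y i - X i * Y j := rfl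
        rw [this]
        simp only [hX, hY]
        push_cast
        field_simp
      rw [e, abs_div, abs_of_pos hxj0, two_mul, pow_add]
      calc |(Δ i : ℝ)| / (x j : ℝ) ^ k * ((Z : ℝ) ^ k * (Z : ℝ) ^ k)
          = |(Δ i : ℝ)| * (Z : ℝ) ^ k * ((Z : ℝ) ^ k / (x j : ℝ) ^ k) := by ring
        _ ≤ |(Δ i : ℝ)| * (Z : ℝ) ^ k * 1 := by
            refine mul_le_mul_of_nonneg_left ?_ (by positivity)
            rw [div_le_one hxj0]; exact hZx j
        _ ≤ ((Δ s).natAbs : ℝ) * (x i : ℝ) ^ k := by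
            rw [mul_one]
            exact mul_le_mul h1 (hZx i) (by positivity) (by positivity)
        _ = _ := mul_comm _ _
  · intro α A B' U w r r' hw hB'
    have hw' : (w : ℤ) * B ≤ U * |Δ s| := by
      rw [← hDs, hBdef]; exact_mod_cast hw
    have hwU : (w : ℤ) ≤ (2 * 2 ^ k * U) * K := by
      have h1 : |Δ s| ≤ 2 * (B * B) := by
        have a1 : X j * Y s ≤ B * B := mul_le_mul (hXb j).2 (hYb s).2 (hK.le.trans (hYb s).1)
          (hK.le.trans ((hXb j).1.trans (hXb j).2))
        have a2 : X s * Y j ≤ B * B := mul_le_mul (hXb s).2 (hYb j).2 (hK.le.trans (hYb j).1)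
          (hK.le.trans ((hXb j).1.trans (hXb j).2))
        have a3 : 0 ≤ X j * Y s := mul_nonneg (hK.le.trans (hXb j).1) (hK.le.trans (hYb s).1)
        have a4 : 0 ≤ X s * Y j := mul_nonneg (hK.le.trans (hXb s).1) (hK.le.trans (hYb j).1)
        have a5 : Δ s = X j * Y s - X s * Y j := rfl
        rw [a5, abs_le]
        constructor <;> nlinarith
      have hBp : 0 < B := hK.trans_le ((hXb j).1.trans (hXb j).2)
      have h2 : (w : ℤ) * B ≤ (2 * U * B) * B := by
        calc (w : ℤ) * B ≤ U * (2 * (B * B)) :=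
              hw'.trans (mul_le_mul_of_nonneg_left h1 (by positivity))
          _ = _ := by ring
      have := le_of_mul_le_mul_right h2 hBp
      calc (w : ℤ) ≤ 2 * U * B := this
        _ = _ := by rw [hBK]; ring
    set P := (Finset.range w ×ˢ Finset.range w).filter
      (fun z : ℕ × ℕ => ((H * f : ℕ) : ℤ) ∣ X j * z.2 - Y j * z.1) with hP
    have hPc : w * (w / (H * f)) ≤ P.card := mul_div_le_card_pairs (by positivity) hcoXG w
    have hPm : ∀ p ∈ P, p.1 < w ∧ p.2 < w ∧ G ∣ X j * p.2 - Y j * p.1 := by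
      intro p hp
      rw [hP, Finset.mem_filter, Finset.mem_product, Finset.mem_range, Finset.mem_range,
        hdvdG] at hp
      exact ⟨hp.1.1, hp.1.2, hp.2⟩
    have hex : ∀ p ∈ P, ∃ v : Fin t → ℤ, ∑ l, v l * X l = p.1 ∧ ∑ l, v l * Y l = p.2 ∧
        ∀ l, |v l| ≤ 2 * 2 ^ k * U + (1 + t * 2 ^ k) * (U + t * |Δ s|) := by
      intro p hp
      obtain ⟨h1, h2, h3⟩ := hPm p hp
      exact exists_small_pair (B := B) (W := w) hcoXY hK hXb (hYb j) hBK.le hs0 hmax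
        ⟨by positivity, by exact_mod_cast h1.le⟩ ⟨by positivity, by exact_mod_cast h2.le⟩ h3 hw' hwU
    have hfin := card_shift_pair hH (α := α) (A := A) (B := B') hex
      (by rw [← hDs]; exact_mod_cast hB') r r'
    refine (Nat.mul_le_mul_right _ hPc).trans (hfin.trans (Finset.card_le_card ?_))
    intro a ha
    rw [Finset.mem_filter] at ha ⊢
    obtain ⟨ha, p, hp, hp1, hp2⟩ := ha
    obtain ⟨h1, h2, h3⟩ := hPm p hp
    refine ⟨ha, p.1, p.2, h1, h2, ?_, hp1, hp2⟩
    have e : (p.2 : ℤ) - p.1 = (X j * p.2 - Y j * p.1) - (X j - 1) * p.2 + (Y j - 1) * p.1 := by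
      ring
    rw [e]
    exact dvd_add (dvd_sub (hHG.trans h3) (dvd_mul_of_dvd_left (hxH j) _))
      (dvd_mul_of_dvd_left (hyH j) _)

theorem single_count {k Z H t : ℕ} (hZ : 0 < Z) {x : Fin t → ℕ}
    (hxp : ∀ l, (x l).Prime) (hx : ∀ l, Z < x l ∧ x l ≤ 2 * Z) (hxc : ¬ ∃ v, ∀ l, x l = v)
    (ht : 0 < t) (α : Fin t → ℤ) (A B : ℤ) (U w : ℕ) (r : ℤ) (hw : w ≤ U * Z ^ k)
    (hB : A + H * (U + (2 * Z) ^ k) ≤ B) :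
    ((boxClass H α A).filter (fun a => ∃ m : ℕ, m < w ∧
      ∑ l, a l * (x l : ℤ) ^ k = r + H * m)).card ≤
      w * ((boxClass H α B).filter (fun a => ∑ l, a l * (x l : ℤ) ^ k = r)).card := by
  obtain ⟨l, hl⟩ : ∃ l, x l ≠ x ⟨0, ht⟩ := by
    by_contra h; push Not at h; exact hxc ⟨_, h⟩
  refine card_shift_single (V := U + (2 * Z) ^ k) (fun m hm => ?_) hB r
  refine exists_small_single (X := fun l => (x l : ℤ) ^ k) (K := (Z : ℤ) ^ k) (j := ⟨0, ht⟩) (l := l)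
    (fun h => hl (by rw [h])) ?_ (by positivity) ?_ (by positivity) ?_
  · refine IsCoprime.pow ?_
    rw [Nat.isCoprime_iff_coprime]
    exact (Nat.coprime_primes (hxp _) (hxp l)).2 (Ne.symm hl)
  · exact fun i => ⟨pow_le_pow_left₀ (by positivity) (by exact_mod_cast (hx i).1.le) _,
     pow_le_pow_left₀ (by positivity) (by exact_mod_cast (hx i).2) _⟩
  · have : m ≤ U * Z ^ k := hm.le.trans hw
    exact_mod_cast this

theorem sum_filter_exists_le {ι β : Type*} {I : Finset ι} {T : Finset β} {f : β → ℝ}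
    (hf : ∀ b ∈ T, 0 ≤ f b) {P : β → Prop} {Q : ι → β → Prop} [DecidablePred P]
    [∀ i, DecidablePred (Q i)] (h : ∀ b ∈ T, P b → ∃ i ∈ I, Q i b) :
    ∑ b ∈ T.filter P, f b ≤ ∑ i ∈ I, ∑ b ∈ T.filter (Q i), f b := by
  simp only [Finset.sum_filter]
  rw [Finset.sum_comm]
  refine Finset.sum_le_sum fun b hb => ?_
  have hnn : ∀ i ∈ I, 0 ≤ (if Q i b then f b else 0) := fun i _ => by
    split_ifs
    · exact hf b hb
    · exact le_rfl
  split_ifs with hP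
  · obtain ⟨i, hi, hQ⟩ := h b hb hP
    have := Finset.single_le_sum hnn hi
    rwa [if_pos hQ] at this
  · exact Finset.sum_nonneg hnn

/-- Product weight of a vector. -/
def vecW {t : ℕ} (π : ℕ → ℝ) (x : Fin t → ℕ) : ℝ := ∏ l, π (x l)

/-- Vectors with all entries in `S`. -/
def vecS (t : ℕ) (S : Finset ℕ) : Finset (Fin t → ℕ) := Fintype.piFinset fun _ => S

theorem mem_vecS {t : ℕ} {S : Finset ℕ} {x : Fin t → ℕ} : x ∈ vecS t S ↔ ∀ l, x l ∈ S := by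
  simp [vecS]

theorem vecW_nonneg {t : ℕ} {π : ℕ → ℝ} (h : ∀ x, 0 ≤ π x) (x : Fin t → ℕ) : 0 ≤ vecW π x :=
  Finset.prod_nonneg fun _ _ => h _

theorem sum_vecW_filter {t : ℕ} (S : Finset ℕ) (π : ℕ → ℝ) (P : Fin t → ℕ → Prop)
    [∀ l, DecidablePred (P l)] :
    ∑ x ∈ (vecS t S).filter (fun x => ∀ l, P l (x l)), vecW π x =
      ∏ l, ∑ x ∈ S.filter (P l), π x := by
  rw [Finset.prod_univ_sum]
  refine Finset.sum_congr ?_ fun _ _ => rfl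
  ext x
  simp only [Finset.mem_filter, mem_vecS, Fintype.mem_piFinset]
  exact forall_and.symm

theorem sum_vecW {t : ℕ} {S : Finset ℕ} {π : ℕ → ℝ} (h : ∑ x ∈ S, π x = 1) :
    ∑ x ∈ vecS t S, vecW π x = 1 := by
  have := sum_vecW_filter (t := t) S π (fun _ _ => True)
  simpa [h] using this

theorem vecW_le {t : ℕ} {π : ℕ → ℝ} (h : ∀ x, 0 ≤ π x) {s : ℝ} (hs : ∀ x, π x ≤ s)
    (x : Fin t → ℕ) : vecW π x ≤ s ^ t := by
  calc vecW π x ≤ ∏ _l : Fin t, s := Finset.prod_le_prod (fun _ _ => h _) fun _ _ => hs _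
    _ = s ^ t := by simp

theorem sum_vecW_const_le {t : ℕ} (ht : 0 < t) {S : Finset ℕ} {π : ℕ → ℝ}
    (hn : ∀ x, 0 ≤ π x) (h1 : ∑ x ∈ S, π x = 1) {s : ℝ} (hs : ∀ x, π x ≤ s) :
    ∑ x ∈ (vecS t S).filter (fun x => ∃ v, ∀ l, x l = v), vecW π x ≤ s ^ (t - 1) := by
  calc _ ≤ ∑ v ∈ S, ∑ x ∈ (vecS t S).filter (fun x => ∀ l, x l = v), vecW π x := by
        refine sum_filter_exists_le (fun x _ => vecW_nonneg hn x) ?_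
        rintro x hx ⟨v, hv⟩
        exact ⟨v, hv ⟨0, ht⟩ ▸ mem_vecS.1 hx _, hv⟩
    _ ≤ ∑ v ∈ S, s ^ (t - 1) * π v := by
        refine Finset.sum_le_sum fun v hv => ?_
        rw [sum_vecW_filter S π (fun _ y => y = v)]
        rw [Finset.filter_eq', if_pos hv]
        simp only [Finset.sum_singleton, Finset.prod_const, Finset.card_univ, Fintype.card_fin]
        obtain ⟨r, rfl⟩ : ∃ r, t = r + 1 := ⟨t - 1, by omega⟩
        rw [pow_succ, Nat.add_sub_cancel]
        exact mul_le_mul_of_nonneg_right (pow_le_pow_left₀ (hn v) (hs v) _) (hn v)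
    _ = s ^ (t - 1) := by rw [← Finset.mul_sum, h1, mul_one]

theorem sum_vecW_sq_le {t : ℕ} {S : Finset ℕ} {π : ℕ → ℝ}
    (hn : ∀ x, 0 ≤ π x) (h1 : ∑ x ∈ S, π x = 1) {s : ℝ} (hs : ∀ x, π x ≤ s) :
    ∑ x ∈ vecS t S, vecW π x * vecW π x ≤ s ^ t := by
  calc _ ≤ ∑ x ∈ vecS t S, s ^ t * vecW π x := Finset.sum_le_sum fun x _ =>
        mul_le_mul_of_nonneg_right (vecW_le hn hs x) (vecW_nonneg hn x)
    _ = s ^ t := by rw [← Finset.mul_sum, sum_vecW h1, mul_one]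

theorem sum_vecW_congr_le {k t q : ℕ} (hq : 0 < q) {S : Finset ℕ} {π : ℕ → ℝ}
    (hn : ∀ x, 0 ≤ π x) {κ : ℝ}
    (hκ : ∀ c : ℤ, ∑ x ∈ S.filter (fun x : ℕ => (q : ℤ) ∣ (x : ℤ) ^ k - c), π x ≤ κ)
    (X : Fin t → ℤ) :
    ∑ y ∈ (vecS t S).filter (fun y => ∃ c : ℤ, ∀ l, (q : ℤ) ∣ (y l : ℤ) ^ k - c * X l),
      vecW π y ≤ q * κ ^ t := by
  have hq' : (q : ℤ) ≠ 0 := by exact_mod_cast hq.ne'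
  calc _ ≤ ∑ c ∈ Finset.range q, ∑ y ∈ (vecS t S).filter
        (fun y => ∀ l, (q : ℤ) ∣ (y l : ℤ) ^ k - c * X l), vecW π y := by
        refine sum_filter_exists_le (fun x _ => vecW_nonneg hn x) ?_
        rintro y hy ⟨c, hc⟩
        have h0 := Int.emod_nonneg c hq'
        have hlt := Int.emod_lt_of_pos c (by exact_mod_cast hq : (0 : ℤ) < q)
        refine ⟨(c % q).toNat, Finset.mem_range.2 (by omega), fun l => ?_⟩
        rw [Int.toNat_of_nonneg h0]
        have e : (y l : ℤ) ^ k - c % q * X l = ((y l : ℤ) ^ k - c * X l) + q * ((c / q) * X l) := by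
          have := Int.emod_add_mul_ediv c q
          linear_combination (-X l) * this
        rw [e]
        exact dvd_add (hc l) (dvd_mul_right _ _)
    _ ≤ ∑ c ∈ Finset.range q, κ ^ t := by
        refine Finset.sum_le_sum fun c _ => ?_
        rw [sum_vecW_filter S π (fun l (y : ℕ) => (q : ℤ) ∣ (y : ℤ) ^ k - c * X l)]
        calc _ ≤ ∏ _l : Fin t, κ := Finset.prod_le_prod
              (fun _ _ => Finset.sum_nonneg fun _ _ => hn _) fun l _ => hκ _
          _ = κ ^ t := by simp
    _ = _ := by simp

theorem sum_vecW_near_le {k t D : ℕ} (hD : 0 < D) {S : Finset ℕ} {π : ℕ → ℝ}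
    (hn : ∀ x, 0 ≤ π x) {κ M : ℝ}
    (hκ : ∀ y : ℝ, ∑ x ∈ S.filter (fun x : ℕ => y ≤ (x : ℝ) ^ k ∧ (x : ℝ) ^ k ≤ y + 3 * M / D),
      π x ≤ κ) {X : Fin t → ℝ} (hX : ∀ l, 0 ≤ X l ∧ X l ≤ M) :
    ∑ y ∈ (vecS t S).filter (fun y => ∃ ρ : ℝ, 0 ≤ ρ ∧ ρ ≤ 2 ^ k ∧
      ∀ l, |(y l : ℝ) ^ k - ρ * X l| ≤ X l / D), vecW π y ≤ (2 ^ k * D + 1) * κ ^ t := by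
  have hD' : (0 : ℝ) < D := by exact_mod_cast hD
  calc _ ≤ ∑ i ∈ Finset.range (2 ^ k * D + 1), ∑ y ∈ (vecS t S).filter
        (fun y => ∀ l, X l * ((i : ℝ) - 1) / D ≤ (y l : ℝ) ^ k ∧
          (y l : ℝ) ^ k ≤ X l * ((i : ℝ) - 1) / D + 3 * M / D), vecW π y := by
        refine sum_filter_exists_le (fun x _ => vecW_nonneg hn x) ?_
        rintro y hy ⟨ρ, h0, h1, hρ⟩
        have hf1 := Nat.floor_le (mul_nonneg h0 hD'.le)
        have hf2 := Nat.lt_floor_add_one (ρ * D)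
        refine ⟨⌊ρ * D⌋₊, ?_, fun l => ?_⟩
        · rw [Finset.mem_range, Nat.lt_succ_iff]
          refine Nat.floor_le_of_le ?_
          push_cast
          exact mul_le_mul_of_nonneg_right h1 hD'.le
        · have h2 := abs_le.1 (hρ l)
          have e : X l / D * D = X l := by field_simp
          constructor
          · rw [div_le_iff₀ hD']
            have := mul_le_mul_of_nonneg_left hf1 (hX l).1
            have h3 := mul_le_mul_of_nonneg_right h2.1 hD'.le
            nlinarith
          · rw [← add_div, le_div_iff₀ hD']
            have := mul_le_mul_of_nonneg_left hf2.le (hX l).1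
            have h3 := mul_le_mul_of_nonneg_right h2.2 hD'.le
            have h4 := (hX l).2
            nlinarith
    _ ≤ ∑ i ∈ Finset.range (2 ^ k * D + 1), κ ^ t := by
        refine Finset.sum_le_sum fun i _ => ?_
        rw [sum_vecW_filter S π (fun l (y : ℕ) => X l * ((i : ℝ) - 1) / D ≤ (y : ℝ) ^ k ∧
          (y : ℝ) ^ k ≤ X l * ((i : ℝ) - 1) / D + 3 * M / D)]
        calc _ ≤ ∏ _l : Fin t, κ := Finset.prod_le_prod
              (fun _ _ => Finset.sum_nonneg fun _ _ => hn _) fun l _ => hκ _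
          _ = κ ^ t := by simp
    _ = _ := by simp

theorem exists_sum_mul_eq_one_mod {t H : ℕ} {a : Fin t → ℤ}
    (ha : ∀ p : ℕ, p.Prime → p ∣ H → ∃ l, ¬ (p : ℤ) ∣ a l) :
    ∃ u : Fin t → ℤ, (H : ℤ) ∣ ∑ l, a l * u l - 1 := by
  obtain ⟨g, hg⟩ := Finset.gcd_eq_sum_mul Finset.univ a
  have hco : IsCoprime (Finset.univ.gcd a) (H : ℤ) := by
    rw [Int.isCoprime_iff_nat_coprime, Int.natAbs_natCast]
    refine Nat.coprime_of_dvd fun p hp h1 h2 => ?_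
    obtain ⟨l, hl⟩ := ha p hp h2
    exact hl ((Int.natCast_dvd.2 h1).trans (Finset.gcd_dvd (Finset.mem_univ l)))
  obtain ⟨p, q, hpq⟩ := hco
  refine ⟨fun l => p * g l, -q, ?_⟩
  have : ∑ l, a l * (p * g l) = p * Finset.univ.gcd a := by
    rw [hg, Finset.mul_sum]
    exact Finset.sum_congr rfl fun _ _ => by ring
  rw [this]
  linear_combination hpq

theorem card_linear_fiber {t H : ℕ} [NeZero H] {a : Fin t → ZMod H}
    (ha : ∃ u : Fin t → ZMod H, ∑ l, a l * u l = 1) (e : ZMod H) :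
    (H : ℝ) * ((Finset.univ.filter (fun ζ : Fin t → ZMod H => ∑ l, a l * ζ l = e)).card : ℝ) =
      (H : ℝ) ^ t := by
  obtain ⟨u, hu⟩ := ha
  have hc : ∀ e' : ZMod H,
      (Finset.univ.filter (fun ζ : Fin t → ZMod H => ∑ l, a l * ζ l = e')).card =
      (Finset.univ.filter (fun ζ : Fin t → ZMod H => ∑ l, a l * ζ l = e)).card := by
    intro e'
    refine Finset.card_bij' (fun ζ _ => fun l => ζ l + (e - e') * u l)
      (fun ζ _ => fun l => ζ l - (e - e') * u l) ?_ ?_ ?_ ?_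
    · intro ζ hζ
      simp only [Finset.mem_filter, Finset.mem_univ, true_and] at hζ ⊢
      have : ∑ l, a l * (ζ l + (e - e') * u l) = ∑ l, a l * ζ l + (e - e') * ∑ l, a l * u l := by
        rw [Finset.mul_sum, ← Finset.sum_add_distrib]
        exact Finset.sum_congr rfl fun _ _ => by ring
      rw [this, hζ, hu]; ring
    · intro ζ hζ
      simp only [Finset.mem_filter, Finset.mem_univ, true_and] at hζ ⊢
      have : ∑ l, a l * (ζ l - (e - e') * u l) = ∑ l, a l * ζ l - (e - e') * ∑ l, a l * u l := by
        rw [Finset.mul_sum, ← Finset.sum_sub_distrib]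
        exact Finset.sum_congr rfl fun _ _ => by ring
      rw [this, hζ, hu]; ring
    · intro ζ _; funext l; ring
    · intro ζ _; funext l; ring
  have htot : ∑ e' : ZMod H,
      (Finset.univ.filter (fun ζ : Fin t → ZMod H => ∑ l, a l * ζ l = e')).card = H ^ t := by
    rw [← Finset.card_eq_sum_card_fiberwise (f := fun ζ : Fin t → ZMod H => ∑ l, a l * ζ l)
      (s := Finset.univ) (t := Finset.univ) (fun _ _ => Finset.mem_coe.2 (Finset.mem_univ _))]
    simp [ZMod.card]
  simp only [hc, Finset.sum_const, Finset.card_univ, ZMod.card, smul_eq_mul] at htot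
  exact_mod_cast htot

theorem sum_vecW_linear {k t H : ℕ} (hH : 0 < H) {S : Finset ℕ} {π : ℕ → ℝ}
    (hS : ∀ x ∈ S, (H : ℤ) ∣ (x : ℤ) ^ k - 1)
    (hu : ∀ z : ℤ, ∑ x ∈ S.filter (fun x : ℕ => ((H : ℤ) ^ 2) ∣ (x : ℤ) ^ k - 1 - H * z), π x =
      (H : ℝ)⁻¹) {a : Fin t → ℤ}
    (ha : ∀ p : ℕ, p.Prime → p ∣ H → ∃ l, ¬ (p : ℤ) ∣ a l) (e : ℤ) :
    ∑ x ∈ (vecS t S).filter (fun x => ((H : ℤ) ^ 2) ∣ ∑ l, a l * ((x l : ℤ) ^ k - 1) - H * e),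
      vecW π x = (H : ℝ)⁻¹ := by
  have : NeZero H := ⟨hH.ne'⟩
  have hH0 : (H : ℤ) ≠ 0 := by exact_mod_cast hH.ne'
  have hHr : (H : ℝ) ≠ 0 := by exact_mod_cast hH.ne'
  set z : ℕ → ZMod H := fun x => ((((x : ℤ) ^ k - 1) / H : ℤ) : ZMod H) with hz
  have hzx : ∀ x ∈ S, (x : ℤ) ^ k - 1 = H * (((x : ℤ) ^ k - 1) / H) := fun x hx =>
    (Int.mul_ediv_cancel' (hS x hx)).symm
  have hdv : ∀ b : ℤ, ((H : ℤ) ^ 2 ∣ H * b ↔ ((b : ℤ) : ZMod H) = 0) := by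
    intro b
    rw [sq, mul_dvd_mul_iff_left hH0, ZMod.intCast_zmod_eq_zero_iff_dvd]
  have hu' : ∀ ζ : ZMod H, ∑ x ∈ S.filter (fun x => z x = ζ), π x = (H : ℝ)⁻¹ := by
    intro ζ
    rw [← hu (ζ.val : ℤ)]
    refine Finset.sum_congr (Finset.filter_congr fun x hx => ?_) fun _ _ => rfl
    have e1 : (x : ℤ) ^ k - 1 - H * (ζ.val : ℤ) = H * (((x : ℤ) ^ k - 1) / H - ζ.val) := by
      conv_lhs => rw [hzx x hx]
      ring
    rw [e1, hdv]
    push_cast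
    rw [ZMod.natCast_zmod_val, sub_eq_zero]
  have hiff : ∀ x ∈ vecS t S, (((H : ℤ) ^ 2) ∣ ∑ l, a l * ((x l : ℤ) ^ k - 1) - H * e ↔
      ∑ l, (a l : ZMod H) * z (x l) = e) := by
    intro x hx
    have e1 : ∑ l, a l * ((x l : ℤ) ^ k - 1) - H * e =
        H * (∑ l, a l * (((x l : ℤ) ^ k - 1) / H) - e) := by
      rw [mul_sub, Finset.mul_sum]
      congr 1
      refine Finset.sum_congr rfl fun l _ => ?_
      conv_lhs => rw [hzx _ (mem_vecS.1 hx l)]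
      ring
    rw [e1, hdv]
    push_cast
    rw [sub_eq_zero]
  rw [Finset.filter_congr hiff]
  obtain ⟨u, hu1⟩ := exists_sum_mul_eq_one_mod ha
  have hcard := card_linear_fiber (a := fun l => (a l : ZMod H)) ⟨fun l => (u l : ZMod H), by
    have := (ZMod.intCast_zmod_eq_zero_iff_dvd _ _).2 hu1
    push_cast at this
    exact sub_eq_zero.1 this⟩ (e : ZMod H)
  have hfib : ∑ x ∈ (vecS t S).filter (fun x => ∑ l, (a l : ZMod H) * z (x l) = e), vecW π x =
      ∑ ζ ∈ Finset.univ.filter (fun ζ : Fin t → ZMod H => ∑ l, (a l : ZMod H) * ζ l = e),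
        ∑ x ∈ (vecS t S).filter (fun x => ∀ l, z (x l) = ζ l), vecW π x := by
    rw [← Finset.sum_fiberwise_of_maps_to
      (s := (vecS t S).filter (fun x => ∑ l, (a l : ZMod H) * z (x l) = e))
      (t := Finset.univ.filter (fun ζ : Fin t → ZMod H => ∑ l, (a l : ZMod H) * ζ l = e))
      (g := fun x l => z (x l))
      (fun x hx => by
        rw [Finset.mem_filter] at hx ⊢
        exact ⟨Finset.mem_univ _, hx.2⟩)]
    refine Finset.sum_congr rfl fun ζ hζ => Finset.sum_congr ?_ fun _ _ => rfl
    rw [Finset.filter_filter]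
    refine Finset.filter_congr fun x _ => ?_
    rw [Finset.mem_filter] at hζ
    constructor
    · rintro ⟨_, h2⟩ l
      exact congrFun h2 l
    · intro h
      have : (fun l => z (x l)) = ζ := funext h
      exact ⟨by rw [← hζ.2, ← this], this⟩
  rw [hfib]
  have : ∀ ζ : Fin t → ZMod H, ∑ x ∈ (vecS t S).filter (fun x => ∀ l, z (x l) = ζ l), vecW π x =
      ((H : ℝ)⁻¹) ^ t := by
    intro ζ
    rw [sum_vecW_filter S π (fun l x => z x = ζ l)]
    simp [hu']
  simp only [this, Finset.sum_const, nsmul_eq_mul]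
  rw [inv_pow, ← hcard]
  have hne : ((Finset.univ.filter (fun ζ : Fin t → ZMod H =>
      ∑ l, (a l : ZMod H) * ζ l = e)).card : ℝ) ≠ 0 := by
    intro h
    rw [h, mul_zero] at hcard
    exact pow_ne_zero t hHr hcard.symm
  field_simp

theorem sum_sum_mul_card_filter {β ζ : Type*} (T : Finset β) (Z : Finset ζ) (μ : ζ → ℝ)
    (e : β → ζ → Prop) :
    ∑ z ∈ Z, ∑ z' ∈ Z, μ z * μ z' * ((T.filter (fun a => e a z ∧ e a z')).card : ℝ) =
      ∑ a ∈ T, (∑ z ∈ Z, μ z * (if e a z then 1 else 0)) ^ 2 := by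
  have h1 : ∀ z z', ((T.filter (fun a => e a z ∧ e a z')).card : ℝ) =
      ∑ a ∈ T, (if e a z then (1 : ℝ) else 0) * (if e a z' then 1 else 0) := by
    intro z z'
    rw [Finset.card_filter]
    push_cast
    refine Finset.sum_congr rfl fun a _ => ?_
    by_cases h1 : e a z <;> by_cases h2 : e a z' <;> simp [h1, h2]
  simp only [h1, Finset.mul_sum, sq, Finset.sum_mul]
  rw [Finset.sum_comm' (t' := Z) (s' := fun _ => Z) (by tauto)]
  symm
  rw [Finset.sum_comm]
  refine Finset.sum_congr rfl fun z _ => ?_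
  rw [Finset.sum_comm]
  refine Finset.sum_congr rfl fun z' _ => Finset.sum_congr rfl fun a _ => ?_
  ring

theorem second_moment_le {β ι κ : Type*} {Q Q' : Finset β} {S₁ : Finset ι} {V : Finset κ}
    {p : ι → ℝ} {W : κ → ℝ} (hp : ∀ x, 0 ≤ p x) (hp1 : ∑ x ∈ S₁, p x = 1) (hW : ∀ v, 0 ≤ W v)
    {E : β → ι → κ → Prop} {C : β → ℕ → ι → κ → Prop} {H : ℕ} (hH : 0 < H)
    {τ φ : κ → κ → ℝ} (hφ0 : ∀ v v', 0 ≤ φ v v') {c₁ s τb φb Ω : ℝ} (hc₁ : 0 ≤ c₁)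
    (hN : ∀ x ∈ S₁, ∀ v ∈ V, ∀ x' ∈ S₁, ∀ v' ∈ V,
      ((Q.filter (fun a => E a x v ∧ E a x' v')).card : ℝ) ≤
        (if v = v' then (Q.card : ℝ) else 0) + τ v v' +
        c₁ * ((Q'.filter (fun a => ∃ h < H, C a h x v ∧ C a h x' v')).card : ℝ) +
        c₁ * φ v v' * ((Q'.filter (fun a => (∃ h < H, C a h x v) ∧
          ∃ h < H, C a h x' v')).card : ℝ))
    (hs : ∑ v ∈ V, W v * W v ≤ s) (hτ : ∑ v ∈ V, ∑ v' ∈ V, W v * W v' * τ v v' ≤ τb)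
    (hφ : ∑ v ∈ V, ∑ v' ∈ V, W v * W v' * φ v v' ≤ φb)
    (hC1 : ∀ a ∈ Q', ∀ h < H, ∑ z ∈ S₁ ×ˢ V, p z.1 * W z.2 * (if C a h z.1 z.2 then 1 else 0) ≤
      Ω / H)
    (hC2 : ∀ a ∈ Q', ∀ v ∈ V, ∑ x ∈ S₁, p x * (if ∃ h < H, C a h x v then 1 else 0) ≤ Ω) :
    ∑ a ∈ Q, (∑ z ∈ S₁ ×ˢ V, p z.1 * W z.2 * (if E a z.1 z.2 then 1 else 0)) ^ 2 ≤
      Q.card * s + τb + c₁ * Q'.card * Ω ^ 2 * (1 / H + φb) := by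
  have hHr : (0 : ℝ) < H := by exact_mod_cast hH
  set Z := S₁ ×ˢ V with hZ
  set μ : ι × κ → ℝ := fun z => p z.1 * W z.2 with hμ
  have hμ0 : ∀ z, 0 ≤ μ z := fun z => mul_nonneg (hp _) (hW _)
  have hsep : ∀ g : κ → κ → ℝ, ∑ z ∈ Z, ∑ z' ∈ Z, μ z * μ z' * g z.2 z'.2 =
      ∑ v ∈ V, ∑ v' ∈ V, W v * W v' * g v v' := by
    intro g
    have e1 : ∀ z, ∑ z' ∈ Z, μ z * μ z' * g z.2 z'.2 =
        p z.1 * ∑ v' ∈ V, W z.2 * W v' * g z.2 v' := by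
      intro z
      rw [hZ, Finset.sum_product]
      have : ∀ x ∈ S₁, ∑ y ∈ V, μ z * μ (x, y) * g z.2 y =
          p x * (p z.1 * ∑ v' ∈ V, W z.2 * W v' * g z.2 v') := by
        intro x _
        rw [Finset.mul_sum, Finset.mul_sum]
        exact Finset.sum_congr rfl fun y _ => by simp only [hμ]; ring
      rw [Finset.sum_congr rfl this, ← Finset.sum_mul, hp1, one_mul]
    simp only [e1]
    rw [hZ, Finset.sum_product]
    simp only
    have : ∀ x ∈ S₁, ∑ y ∈ V, p x * ∑ v' ∈ V, W y * W v' * g y v' =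
        p x * ∑ y ∈ V, ∑ v' ∈ V, W y * W v' * g y v' := fun x _ => by rw [Finset.mul_sum]
    rw [Finset.sum_congr rfl this, ← Finset.sum_mul, hp1, one_mul]
  have hdeg : ∑ z ∈ Z, ∑ z' ∈ Z, μ z * μ z' * (if z.2 = z'.2 then (Q.card : ℝ) else 0) ≤
      Q.card * s := by
    rw [hsep (fun v v' => if v = v' then (Q.card : ℝ) else 0)]
    calc _ = Q.card * ∑ v ∈ V, W v * W v := by
          rw [Finset.mul_sum]
          refine Finset.sum_congr rfl fun v hv => ?_
          simp only [mul_ite, mul_zero]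
          rw [Finset.sum_ite_eq, if_pos hv]
          ring
      _ ≤ _ := mul_le_mul_of_nonneg_left hs (by positivity)
  have hM1 : ∑ z ∈ Z, ∑ z' ∈ Z, μ z * μ z' *
      ((Q'.filter (fun a => ∃ h < H, C a h z.1 z.2 ∧ C a h z'.1 z'.2)).card : ℝ) ≤
      Q'.card * (Ω ^ 2 / H) := by
    calc _ ≤ ∑ z ∈ Z, ∑ z' ∈ Z, μ z * μ z' * ∑ h ∈ Finset.range H,
          ((Q'.filter (fun a => C a h z.1 z.2 ∧ C a h z'.1 z'.2)).card : ℝ) := by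
          refine Finset.sum_le_sum fun z _ => Finset.sum_le_sum fun z' _ =>
            mul_le_mul_of_nonneg_left ?_ (mul_nonneg (hμ0 _) (hμ0 _))
          have : Q'.filter (fun a => ∃ h < H, C a h z.1 z.2 ∧ C a h z'.1 z'.2) ⊆
              (Finset.range H).biUnion fun h =>
                Q'.filter (fun a => C a h z.1 z.2 ∧ C a h z'.1 z'.2) := by
            intro a ha
            rw [Finset.mem_filter] at ha
            obtain ⟨ha, h, hh, hc⟩ := ha
            exact Finset.mem_biUnion.2 ⟨h, Finset.mem_range.2 hh, Finset.mem_filter.2 ⟨ha, hc⟩⟩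
          exact_mod_cast (Finset.card_le_card this).trans Finset.card_biUnion_le
      _ = ∑ h ∈ Finset.range H, ∑ z ∈ Z, ∑ z' ∈ Z, μ z * μ z' *
          ((Q'.filter (fun a => C a h z.1 z.2 ∧ C a h z'.1 z'.2)).card : ℝ) := by
          simp only [Finset.mul_sum]
          rw [Finset.sum_comm]
          refine Eq.trans ?_ Finset.sum_comm
          rw [Finset.sum_comm]
          refine Finset.sum_congr rfl fun z _ => ?_
          rw [Finset.sum_comm]
      _ = ∑ h ∈ Finset.range H, ∑ a ∈ Q', (∑ z ∈ Z, μ z *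
          (if C a h z.1 z.2 then 1 else 0)) ^ 2 :=
          Finset.sum_congr rfl fun h _ =>
            sum_sum_mul_card_filter Q' Z μ (fun a z => C a h z.1 z.2)
      _ ≤ ∑ h ∈ Finset.range H, ∑ a ∈ Q', (Ω / H) ^ 2 := by
          refine Finset.sum_le_sum fun h hh => Finset.sum_le_sum fun a ha => ?_
          refine pow_le_pow_left₀ (Finset.sum_nonneg fun z _ => mul_nonneg (hμ0 _) ?_)
            (hC1 a ha h (Finset.mem_range.1 hh)) _
          split_ifs <;> norm_num
      _ = _ := by
          simp only [Finset.sum_const, Finset.card_range, nsmul_eq_mul]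
          field_simp
  have hM2 : ∑ z ∈ Z, ∑ z' ∈ Z, μ z * μ z' * (φ z.2 z'.2 *
      ((Q'.filter (fun a => (∃ h < H, C a h z.1 z.2) ∧ ∃ h < H, C a h z'.1 z'.2)).card : ℝ)) ≤
      Q'.card * (Ω ^ 2 * φb) := by
    set e : β → ι → κ → ℝ := fun a x v => if ∃ h < H, C a h x v then 1 else 0 with he
    have he0 : ∀ a x v, 0 ≤ e a x v := fun a x v => by
      simp only [he]; split_ifs <;> norm_num
    have h1 : ∀ z z' : ι × κ, ((Q'.filter (fun a => (∃ h < H, C a h z.1 z.2) ∧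
        ∃ h < H, C a h z'.1 z'.2)).card : ℝ) = ∑ a ∈ Q', e a z.1 z.2 * e a z'.1 z'.2 := by
      intro z z'
      rw [Finset.card_filter]
      push_cast
      refine Finset.sum_congr rfl fun a _ => ?_
      simp only [he]
      by_cases h1 : ∃ h < H, C a h z.1 z.2 <;> by_cases h2 : ∃ h < H, C a h z'.1 z'.2 <;>
        simp only [h1, h2, and_self, and_true, and_false, if_true, if_false] <;> norm_num
    have h2 : ∑ z ∈ Z, ∑ z' ∈ Z, μ z * μ z' * (φ z.2 z'.2 *
        ((Q'.filter (fun a => (∃ h < H, C a h z.1 z.2) ∧ ∃ h < H, C a h z'.1 z'.2)).card : ℝ)) =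
        ∑ a ∈ Q', ∑ z ∈ Z, ∑ z' ∈ Z, μ z * μ z' * (φ z.2 z'.2 *
          (e a z.1 z.2 * e a z'.1 z'.2)) := by
      simp only [h1, Finset.mul_sum]
      symm
      rw [Finset.sum_comm]
      refine Finset.sum_congr rfl fun z _ => ?_
      rw [Finset.sum_comm]
    rw [h2]
    calc _ ≤ ∑ a ∈ Q', Ω ^ 2 * φb := by
          refine Finset.sum_le_sum fun a ha => ?_
          have h3 : ∑ z ∈ Z, ∑ z' ∈ Z, μ z * μ z' * (φ z.2 z'.2 *
              (e a z.1 z.2 * e a z'.1 z'.2)) = ∑ v ∈ V, ∑ v' ∈ V, W v * W v' * φ v v' *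
              ((∑ x ∈ S₁, p x * e a x v) * ∑ x ∈ S₁, p x * e a x v') := by
            rw [hZ, Finset.sum_product_right]
            refine Finset.sum_congr rfl fun v _ => ?_
            simp only [Finset.sum_product_right]
            rw [Finset.sum_comm]
            refine Finset.sum_congr rfl fun v' _ => ?_
            rw [Finset.sum_mul_sum, Finset.mul_sum]
            refine Finset.sum_congr rfl fun x _ => ?_
            rw [Finset.mul_sum]
            exact Finset.sum_congr rfl fun x' _ => by simp only [hμ]; ring
          rw [h3]
          calc _ ≤ ∑ v ∈ V, ∑ v' ∈ V, W v * W v' * φ v v' * (Ω * Ω) := by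
                refine Finset.sum_le_sum fun v hv => Finset.sum_le_sum fun v' hv' => ?_
                refine mul_le_mul_of_nonneg_left ?_
                  (mul_nonneg (mul_nonneg (hW _) (hW _)) (hφ0 _ _))
                have g0 : ∀ v, 0 ≤ ∑ x ∈ S₁, p x * e a x v := fun v =>
                  Finset.sum_nonneg fun x _ => mul_nonneg (hp _) (he0 _ _ _)
                exact mul_le_mul (hC2 a ha v hv) (hC2 a ha v' hv') (g0 _)
                  ((g0 v).trans (hC2 a ha v hv))
            _ = Ω ^ 2 * ∑ v ∈ V, ∑ v' ∈ V, W v * W v' * φ v v' := by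
                rw [Finset.mul_sum]
                refine Finset.sum_congr rfl fun v _ => ?_
                rw [Finset.mul_sum]
                exact Finset.sum_congr rfl fun v' _ => by ring
            _ ≤ _ := mul_le_mul_of_nonneg_left hφ (by positivity)
      _ = _ := by simp
  have hmain := sum_sum_mul_card_filter Q Z μ (fun a z => E a z.1 z.2)
  rw [← hmain]
  calc _ ≤ ∑ z ∈ Z, ∑ z' ∈ Z, (μ z * μ z' * (if z.2 = z'.2 then (Q.card : ℝ) else 0) +
        μ z * μ z' * τ z.2 z'.2 + c₁ * (μ z * μ z' *
        ((Q'.filter (fun a => ∃ h < H, C a h z.1 z.2 ∧ C a h z'.1 z'.2)).card : ℝ)) +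
        c₁ * (μ z * μ z' * (φ z.2 z'.2 * ((Q'.filter (fun a => (∃ h < H, C a h z.1 z.2) ∧
          ∃ h < H, C a h z'.1 z'.2)).card : ℝ)))) := by
        refine Finset.sum_le_sum fun z hz => Finset.sum_le_sum fun z' hz' => ?_
        rw [hZ, Finset.mem_product] at hz hz'
        have := mul_le_mul_of_nonneg_left (hN z.1 hz.1 z.2 hz.2 z'.1 hz'.1 z'.2 hz'.2)
          (mul_nonneg (hμ0 z) (hμ0 z'))
        refine this.trans (le_of_eq ?_)
        ring
    _ ≤ Q.card * s + τb + c₁ * (Q'.card * (Ω ^ 2 / H)) + c₁ * (Q'.card * (Ω ^ 2 * φb)) := by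
        simp only [Finset.sum_add_distrib, ← Finset.mul_sum]
        have h4 := hsep τ
        rw [h4]
        have h5 := mul_le_mul_of_nonneg_left hM1 hc₁
        have h6 := mul_le_mul_of_nonneg_left hM2 hc₁
        linarith
    _ = _ := by ring

theorem card_zero_le {β : Type*} {Q : Finset β} {R : β → ℝ} {M₁ M₂ : ℝ}
    (h1 : M₁ ≤ ∑ a ∈ Q, R a) (hM₁ : 0 ≤ M₁) (h2 : ∑ a ∈ Q, R a ^ 2 ≤ M₂) (hM₂ : 0 < M₂) :
    ((Q.filter (fun a => R a = 0)).card : ℝ) ≤ Q.card - M₁ ^ 2 / M₂ := by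
  have hs : ∑ a ∈ Q, R a = ∑ a ∈ Q.filter (fun a => ¬ R a = 0), R a := by
    rw [← Finset.sum_filter_add_sum_filter_not Q (fun a => R a = 0)]
    rw [Finset.sum_eq_zero (s := Q.filter (fun a => R a = 0)) fun a ha => (Finset.mem_filter.1 ha).2,
      zero_add]
  have hcs := sq_sum_le_card_mul_sum_sq (s := Q.filter (fun a => ¬ R a = 0)) (f := R)
  have hle : ∑ a ∈ Q.filter (fun a => ¬ R a = 0), R a ^ 2 ≤ M₂ :=
    (Finset.sum_le_sum_of_subset_of_nonneg (Finset.filter_subset _ _)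
      fun _ _ _ => sq_nonneg _).trans h2
  have hc := Finset.card_filter_add_card_filter_not (s := Q) (fun a => R a = 0)
  have hc' : ((Q.filter (fun a => R a = 0)).card : ℝ) +
      ((Q.filter (fun a => ¬ R a = 0)).card : ℝ) = Q.card := by exact_mod_cast hc
  have h3 : M₁ ^ 2 ≤ ((Q.filter (fun a => ¬ R a = 0)).card : ℝ) * M₂ := by
    calc M₁ ^ 2 ≤ (∑ a ∈ Q, R a) ^ 2 := pow_le_pow_left₀ hM₁ h1 2
      _ ≤ _ := by rw [hs]; exact hcs
      _ ≤ _ := mul_le_mul_of_nonneg_left hle (by positivity)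
  have h4 : M₁ ^ 2 / M₂ ≤ ((Q.filter (fun a => ¬ R a = 0)).card : ℝ) := by
    rwa [div_le_iff₀ hM₂]
  linarith

theorem le_first_moment {β ι κ : Type*} {Q Q' : Finset β} {S₁ : Finset ι} {V : Finset κ}
    {p : ι → ℝ} {W : κ → ℝ} (hp : ∀ x, 0 ≤ p x) (hW : ∀ v, 0 ≤ W v)
    {E F : β → ι → κ → Prop} {w L c : ℝ} (hL : 0 ≤ L)
    (hcount : ∀ x ∈ S₁, ∀ v ∈ V, ((Q'.filter (fun a => F a x v)).card : ℝ) ≤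
      w * ((Q.filter (fun a => E a x v)).card : ℝ))
    (hF : ∀ a ∈ Q', ∀ v ∈ V, L ≤ ∑ x ∈ S₁, p x * (if F a x v then 1 else 0))
    (hV : c ≤ ∑ v ∈ V, W v) :
    Q'.card * (L * c) ≤
      w * ∑ a ∈ Q, ∑ z ∈ S₁ ×ˢ V, p z.1 * W z.2 * (if E a z.1 z.2 then 1 else 0) := by
  have hcf : ∀ (T : Finset β) (G : β → ι → κ → Prop),
      ∑ a ∈ T, ∑ z ∈ S₁ ×ˢ V, p z.1 * W z.2 * (if G a z.1 z.2 then (1 : ℝ) else 0) =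
      ∑ z ∈ S₁ ×ˢ V, p z.1 * W z.2 * ((T.filter (fun a => G a z.1 z.2)).card : ℝ) := by
    intro T G
    rw [Finset.sum_comm]
    refine Finset.sum_congr rfl fun z _ => ?_
    rw [← Finset.mul_sum, Finset.card_filter]
    push_cast
    rfl
  calc _ = ∑ a ∈ Q', L * c := by simp
    _ ≤ ∑ a ∈ Q', ∑ v ∈ V, W v * L := by
        refine Finset.sum_le_sum fun a _ => ?_
        rw [← Finset.sum_mul, mul_comm]
        exact mul_le_mul_of_nonneg_right hV hL
    _ ≤ ∑ a ∈ Q', ∑ v ∈ V, W v * ∑ x ∈ S₁, p x * (if F a x v then 1 else 0) :=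
        Finset.sum_le_sum fun a ha => Finset.sum_le_sum fun v hv =>
          mul_le_mul_of_nonneg_left (hF a ha v hv) (hW v)
    _ = ∑ a ∈ Q', ∑ z ∈ S₁ ×ˢ V, p z.1 * W z.2 * (if F a z.1 z.2 then (1 : ℝ) else 0) := by
        refine Finset.sum_congr rfl fun a _ => ?_
        rw [Finset.sum_product_right]
        refine Finset.sum_congr rfl fun v _ => ?_
        rw [Finset.mul_sum]
        exact Finset.sum_congr rfl fun x _ => by ring
    _ = _ := hcf Q' F
    _ ≤ ∑ z ∈ S₁ ×ˢ V, p z.1 * W z.2 * (w * ((Q.filter (fun a => E a z.1 z.2)).card : ℝ)) := by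
        refine Finset.sum_le_sum fun z hz => ?_
        rw [Finset.mem_product] at hz
        exact mul_le_mul_of_nonneg_left (hcount z.1 hz.1 z.2 hz.2) (mul_nonneg (hp _) (hW _))
    _ = _ := by
        rw [hcf Q E, Finset.mul_sum]
        exact Finset.sum_congr rfl fun z _ => by ring

theorem sum_mul_ite_eq_filter {ι : Type*} (S : Finset ι) (p : ι → ℝ) (P : ι → Prop)
    [DecidablePred P] :
    ∑ x ∈ S, p x * (if P x then 1 else 0) = ∑ x ∈ S.filter P, p x := by
  rw [Finset.sum_filter]
  exact Finset.sum_congr rfl fun x _ => by split_ifs <;> simp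

section Windows

variable {k : ℕ} {c c' : ℝ} {N Z : ℕ} {S₁ : Finset ℕ} {π₁ : ℕ → ℝ}

theorem FlatWeight.window_le (F : FlatWeight k c c' N Z S₁ π₁) (hk : 0 < k) (y : ℝ) {h : ℝ}
    (hh : 0 ≤ h) :
    ∑ x ∈ S₁.filter (fun x : ℕ => y ≤ (x : ℝ) ^ k ∧ (x : ℝ) ^ k < y + h), π₁ x ≤
      h / ((c' - c) * Z ^ k) + 2 / N := by
  have hH := modH_pos hk
  have hHr : (modH k : ℝ) ≠ 0 := by exact_mod_cast hH.ne'
  have hHz : (modH k : ℤ) ≠ 0 := by exact_mod_cast hH.ne'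
  calc _ ≤ ∑ z ∈ Finset.range (modH k), ∑ x ∈ S₁.filter
        (fun x : ℕ => ((modH k : ℤ) ^ 2) ∣ (x : ℤ) ^ k - 1 - modH k * (z : ℤ) ∧
          y ≤ (x : ℝ) ^ k ∧ (x : ℝ) ^ k < y + h), π₁ x := by
        refine sum_filter_exists_le (fun x _ => F.nonneg x) ?_
        intro x hx hxy
        obtain ⟨e, he⟩ := F.congr x hx
        have h0 := Int.emod_nonneg e hHz
        have hlt := Int.emod_lt_of_pos e (by exact_mod_cast hH : (0 : ℤ) < modH k)
        refine ⟨(e % modH k).toNat, Finset.mem_range.2 (by omega), ?_, hxy⟩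
        rw [Int.toNat_of_nonneg h0, he]
        refine ⟨e / modH k, ?_⟩
        have := Int.emod_add_mul_ediv e (modH k)
        linear_combination (-(modH k : ℤ)) * this
    _ ≤ ∑ z ∈ Finset.range (modH k), (modH k : ℝ)⁻¹ * (h / ((c' - c) * Z ^ k) + 2 / N) :=
        Finset.sum_le_sum fun z _ => F.upper y h hh z
    _ = _ := by
        rw [Finset.sum_const, Finset.card_range, nsmul_eq_mul, ← mul_assoc, mul_inv_cancel₀ hHr,
          one_mul]

/-- The linear form in the `k`-th powers of the entries. -/
def linForm {t : ℕ} (k : ℕ) (a : Fin t → ℤ) (x : Fin t → ℕ) : ℤ := ∑ l, a l * (x l : ℤ) ^ k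

/-- The equation is solved up to an error `H * m` with `m < w` in the class of `h`. -/
def IsNearSol {t : ℕ} (k H w : ℕ) (a₁ n : ℤ) (a : Fin t → ℤ) (h x : ℕ) (v : Fin t → ℕ) : Prop :=
  ∃ m : ℕ, m < w ∧ (H : ℤ) ∣ m - (h : ℤ) ∧ a₁ * (x : ℤ) ^ k + linForm k a v = n + H * m

theorem window_of_eq {t H w m : ℕ} {a₁ n : ℤ} (hH : 0 < H) (ha₁ : 0 < a₁) {a : Fin t → ℤ}
    {x : ℕ} {v : Fin t → ℕ} (hm : m < w) (h : a₁ * (x : ℤ) ^ k + linForm k a v = n + H * m) :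
    ((n - linForm k a v : ℤ) : ℝ) / a₁ ≤ (x : ℝ) ^ k ∧
      (x : ℝ) ^ k < ((n - linForm k a v : ℤ) : ℝ) / a₁ + H * w / a₁ := by
  have ha : (0 : ℝ) < a₁ := by exact_mod_cast ha₁
  have h' : (a₁ : ℝ) * (x : ℝ) ^ k + linForm k a v = n + H * m := by exact_mod_cast h
  have hm' : (m : ℝ) < w := by exact_mod_cast hm
  have hH' : (0 : ℝ) < H := by exact_mod_cast hH
  have h1 : (0 : ℝ) ≤ H * m := by positivity
  have h2 : (H : ℝ) * m < H * w := mul_lt_mul_of_pos_left hm' hH'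
  rw [← add_div, div_le_iff₀ ha, lt_div_iff₀ ha]
  push_cast
  constructor <;> linarith

theorem eq_of_window {t H w : ℕ} {a₁ n : ℤ} (hH : 0 < H) (ha₁ : 0 < a₁) {a : Fin t → ℤ}
    {x : ℕ} {v : Fin t → ℕ} (hd : (H : ℤ) ∣ a₁ * (x : ℤ) ^ k + linForm k a v - n)
    (h1 : ((n - linForm k a v : ℤ) : ℝ) / a₁ ≤ (x : ℝ) ^ k)
    (h2 : (x : ℝ) ^ k < ((n - linForm k a v : ℤ) : ℝ) / a₁ + H * w / a₁) :
    ∃ m : ℕ, m < w ∧ a₁ * (x : ℤ) ^ k + linForm k a v = n + H * m := by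
  have ha : (0 : ℝ) < a₁ := by exact_mod_cast ha₁
  have hH' : (0 : ℤ) < H := by exact_mod_cast hH
  obtain ⟨e, he⟩ := hd
  rw [← add_div, lt_div_iff₀ ha] at h2
  rw [div_le_iff₀ ha] at h1
  have h1' : n - linForm k a v ≤ (x : ℤ) ^ k * a₁ := by exact_mod_cast h1
  have h2' : (x : ℤ) ^ k * a₁ < n - linForm k a v + H * w := by exact_mod_cast h2
  have h3 : 0 ≤ (H : ℤ) * e := by linarith
  have h4 : (H : ℤ) * e < H * w := by linarith
  have h5 : 0 ≤ e := nonneg_of_mul_nonneg_right h3 hH'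
  have h6 : e < w := lt_of_mul_lt_mul_left h4 hH'.le
  refine ⟨e.toNat, by omega, ?_⟩
  rw [Int.toNat_of_nonneg h5]
  linarith

theorem FlatWeight.le_window (F : FlatWeight k c c' N Z S₁ π₁) (hk : 0 < k) {t w : ℕ} {a₁ n : ℤ}
    (ha₁ : 0 < a₁) {a : Fin t → ℤ} {v : Fin t → ℕ}
    (hv : ∀ l, (modH k : ℤ) ∣ (v l : ℤ) ^ k - 1) (ha : (modH k : ℤ) ∣ a₁ + ∑ l, a l - n)
    (h1 : c * Z ^ k ≤ ((n - linForm k a v : ℤ) : ℝ) / a₁)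
    (h2 : ((n - linForm k a v : ℤ) : ℝ) / a₁ + modH k * w / a₁ ≤ c' * Z ^ k) :
    modH k * w / a₁ / ((c' - c) * Z ^ k) - 2 / N ≤ ∑ x ∈ S₁, π₁ x *
      (if ∃ m : ℕ, m < w ∧ a₁ * (x : ℤ) ^ k + linForm k a v = n + modH k * m then 1 else 0) := by
  rw [sum_mul_ite_eq_filter]
  refine (F.lower _ _ h1 h2).trans ?_
  refine Finset.sum_le_sum_of_subset_of_nonneg ?_ fun x _ _ => F.nonneg x
  intro x hx
  rw [Finset.mem_filter] at hx ⊢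
  refine ⟨hx.1, eq_of_window (modH_pos hk) ha₁ ?_ hx.2.1 hx.2.2⟩
  have e : a₁ * (x : ℤ) ^ k + linForm k a v - n = a₁ * ((x : ℤ) ^ k - 1) +
      ∑ l, a l * ((v l : ℤ) ^ k - 1) + (a₁ + ∑ l, a l - n) := by
    simp only [linForm, mul_sub, mul_one, Finset.sum_sub_distrib]
    ring
  rw [e]
  refine dvd_add (dvd_add (dvd_mul_of_dvd_right (F.congr x hx.1) _) ?_) ha
  exact Finset.dvd_sum fun l _ => dvd_mul_of_dvd_right (hv l) _

theorem FlatWeight.window_upper (F : FlatWeight k c c' N Z S₁ π₁) (hk : 0 < k) {t w : ℕ}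
    {a₁ n : ℤ} (ha₁ : 0 < a₁) (a : Fin t → ℤ) (v : Fin t → ℕ) (H' : ℕ) :
    ∑ x ∈ S₁, π₁ x * (if ∃ h < H', IsNearSol k (modH k) w a₁ n a h x v then 1 else 0) ≤
    modH k * w / a₁ / ((c' - c) * Z ^ k) + 2 / N := by
  have ha : (0 : ℝ) < a₁ := by exact_mod_cast ha₁
  rw [sum_mul_ite_eq_filter]
  refine le_trans ?_ (F.window_le hk (((n - linForm k a v : ℤ) : ℝ) / a₁)
    (h := modH k * w / a₁) (by positivity))
  refine Finset.sum_le_sum_of_subset_of_nonneg ?_ fun x _ _ => F.nonneg x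
  intro x hx
  rw [Finset.mem_filter] at hx ⊢
  obtain ⟨hx, h, -, m, hm, -, he⟩ := hx
  exact ⟨hx, window_of_eq (modH_pos hk) ha₁ hm he⟩

theorem FlatWeight.window_class_upper (F : FlatWeight k c c' N Z S₁ π₁) (hk : 0 < k) {t w : ℕ}
    {S : Finset ℕ} {π : ℕ → ℝ} (hπ : ∀ x, 0 ≤ π x)
    (hS : ∀ x ∈ S, (modH k : ℤ) ∣ (x : ℤ) ^ k - 1)
    (hu : ∀ z : ℤ, ∑ x ∈ S.filter (fun x : ℕ => ((modH k : ℤ) ^ 2) ∣ (x : ℤ) ^ k - 1 - modH k * z),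
      π x = (modH k : ℝ)⁻¹)
    {a₁ n : ℤ} (ha₁ : 0 < a₁) {a : Fin t → ℤ}
    (hap : ∀ p : ℕ, p.Prime → p ∣ modH k → ∃ l, ¬ (p : ℤ) ∣ a l)
    (ha : (modH k : ℤ) ∣ a₁ + ∑ l, a l - n) {V : Finset (Fin t → ℕ)} (hV : V ⊆ vecS t S) (h : ℕ) :
    ∑ z ∈ S₁ ×ˢ V, π₁ z.1 * vecW π z.2 * (if IsNearSol k (modH k) w a₁ n a h z.1 z.2 then 1 else 0) ≤
    (modH k * w / a₁ / ((c' - c) * Z ^ k) + 2 / N) / modH k := by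
  have hH := modH_pos hk
  have hHr : (0 : ℝ) < (modH k : ℝ) := by exact_mod_cast hH
  have hHz : (modH k : ℤ) ≠ 0 := by exact_mod_cast hH.ne'
  have har : (0 : ℝ) < a₁ := by exact_mod_cast ha₁
  obtain ⟨c₀, hc₀⟩ := ha
  set Y : (Fin t → ℕ) → ℝ := fun v => ((n - linForm k a v : ℤ) : ℝ) / a₁ with hY
  set hw : ℝ := modH k * w / a₁ with hhw
  have hhw0 : 0 ≤ hw := by positivity
  set Ω : ℝ := hw / ((c' - c) * Z ^ k) + 2 / N with hΩ
  rw [sum_mul_ite_eq_filter (S₁ ×ˢ V) (fun z : ℕ × (Fin t → ℕ) => π₁ z.1 * vecW π z.2)]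
  calc _ ≤ ∑ ζ ∈ Finset.range (modH k), ∑ z ∈ (S₁ ×ˢ V).filter (fun z : ℕ × (Fin t → ℕ) =>
        (((modH k : ℤ) ^ 2) ∣ (z.1 : ℤ) ^ k - 1 - modH k * (ζ : ℤ) ∧
          Y z.2 ≤ (z.1 : ℝ) ^ k ∧ (z.1 : ℝ) ^ k < Y z.2 + hw) ∧
        ((modH k : ℤ) ^ 2) ∣ ∑ l, a l * ((z.2 l : ℤ) ^ k - 1) - modH k * (h - c₀ - a₁ * ζ)),
          π₁ z.1 * vecW π z.2 := by
        refine sum_filter_exists_le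
          (fun z _ => mul_nonneg (F.nonneg _) (vecW_nonneg hπ _)) ?_
        rintro ⟨x, v⟩ hz ⟨m, hm, hmh, he⟩
        rw [Finset.mem_product] at hz
        simp only at hz he ⊢
        obtain ⟨e, hxe⟩ := F.congr x hz.1
        obtain ⟨d, hd⟩ := hmh
        have h0 := Int.emod_nonneg e hHz
        have hlt := Int.emod_lt_of_pos e (by exact_mod_cast hH : (0 : ℤ) < modH k)
        have hdm := Int.emod_add_mul_ediv e (modH k)
        refine ⟨(e % modH k).toNat, Finset.mem_range.2 (by omega),
          ⟨?_, window_of_eq hH ha₁ hm he⟩, ?_⟩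
        · rw [Int.toNat_of_nonneg h0, hxe]
          refine ⟨e / modH k, ?_⟩
          linear_combination (-(modH k : ℤ)) * hdm
        · rw [Int.toNat_of_nonneg h0]
          refine ⟨d - a₁ * (e / modH k), ?_⟩
          have e1 : ∑ l, a l * ((v l : ℤ) ^ k - 1) = linForm k a v - ∑ l, a l := by
            simp only [linForm, mul_sub, mul_one, Finset.sum_sub_distrib]
          rw [e1]
          linear_combination he - hc₀ - a₁ * hxe + (modH k : ℤ) * hd + (modH k : ℤ) * a₁ * hdm
    _ ≤ ∑ ζ ∈ Finset.range (modH k), ((modH k : ℝ)⁻¹ * Ω) * (modH k : ℝ)⁻¹ := by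
        refine Finset.sum_le_sum fun ζ _ => ?_
        have hlin := sum_vecW_linear hH hS hu hap (h - c₀ - a₁ * ζ)
        have hΩ0 : 0 ≤ Ω :=
          (Finset.sum_nonneg fun x _ => F.nonneg x).trans (F.window_le hk 0 hhw0)
        refine le_trans ?_ (mul_le_mul_of_nonneg_left hlin.le (by positivity))
        rw [Finset.mul_sum, Finset.sum_filter, Finset.sum_product_right]
        refine le_trans (b := ∑ v ∈ V.filter (fun v : Fin t → ℕ =>
          ((modH k : ℤ) ^ 2) ∣ ∑ l, a l * ((v l : ℤ) ^ k - 1) - modH k * (h - c₀ - a₁ * ζ)),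
          (modH k : ℝ)⁻¹ * Ω * vecW π v) ?_ ?_
        · rw [Finset.sum_filter]
          refine Finset.sum_le_sum fun v _ => ?_
          by_cases hd : ((modH k : ℤ) ^ 2) ∣ ∑ l, a l * ((v l : ℤ) ^ k - 1) -
              modH k * (h - c₀ - a₁ * ζ)
          · simp only [hd, and_true, if_true]
            rw [← Finset.sum_filter, ← Finset.sum_mul]
            exact mul_le_mul_of_nonneg_right (F.upper _ _ hhw0 _) (vecW_nonneg hπ _)
          · simp [hd]
        · refine Finset.sum_le_sum_of_subset_of_nonneg ?_ ?_
          · intro v hv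
            rw [Finset.mem_filter] at hv ⊢
            exact ⟨hV hv.1, hv.2⟩
          · intro v _ _
            exact mul_nonneg (by positivity) (vecW_nonneg hπ _)
    _ = _ := by
        rw [Finset.sum_const, Finset.card_range, nsmul_eq_mul]
        field_simp

end Windows

theorem sum_mul_comp_le {β : Type*} {T : Finset β} {W : β → ℝ} (hW : ∀ b, 0 ≤ W b) (g : β → ℕ)
    {I : Finset ℕ} {ψ : ℕ → ℝ} (hψ : ∀ i, 0 ≤ ψ i) {P : ℕ → β → Prop} [∀ i, DecidablePred (P i)]
    (h : ∀ b ∈ T, ψ (g b) ≠ 0 → g b ∈ I ∧ P (g b) b) :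
    ∑ b ∈ T, W b * ψ (g b) ≤ ∑ i ∈ I, ψ i * ∑ b ∈ T.filter (P i), W b := by
  calc _ ≤ ∑ b ∈ T, ∑ i ∈ I, (if P i b then ψ i * W b else 0) := by
        refine Finset.sum_le_sum fun b hb => ?_
        have h0 : ∀ i ∈ I, 0 ≤ (if P i b then ψ i * W b else 0) := fun i _ => by
          split_ifs
          · exact mul_nonneg (hψ i) (hW b)
          · exact le_rfl
        by_cases hz : ψ (g b) = 0
        · rw [hz, mul_zero]
          exact Finset.sum_nonneg h0
        · obtain ⟨hI, hP⟩ := h b hb hz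
          refine le_trans (le_of_eq ?_) (Finset.single_le_sum h0 hI)
          rw [if_pos hP, mul_comm]
    _ = _ := by
        rw [Finset.sum_comm]
        refine Finset.sum_congr rfl fun i _ => ?_
        rw [Finset.mul_sum, Finset.sum_filter]

theorem pow_le_half_pow_mul {C θ : ℝ} (hθ : 0 < θ) :
    ∃ F₀ : ℝ, 0 < F₀ ∧ ∃ t₀ : ℕ, ∀ t ≥ t₀, ∀ f : ℕ, 0 < f → ∀ κ : ℝ, 0 ≤ κ → κ ≤ 1 / 2 →
      κ ≤ C * (f : ℝ) ^ (-θ) → κ ^ t ≤ (1 / 2) ^ t * F₀ * ((f : ℝ) ^ 4)⁻¹ := by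
  obtain ⟨F₁, hF₁, hF₁'⟩ : ∃ F₁ : ℝ, 1 ≤ F₁ ∧ ∀ x ≥ F₁, C * x ^ (-(θ / 2)) ≤ 1 / 2 := by
    have ht : Tendsto (fun x : ℝ => C * x ^ (-(θ / 2))) atTop (nhds (C * 0)) :=
      (tendsto_rpow_neg_atTop (by positivity)).const_mul C
    rw [mul_zero] at ht
    obtain ⟨F, hF⟩ := eventually_atTop.1 (ht.eventually (ge_mem_nhds (by norm_num : (0 : ℝ) < 1 / 2)))
    exact ⟨max F 1, le_max_right _ _, fun x hx => hF x ((le_max_left _ _).trans hx)⟩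
  refine ⟨F₁ ^ 4, by positivity, ⌈8 / θ⌉₊, fun t ht f hf κ hκ0 hκ1 hκ2 => ?_⟩
  have hfr : (1 : ℝ) ≤ f := by exact_mod_cast hf
  have hf0 : (0 : ℝ) < f := by linarith
  have ht' : 8 / θ ≤ t := (Nat.le_ceil _).trans (by exact_mod_cast ht)
  rw [div_le_iff₀ hθ] at ht'
  rcases le_total F₁ f with hF | hF
  · have h1 : κ ≤ 1 / 2 * (f : ℝ) ^ (-(θ / 2)) := by
      refine hκ2.trans ?_
      have e : (f : ℝ) ^ (-θ) = (f : ℝ) ^ (-(θ / 2)) * (f : ℝ) ^ (-(θ / 2)) := by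
        rw [← Real.rpow_add hf0]
        congr 1
        ring
      rw [e, ← mul_assoc]
      exact mul_le_mul_of_nonneg_right (hF₁' f hF) (by positivity)
    have h2 : ((f : ℝ) ^ (-(θ / 2))) ^ t ≤ ((f : ℝ) ^ 4)⁻¹ := by
      rw [← Real.rpow_natCast, ← Real.rpow_mul hf0.le, ← Real.rpow_natCast (f : ℝ) 4,
        ← Real.rpow_neg hf0.le]
      refine Real.rpow_le_rpow_of_exponent_le hfr ?_
      push_cast
      nlinarith
    calc κ ^ t ≤ (1 / 2 * (f : ℝ) ^ (-(θ / 2))) ^ t := pow_le_pow_left₀ hκ0 h1 t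
      _ = (1 / 2) ^ t * ((f : ℝ) ^ (-(θ / 2))) ^ t := mul_pow _ _ _
      _ ≤ (1 / 2) ^ t * ((f : ℝ) ^ 4)⁻¹ := mul_le_mul_of_nonneg_left h2 (by positivity)
      _ ≤ _ := by
        refine mul_le_mul_of_nonneg_right ?_ (by positivity)
        exact le_mul_of_one_le_right (by positivity) (one_le_pow₀ hF₁)
  · calc κ ^ t ≤ (1 / 2) ^ t := pow_le_pow_left₀ hκ0 hκ1 t
      _ = (1 / 2) ^ t * 1 := (mul_one _).symm
      _ ≤ (1 / 2) ^ t * (F₁ ^ 4 * ((f : ℝ) ^ 4)⁻¹) := by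
        refine mul_le_mul_of_nonneg_left ?_ (by positivity)
        rw [← div_eq_mul_inv, one_le_div (by positivity)]
        exact pow_le_pow_left₀ hf0.le hF 4
      _ = _ := by ring

theorem GoodWeight.sum_mult_le {k : ℕ} (hk : 0 < k) {C θ : ℝ} (hC : 0 < C) (hθ : 0 < θ) :
    ∃ C' : ℝ, 0 < C' ∧ ∃ t₀ : ℕ, ∀ t ≥ t₀, ∀ (Z : ℕ) (S : Finset ℕ) (π : ℕ → ℝ),
      GoodWeight k C θ Z S π → 2 * ((2 * Z) ^ k) ^ 2 ≤ Z ^ (3 * k) →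
      ∀ (V : Finset (Fin t → ℕ)), V ⊆ vecS t S → ∀ (x : Fin t → ℕ) (f D : (Fin t → ℕ) → ℕ),
        (∀ y ∈ V, PairStat k Z (modH k) x y (f y) (D y)) →
        ∑ y ∈ V, vecW π y * (if 2 ≤ f y then (f y : ℝ) else 0) ≤ C' * (1 / 2) ^ t := by
  obtain ⟨F₀, hF₀, t₀, hκ⟩ := pow_le_half_pow_mul (C := C) hθ
  have hH := modH_pos hk
  have hHr : (0 : ℝ) < (modH k : ℝ) := by exact_mod_cast hH
  refine ⟨modH k * F₀, by positivity, t₀, fun t ht Z S π G hZ V hV x f D hst => ?_⟩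
  set H := modH k with hHdef
  set I := (Finset.Ioo 1 (Z ^ (3 * k) + 1)).filter (fun i => H * i ≤ Z ^ (3 * k)) with hI
  set κ : ℕ → ℝ := fun i => min (1 / 2) (C * ((H * i : ℕ) : ℝ) ^ (-θ)) with hκd
  have hκ0 : ∀ i, 0 ≤ κ i := fun i => le_min (by norm_num) (by positivity)
  calc _ ≤ ∑ i ∈ I, (if 2 ≤ i then (i : ℝ) else 0) * ∑ y ∈ V.filter (fun y : Fin t → ℕ =>
        ∃ c : ℤ, ∀ l, ((H * i : ℕ) : ℤ) ∣ (y l : ℤ) ^ k - c * (x l : ℤ)^k), vecW π y := by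
        refine sum_mul_comp_le (ψ := fun i : ℕ => if 2 ≤ i then (i : ℝ) else 0)
          (vecW_nonneg G.nonneg) f (fun i => by split_ifs <;> positivity) ?_
        intro y hy hne
        have hst := hst y hy
        have h2 : 2 ≤ f y := by
          by_contra h
          exact hne (if_neg h)
        have hle : H * f y ≤ Z ^ (3 * k) := hst.mul_le.trans (hst.D_le.trans hZ)
        refine ⟨?_, hst.cong⟩
        rw [hI, Finset.mem_filter, Finset.mem_Ioo]
        have : f y ≤ H * f y := Nat.le_mul_of_pos_left _ hH
        exact ⟨by omega, hle⟩
    _ ≤ ∑ i ∈ I, (1 / 2) ^ t * (H * F₀) * ((i : ℝ) ^ 2)⁻¹ := by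
        refine Finset.sum_le_sum fun i hi => ?_
        rw [hI, Finset.mem_filter, Finset.mem_Ioo] at hi
        have hi0 : 0 < i := by omega
        have hir : (0 : ℝ) < i := by exact_mod_cast hi0
        have hHi : 0 < H * i := Nat.mul_pos hH hi0
        have hb : ∀ c : ℤ, ∑ x ∈ S.filter (fun x : ℕ => ((H * i : ℕ) : ℤ) ∣ (x : ℤ) ^ k - c),
            π x ≤ κ i := fun c =>
          le_min (G.half i (by omega) hi.2 c) (G.dvd_le (H * i) hHi hi.2 c)
        have h1 := sum_vecW_congr_le hHi G.nonneg hb (fun l : Fin t => (x l : ℤ) ^ k)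
        have h2 := hκ t ht i hi0 (κ i) (hκ0 i) (min_le_left _ _) ((min_le_right _ _).trans
          (mul_le_mul_of_nonneg_left (Real.rpow_le_rpow_of_nonpos hir
            (by exact_mod_cast Nat.le_mul_of_pos_left i hH) (by linarith)) hC.le))
        rw [if_pos (by omega : 2 ≤ i)]
        calc _ ≤ (i : ℝ) * (((H * i : ℕ) : ℝ) * κ i ^ t) := by
              refine mul_le_mul_of_nonneg_left (le_trans ?_ h1) hir.le
              refine Finset.sum_le_sum_of_subset_of_nonneg ?_
                fun y _ _ => vecW_nonneg G.nonneg y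
              intro y hy
              rw [Finset.mem_filter] at hy ⊢
              exact ⟨hV hy.1, hy.2⟩
          _ ≤ (i : ℝ) * (((H * i : ℕ) : ℝ) * ((1 / 2) ^ t * F₀ * ((i : ℝ) ^ 4)⁻¹)) := by
              refine mul_le_mul_of_nonneg_left (mul_le_mul_of_nonneg_left h2 (by positivity)) hir.le
          _ = _ := by
              push_cast
              field_simp
    _ ≤ (1 / 2) ^ t * (H * F₀) * 1 := by
        rw [← Finset.mul_sum]
        refine mul_le_mul_of_nonneg_left ?_ (by positivity)
        refine (Finset.sum_le_sum_of_subset_of_nonneg (Finset.filter_subset _ _)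
          fun i _ _ => by positivity).trans ((sum_Ioo_inv_sq_le (α := ℝ) 1 (Z ^ (3 * k) + 1)).trans ?_)
        norm_num
    _ = _ := by ring

theorem pow_le_const_mul {C θ : ℝ} (hC : 0 < C) {t : ℕ} (ht : 6 / θ ≤ t)
    (hθ : 0 < θ) {i : ℕ} (hi : 0 < i) :
    (C * (i : ℝ) ^ (-θ)) ^ t ≤ C ^ t * ((i : ℝ) ^ 6)⁻¹ := by
  have hir : (1 : ℝ) ≤ i := by exact_mod_cast hi
  have hi0 : (0 : ℝ) < i := by linarith
  rw [mul_pow]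
  refine mul_le_mul_of_nonneg_left ?_ (by positivity)
  rw [div_le_iff₀ hθ] at ht
  rw [← Real.rpow_natCast, ← Real.rpow_mul hi0.le, ← Real.rpow_natCast (i : ℝ) 6,
    ← Real.rpow_neg hi0.le]
  refine Real.rpow_le_rpow_of_exponent_le hir ?_
  push_cast
  nlinarith

theorem sum_inv_sq_filter_le {D₀ : ℕ} (hD₀ : 2 ≤ D₀) (n : ℕ) (T : Finset ℕ)
    (hT : ∀ i ∈ T, D₀ ≤ i + 1 ∧ i < n) : ∑ i ∈ T, ((i : ℝ) ^ 2)⁻¹ ≤ 4 / D₀ := by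
  have hD : (2 : ℝ) ≤ D₀ := by exact_mod_cast hD₀
  have h1 : ∑ i ∈ T, ((i : ℝ) ^ 2)⁻¹ ≤ ∑ i ∈ Finset.Ioo (D₀ - 2) n, ((i : ℝ) ^ 2)⁻¹ := by
    refine Finset.sum_le_sum_of_subset_of_nonneg ?_ fun i _ _ => by positivity
    intro i hi
    have := hT i hi
    rw [Finset.mem_Ioo]
    omega
  refine h1.trans ((sum_Ioo_inv_sq_le (α := ℝ) (D₀ - 2) n).trans ?_)
  rw [Nat.cast_sub hD₀, div_le_div_iff₀ (by push_cast; linarith) (by linarith)]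
  push_cast
  linarith

theorem GoodWeight.sum_tail_le {k : ℕ} (hk : 0 < k) {C θ : ℝ} (hC : 0 < C) (hθ : 0 < θ) {t : ℕ}
    (ht : 6 / θ ≤ t) : ∃ K : ℝ, 0 < K ∧ ∀ D₀ : ℕ, 2 ≤ D₀ → ∀ (Z : ℕ) (S : Finset ℕ) (π : ℕ → ℝ),
      GoodWeight k C θ Z S π → 2 * ((2 * Z) ^ k) ^ 2 ≤ Z ^ (3 * k) →
      ∀ (V : Finset (Fin t → ℕ)), V ⊆ vecS t S → ∀ (x : Fin t → ℕ), x ∈ vecS t S →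
      ∀ (f D : (Fin t → ℕ) → ℕ), (∀ y ∈ V, PairStat k Z (modH k) x y (f y) (D y)) →
        ∑ y ∈ V, vecW π y * (if modH k * f y < D₀ ∧ Z ^ (2 * k) / D y + 1 < D₀ then 0 else
          ((modH k * f y : ℕ) : ℝ) * ((Z ^ (2 * k) / D y + 1 : ℕ) : ℝ) ^ 2) ≤ K / D₀ := by
  have hH := modH_pos hk
  refine ⟨(C ^ t + 2 ^ (k + 4) * C ^ t) * 4, by positivity,
    fun D₀ hD₀ Z S π G hZ V hV x hx f D hst => ?_⟩
  have hDr : (0 : ℝ) < D₀ := by exact_mod_cast (by omega : 0 < D₀)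
  set H := modH k with hHdef
  set n := Z ^ (3 * k) + 1 with hn
  set g : (Fin t → ℕ) → ℕ := fun y => H * f y with hg
  set q : (Fin t → ℕ) → ℕ := fun y => Z ^ (2 * k) / D y with hq
  have hZ2 : Z ^ (2 * k) ≤ Z ^ (3 * k) := by
    have e : ((2 * Z) ^ k) ^ 2 = 2 ^ (2 * k) * Z ^ (2 * k) := by
      rw [← pow_mul, mul_comm k 2, mul_pow]
    refine le_trans ?_ hZ
    rw [e]
    have : 1 ≤ 2 ^ (2 * k) := Nat.one_le_two_pow
    nlinarith
  have hnn := vecW_nonneg G.nonneg (t := t)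
  set T := (Finset.range n).filter (fun i => D₀ ≤ i + 1) with hT
  have hTm : ∀ i ∈ T, D₀ ≤ i + 1 ∧ i < n := fun i hi => by
    rw [hT, Finset.mem_filter, Finset.mem_range] at hi
    exact ⟨hi.2, hi.1⟩
  have hsq := sum_inv_sq_filter_le hD₀ n T hTm
  have hA : ∑ y ∈ V, vecW π y * (if D₀ ≤ g y then ((g y : ℕ) : ℝ) ^ 3 else 0) ≤
      C ^ t * (4 / D₀) := by
    calc _ ≤ ∑ i ∈ T, (if D₀ ≤ i then (i : ℝ) ^ 3 else 0) * ∑ y ∈ V.filter (fun y : Fin t → ℕ =>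
          ∃ c : ℤ, ∀ l, (i : ℤ) ∣ (y l : ℤ) ^ k - c * (x l : ℤ) ^ k), vecW π y := by
          refine sum_mul_comp_le (ψ := fun i : ℕ => if D₀ ≤ i then (i : ℝ) ^ 3 else 0)
            hnn g (fun i => by split_ifs <;> positivity) ?_
          intro y hy hne
          have hst := hst y hy
          have h2 : D₀ ≤ g y := by
            by_contra h
            exact hne (if_neg h)
          have hle : g y ≤ Z ^ (3 * k) := hst.mul_le.trans (hst.D_le.trans hZ)
          refine ⟨?_, hst.cong⟩
          rw [hT, Finset.mem_filter, Finset.mem_range]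
          omega
      _ ≤ ∑ i ∈ T, C ^ t * ((i : ℝ) ^ 2)⁻¹ := by
          refine Finset.sum_le_sum fun i hi => ?_
          obtain ⟨hi1, hi2⟩ := hTm i hi
          have hi0 : 0 < i := by omega
          have hir : (0 : ℝ) < i := by exact_mod_cast hi0
          have h1 := sum_vecW_congr_le hi0 G.nonneg (fun c => G.dvd_le i hi0 (by omega) c)
            (fun l : Fin t => (x l : ℤ) ^ k)
          have h2 := pow_le_const_mul hC ht hθ hi0
          calc _ ≤ (i : ℝ) ^ 3 * ((i : ℝ) * (C * (i : ℝ) ^ (-θ)) ^ t) := by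
                refine mul_le_mul (by split_ifs <;> first | exact le_rfl | positivity)
                  (le_trans ?_ h1) (Finset.sum_nonneg fun _ _ => hnn _) (by positivity)
                refine Finset.sum_le_sum_of_subset_of_nonneg ?_ fun y _ _ => hnn y
                intro y hy
                rw [Finset.mem_filter] at hy ⊢
                exact ⟨hV hy.1, hy.2⟩
            _ ≤ (i : ℝ) ^ 3 * ((i : ℝ) * (C ^ t * ((i : ℝ) ^ 6)⁻¹)) :=
                mul_le_mul_of_nonneg_left (mul_le_mul_of_nonneg_left h2 hir.le) (by positivity)
            _ = _ := by field_simp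
      _ ≤ _ := by
          rw [← Finset.mul_sum]
          exact mul_le_mul_of_nonneg_left hsq (by positivity)
  have hB : ∑ y ∈ V, vecW π y * (if D₀ ≤ q y + 1 then ((q y : ℝ) + 1) ^ 3 else 0) ≤
      2 ^ (k + 4) * C ^ t * (4 / D₀) := by
    calc _ ≤ ∑ i ∈ T, (if D₀ ≤ i + 1 then ((i : ℝ) + 1) ^ 3 else 0) * ∑ y ∈ V.filter
          (fun y : Fin t → ℕ => ∃ ρ : ℝ, 0 ≤ ρ ∧ ρ ≤ 2 ^ k ∧
            ∀ l, |(y l : ℝ) ^ k - ρ * (x l : ℝ) ^ k| ≤ (x l : ℝ) ^ k / i), vecW π y := by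
          refine sum_mul_comp_le (ψ := fun i : ℕ => if D₀ ≤ i + 1 then ((i : ℝ) + 1) ^ 3 else 0)
            hnn q (fun i => by split_ifs <;> positivity) ?_
          intro y hy hne
          have hst := hst y hy
          have h2 : D₀ ≤ q y + 1 := by
            by_contra h
            exact hne (if_neg h)
          have hqle : q y * D y ≤ Z ^ (2 * k) := Nat.div_mul_le_self _ _
          have hle : q y ≤ Z ^ (3 * k) := (Nat.div_le_self _ _).trans hZ2
          refine ⟨?_, ?_⟩
          · rw [hT, Finset.mem_filter, Finset.mem_range]
            omega
          · obtain ⟨ρ, h0, h1, hl⟩ := hst.near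
            refine ⟨ρ, h0, h1, fun l => ?_⟩
            have hqp : (0 : ℝ) < q y := by exact_mod_cast (by omega : 0 < q y)
            have hDp : (0 : ℝ) < D y := by exact_mod_cast hst.D_pos
            have hqr : (q y : ℝ) * D y ≤ (Z : ℝ) ^ (2 * k) := by exact_mod_cast hqle
            rw [le_div_iff₀ hqp]
            refine le_of_mul_le_mul_right ?_ hDp
            refine le_trans ?_ (hl l)
            rw [mul_assoc]
            exact mul_le_mul_of_nonneg_left hqr (abs_nonneg _)
      _ ≤ ∑ i ∈ T, 2 ^ (k + 4) * C ^ t * ((i : ℝ) ^ 2)⁻¹ := by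
          refine Finset.sum_le_sum fun i hi => ?_
          obtain ⟨hi1, hi2⟩ := hTm i hi
          have hi0 : 0 < i := by omega
          have hir : (1 : ℝ) ≤ i := by exact_mod_cast hi0
          have hir0 : (0 : ℝ) < i := by linarith
          have hX : ∀ l : Fin t, (0 : ℝ) ≤ (x l : ℝ) ^ k ∧ (x l : ℝ) ^ k ≤ 2 ^ k * (Z : ℝ) ^ k := by
            intro l
            refine ⟨by positivity, ?_⟩
            rw [← mul_pow]
            exact pow_le_pow_left₀ (by positivity) (by exact_mod_cast G.le _ (mem_vecS.1 hx l)) k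
          have h1 := sum_vecW_near_le (k := k) (t := t) (M := 2 ^ k * (Z : ℝ) ^ k) hi0 G.nonneg
            (fun y => by
              have := G.interval_le i hi0 (by omega) y
              rwa [mul_assoc 3] at this) hX
          have h2 := pow_le_const_mul hC ht hθ hi0
          rw [if_pos hi1]
          have h3 : ((i : ℝ) + 1) ^ 3 ≤ (2 * i) ^ 3 :=
            pow_le_pow_left₀ (by positivity) (by linarith) 3
          have h4 : (2 : ℝ) ^ k * i + 1 ≤ 2 ^ k * i * 2 := by
            have : (1 : ℝ) ≤ 2 ^ k := one_le_pow₀ (by norm_num)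
            nlinarith
          calc _ ≤ (2 * (i : ℝ)) ^ 3 * ((2 ^ k * i + 1) * (C * (i : ℝ) ^ (-θ)) ^ t) := by
                refine mul_le_mul h3
                  (le_trans ?_ h1) (Finset.sum_nonneg fun _ _ => hnn _) (by positivity)
                refine Finset.sum_le_sum_of_subset_of_nonneg ?_ fun y _ _ => hnn y
                intro y hy
                rw [Finset.mem_filter] at hy ⊢
                exact ⟨hV hy.1, hy.2⟩
            _ ≤ (2 * (i : ℝ)) ^ 3 * ((2 ^ k * i * 2) * (C ^ t * ((i : ℝ) ^ 6)⁻¹)) :=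
                mul_le_mul_of_nonneg_left (mul_le_mul h4 h2 (by positivity) (by positivity))
                  (by positivity)
            _ = _ := by
                rw [pow_add]
                field_simp
      _ ≤ _ := by
          rw [← Finset.mul_sum]
          exact mul_le_mul_of_nonneg_left hsq (by positivity)
  have hAB := add_le_add hA hB
  rw [← Finset.sum_add_distrib] at hAB
  refine le_trans (Finset.sum_le_sum fun y _ => ?_) (hAB.trans (le_of_eq (by ring)))
  rw [← mul_add]
  refine mul_le_mul_of_nonneg_left ?_ (hnn y)
  change (if g y < D₀ ∧ q y + 1 < D₀ then (0 : ℝ) else (g y : ℝ) * ((q y + 1 : ℕ) : ℝ) ^ 2) ≤ _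
  have hp1 : (0 : ℝ) ≤ if D₀ ≤ g y then (g y : ℝ) ^ 3 else 0 := by split_ifs <;> positivity
  have hp2 : (0 : ℝ) ≤ if D₀ ≤ q y + 1 then ((q y : ℝ) + 1) ^ 3 else 0 := by
    split_ifs <;> positivity
  by_cases hm : g y < D₀ ∧ q y + 1 < D₀
  · rw [if_pos hm]
    exact add_nonneg hp1 hp2
  · rw [if_neg hm]
    push_cast
    rcases le_total (q y + 1) (g y) with hqg | hqg
    · have h1 : (q y : ℝ) + 1 ≤ g y := by exact_mod_cast hqg
      refine le_trans ?_ (le_add_of_nonneg_right hp2)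
      rw [if_pos (by omega : D₀ ≤ g y)]
      calc (g y : ℝ) * ((q y : ℝ) + 1) ^ 2 ≤ g y * (g y : ℝ) ^ 2 := by gcongr
        _ = _ := by ring
    · have h1 : (g y : ℝ) ≤ q y + 1 := by exact_mod_cast hqg
      refine le_trans ?_ (le_add_of_nonneg_left hp1)
      rw [if_pos (by omega : D₀ ≤ q y + 1)]
      calc (g y : ℝ) * ((q y : ℝ) + 1) ^ 2 ≤ (q y + 1) * ((q y : ℝ) + 1) ^ 2 := by gcongr
        _ = _ := by ring

theorem half_le_natDiv {a b : ℕ} (hb : 0 < b) (h : b ≤ a) :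
    (a : ℝ) / (2 * b) ≤ ((a / b : ℕ) : ℝ) := by
  have h1 : 1 ≤ a / b := Nat.div_pos h hb
  have h2 : a < b * (a / b) + b := by
    have := Nat.div_add_mod a b
    have := Nat.mod_lt a hb
    omega
  have h3 : a ≤ 2 * b * (a / b) := by nlinarith
  have h4 : (a : ℝ) ≤ 2 * b * ((a / b : ℕ) : ℝ) := by exact_mod_cast h3
  rw [div_le_iff₀ (by positivity)]
  linarith

theorem PairStat.tail_bound {k Z H t : ℕ} (hZ : 0 < Z) (hH : 0 < H) {x y : Fin t → ℕ} {f D : ℕ}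
    (st : PairStat k Z H x y f D) {M K : ℕ} (hM : M = 2 * H * (2 * 2 ^ k + (1 + t * 2 ^ k)))
    (hK : K = 2 ^ k * M) {A : ℕ}
    (hA : 2 * (H * (2 * 2 ^ k + (1 + t * 2 ^ k)) +
      H * ((1 + t * 2 ^ k) * (t * (2 * ((2 * Z) ^ k) ^ 2)))) ≤ A)
    (hA' : K * Z ^ k ≤ A) (α : Fin t → ℤ) (r r' : ℤ) :
    (((boxClass H α A).filter (fun a => ∑ l, a l * (x l : ℤ) ^ k = r ∧
      ∑ l, a l * (y l : ℤ) ^ k = r')).card : ℝ) ≤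
    8 * (K : ℝ) ^ 2 * (6 * A) ^ t / ((A : ℝ) * Z ^ k) ^ 2 *
      (((H * f : ℕ) : ℝ) * ((Z ^ (2 * k) / D + 1 : ℕ) : ℝ) ^ 2) := by
  have hMp : 0 < M := by rw [hM]; positivity
  have hKp : 0 < K := by rw [hK]; positivity
  have hZk : 0 < Z ^ k := by positivity
  have hKZ : 0 < K * Z ^ k := Nat.mul_pos hKp hZk
  have hAp : 0 < A := lt_of_lt_of_le hKZ hA'
  set c₁ := 2 * 2 ^ k + (1 + t * 2 ^ k) with hc₁
  set w := D * A / (K * Z ^ k) with hw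
  set U := A / M + 1 with hU
  set q := Z ^ (2 * k) / D with hq
  have hDw : D ≤ w := by
    rw [hw, Nat.le_div_iff_mul_le hKZ]
    exact Nat.mul_le_mul_left _ hA'
  have hcnt := st.count α A ((2 * A : ℕ) : ℤ) U w r r' ?_ ?_
  · set N := ((boxClass H α A).filter (fun a => ∑ l, a l * (x l : ℤ) ^ k = r ∧
      ∑ l, a l * (y l : ℤ) ^ k = r')).card with hN
    have hbox : ((boxClass H α ((2 * A : ℕ) : ℤ)).card : ℝ) ≤ (6 * (A : ℝ)) ^ t := by
      refine (card_boxClass_le hH α (by positivity)).trans (pow_le_pow_left₀ (by positivity) ?_ t)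
      have h1 : (1 : ℝ) ≤ A := by exact_mod_cast hAp
      have h2 : (1 : ℝ) ≤ H := by exact_mod_cast hH
      have h3 : (2 * (((2 * A : ℕ) : ℤ) : ℝ) + 1) / H ≤ 2 * (((2 * A : ℕ) : ℤ) : ℝ) + 1 :=
        div_le_self (by positivity) h2
      push_cast at h3 ⊢
      linarith
    have h1 : (w : ℝ) * ((w / (H * f) : ℕ) : ℝ) * N ≤ (6 * (A : ℝ)) ^ t := by
      refine le_trans ?_ hbox
      exact_mod_cast hcnt.trans (Finset.card_le_card (Finset.filter_subset _ _))
    have hg : 0 < H * f := Nat.mul_pos hH st.f_pos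
    have hgr : (0 : ℝ) < ((H * f : ℕ) : ℝ) := by exact_mod_cast hg
    have h2 := half_le_natDiv hg (st.mul_le.trans hDw)
    have h3 := half_le_natDiv hKZ (a := D * A) (by
      have := st.D_pos
      nlinarith)
    have hAr : (0 : ℝ) < A := by exact_mod_cast hAp
    have hKr : (0 : ℝ) < K := by exact_mod_cast hKp
    have hZr : (0 : ℝ) < (Z : ℝ) ^ k := by exact_mod_cast hZk
    have hDq : (Z : ℝ) ^ k * (Z : ℝ) ^ k ≤ D * ((q + 1 : ℕ) : ℝ) := by
      have : Z ^ (2 * k) ≤ D * (q + 1) := by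
        rw [hq]
        have e1 := Nat.div_add_mod (Z ^ (2 * k)) D
        have e2 := Nat.mod_lt (Z ^ (2 * k)) st.D_pos
        rw [mul_add]
        omega
      have e : (Z : ℝ) ^ k * (Z : ℝ) ^ k = (Z : ℝ) ^ (2 * k) := by rw [two_mul, pow_add]
      rw [e]
      exact_mod_cast this
    have h4 : (A : ℝ) * Z ^ k ≤ 2 * K * (w * ((q + 1 : ℕ) : ℝ)) := by
      have h5 : (D : ℝ) * A ≤ w * (2 * (K * Z ^ k)) := by
        rw [div_le_iff₀ (by positivity)] at h3
        push_cast at h3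
        exact h3
      refine le_of_mul_le_mul_right ?_ hZr
      calc (A : ℝ) * Z ^ k * Z ^ k = A * ((Z : ℝ) ^ k * Z ^ k) := by ring
        _ ≤ A * (D * ((q + 1 : ℕ) : ℝ)) := mul_le_mul_of_nonneg_left hDq hAr.le
        _ = (D * A) * ((q + 1 : ℕ) : ℝ) := by ring
        _ ≤ w * (2 * (K * Z ^ k)) * ((q + 1 : ℕ) : ℝ) :=
            mul_le_mul_of_nonneg_right h5 (by positivity)
        _ = _ := by ring
    have h6 : (w : ℝ) ^ 2 * N ≤ 2 * ((H * f : ℕ) : ℝ) * (6 * (A : ℝ)) ^ t := by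
      have h7 : (w : ℝ) ≤ 2 * ((H * f : ℕ) : ℝ) * ((w / (H * f) : ℕ) : ℝ) := by
        rw [div_le_iff₀ (by positivity)] at h2
        linarith
      calc (w : ℝ) ^ 2 * N = w * N * w := by ring
        _ ≤ w * N * (2 * ((H * f : ℕ) : ℝ) * ((w / (H * f) : ℕ) : ℝ)) :=
            mul_le_mul_of_nonneg_left h7 (by positivity)
        _ = 2 * ((H * f : ℕ) : ℝ) * (w * ((w / (H * f) : ℕ) : ℝ) * N) := by ring
        _ ≤ _ := mul_le_mul_of_nonneg_left h1 (by positivity)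
    rw [div_mul_eq_mul_div, le_div_iff₀ (by positivity)]
    calc (N : ℝ) * ((A : ℝ) * Z ^ k) ^ 2 ≤ N * (2 * K * (w * ((q + 1 : ℕ) : ℝ))) ^ 2 :=
          mul_le_mul_of_nonneg_left (pow_le_pow_left₀ (by positivity) h4 2) (by positivity)
      _ = 4 * (K : ℝ) ^ 2 * ((q + 1 : ℕ) : ℝ) ^ 2 * ((w : ℝ) ^ 2 * N) := by ring
      _ ≤ 4 * (K : ℝ) ^ 2 * ((q + 1 : ℕ) : ℝ) ^ 2 *
          (2 * ((H * f : ℕ) : ℝ) * (6 * (A : ℝ)) ^ t) :=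
          mul_le_mul_of_nonneg_left h6 (by positivity)
      _ = _ := by ring
  · have e1 : w * (K * Z ^ k) ≤ D * A := Nat.div_mul_le_self _ _
    have e2 : A ≤ U * M := by
      rw [hU]
      have := Nat.div_add_mod A M
      have := Nat.mod_lt A hMp
      nlinarith
    refine Nat.le_of_mul_le_mul_right ?_ hMp
    calc w * (2 * Z) ^ k * M = w * (K * Z ^ k) := by rw [hK, mul_pow]; ring
      _ ≤ D * A := e1
      _ ≤ D * (U * M) := Nat.mul_le_mul_left _ e2
      _ = _ := by ring
  · have hle : H * (2 * 2 ^ k * U + (1 + t * 2 ^ k) * (U + t * D)) ≤ A := by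
      have e1 : A / M * M ≤ A := Nat.div_mul_le_self _ _
      have e2 : H * c₁ * (A / M) * 2 ≤ A := by
        rw [hM] at e1 ⊢
        nlinarith
      have e3 : H * ((1 + t * 2 ^ k) * (t * D)) ≤
          H * ((1 + t * 2 ^ k) * (t * (2 * ((2 * Z) ^ k) ^ 2))) :=
        Nat.mul_le_mul_left _ (Nat.mul_le_mul_left _ (Nat.mul_le_mul_left _ st.D_le))
      have e4 : H * (2 * 2 ^ k * U + (1 + t * 2 ^ k) * (U + t * D)) =
          H * c₁ * (A / M) + H * c₁ + H * ((1 + t * 2 ^ k) * (t * D)) := by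
        rw [hU, hc₁]; ring
      omega
    have : ((H * (2 * 2 ^ k * U + (1 + t * 2 ^ k) * (U + t * D)) : ℕ) : ℤ) ≤ A := by
      exact_mod_cast hle
    push_cast at this ⊢
    linarith

theorem PairStat.main_bound {k Z H t : ℕ} (hH : 0 < H) {x y : Fin t → ℕ} {f D : ℕ}
    (st : PairStat k Z H x y f D) (α : Fin t → ℤ) {A B : ℤ} {U w : ℕ} {σ : ℝ}
    (hσ : ((H * f : ℕ) : ℝ) ≤ σ * w) (hw : 0 < w) (hσ1 : σ < 1)
    (hU : w * (2 * Z) ^ k ≤ U * D)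
    (hB : A + H * (2 * 2 ^ k * U + (1 + t * 2 ^ k) * (U + t * D)) ≤ B) (r r' : ℤ) :
    (((boxClass H α A).filter (fun a => ∑ l, a l * (x l : ℤ) ^ k = r ∧
      ∑ l, a l * (y l : ℤ) ^ k = r')).card : ℝ) ≤
    H / ((w : ℝ) ^ 2 * (1 - σ)) * f *
    (((boxClass H α B).filter (fun a => ∃ m m' : ℕ, m < w ∧ m' < w ∧ (H : ℤ) ∣ (m' : ℤ) - m ∧
      ∑ l, a l * (x l : ℤ) ^ k = r + H * m ∧ ∑ l, a l * (y l : ℤ) ^ k = r' + H * m')).card : ℝ) := by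
  have hcnt := st.count α A B U w r r' hU hB
  set N := ((boxClass H α A).filter (fun a => ∑ l, a l * (x l : ℤ) ^ k = r ∧
      ∑ l, a l * (y l : ℤ) ^ k = r')).card
  set N' := ((boxClass H α B).filter (fun a => ∃ m m' : ℕ, m < w ∧ m' < w ∧
    (H : ℤ) ∣ (m' : ℤ) - m ∧ ∑ l, a l * (x l : ℤ) ^ k = r + H * m ∧
    ∑ l, a l * (y l : ℤ) ^ k = r' + H * m')).card
  have hg : 0 < H * f := Nat.mul_pos hH st.f_pos
  have hgr : (0 : ℝ) < ((H * f : ℕ) : ℝ) := by exact_mod_cast hg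
  have hwr : (0 : ℝ) < w := by exact_mod_cast hw
  have h1 : (w : ℝ) * ((w / (H * f) : ℕ) : ℝ) * N ≤ N' := by exact_mod_cast hcnt
  have h2 : (w : ℝ) * (1 - σ) ≤ ((H * f : ℕ) : ℝ) * ((w / (H * f) : ℕ) : ℝ) := by
    have h3 : w ≤ H * f * (w / (H * f)) + H * f := by
      have := Nat.div_add_mod w (H * f)
      have := Nat.mod_lt w hg
      omega
    have h4 : (w : ℝ) ≤ ((H * f : ℕ) : ℝ) * ((w / (H * f) : ℕ) : ℝ) + ((H * f : ℕ) : ℝ) := by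
      exact_mod_cast h3
    linarith
  rw [div_mul_eq_mul_div, div_mul_eq_mul_div, le_div_iff₀
    (mul_pos (by positivity) (by linarith))]
  calc (N : ℝ) * ((w : ℝ) ^ 2 * (1 - σ)) = w * N * (w * (1 - σ)) := by ring
    _ ≤ w * N * (((H * f : ℕ) : ℝ) * ((w / (H * f) : ℕ) : ℝ)) :=
        mul_le_mul_of_nonneg_left h2 (by positivity)
    _ = ((H * f : ℕ) : ℝ) * (w * ((w / (H * f) : ℕ) : ℝ) * N) := by ring
    _ ≤ ((H * f : ℕ) : ℝ) * N' := mul_le_mul_of_nonneg_left h1 (by positivity)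
    _ = _ := by push_cast; ring

section

attribute [local irreducible] modH

/-- The nonconstant vectors with entries in `S`. -/
def ncVec (t : ℕ) (S : Finset ℕ) : Finset (Fin t → ℕ) :=
  (vecS t S).filter fun x => ¬ ∃ v, ∀ l, x l = v

theorem ncVec_subset (t : ℕ) (S : Finset ℕ) : ncVec t S ⊆ vecS t S := Finset.filter_subset _ _

theorem mem_ncVec {t : ℕ} {S : Finset ℕ} {x : Fin t → ℕ} :
    x ∈ ncVec t S ↔ (∀ l, x l ∈ S) ∧ ¬ ∃ v, ∀ l, x l = v := by
  rw [ncVec, Finset.mem_filter, mem_vecS]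

/-- The equation `a₁ x ^ k + ∑ a l * (v l) ^ k = n`. -/
def IsSol {t : ℕ} (k : ℕ) (a₁ n : ℤ) (a : Fin t → ℤ) (x : ℕ) (v : Fin t → ℕ) : Prop :=
  a₁ * (x : ℤ) ^ k + linForm k a v = n

/-- The weighted number of solutions of `a₁ x ^ k + ∑ a l * (v l) ^ k = n`. -/
def wSol {t : ℕ} (k : ℕ) (a₁ n : ℤ) (S₁ : Finset ℕ) (π₁ : ℕ → ℝ) (V : Finset (Fin t → ℕ))
    (π : ℕ → ℝ) (a : Fin t → ℤ) : ℝ :=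
  ∑ z ∈ S₁ ×ˢ V, π₁ z.1 * vecW π z.2 * (if IsSol k a₁ n a z.1 z.2 then 1 else 0)

theorem wSol_eq_zero {t k : ℕ} {a₁ n : ℤ} {S₁ : Finset ℕ} {π₁ : ℕ → ℝ} {V : Finset (Fin t → ℕ)}
    {π : ℕ → ℝ} {a : Fin t → ℤ}
    (h : ¬ ∃ x ∈ S₁, ∃ v ∈ V, IsSol k a₁ n a x v) :
    wSol k a₁ n S₁ π₁ V π a = 0 := by
  refine Finset.sum_eq_zero fun z hz => ?_
  rw [Finset.mem_product] at hz
  rw [if_neg fun he => h ⟨z.1, hz.1, z.2, hz.2, he⟩, mul_zero]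

/-- The function `ψ` set to zero on the diagonal. -/
def offDiagFun {κ : Type*} (ψ : κ → κ → ℝ) (v v' : κ) : ℝ := if v = v' then 0 else ψ v v'

theorem offDiagFun_self {κ : Type*} (ψ : κ → κ → ℝ) (v : κ) : offDiagFun ψ v v = 0 := if_pos rfl

theorem offDiagFun_of_ne {κ : Type*} (ψ : κ → κ → ℝ) {v v' : κ} (h : v ≠ v') :
    offDiagFun ψ v v' = ψ v v' := if_neg h

/-- The elements of `V` different from `v`. -/
def otherElts {κ : Type*} (V : Finset κ) (v : κ) : Finset κ := V.filter fun v' => v ≠ v'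

theorem mem_otherElts {κ : Type*} {V : Finset κ} {v v' : κ} :
    v' ∈ otherElts V v ↔ v' ∈ V ∧ v ≠ v' := by
  rw [otherElts, Finset.mem_filter]

theorem otherElts_subset {κ : Type*} (V : Finset κ) (v : κ) : otherElts V v ⊆ V :=
  Finset.filter_subset _ _

theorem sum_sum_offDiagFun_le {κ : Type*} {V : Finset κ} {W : κ → ℝ} (hW : ∀ v, 0 ≤ W v)
    (hW1 : ∑ v ∈ V, W v ≤ 1) {ψ : κ → κ → ℝ} {b : ℝ} (hb : 0 ≤ b)
    (h : ∀ v ∈ V, ∑ v' ∈ otherElts V v, W v' * ψ v v' ≤ b) :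
    ∑ v ∈ V, ∑ v' ∈ V, W v * W v' * offDiagFun ψ v v' ≤ b := by
  calc _ ≤ ∑ v ∈ V, W v * b := by
        refine Finset.sum_le_sum fun v hv => ?_
        refine le_trans (le_of_eq ?_) (mul_le_mul_of_nonneg_left (h v hv) (hW v))
        rw [otherElts, Finset.sum_filter, Finset.mul_sum]
        refine Finset.sum_congr rfl fun v' _ => ?_
        by_cases hvv : v = v'
        · rw [hvv, offDiagFun_self]
          simp
        · rw [offDiagFun_of_ne _ hvv, if_pos hvv]
          ring
    _ = (∑ v ∈ V, W v) * b := (Finset.sum_mul _ _ _).symm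
    _ ≤ 1 * b := mul_le_mul_of_nonneg_right hW1 hb
    _ = b := one_mul b

/-- The weight of a far-from-generic pair in the tail of the second moment. -/
def tailTerm (k Z D₀ f D : ℕ) : ℝ :=
  if modH k * f < D₀ ∧ Z ^ (2 * k) / D + 1 < D₀ then 0 else
    ((modH k * f : ℕ) : ℝ) * ((Z ^ (2 * k) / D + 1 : ℕ) : ℝ) ^ 2

/-- The weight of a pair with gcd `f`, when it exceeds `1`. -/
def multTerm (f : ℕ) : ℝ := if 2 ≤ f then (f : ℝ) else 0

theorem multTerm_nonneg (f : ℕ) : 0 ≤ multTerm f := by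
  rw [multTerm]
  split_ifs <;> positivity

section Core

variable {k t Z N : ℕ} {C θ c c' : ℝ} {S S₁ : Finset ℕ} {π π₁ : ℕ → ℝ}

set_option maxHeartbeats 400000 in
theorem sum_wSol_sq_le (hk : 0 < k) (hZ : 0 < Z) (G : GoodWeight k C θ Z S π)
    (F : FlatWeight k c c' N Z S₁ π₁) {s φb τb τ₀ Ω σ : ℝ} (hs : ∀ x, π x ≤ s) {D₀ w Sh A : ℕ}
    {a₁ n : ℤ} (ha₁ : 0 < a₁) {α : Fin t → ℤ}
    (hα : ∀ p : ℕ, p.Prime → p ∣ modH k → ∃ l, ¬ (p : ℤ) ∣ α l)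
    (hαn : (modH k : ℤ) ∣ a₁ + ∑ l, α l - n) (hw : 0 < w) (hσ1 : σ < 1)
    (hD₀ : (D₀ : ℝ) ≤ σ * w)
    (hΩ : Ω = modH k * w / a₁ / ((c' - c) * Z ^ k) + 2 / N) (hφb : 0 ≤ φb) (hτb : 0 ≤ τb)
    (hτ₀ : 0 ≤ τ₀)
    (hφ : ∀ V : Finset (Fin t → ℕ), V ⊆ vecS t S → ∀ (x : Fin t → ℕ) (f D : (Fin t → ℕ) → ℕ),
      (∀ y ∈ V, PairStat k Z (modH k) x y (f y) (D y)) →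
      ∑ y ∈ V, vecW π y * multTerm (f y) ≤ φb)
    (hτ : ∀ V : Finset (Fin t → ℕ), V ⊆ vecS t S → ∀ x : Fin t → ℕ, x ∈ vecS t S →
      ∀ f D : (Fin t → ℕ) → ℕ, (∀ y ∈ V, PairStat k Z (modH k) x y (f y) (D y)) →
        ∑ y ∈ V, vecW π y * tailTerm k Z D₀ (f y) (D y) ≤ τb)
    (htail : ∀ (x y : Fin t → ℕ) (f D : ℕ), PairStat k Z (modH k) x y f D → ∀ r r' : ℤ,
      (((boxClass (modH k) α A).filter (fun a => ∑ l, a l * (x l : ℤ) ^ k = r ∧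
      ∑ l, a l * (y l : ℤ) ^ k = r')).card : ℝ) ≤
      τ₀ * (((modH k * f : ℕ) : ℝ) * ((Z ^ (2 * k) / D + 1 : ℕ) : ℝ) ^ 2))
    (hmain : ∀ D : ℕ, 0 < D → D ≤ 2 * ((2 * Z) ^ k) ^ 2 → Z ^ (2 * k) / D + 1 < D₀ →
      ∃ U : ℕ, w * (2 * Z) ^ k ≤ U * D ∧
        modH k * (2 * 2 ^ k * U + (1 + t * 2 ^ k) * (U + t * D)) ≤ Sh) :
    ∑ a ∈ boxClass (modH k) α A, wSol k a₁ n S₁ π₁ (ncVec t S) π a ^ 2 ≤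
      (boxClass (modH k) α A).card * s ^ t + τ₀ * τb +
        modH k / ((w : ℝ) ^ 2 * (1 - σ)) * (boxClass (modH k) α ((A + Sh : ℕ) : ℤ)).card * Ω ^ 2 *
          (1 / modH k + φb) := by
  have hH := modH_pos hk
  have hHz : (modH k : ℤ) ≠ 0 := by exact_mod_cast hH.ne'
  have hWn := vecW_nonneg G.nonneg (t := t)
  have hsub := ncVec_subset t S
  have hW1 : ∑ v ∈ ncVec t S, vecW π v ≤ 1 := by
    rw [← sum_vecW (t := t) G.sum_eq_one]
    exact Finset.sum_le_sum_of_subset_of_nonneg hsub fun v _ _ => hWn v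
  have hex : ∀ x y : Fin t → ℕ, ∃ fD : ℕ × ℕ, x ∈ ncVec t S → y ∈ ncVec t S → x ≠ y →
      PairStat k Z (modH k) x y fD.1 fD.2 := by
    intro x y
    by_cases h : x ∈ ncVec t S ∧ y ∈ ncVec t S ∧ x ≠ y
    · obtain ⟨hx, hy, hxy⟩ := h
      rw [mem_ncVec] at hx hy
      obtain ⟨f, D, hst⟩ := exists_pairStat hk hZ hH
        (fun l => G.prime _ (hx.1 l)) (fun l => G.prime _ (hy.1 l))
        (fun l => ⟨G.lt _ (hx.1 l), G.le _ (hx.1 l)⟩) (fun l => ⟨G.lt _ (hy.1 l), G.le _ (hy.1 l)⟩)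
        (fun l => G.congr _ (hx.1 l)) (fun l => G.congr _ (hy.1 l)) hx.2 hxy
      exact ⟨(f, D), fun _ _ _ => hst⟩
    · exact ⟨(0, 0), fun h1 h2 h3 => absurd ⟨h1, h2, h3⟩ h⟩
  choose fD hst using hex
  have hne : ∀ x ∈ ncVec t S, ∀ y ∈ otherElts (ncVec t S) x,
      PairStat k Z (modH k) x y (fD x y).1 (fD x y).2 := by
    intro x hx y hy
    rw [mem_otherElts] at hy
    exact hst x y hx hy.1 hy.2
  have hc₁ : 0 ≤ (modH k : ℝ) / ((w : ℝ) ^ 2 * (1 - σ)) :=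
    div_nonneg (by positivity) (mul_nonneg (by positivity) (by linarith))
  refine second_moment_le (E := IsSol k a₁ n) (C := IsNearSol k (modH k) w a₁ n)
    (τ := offDiagFun fun v v' => τ₀ * tailTerm k Z D₀ (fD v v').1 (fD v v').2)
    (φ := offDiagFun fun v v' => multTerm (fD v v').1)
    F.nonneg F.sum_eq_one hWn hH ?_ hc₁ ?_ ?_ ?_ ?_ ?_ ?_
  · intro v v'
    rw [offDiagFun]
    split_ifs
    · exact le_rfl
    · exact multTerm_nonneg _
  · intro x _ v hv x' _ v' hv'
    have hφn := multTerm_nonneg (fD v v').1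
    by_cases hvv : v = v'
    · subst hvv
      rw [offDiagFun_self, offDiagFun_self, if_pos rfl]
      have h1 : ∀ (P : (Fin t → ℤ) → Prop) [DecidablePred P], (((boxClass (modH k) α A).filter P).card : ℝ) ≤
          (boxClass (modH k) α A).card := fun P _ => by
        exact_mod_cast Finset.card_le_card (Finset.filter_subset _ _)
      have h2 := mul_nonneg hc₁ (Nat.cast_nonneg (α := ℝ) ((boxClass (modH k) α ((A + Sh : ℕ) : ℤ)).filter
        (fun a => ∃ h < modH k, IsNearSol k (modH k) w a₁ n a h x v ∧ IsNearSol k (modH k) w a₁ n a h x' v)).card)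
      refine (h1 _).trans ?_
      simp only [mul_zero, zero_mul, add_zero]
      linarith
    · rw [offDiagFun_of_ne _ hvv, offDiagFun_of_ne _ hvv, if_neg hvv, zero_add]
      have st := hst v v' hv hv' hvv
      have hQ : (((boxClass (modH k) α A).filter (fun a => IsSol k a₁ n a x v ∧
          IsSol k a₁ n a x' v')).card : ℝ) ≤
          (((boxClass (modH k) α A).filter (fun a => ∑ l, a l * (v l : ℤ) ^ k = n - a₁ * (x : ℤ) ^ k ∧
            ∑ l, a l * (v' l : ℤ) ^ k = n - a₁ * (x' : ℤ) ^ k)).card : ℝ) := by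
        refine Nat.cast_le.2 (Finset.card_le_card ?_)
        intro a ha
        rw [Finset.mem_filter] at ha ⊢
        refine ⟨ha.1, ?_, ?_⟩
        · have := ha.2.1
          rw [IsSol, linForm] at this
          linarith
        · have := ha.2.2
          rw [IsSol, linForm] at this
          linarith
      refine hQ.trans ?_
      by_cases hm : modH k * (fD v v').1 < D₀ ∧ Z ^ (2 * k) / (fD v v').2 + 1 < D₀
      · rw [tailTerm, if_pos hm, mul_zero, zero_add]
        obtain ⟨U, hU1, hU2⟩ := hmain _ st.D_pos st.D_le hm.2
        have hmb := st.main_bound hH α (A := A) (B := ((A + Sh : ℕ) : ℤ)) (U := U) (w := w)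
          (le_trans (by exact_mod_cast hm.1.le) hD₀) hw hσ1 hU1
          (by
            have : ((modH k * (2 * 2 ^ k * U + (1 + t * 2 ^ k) * (U + t * (fD v v').2)) : ℕ) : ℤ) ≤ Sh := by
              exact_mod_cast hU2
            push_cast at this ⊢
            linarith) (n - a₁ * (x : ℤ) ^ k) (n - a₁ * (x' : ℤ) ^ k)
        refine hmb.trans ?_
        have hkey : ∀ a : Fin t → ℤ, (∃ m m' : ℕ, m < w ∧ m' < w ∧ (modH k : ℤ) ∣ (m' : ℤ) - m ∧
            ∑ l, a l * (v l : ℤ) ^ k = n - a₁ * (x : ℤ) ^ k + modH k * m ∧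
            ∑ l, a l * (v' l : ℤ) ^ k = n - a₁ * (x' : ℤ) ^ k + modH k * m') →
            ∃ h < modH k, IsNearSol k (modH k) w a₁ n a h x v ∧ IsNearSol k (modH k) w a₁ n a h x' v' := by
          rintro a ⟨m, m', hmw, hmw', hmm, h1, h2⟩
          have hmd : (modH k : ℤ) ∣ m - ((m % modH k : ℕ) : ℤ) := by
            push_cast
            exact Int.dvd_self_sub_emod
          refine ⟨m % modH k, Nat.mod_lt _ hH, ⟨m, hmw, hmd, ?_⟩, m', hmw', ?_, ?_⟩
          · rw [linForm]; linarith
          · have := dvd_add hmm hmd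
            rwa [sub_add_sub_cancel] at this
          · rw [linForm]; linarith
        by_cases hf : 2 ≤ (fD v v').1
        · rw [multTerm, if_pos hf]
          refine le_trans ?_ (le_add_of_nonneg_left (mul_nonneg hc₁ (Nat.cast_nonneg _)))
          refine mul_le_mul_of_nonneg_left ?_ (mul_nonneg hc₁ (Nat.cast_nonneg _))
          refine Nat.cast_le.2 (Finset.card_le_card ?_)
          intro a ha
          rw [Finset.mem_filter] at ha ⊢
          obtain ⟨h, hh, h1, h2⟩ := hkey a ha.2
          exact ⟨ha.1, ⟨h, hh, h1⟩, h, hh, h2⟩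
        · have hf1 : (fD v v').1 = 1 := by
            have := st.f_pos
            omega
          rw [multTerm, if_neg hf, hf1, Nat.cast_one, mul_one, mul_zero, zero_mul, add_zero]
          refine mul_le_mul_of_nonneg_left ?_ hc₁
          refine Nat.cast_le.2 (Finset.card_le_card ?_)
          intro a ha
          rw [Finset.mem_filter] at ha ⊢
          exact ⟨ha.1, hkey a ha.2⟩
      · rw [tailTerm, if_neg hm, add_assoc]
        refine (htail v v' _ _ st _ _).trans (le_add_of_nonneg_right ?_)
        exact add_nonneg (mul_nonneg hc₁ (Nat.cast_nonneg _))
          (mul_nonneg (mul_nonneg hc₁ hφn) (Nat.cast_nonneg _))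
  · refine le_trans ?_ (sum_vecW_sq_le (t := t) G.nonneg G.sum_eq_one hs)
    exact Finset.sum_le_sum_of_subset_of_nonneg hsub fun v _ _ => mul_self_nonneg _
  · refine sum_sum_offDiagFun_le hWn hW1 (mul_nonneg hτ₀ hτb) fun v hv => ?_
    have := mul_le_mul_of_nonneg_left (hτ (otherElts (ncVec t S) v)
      ((otherElts_subset _ _).trans hsub) v (hsub hv) (fun y => (fD v y).1)
      (fun y => (fD v y).2) (hne v hv)) hτ₀
    refine le_trans (le_of_eq ?_) this
    rw [Finset.mul_sum]
    exact Finset.sum_congr rfl fun y _ => by ring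
  · refine sum_sum_offDiagFun_le hWn hW1 hφb fun v hv => ?_
    exact hφ (otherElts (ncVec t S) v)
      ((otherElts_subset _ _).trans hsub) v (fun y => (fD v y).1)
      (fun y => (fD v y).2) (hne v hv)
  · intro a ha h _
    rw [mem_boxClass] at ha
    have hsum : (modH k : ℤ) ∣ ∑ l, a l - ∑ l, α l := by
      rw [← Finset.sum_sub_distrib]
      exact Finset.dvd_sum fun l _ => (ha l).2
    have := F.window_class_upper hk (w := w) G.nonneg G.congr G.unif ha₁ (a := a) (n := n) ?_ ?_
      hsub h
    · rw [hΩ]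
      exact this
    · intro p hp hpH
      obtain ⟨l, hl⟩ := hα p hp hpH
      refine ⟨l, fun hd => hl ?_⟩
      have h1 : (p : ℤ) ∣ a l - α l := (Int.natCast_dvd_natCast.2 hpH).trans (ha l).2
      exact (dvd_sub_right hd).1 h1
    · have := dvd_add hαn hsum
      rwa [show a₁ + ∑ l, α l - n + (∑ l, a l - ∑ l, α l) = a₁ + ∑ l, a l - n by ring] at this
  · intro a _ v _
    rw [hΩ]
    exact F.window_upper hk (w := w) (n := n) ha₁ a v (modH k)

end Core

end

section

attribute [local irreducible] modH

/-- The equation `a₁ x ^ k + ∑ a l * (v l) ^ k = n + H m` for some `m < w`. -/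
def IsWinSol {t : ℕ} (k H w : ℕ) (a₁ n : ℤ) (a : Fin t → ℤ) (x : ℕ) (v : Fin t → ℕ) : Prop :=
  ∃ m : ℕ, m < w ∧ a₁ * (x : ℤ) ^ k + linForm k a v = n + H * m

theorem abs_linForm_le {k t Z : ℕ} {A : ℤ} {a : Fin t → ℤ} {v : Fin t → ℕ}
    (ha : ∀ l, |a l| ≤ A) (hv : ∀ l, v l ≤ 2 * Z) :
    |linForm k a v| ≤ t * (A * (2 * Z) ^ k) := by
  rw [linForm]
  refine (Finset.abs_sum_le_sum_abs _ _).trans ?_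
  calc ∑ l, |a l * (v l : ℤ) ^ k| ≤ ∑ _l : Fin t, A * (2 * (Z : ℤ)) ^ k := by
        refine Finset.sum_le_sum fun l _ => ?_
        rw [abs_mul, abs_of_nonneg (show (0 : ℤ) ≤ (v l : ℤ) ^ k by positivity)]
        have h1 : ((v l : ℕ) : ℤ) ≤ 2 * Z := by exact_mod_cast hv l
        exact mul_le_mul (ha l) (pow_le_pow_left₀ (by positivity) h1 k) (by positivity)
          ((abs_nonneg _).trans (ha l))
    _ = _ := by simp

theorem le_sum_vecW_ncVec {t : ℕ} (ht : 0 < t) {S : Finset ℕ} {π : ℕ → ℝ} (hn : ∀ x, 0 ≤ π x)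
    (h1 : ∑ x ∈ S, π x = 1) {s : ℝ} (hs : ∀ x, π x ≤ s) :
    1 - s ^ (t - 1) ≤ ∑ v ∈ ncVec t S, vecW π v := by
  have e1 := Finset.sum_filter_add_sum_filter_not (vecS t S) (fun x => ∃ v, ∀ l, x l = v)
    (vecW π)
  rw [sum_vecW h1] at e1
  have := sum_vecW_const_le ht hn h1 hs
  rw [ncVec]
  linarith

theorem le_sum_wSol {k t Z N : ℕ} {C θ c c' : ℝ} {S S₁ : Finset ℕ} {π π₁ : ℕ → ℝ}
    (hk : 0 < k) (hZ : 0 < Z) (ht : 0 < t) (G : GoodWeight k C θ Z S π)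
    (F : FlatWeight k c c' N Z S₁ π₁) {s L : ℝ} (hs : ∀ x, π x ≤ s) {w U Sh A : ℕ}
    {a₁ n : ℤ} (ha₁ : 0 < a₁) {α : Fin t → ℤ} (hαn : (modH k : ℤ) ∣ a₁ + ∑ l, α l - n)
    (hL : L ≤ modH k * w / a₁ / ((c' - c) * Z ^ k) - 2 / N) (hL0 : 0 ≤ L)
    (hw : w ≤ U * Z ^ k) (hU : modH k * (U + (2 * Z) ^ k) ≤ Sh) (hSh : Sh ≤ A)
    (h1 : c * Z ^ k * a₁ + t * (A * (2 * Z) ^ k) ≤ n)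
    (h2 : n + t * (A * (2 * Z) ^ k) + modH k * w ≤ c' * Z ^ k * a₁) :
    (boxClass (modH k) α ((A - Sh : ℕ) : ℤ)).card * (L * (1 - s ^ (t - 1))) ≤
      w * ∑ a ∈ boxClass (modH k) α A, wSol k a₁ n S₁ π₁ (ncVec t S) π a := by
  have ha : (0 : ℝ) < a₁ := by exact_mod_cast ha₁
  refine le_first_moment (E := IsSol k a₁ n) (F := IsWinSol k (modH k) w a₁ n)
    F.nonneg (vecW_nonneg G.nonneg) hL0 ?_ ?_ (le_sum_vecW_ncVec ht G.nonneg G.sum_eq_one hs)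
  · intro x _ v hv
    rw [mem_ncVec] at hv
    have := single_count (k := k) (H := modH k) hZ (fun l => G.prime _ (hv.1 l))
      (fun l => ⟨G.lt _ (hv.1 l), G.le _ (hv.1 l)⟩) hv.2 ht α ((A - Sh : ℕ) : ℤ) A U w
      (n - a₁ * (x : ℤ) ^ k) hw (by
        have h3 : ((modH k * (U + (2 * Z) ^ k) : ℕ) : ℤ) ≤ Sh := by exact_mod_cast hU
        push_cast [Nat.cast_sub hSh] at h3 ⊢
        linarith)
    have h4 : ∀ (P P' : (Fin t → ℤ) → Prop) [DecidablePred P] [DecidablePred P'] (B : ℤ),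
        (∀ a, P a → P' a) → ((boxClass (modH k) α B).filter P).card ≤
          ((boxClass (modH k) α B).filter P').card := by
      intro P P' _ _ B h
      refine Finset.card_le_card fun a ha => ?_
      rw [Finset.mem_filter] at ha ⊢
      exact ⟨ha.1, h a ha.2⟩
    have h5 := (h4 (fun a => IsWinSol k (modH k) w a₁ n a x v) (fun a => ∃ m : ℕ, m < w ∧
      ∑ l, a l * (v l : ℤ) ^ k = n - a₁ * (x : ℤ) ^ k + modH k * m) ((A - Sh : ℕ) : ℤ) (by
        rintro a ⟨m, hm, he⟩
        refine ⟨m, hm, ?_⟩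
        rw [linForm] at he
        linarith)).trans (this.trans (Nat.mul_le_mul_left w (h4 _ (fun a => IsSol k a₁ n a x v) A (by
          intro a he
          rw [IsSol, linForm]
          linarith))))
    exact_mod_cast h5
  · intro a hmem v hv
    rw [mem_boxClass] at hmem
    rw [mem_ncVec] at hv
    have hsum : (modH k : ℤ) ∣ ∑ l, a l - ∑ l, α l := by
      rw [← Finset.sum_sub_distrib]
      exact Finset.dvd_sum fun l _ => (hmem l).2
    have hlin : |linForm k a v| ≤ t * ((A : ℤ) * (2 * Z) ^ k) := by
      refine abs_linForm_le (fun l => (hmem l).1.trans ?_) fun l => G.le _ (hv.1 l)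
      exact_mod_cast Nat.sub_le A Sh
    have hlin' : |(linForm k a v : ℝ)| ≤ t * (A * (2 * Z) ^ k) := by exact_mod_cast hlin
    rw [abs_le] at hlin'
    refine hL.trans ((F.le_window (w := w) (n := n) (a := a) (v := v) hk ha₁
      (fun l => G.congr _ (hv.1 l)) ?_ ?_ ?_).trans (le_of_eq ?_))
    · have := dvd_add hαn hsum
      rwa [show a₁ + ∑ l, α l - n + (∑ l, a l - ∑ l, α l) = a₁ + ∑ l, a l - n by ring] at this
    · rw [le_div_iff₀ ha]
      push_cast
      linarith
    · rw [← add_div, div_le_iff₀ ha]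
      push_cast
      linarith
    · refine Finset.sum_congr rfl fun x _ => ?_
      congr 1
      by_cases hx : IsWinSol k (modH k) w a₁ n a x v
      · rw [if_pos hx]
        exact if_pos hx
      · rw [if_neg hx]
        exact if_neg hx

end

section

attribute [local irreducible] modH

theorem sub_sq_div_le {V₀ r β P Q M₁ M₂ : ℝ} (hV₀ : 0 < V₀) (hr : 0 < r) (hβ : 0 < β)
    (hβ1 : β ≤ 1 / 2) (hP : 0 ≤ P) (hQ : Q ≤ V₀ * (1 + β)) (hM₁ : V₀ * r * (1 - β) ^ 3 ≤ M₁)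
    (hM₂ : 0 < M₂)
    (hM₂' : M₂ ≤ V₀ * r ^ 2 * ((1 + β) ^ 3 * (1 + P * β) / (1 - β) + 2 * β)) :
    Q - M₁ ^ 2 / M₂ ≤ (25 + 9 * P) * β * V₀ := by
  have h1 : (1 + β) ^ 3 * (1 + P * β) / (1 - β) + 2 * β ≤ 1 + (18 + 9 * P) * β := by
    have hPβ : 0 ≤ P * β := by positivity
    have h2 : (1 + β) ^ 3 * (1 + P * β) / (1 - β) ≤ 1 + (16 + 9 * P) * β := by
      rw [div_le_iff₀ (by linarith)]
      have e1 : (1 + β) ^ 3 ≤ (1 + 16 * β) * (1 - β) := by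
        nlinarith [mul_pos hβ hβ, mul_nonneg hβ.le (sub_nonneg.2 hβ1),
          mul_nonneg (mul_pos hβ hβ).le (sub_nonneg.2 hβ1)]
      have e2 : (1 + β) ^ 3 * (1 + P * β) ≤ (1 + 16 * β) * (1 - β) * (1 + P * β) :=
        mul_le_mul_of_nonneg_right e1 (by linarith)
      refine e2.trans ?_
      rw [mul_right_comm]
      refine mul_le_mul_of_nonneg_right ?_ (by linarith)
      nlinarith [mul_nonneg hPβ (sub_nonneg.2 hβ1)]
    linarith
  have hD : 0 < 1 + (18 + 9 * P) * β := by positivity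
  have hM₂'' : M₂ ≤ V₀ * r ^ 2 * (1 + (18 + 9 * P) * β) :=
    hM₂'.trans (mul_le_mul_of_nonneg_left h1 (by positivity))
  have h0 : 0 ≤ V₀ * r * (1 - β) ^ 3 :=
    mul_nonneg (by positivity) (pow_nonneg (by linarith) _)
  have h3 : V₀ * (1 - (24 + 9 * P) * β) ≤ M₁ ^ 2 / M₂ := by
    calc V₀ * (1 - (24 + 9 * P) * β) ≤
          (V₀ * r * (1 - β) ^ 3) ^ 2 / (V₀ * r ^ 2 * (1 + (18 + 9 * P) * β)) := by
          rw [le_div_iff₀ (by positivity)]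
          have e1 : 1 - 6 * β ≤ ((1 - β) ^ 3) ^ 2 := by
            have := one_add_mul_le_pow (show (-2 : ℝ) ≤ -β by linarith) 6
            rw [← pow_mul]
            push_cast at this
            calc _ = 1 + 6 * -β := by ring
              _ ≤ _ := this
              _ = _ := by ring
          have e2 : (1 - (24 + 9 * P) * β) * (1 + (18 + 9 * P) * β) ≤ 1 - 6 * β := by
            have : 0 ≤ (24 + 9 * P) * (18 + 9 * P) * β ^ 2 := by positivity
            nlinarith
          have e3 := mul_le_mul_of_nonneg_left (e2.trans e1)
            (show 0 ≤ V₀ ^ 2 * r ^ 2 by positivity)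
          calc _ = V₀ ^ 2 * r ^ 2 * ((1 - (24 + 9 * P) * β) * (1 + (18 + 9 * P) * β)) := by ring
            _ ≤ _ := e3
            _ = _ := by ring
      _ ≤ M₁ ^ 2 / M₂ := by
          refine div_le_div₀ (sq_nonneg _) (pow_le_pow_left₀ h0 hM₁ 2) hM₂ hM₂''
  linarith

set_option maxHeartbeats 400000 in
theorem card_not_isSol_le {k t Z N : ℕ} {C θ c c' : ℝ} {S S₁ : Finset ℕ} {π π₁ : ℕ → ℝ}
    (hk : 0 < k) (hZ : 0 < Z) (ht : 0 < t) (G : GoodWeight k C θ Z S π)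
    (F : FlatWeight k c c' N Z S₁ π₁) (hcc : c < c') {s φb τb τ₀ σ : ℝ} (hs : ∀ x, π x ≤ s)
    {D₀ w U Sh A : ℕ}
    {a₁ n : ℤ} (ha₁ : 0 < a₁) {α : Fin t → ℤ}
    (hα : ∀ p : ℕ, p.Prime → p ∣ modH k → ∃ l, ¬ (p : ℤ) ∣ α l)
    (hαn : (modH k : ℤ) ∣ a₁ + ∑ l, α l - n) (hw : 0 < w)
    (hD₀ : (D₀ : ℝ) ≤ σ * w) (hφb : 0 ≤ φb) (hτb : 0 ≤ τb)
    (hτ₀ : 0 ≤ τ₀)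
    (hφ : ∀ V : Finset (Fin t → ℕ), V ⊆ vecS t S → ∀ (x : Fin t → ℕ) (f D : (Fin t → ℕ) → ℕ),
      (∀ y ∈ V, PairStat k Z (modH k) x y (f y) (D y)) →
      ∑ y ∈ V, vecW π y * multTerm (f y) ≤ φb)
    (hτ : ∀ V : Finset (Fin t → ℕ), V ⊆ vecS t S → ∀ x : Fin t → ℕ, x ∈ vecS t S →
      ∀ f D : (Fin t → ℕ) → ℕ, (∀ y ∈ V, PairStat k Z (modH k) x y (f y) (D y)) →
        ∑ y ∈ V, vecW π y * tailTerm k Z D₀ (f y) (D y) ≤ τb)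
    (htail : ∀ (x y : Fin t → ℕ) (f D : ℕ), PairStat k Z (modH k) x y f D → ∀ r r' : ℤ,
      (((boxClass (modH k) α A).filter (fun a => ∑ l, a l * (x l : ℤ) ^ k = r ∧
      ∑ l, a l * (y l : ℤ) ^ k = r')).card : ℝ) ≤
      τ₀ * (((modH k * f : ℕ) : ℝ) * ((Z ^ (2 * k) / D + 1 : ℕ) : ℝ) ^ 2))
    (hmain : ∀ D : ℕ, 0 < D → D ≤ 2 * ((2 * Z) ^ k) ^ 2 → Z ^ (2 * k) / D + 1 < D₀ →
      ∃ U : ℕ, w * (2 * Z) ^ k ≤ U * D ∧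
        modH k * (2 * 2 ^ k * U + (1 + t * 2 ^ k) * (U + t * D)) ≤ Sh)
    (hwU : w ≤ U * Z ^ k) (hU : modH k * (U + (2 * Z) ^ k) ≤ Sh) (hSh : Sh ≤ A)
    (h1 : c * Z ^ k * a₁ + t * (A * (2 * Z) ^ k) ≤ n)
    (h2 : n + t * (A * (2 * Z) ^ k) + modH k * w ≤ c' * Z ^ k * a₁)
    {V₀ r β P : ℝ} (hV₀ : 0 < V₀) (hβ : 0 < β) (hβ1 : β ≤ 1 / 2) (hP : 0 ≤ P)
    (hQ : (boxClass (modH k) α A).card ≤ V₀ * (1 + β))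
    (hQm : V₀ * (1 - β) ≤ (boxClass (modH k) α ((A - Sh : ℕ) : ℤ)).card)
    (hQp : (boxClass (modH k) α ((A + Sh : ℕ) : ℤ)).card ≤ V₀ * (1 + β))
    (hr : r = modH k / a₁ / ((c' - c) * Z ^ k)) (hN : 2 / N ≤ β * (r * w))
    (hs0 : 0 ≤ s) (hs1 : s ^ (t - 1) ≤ β) (hst : 2 * s ^ t ≤ β * r ^ 2)
    (hττ : τ₀ * τb ≤ β * (V₀ * r ^ 2)) (hφP : modH k * φb ≤ P * β) (hσβ : σ ≤ β) :
    (((boxClass (modH k) α A).filter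
      (fun a => ¬ ∃ x ∈ S₁, ∃ v ∈ ncVec t S, IsSol k a₁ n a x v)).card : ℝ) ≤
      (25 + 9 * P) * β * V₀ := by
  have hH : (0 : ℝ) < modH k := by exact_mod_cast modH_pos hk
  have har : (0 : ℝ) < a₁ := by exact_mod_cast ha₁
  have hZr : (0 : ℝ) < Z := by exact_mod_cast hZ
  have hwr : (0 : ℝ) < w := by exact_mod_cast hw
  have hcc' : 0 < c' - c := by linarith
  have hr0 : 0 < r := by rw [hr]; positivity
  have hω : modH k * w / a₁ / ((c' - c) * Z ^ k) = r * w := by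
    rw [hr]
    field_simp
  have hm2 := sum_wSol_sq_le hk hZ G F hs ha₁ hα hαn hw (by linarith : σ < 1) hD₀ rfl hφb hτb hτ₀
    hφ hτ htail hmain
  have hL0 : 0 ≤ (1 - β) * (r * w) := mul_nonneg (by linarith) (by positivity)
  have hm1 := le_sum_wSol (L := (1 - β) * (r * w)) hk hZ ht G F hs ha₁ hαn
    (by rw [hω]; linarith) hL0 hwU hU hSh h1 h2
  have hM₁ : V₀ * r * (1 - β) ^ 3 ≤
      ∑ a ∈ boxClass (modH k) α A, wSol k a₁ n S₁ π₁ (ncVec t S) π a := by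
    have e1 : V₀ * (1 - β) * ((1 - β) * (r * w) * (1 - β)) ≤
        (boxClass (modH k) α ((A - Sh : ℕ) : ℤ)).card *
          ((1 - β) * (r * w) * (1 - s ^ (t - 1))) := by
      refine mul_le_mul hQm (mul_le_mul_of_nonneg_left (by linarith) hL0)
        (mul_nonneg hL0 (by linarith)) (Nat.cast_nonneg _)
    refine le_of_mul_le_mul_left ?_ hwr
    refine le_trans (le_of_eq ?_) (e1.trans hm1)
    ring
  have hM₂ : 0 < V₀ * r ^ 2 * ((1 + β) ^ 3 * (1 + P * β) / (1 - β) + 2 * β) := by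
    have : 0 < 1 - β := by linarith
    positivity
  have hm2' : ∑ a ∈ boxClass (modH k) α A, wSol k a₁ n S₁ π₁ (ncVec t S) π a ^ 2 ≤
      V₀ * r ^ 2 * ((1 + β) ^ 3 * (1 + P * β) / (1 - β) + 2 * β) := by
    refine hm2.trans ?_
    rw [hω]
    have e1 : ((boxClass (modH k) α A).card : ℝ) * s ^ t ≤ β * (V₀ * r ^ 2) := by
      calc _ ≤ V₀ * (1 + β) * s ^ t := mul_le_mul_of_nonneg_right hQ (by positivity)
        _ ≤ V₀ * 2 * s ^ t := by
            refine mul_le_mul_of_nonneg_right ?_ (by positivity)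
            exact mul_le_mul_of_nonneg_left (by linarith) hV₀.le
        _ = V₀ * (2 * s ^ t) := by ring
        _ ≤ V₀ * (β * r ^ 2) := mul_le_mul_of_nonneg_left hst hV₀.le
        _ = _ := by ring
    have e2 : (r * w + 2 / N) ^ 2 ≤ ((1 + β) * (r * w)) ^ 2 := by
      refine pow_le_pow_left₀ (by positivity) ?_ 2
      linarith
    have e3 : (modH k : ℝ) / ((w : ℝ) ^ 2 * (1 - σ)) ≤ modH k / ((w : ℝ) ^ 2 * (1 - β)) := by
      refine div_le_div_of_nonneg_left hH.le (mul_pos (by positivity) (by linarith)) ?_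
      exact mul_le_mul_of_nonneg_left (by linarith) (by positivity)
    have e4 : 1 / (modH k : ℝ) + φb ≤ (1 + P * β) / modH k := by
      rw [le_div_iff₀ hH]
      calc _ = 1 + modH k * φb := by field_simp
        _ ≤ _ := by linarith
    have hb : 0 < 1 - β := by linarith
    have e5 : (modH k : ℝ) / ((w : ℝ) ^ 2 * (1 - σ)) *
        (boxClass (modH k) α ((A + Sh : ℕ) : ℤ)).card * (r * w + 2 / N) ^ 2 *
          (1 / modH k + φb) ≤ modH k / ((w : ℝ) ^ 2 * (1 - β)) * (V₀ * (1 + β)) *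
          ((1 + β) * (r * w)) ^ 2 * ((1 + P * β) / modH k) := by
      refine mul_le_mul (mul_le_mul (mul_le_mul e3 hQp (Nat.cast_nonneg _) (by positivity)) e2
        (by positivity) (by positivity)) e4 (by positivity) (by positivity)
    have e6 : modH k / ((w : ℝ) ^ 2 * (1 - β)) * (V₀ * (1 + β)) *
          ((1 + β) * (r * w)) ^ 2 * ((1 + P * β) / modH k) =
          V₀ * r ^ 2 * ((1 + β) ^ 3 * (1 + P * β) / (1 - β)) := by
      field_simp
    rw [e6] at e5
    linarith
  have hfail := card_zero_le hM₁ (mul_nonneg (by positivity) (pow_nonneg (by linarith) _)) hm2' hM₂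
  refine le_trans ?_ (hfail.trans (sub_sq_div_le hV₀ hr0 hβ hβ1 hP hQ le_rfl hM₂ le_rfl))
  refine Nat.cast_le.2 (Finset.card_le_card fun a ha => ?_)
  rw [Finset.mem_filter] at ha ⊢
  exact ⟨ha.1, wSol_eq_zero ha.2⟩

end

section

attribute [local irreducible] modH

theorem card_boxClass_le_mul {t H A S : ℕ} {σ β : ℝ} (hH : 0 < H) (ht : 0 < t) (α : Fin t → ℤ)
    (hβ : 0 < β) (hβ1 : β ≤ 1) (hσ : σ = β / (4 * t)) (hA : (H : ℝ) ≤ σ * A) (hS : (S : ℝ) ≤ σ * A) :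
    ((boxClass H α ((A + S : ℕ) : ℤ)).card : ℝ) ≤ (2 * A / H) ^ t * (1 + β) := by
  have hHr : (1 : ℝ) ≤ H := by exact_mod_cast hH
  have htr : (0 : ℝ) < t := by exact_mod_cast ht
  have hσ0 : 0 < σ := by rw [hσ]; positivity
  refine (card_boxClass_le hH α (by positivity)).trans ?_
  have h1 : (2 * (((A + S : ℕ) : ℤ) : ℝ) + 1) / H + 1 ≤ 2 * A / H * (1 + 2 * σ) := by
    rw [div_add_one (by positivity), div_mul_eq_mul_div]
    refine div_le_div_of_nonneg_right ?_ (by positivity)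
    push_cast
    nlinarith
  refine (pow_le_pow_left₀ (by positivity) h1 t).trans ?_
  rw [mul_pow]
  refine mul_le_mul_of_nonneg_left ?_ (by positivity)
  have h2 : 1 + 2 * σ ≤ Real.exp (2 * σ) := by
    have := Real.add_one_le_exp (2 * σ)
    linarith
  calc (1 + 2 * σ) ^ t ≤ Real.exp (2 * σ) ^ t := pow_le_pow_left₀ (by positivity) h2 t
    _ = Real.exp (β / 2) := by
        rw [← Real.exp_nat_mul, hσ]
        congr 1
        field_simp
        ring
    _ ≤ 1 + β := by
        have := Real.abs_exp_sub_one_le (x := β / 2) (by rw [abs_of_nonneg] <;> linarith)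
        rw [abs_of_nonneg (show 0 ≤ β / 2 by linarith)] at this
        have := (abs_le.1 this).2
        linarith

theorem le_card_boxClass_mul {t H A S : ℕ} {σ β : ℝ} (hH : 0 < H) (ht : 0 < t) (α : Fin t → ℤ)
    (hβ : 0 < β) (hβ1 : β ≤ 1) (hσ : σ = β / (4 * t)) (hA : (H : ℝ) ≤ σ * A) (hS : (S : ℝ) ≤ σ * A) :
    (2 * A / H) ^ t * (1 - β) ≤ ((boxClass H α ((A - S : ℕ) : ℤ)).card : ℝ) := by
  have hHr : (1 : ℝ) ≤ H := by exact_mod_cast hH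
  have htr : (1 : ℝ) ≤ t := by exact_mod_cast ht
  have hσ0 : 0 < σ := by rw [hσ]; positivity
  have hσ1 : σ ≤ 1 / 4 := by
    rw [hσ, div_le_iff₀ (by positivity)]
    linarith
  have hSA : S ≤ A := by
    have : (S : ℝ) ≤ A := hS.trans (by nlinarith [Nat.cast_nonneg (α := ℝ) A])
    exact_mod_cast this
  refine le_trans ?_ (le_card_boxClass hH α ?_)
  · have h1 : 2 * A / H * (1 - 2 * σ) ≤ (2 * (((A - S : ℕ) : ℤ) : ℝ) + 1) / H - 1 := by
      rw [div_sub_one (by positivity), div_mul_eq_mul_div]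
      refine div_le_div_of_nonneg_right ?_ (by positivity)
      push_cast [Nat.cast_sub hSA]
      nlinarith
    refine le_trans ?_ (pow_le_pow_left₀ (mul_nonneg (by positivity) (by linarith)) h1 t)
    rw [mul_pow]
    refine mul_le_mul_of_nonneg_left ?_ (by positivity)
    have h2 := one_add_mul_le_pow (show (-2 : ℝ) ≤ -(2 * σ) by linarith) t
    calc 1 - β ≤ 1 + t * -(2 * σ) := by
          have : (t : ℝ) * σ = β / 4 := by
            rw [hσ]
            field_simp
          nlinarith
      _ ≤ _ := h2
  · have h3 : (H : ℝ) ≤ ((A - S : ℕ) : ℝ) := by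
      push_cast [Nat.cast_sub hSA]
      nlinarith [Nat.cast_nonneg (α := ℝ) A]
    exact_mod_cast h3

theorem exists_shift_bound {k t Z H D₀ w Sh A : ℕ} {σ ν c₃ c₄ : ℝ} (hZ : 0 < Z)
    (hν : 0 < ν) (hw : (w : ℝ) ≤ ν * (A * Z ^ k))
    (hc₃ : c₃ = H * (2 * 2 ^ k + (1 + t * 2 ^ k))) (hc₄ : c₄ = H * (1 + t * 2 ^ k) * t)
    (hνσ : c₃ * (ν * 2 ^ k * D₀) ≤ σ / 8) (hA1 : 8 * c₃ ≤ σ * A)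
    (hA2 : 16 * 4 ^ k * c₄ * Z ^ (2 * k) ≤ σ * A) (hSh : σ * A / 2 ≤ Sh)
    {D : ℕ} (hD : 0 < D) (hDle : D ≤ 2 * ((2 * Z) ^ k) ^ 2) (hDD : Z ^ (2 * k) / D + 1 < D₀) :
    ∃ U : ℕ, w * (2 * Z) ^ k ≤ U * D ∧
      H * (2 * 2 ^ k * U + (1 + t * 2 ^ k) * (U + t * D)) ≤ Sh := by
  refine ⟨w * (2 * Z) ^ k / D + 1, ?_, ?_⟩
  · nlinarith [Nat.div_add_mod (w * (2 * Z) ^ k) D, Nat.mod_lt (w * (2 * Z) ^ k) hD]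
  have hZr : (0 : ℝ) < Z := by exact_mod_cast hZ
  have hDr : (0 : ℝ) < D := by exact_mod_cast hD
  have hc₃0 : 0 ≤ c₃ := by rw [hc₃]; positivity
  have hc₄0 : 0 ≤ c₄ := by rw [hc₄]; positivity
  have h1 : (Z : ℝ) ^ (2 * k) ≤ D₀ * D := by
    have : Z ^ (2 * k) ≤ D₀ * D := by
      nlinarith [Nat.div_add_mod (Z ^ (2 * k)) D, Nat.mod_lt (Z ^ (2 * k)) hD]
    exact_mod_cast this
  have hU : ((w * (2 * Z) ^ k / D + 1 : ℕ) : ℝ) ≤ ν * 2 ^ k * D₀ * A + 1 := by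
    push_cast
    have h2 : ((w * (2 * Z) ^ k / D : ℕ) : ℝ) ≤ w * (2 * Z) ^ k / D := by
      have := Nat.cast_div_le (α := ℝ) (m := w * (2 * Z) ^ k) (n := D)
      push_cast at this
      exact this
    have h3 : (w : ℝ) * (2 * Z) ^ k / D ≤ ν * 2 ^ k * D₀ * A := by
      rw [div_le_iff₀ hDr]
      calc (w : ℝ) * (2 * Z) ^ k ≤ ν * (A * Z ^ k) * (2 * Z) ^ k :=
            mul_le_mul_of_nonneg_right hw (by positivity)
        _ = ν * 2 ^ k * A * Z ^ (2 * k) := by rw [mul_pow, two_mul, pow_add]; ring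
        _ ≤ ν * 2 ^ k * A * (D₀ * D) := mul_le_mul_of_nonneg_left h1 (by positivity)
        _ = _ := by ring
    linarith
  have hDr2 : (D : ℝ) ≤ 2 * 4 ^ k * Z ^ (2 * k) := by
    have h4 : (D : ℝ) ≤ 2 * ((2 * Z) ^ k) ^ 2 := by exact_mod_cast hDle
    refine h4.trans (le_of_eq ?_)
    rw [mul_pow, mul_pow, show (4 : ℝ) = 2 ^ 2 by norm_num, ← pow_mul, ← pow_mul, ← pow_mul,
      mul_comm k 2, mul_assoc]
  have hgoal : ((H * (2 * 2 ^ k * (w * (2 * Z) ^ k / D + 1) +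
      (1 + t * 2 ^ k) * ((w * (2 * Z) ^ k / D + 1) + t * D)) : ℕ) : ℝ) ≤ Sh := by
    have e : ((H * (2 * 2 ^ k * (w * (2 * Z) ^ k / D + 1) +
        (1 + t * 2 ^ k) * ((w * (2 * Z) ^ k / D + 1) + t * D)) : ℕ) : ℝ) =
        c₃ * ((w * (2 * Z) ^ k / D + 1 : ℕ) : ℝ) + c₄ * D := by
      rw [hc₃, hc₄]
      push_cast
      ring
    rw [e]
    calc _ ≤ c₃ * (ν * 2 ^ k * D₀ * A + 1) + c₄ * (2 * 4 ^ k * Z ^ (2 * k)) :=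
          add_le_add (mul_le_mul_of_nonneg_left hU hc₃0) (mul_le_mul_of_nonneg_left hDr2 hc₄0)
      _ = c₃ * (ν * 2 ^ k * D₀) * A + c₃ + c₄ * (2 * 4 ^ k * Z ^ (2 * k)) := by ring
      _ ≤ σ / 8 * A + σ * A / 8 + σ * A / 8 := by
          refine add_le_add (add_le_add (mul_le_mul_of_nonneg_right hνσ (Nat.cast_nonneg _)) ?_) ?_ <;>
            linarith
      _ ≤ σ * A / 2 := by
          have : 0 ≤ σ * A := le_trans (by positivity) hA1
          linarith
      _ ≤ Sh := hSh
  exact_mod_cast hgoal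

end

section

attribute [local irreducible] modH

set_option maxHeartbeats 400000 in
theorem card_not_isSol_le_of_large {k t Z N D₀ A : ℕ} {C θ c c' c₂ θ' σ ν β K₂ P c₃ c₄ R s : ℝ} {K : ℕ}
    {S S₁ : Finset ℕ} {π π₁ : ℕ → ℝ} (hk : 0 < k) (hZ : 0 < Z) (ht : 0 < t)
    (G : GoodWeight k C θ Z S π) (F : FlatWeight k c c' N Z S₁ π₁)
    (hN0 : 0 < N) (hP : 0 ≤ P) (hK₂ : 0 ≤ K₂) (hD₀2 : 2 ≤ D₀)
    (hβ : 0 < β) (hβ1 : β ≤ 1 / 2) (hσ : σ = β / (4 * t)) (hν : 0 < ν) (hν1 : ν ≤ 1)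
    (hc : c = t * 2 ^ k) (hcc : c < c') (hc' : c₂ + t * 2 ^ k + modH k ≤ c' * θ')
    (hc₃ : c₃ = modH k * (2 * 2 ^ k + (1 + t * 2 ^ k))) (hc₄ : c₄ = modH k * (1 + t * 2 ^ k) * t)
    (hK : K = 2 ^ k * (2 * modH k * (2 * 2 ^ k + (1 + t * 2 ^ k))))
    (hνσ : c₃ * (ν * 2 ^ k * D₀) ≤ σ / 8)
    (hN : 4 * (c' - c) ≤ β * modH k * ν * N)
    (hD₀ : 8 * K ^ 2 * (3 * modH k) ^ t * K₂ * (c' - c) ^ 2 ≤ β * modH k ^ 2 * D₀)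
    (hR : 16 * (c₃ + 4 ^ k * c₄ + D₀ + K) ≤ R * (σ * ν)) (hRA : R * Z ^ (2 * k) ≤ A)
    (hs : s = C * (Z : ℝ) ^ (-(1 / 2 : ℝ))) (hs0 : 0 ≤ s) (hs1 : s ^ (t - 1) ≤ β)
    (hst : 2 * s ^ t * (A * ((c' - c) * Z ^ k)) ^ 2 ≤ β * modH k ^ 2)
    (hφ : ∀ V : Finset (Fin t → ℕ), V ⊆ vecS t S → ∀ (x : Fin t → ℕ) (f D : (Fin t → ℕ) → ℕ),
      (∀ y ∈ V, PairStat k Z (modH k) x y (f y) (D y)) →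
      ∑ y ∈ V, vecW π y * multTerm (f y) ≤ P * β)
    (hτ : ∀ V : Finset (Fin t → ℕ), V ⊆ vecS t S → ∀ x : Fin t → ℕ, x ∈ vecS t S →
      ∀ f D : (Fin t → ℕ) → ℕ, (∀ y ∈ V, PairStat k Z (modH k) x y (f y) (D y)) →
        ∑ y ∈ V, vecW π y * tailTerm k Z D₀ (f y) (D y) ≤ K₂ / D₀)
    {a₁ n : ℤ} (ha₁0 : 0 < a₁) (ha₁θ : θ' * A ≤ a₁) (ha₁A : a₁ ≤ A)
    (hn1 : 2 * (t * 2 ^ k) * (A * Z ^ k) ≤ (n : ℝ)) (hn2 : n ≤ c₂ * (A * Z ^ k)) {α : Fin t → ℤ}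
    (hα : ∀ p : ℕ, p.Prime → p ∣ modH k → ∃ l, ¬ (p : ℤ) ∣ α l)
    (hαn : (modH k : ℤ) ∣ a₁ + ∑ l, α l - n) :
    (((boxClass (modH k) α A).filter
      (fun a => ¬ ∃ x ∈ S₁, ∃ v ∈ ncVec t S, IsSol k a₁ n a x v)).card : ℝ) ≤
      (25 + 9 * (modH k * P)) * β * (2 * A / modH k) ^ t := by
  have hHn := modH_pos hk
  have hH : (1 : ℝ) ≤ modH k := by exact_mod_cast hHn
  have hZr : (1 : ℝ) ≤ Z := by exact_mod_cast hZ
  have htr : (1 : ℝ) ≤ t := by exact_mod_cast ht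
  have har : (0 : ℝ) < a₁ := by exact_mod_cast ha₁0
  have hNr : (0 : ℝ) < N := by exact_mod_cast hN0
  have hσ0 : 0 < σ := by rw [hσ]; positivity
  have hσβ : σ ≤ β := by
    rw [hσ]
    exact div_le_self hβ.le (by linarith)
  have hσ1 : σ ≤ 1 := by linarith
  have hB : (1 : ℝ) ≤ (Z : ℝ) ^ (2 * k) := one_le_pow₀ hZr
  have hy : (1 : ℝ) ≤ (Z : ℝ) ^ k := one_le_pow₀ hZr
  have hyB : (Z : ℝ) ^ k ≤ (Z : ℝ) ^ (2 * k) := pow_le_pow_right₀ hZr (by omega)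
  have h2k : (1 : ℝ) ≤ 2 ^ k := one_le_pow₀ (by norm_num)
  have h4k : (1 : ℝ) ≤ 4 ^ k := one_le_pow₀ (by norm_num)
  have hc₃H : (modH k : ℝ) * (1 + 2 ^ k) ≤ c₃ := by
    rw [hc₃]
    refine mul_le_mul_of_nonneg_left ?_ (by linarith)
    have : 0 ≤ (t : ℝ) * 2 ^ k := by positivity
    linarith
  have hc₃0 : 0 < c₃ := lt_of_lt_of_le (by positivity) hc₃H
  have hc₄0 : 0 ≤ c₄ := by rw [hc₄]; positivity
  have hD₀r : (2 : ℝ) ≤ D₀ := by exact_mod_cast hD₀2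
  have hKr : (0 : ℝ) ≤ K := Nat.cast_nonneg _
  have hσν : 0 < σ * ν := by positivity
  have hσν1 : σ * ν ≤ 1 := mul_le_one₀ hσ1 hν.le hν1
  have hw₄ : 0 ≤ 4 ^ k * c₄ := by positivity
  set T : ℝ := c₃ + 4 ^ k * c₄ + D₀ + K with hT
  have hT0 : 2 ≤ T := by linarith
  have hAB : 16 * T * Z ^ (2 * k) ≤ σ * ν * A := by
    calc 16 * T * Z ^ (2 * k) ≤ R * (σ * ν) * Z ^ (2 * k) :=
          mul_le_mul_of_nonneg_right hR (by positivity)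
      _ = σ * ν * (R * Z ^ (2 * k)) := by ring
      _ ≤ _ := mul_le_mul_of_nonneg_left hRA hσν.le
  have hA0 : (0 : ℝ) < A := by
    by_contra h
    have h1 : σ * ν * A ≤ 0 := mul_nonpos_of_nonneg_of_nonpos hσν.le (not_lt.1 h)
    have h2 : 0 < 16 * T * (Z : ℝ) ^ (2 * k) := by positivity
    linarith
  have hAσ : 16 * T * Z ^ (2 * k) ≤ σ * A :=
    hAB.trans (mul_le_mul_of_nonneg_right (mul_le_of_le_one_right hσ0.le hν1) hA0.le)
  have hAν : 16 * T * Z ^ (2 * k) ≤ ν * A :=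
    hAB.trans (mul_le_mul_of_nonneg_right (mul_le_of_le_one_left hν.le hσ1) hA0.le)
  have hA1 : 16 * T * Z ^ (2 * k) ≤ A :=
    hAσ.trans (mul_le_of_le_one_left hA0.le hσ1)
  have hTB : T ≤ T * Z ^ (2 * k) := le_mul_of_one_le_right (by linarith) hB
  have hHA : (modH k : ℝ) ≤ σ * A := by
    have : (modH k : ℝ) ≤ modH k * (1 + 2 ^ k) := le_mul_of_one_le_right (by linarith) (by linarith)
    linarith
  have hσA2 : 2 ≤ σ * A := by linarith
  set Sh : ℕ := ⌊σ * A⌋₊ with hShd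
  have hSh1 : (Sh : ℝ) ≤ σ * A := Nat.floor_le (by linarith)
  have hSh2 : σ * A / 2 ≤ Sh := by
    have := Nat.lt_floor_add_one (σ * A)
    linarith
  set w : ℕ := ⌊ν * (A * Z ^ k)⌋₊ with hwd
  have hAy : (A : ℝ) ≤ A * Z ^ k := le_mul_of_one_le_right hA0.le hy
  have hνA : ν * A ≤ ν * (A * Z ^ k) := mul_le_mul_of_nonneg_left hAy hν.le
  have hw1 : (w : ℝ) ≤ ν * (A * Z ^ k) := Nat.floor_le (by positivity)
  have hw2 : ν * (A * Z ^ k) / 2 ≤ w := by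
    have := Nat.lt_floor_add_one (ν * (A * Z ^ k))
    linarith
  have hwr : (0 : ℝ) < w := lt_of_lt_of_le (by positivity) hw2
  have hw0 : 0 < w := by exact_mod_cast hwr
  have hcc' : 0 < c' - c := by linarith
  have hShA : Sh ≤ A := by
    have : (Sh : ℝ) ≤ A := hSh1.trans (mul_le_of_le_one_left hA0.le hσ1)
    exact_mod_cast this
  set r : ℝ := modH k / a₁ / ((c' - c) * Z ^ k) with hr
  have hrA : modH k / (A * ((c' - c) * Z ^ k)) ≤ r := by
    rw [hr, div_div]
    refine div_le_div_of_nonneg_left (by linarith) (by positivity) ?_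
    exact mul_le_mul_of_nonneg_right (by exact_mod_cast ha₁A) (by positivity)
  have hr0 : 0 < r := lt_of_lt_of_le (by positivity) hrA
  have hr2 : (modH k : ℝ) ^ 2 / (A * ((c' - c) * Z ^ k)) ^ 2 ≤ r ^ 2 := by
    rw [← div_pow]
    exact pow_le_pow_left₀ (by positivity) hrA 2
  refine card_not_isSol_le (U := ⌊ν * A⌋₊ + 1) (Sh := Sh) (w := w) (r := r) (σ := σ) (s := s)
    (φb := P * β) (τb := K₂ / D₀)
    (τ₀ := 8 * (K : ℝ) ^ 2 * (6 * A) ^ t / ((A : ℝ) * Z ^ k) ^ 2) (D₀ := D₀)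
    hk hZ ht G F hcc (fun x => hs ▸ G.le_sup x) ha₁0 hα hαn hw0 ?_ (by positivity)
    (by positivity) (by positivity) hφ hτ ?_ ?_ ?_ ?_ hShA ?_ ?_ (by positivity) hβ hβ1
    (by positivity) ?_ ?_ ?_ rfl ?_ hs0 hs1 ?_ ?_ (le_of_eq (by ring)) hσβ
  · have h1 : (D₀ : ℝ) ≤ σ * (ν * A / 2) := by linarith
    refine h1.trans (mul_le_mul_of_nonneg_left ?_ hσ0.le)
    linarith
  · intro x y f D st r r'
    refine st.tail_bound hZ hHn rfl hK ?_ ?_ α r r'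
    · have : (2 * (modH k * (2 * 2 ^ k + (1 + t * 2 ^ k)) +
          modH k * ((1 + t * 2 ^ k) * (t * (2 * ((2 * Z) ^ k) ^ 2)))) : ℝ) ≤ A := by
        have e : (2 * (modH k * (2 * 2 ^ k + (1 + t * 2 ^ k)) +
            modH k * ((1 + t * 2 ^ k) * (t * (2 * ((2 * Z) ^ k) ^ 2)))) : ℝ) =
            2 * c₃ + 4 * (4 ^ k * c₄ * Z ^ (2 * k)) := by
          rw [hc₃, hc₄, mul_pow, mul_pow, show (4 : ℝ) ^ k = (2 ^ k) ^ 2 by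
            rw [← pow_mul, mul_comm, pow_mul]; norm_num, ← pow_mul (Z : ℝ), mul_comm 2 k]
          ring
        rw [e]
        have h1 : c₃ + 4 ^ k * c₄ ≤ T := by linarith
        have h2 := mul_le_mul_of_nonneg_right h1 (show 0 ≤ (Z : ℝ) ^ (2 * k) by positivity)
        have h3 : c₃ ≤ c₃ * (Z : ℝ) ^ (2 * k) := le_mul_of_one_le_right hc₃0.le hB
        have h4 : 0 ≤ 4 ^ k * c₄ * (Z : ℝ) ^ (2 * k) := by positivity
        linarith
      exact_mod_cast this
    · have : (K : ℝ) * Z ^ k ≤ A := by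
        have h1 : (K : ℝ) * Z ^ k ≤ T * Z ^ (2 * k) :=
          mul_le_mul (by linarith) hyB (by positivity) (by linarith)
        linarith
      exact_mod_cast this
  · intro D hD hD1 hD2
    refine exists_shift_bound hZ hν hw1 hc₃ hc₄ hνσ ?_ ?_ hSh2 hD hD1 hD2
    · linarith
    · have h1 : 4 ^ k * c₄ ≤ T := by linarith
      have h2 := mul_le_mul_of_nonneg_right h1 (show 0 ≤ (Z : ℝ) ^ (2 * k) by positivity)
      linarith
  · have : (w : ℝ) ≤ ((⌊ν * A⌋₊ + 1 : ℕ) : ℝ) * Z ^ k := by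
      refine hw1.trans ?_
      rw [← mul_assoc]
      refine mul_le_mul_of_nonneg_right ?_ (by positivity)
      push_cast
      exact (Nat.lt_floor_add_one _).le
    exact_mod_cast this
  · have : (modH k : ℝ) * (((⌊ν * A⌋₊ + 1 : ℕ) : ℝ) + (2 * Z) ^ k) ≤ Sh := by
      have h1 : ((⌊ν * A⌋₊ + 1 : ℕ) : ℝ) ≤ ν * A + 1 := by
        push_cast
        have := Nat.floor_le (show 0 ≤ ν * A by positivity)
        linarith
      have h2 : (modH k : ℝ) * (ν * A) ≤ σ / 8 * A := by
        rw [← mul_assoc]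
        refine mul_le_mul_of_nonneg_right (le_trans ?_ hνσ) hA0.le
        refine mul_le_mul ?_ ?_ hν.le hc₃0.le
        · refine le_trans ?_ hc₃H
          exact le_mul_of_one_le_right (by linarith) (by linarith)
        · rw [mul_assoc]
          refine le_mul_of_one_le_right hν.le ?_
          exact one_le_mul_of_one_le_of_one_le h2k (by linarith)
      have h3 : (modH k : ℝ) * (1 + (2 * Z) ^ k) ≤ T * Z ^ (2 * k) := by
        have h4 : (1 : ℝ) + (2 * Z) ^ k ≤ (1 + 2 ^ k) * Z ^ (2 * k) := by
          rw [mul_pow, add_mul, one_mul]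
          exact add_le_add hB (mul_le_mul_of_nonneg_left hyB (by positivity))
        calc _ ≤ (modH k : ℝ) * ((1 + 2 ^ k) * Z ^ (2 * k)) :=
              mul_le_mul_of_nonneg_left h4 (by positivity)
          _ = modH k * (1 + 2 ^ k) * Z ^ (2 * k) := by ring
          _ ≤ _ := mul_le_mul_of_nonneg_right (by linarith) (by positivity)
      calc _ ≤ (modH k : ℝ) * ((ν * A + 1) + (2 * Z) ^ k) :=
            mul_le_mul_of_nonneg_left (by linarith) (by positivity)
        _ = (modH k : ℝ) * (ν * A) + modH k * (1 + (2 * Z) ^ k) := by ring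
        _ ≤ _ := by linarith
    exact_mod_cast this
  · refine le_trans ?_ hn1
    rw [hc, mul_pow]
    have : (a₁ : ℝ) ≤ A := by exact_mod_cast ha₁A
    have := mul_le_mul_of_nonneg_left this (show 0 ≤ (t : ℝ) * 2 ^ k * Z ^ k by positivity)
    linarith
  · have h1 : (modH k : ℝ) * w ≤ modH k * (A * Z ^ k) := by
      refine mul_le_mul_of_nonneg_left (hw1.trans ?_) (by positivity)
      exact mul_le_of_le_one_left (by positivity) hν1
    have hc'0 : 0 ≤ c' := by
      have : 0 < c := by rw [hc]; positivity
      linarith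
    have h2 := mul_le_mul_of_nonneg_right hc' (show 0 ≤ (A : ℝ) * Z ^ k by positivity)
    have h3 := mul_le_mul_of_nonneg_left ha₁θ (show 0 ≤ c' * (Z : ℝ) ^ k by positivity)
    rw [mul_pow]
    linarith
  · have := card_boxClass_le_mul (S := 0) (A := A) hHn ht α hβ (by linarith) hσ hHA
      (by push_cast; positivity)
    exact this
  · exact le_card_boxClass_mul hHn ht α hβ (by linarith) hσ hHA hSh1
  · exact card_boxClass_le_mul hHn ht α hβ (by linarith) hσ hHA hSh1
  · have h1 : modH k * ν / (2 * (c' - c)) ≤ r * w := by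
      calc modH k * ν / (2 * (c' - c)) =
            modH k / (A * ((c' - c) * Z ^ k)) * (ν * (A * Z ^ k) / 2) := by field_simp
        _ ≤ _ := mul_le_mul hrA hw2 (by positivity) hr0.le
    refine le_trans ?_ (mul_le_mul_of_nonneg_left h1 hβ.le)
    rw [mul_div_assoc', div_le_div_iff₀ hNr (by positivity)]
    linarith
  · refine le_trans ?_ (mul_le_mul_of_nonneg_left hr2 hβ.le)
    rw [mul_div_assoc', le_div_iff₀ (by positivity)]
    exact hst
  · refine le_trans ?_ (mul_le_mul_of_nonneg_left (mul_le_mul_of_nonneg_left hr2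
      (by positivity)) hβ.le)
    rw [div_mul_div_comm, mul_div_assoc', mul_div_assoc', div_le_div_iff₀ (by positivity) (by positivity)]
    have e1 : (6 * (A : ℝ)) ^ t = (3 * modH k) ^ t * (2 * A / modH k) ^ t := by
      rw [← mul_pow]
      congr 1
      field_simp
      norm_num
    rw [e1]
    have h5 := mul_le_mul_of_nonneg_left hD₀
      (show 0 ≤ (2 * (A : ℝ) / modH k) ^ t * (A * Z ^ k) ^ 2 by positivity)
    linarith

end

section

attribute [local irreducible] modH

/-- The equation `a₁ x ^ k + ∑ a l * (v l) ^ k = n` is solvable in primes `x`, `v l`. -/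
def HasPrimeSol {t : ℕ} (k : ℕ) (a₁ n : ℤ) (a : Fin t → ℤ) : Prop :=
  ∃ x : ℕ, x.Prime ∧ ∃ v : Fin t → ℕ, (∀ l, (v l).Prime) ∧ IsSol k a₁ n a x v

theorem two_mul_sq_pow_le {k Z : ℕ} (hk : 0 < k) (hZ : 8 ≤ Z) :
    2 * ((2 * Z) ^ k) ^ 2 ≤ Z ^ (3 * k) := by
  have h2 : 2 ≤ 2 ^ k := Nat.le_self_pow hk.ne' 2
  calc 2 * ((2 * Z) ^ k) ^ 2 ≤ 2 ^ k * ((2 * Z) ^ k) ^ 2 := Nat.mul_le_mul_right _ h2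
    _ = 8 ^ k * Z ^ (2 * k) := by
        rw [mul_pow, mul_pow, show 8 = 2 ^ 3 by norm_num, ← pow_mul, ← pow_mul, ← pow_mul]
        ring
    _ ≤ Z ^ k * Z ^ (2 * k) := Nat.mul_le_mul_right _ (Nat.pow_le_pow_left hZ k)
    _ = Z ^ (3 * k) := by rw [← pow_add]; congr 1; ring

theorem exists_core {k : ℕ} (hk : 0 < k) {E : ℕ} (hE : 2 * k + 1 ≤ E) :
    ∃ C'' : ℝ, 0 < C'' ∧ ∃ t₀ : ℕ, ∀ t ≥ t₀, ∀ θ' c₂ : ℝ, 0 < θ' → 0 < c₂ → ∃ Z₀ : ℕ, ∀ Z ≥ Z₀,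
      ∀ A : ℕ, Z ^ E ≤ A → A ≤ (2 * Z) ^ E → ∀ a₁ n : ℤ, θ' * A ≤ a₁ → a₁ ≤ A →
      2 * (t * 2 ^ k) * (A * Z ^ k) ≤ (n : ℝ) → (n : ℝ) ≤ c₂ * (A * Z ^ k) → ∀ α : Fin t → ℤ,
      (∀ p : ℕ, p.Prime → p ∣ modH k → ∃ l, ¬ (p : ℤ) ∣ α l) →
      (modH k : ℤ) ∣ a₁ + ∑ l, α l - n →
      (((boxClass (modH k) α A).filter (fun a => ¬ HasPrimeSol k a₁ n a)).card : ℝ) ≤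
        C'' * (1 / 2) ^ t * (2 * A / modH k) ^ t := by
  obtain ⟨C, θ, hC, hθ, Zg, hg⟩ := exists_goodWeight hk
  obtain ⟨P, hP, t₁, hmult⟩ := GoodWeight.sum_mult_le hk hC hθ
  have hHn := modH_pos hk
  have hH : (1 : ℝ) ≤ modH k := by exact_mod_cast hHn
  refine ⟨25 + 9 * (modH k * P), by positivity, 4 * E + 4 * k + 2 + ⌈6 / θ⌉₊ + t₁,
    fun t ht θ' c₂ hθ' hc₂ => ?_⟩
  have ht0 : 0 < t := by omega
  have htr : (1 : ℝ) ≤ t := by exact_mod_cast ht0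
  have ht6 : 6 / θ ≤ t := (Nat.le_ceil _).trans (by exact_mod_cast (by omega : ⌈6 / θ⌉₊ ≤ t))
  obtain ⟨K₂, hK₂, htail⟩ := GoodWeight.sum_tail_le hk hC hθ ht6
  set β : ℝ := (1 / 2) ^ t with hβd
  have hβ : 0 < β := by positivity
  have hβ1 : β ≤ 1 / 2 := pow_le_of_le_one (by norm_num) (by norm_num) ht0.ne'
  obtain ⟨σ, hσ⟩ : ∃ σ : ℝ, σ = β / (4 * t) := ⟨_, rfl⟩
  have hσ0 : 0 < σ := by rw [hσ]; positivity
  obtain ⟨c, hc⟩ : ∃ c : ℝ, c = t * 2 ^ k := ⟨_, rfl⟩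
  have hc0 : 0 < c := by rw [hc]; positivity
  obtain ⟨c', hc'⟩ : ∃ c' : ℝ, c' = (c₂ + t * 2 ^ k + modH k) / θ' + c := ⟨_, rfl⟩
  have hcc : c < c' := by
    have : 0 < (c₂ + t * 2 ^ k + modH k) / θ' := by positivity
    linarith
  have hcc' : 0 < c' - c := by linarith
  have hc'θ : c₂ + t * 2 ^ k + modH k ≤ c' * θ' := by
    rw [hc', add_mul, div_mul_cancel₀ _ hθ'.ne']
    have : 0 < c * θ' := by positivity
    linarith
  obtain ⟨c₃, hc₃⟩ : ∃ c₃ : ℝ, c₃ = modH k * (2 * 2 ^ k + (1 + t * 2 ^ k)) := ⟨_, rfl⟩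
  obtain ⟨c₄, hc₄⟩ : ∃ c₄ : ℝ, c₄ = modH k * (1 + t * 2 ^ k) * t := ⟨_, rfl⟩
  have hc₃0 : 0 < c₃ := by rw [hc₃]; positivity
  obtain ⟨K, hK⟩ : ∃ K : ℕ, K = 2 ^ k * (2 * modH k * (2 * 2 ^ k + (1 + t * 2 ^ k))) := ⟨_, rfl⟩
  obtain ⟨D₀, hD₀2, hD₀⟩ : ∃ D₀ : ℕ, 2 ≤ D₀ ∧
      8 * (K : ℝ) ^ 2 * (3 * modH k) ^ t * K₂ * (c' - c) ^ 2 ≤ β * modH k ^ 2 * D₀ := by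
    refine ⟨⌈8 * (K : ℝ) ^ 2 * (3 * modH k) ^ t * K₂ * (c' - c) ^ 2 / (β * modH k ^ 2)⌉₊ + 2,
      by omega, ?_⟩
    rw [← div_le_iff₀' (by positivity)]
    push_cast
    exact (Nat.le_ceil _).trans (by linarith)
  have hD₀r : (2 : ℝ) ≤ D₀ := by exact_mod_cast hD₀2
  obtain ⟨ν, hν, hν1, hνσ⟩ : ∃ ν : ℝ, 0 < ν ∧ ν ≤ 1 ∧ c₃ * (ν * 2 ^ k * D₀) ≤ σ / 8 := by
    refine ⟨min 1 (σ / 8 / (c₃ * (2 ^ k * D₀))), lt_min one_pos (by positivity), min_le_left _ _, ?_⟩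
    have := min_le_right 1 (σ / 8 / (c₃ * (2 ^ k * D₀)))
    rw [le_div_iff₀ (by positivity)] at this
    linarith
  obtain ⟨N, hN0, hN⟩ : ∃ N : ℕ, 0 < N ∧ 4 * (c' - c) ≤ β * modH k * ν * N := by
    refine ⟨⌈4 * (c' - c) / (β * modH k * ν)⌉₊ + 1, by omega, ?_⟩
    rw [← div_le_iff₀' (by positivity)]
    push_cast
    exact (Nat.le_ceil _).trans (by linarith)
  obtain ⟨R, hR⟩ : ∃ R : ℝ, 16 * (c₃ + 4 ^ k * c₄ + D₀ + K) ≤ R * (σ * ν) :=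
    ⟨16 * (c₃ + 4 ^ k * c₄ + D₀ + K) / (σ * ν), by rw [div_mul_cancel₀ _ (by positivity)]⟩
  obtain ⟨Zf, hf⟩ := exists_flatWeight hk hc0 hcc hN0
  obtain ⟨m, hm⟩ : ∃ m : ℕ, m = 2 * E + 2 * k + 1 := ⟨_, rfl⟩
  obtain ⟨X, hX⟩ : ∃ X : ℝ, X = 2 * (C ^ 2) ^ m * 4 ^ E * (c' - c) ^ 2 := ⟨_, rfl⟩
  refine ⟨Zg + Zf + 8 + ⌈R⌉₊ + ⌈C ^ 2 / β ^ 2⌉₊ + ⌈X / (β * modH k ^ 2)⌉₊,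
    fun Z hZ A hA1 hA2 a₁ n ha₁θ ha₁A hn1 hn2 α hα hαn => ?_⟩
  have hceil : ∀ x : ℝ, ⌈x⌉₊ ≤ Z → x ≤ Z := fun x hx =>
    (Nat.le_ceil x).trans (by exact_mod_cast hx)
  have hZR := hceil R (by omega)
  have hZs := hceil _ (show ⌈C ^ 2 / β ^ 2⌉₊ ≤ Z by omega)
  have hZX := hceil _ (show ⌈X / (β * modH k ^ 2)⌉₊ ≤ Z by omega)
  have hZ8 : 8 ≤ Z := by omega
  have hZ0 : 0 < Z := by omega
  have hZr : (1 : ℝ) ≤ Z := by exact_mod_cast hZ0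
  have hAp : 0 < A := lt_of_lt_of_le (by positivity) hA1
  obtain ⟨S, π, G⟩ := hg Z (by omega)
  obtain ⟨S₁, π₁, F⟩ := hf Z (by omega)
  have ha₁0 : 0 < a₁ := by
    have : (0 : ℝ) < a₁ := lt_of_lt_of_le (by positivity) ha₁θ
    exact_mod_cast this
  have hRA : R * Z ^ (2 * k) ≤ A := by
    calc R * Z ^ (2 * k) ≤ Z * Z ^ (2 * k) := mul_le_mul_of_nonneg_right hZR (by positivity)
      _ = (Z : ℝ) ^ (2 * k + 1) := by ring
      _ ≤ (Z : ℝ) ^ E := pow_le_pow_right₀ hZr hE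
      _ ≤ A := by exact_mod_cast hA1
  obtain ⟨s, hs⟩ : ∃ s : ℝ, s = C * (Z : ℝ) ^ (-(1 / 2 : ℝ)) := ⟨_, rfl⟩
  have hs0 : 0 ≤ s := by rw [hs]; positivity
  have hs2 : s ^ 2 = C ^ 2 / Z := by
    have e : ((Z : ℝ) ^ (-(1 / 2 : ℝ))) ^ 2 = (Z : ℝ)⁻¹ := by
      rw [← Real.rpow_natCast, ← Real.rpow_mul (by positivity), ← Real.rpow_neg_one]
      norm_num
    rw [hs, mul_pow, e, div_eq_mul_inv]
  have hsβ : s ≤ β := by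
    refine le_of_sq_le_sq ?_ hβ.le
    rw [hs2, div_le_iff₀ (by linarith)]
    rwa [div_le_iff₀' (by positivity)] at hZs
  have hs1 : s ≤ 1 := by linarith
  refine le_trans (Nat.cast_le.2 (Finset.card_le_card fun a ha => ?_))
    (card_not_isSol_le_of_large (R := R) (s := s) (P := P) hk hZ0 ht0 G F hN0 hP.le hK₂.le hD₀2 hβ
      hβ1 hσ hν hν1 hc hcc
      hc'θ hc₃ hc₄ hK hνσ hN hD₀ hR hRA hs hs0 ?_ ?_ ?_ ?_ ha₁0 ha₁θ ha₁A hn1 hn2 hα hαn)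
  · rw [Finset.mem_filter] at ha ⊢
    refine ⟨ha.1, ?_⟩
    rintro ⟨x, hx, v, hv, h⟩
    rw [mem_ncVec] at hv
    exact ha.2 ⟨x, F.prime x hx, v, fun l => G.prime _ (hv.1 l), h⟩
  · exact (pow_le_of_le_one hs0 hs1 (by omega)).trans hsβ
  · have e1 : s ^ t ≤ (C ^ 2 / Z) ^ m := by
      rw [← hs2, ← pow_mul]
      exact pow_le_pow_of_le_one hs0 hs1 (by omega)
    have e2 : ((A : ℝ) * ((c' - c) * Z ^ k)) ^ 2 ≤ ((2 * Z) ^ E * ((c' - c) * Z ^ k)) ^ 2 := by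
      refine pow_le_pow_left₀ (by positivity) (mul_le_mul_of_nonneg_right ?_ (by positivity)) 2
      exact_mod_cast hA2
    calc 2 * s ^ t * ((A : ℝ) * ((c' - c) * Z ^ k)) ^ 2 ≤
          2 * (C ^ 2 / Z) ^ m * ((2 * Z) ^ E * ((c' - c) * Z ^ k)) ^ 2 :=
          mul_le_mul (mul_le_mul_of_nonneg_left e1 (by norm_num)) e2 (by positivity) (by positivity)
      _ = X / Z := by
          rw [hX, div_pow, hm, show (4 : ℝ) = 2 ^ 2 by norm_num, ← pow_mul 2 2 E]
          field_simp
          ring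
      _ ≤ β * modH k ^ 2 := by
          rw [div_le_iff₀ (by linarith)]
          rwa [div_le_iff₀' (by positivity)] at hZX
  · intro V hV x f D hst
    have := hmult t (by omega) Z S π G (two_mul_sq_pow_le hk hZ8) V hV x f D hst
    simpa only [multTerm] using this
  · intro V hV x hx f D hst
    have := htail D₀ hD₀2 Z S π G (two_mul_sq_pow_le hk hZ8) V hV x hx f D hst
    simpa only [tailTerm] using this

end

section

attribute [local irreducible] modH

/-- The translations mapping a finite set into itself form a subgroup. -/
def transStab {G : Type*} [AddCommGroup G] (S : Finset G) : AddSubgroup G where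
  carrier := {y | ∀ x ∈ S, x + y ∈ S}
  zero_mem' := fun x hx => by rwa [add_zero]
  add_mem' := fun {y z} hy hz x hx => by
    rw [← add_assoc]
    exact hz _ (hy x hx)
  neg_mem' := fun {y} hy x hx => by
    have hsub : S.image (fun x => x + y) ⊆ S := fun z hz => by
      obtain ⟨x, hx, rfl⟩ := Finset.mem_image.1 hz
      exact hy x hx
    have heq := Finset.eq_of_subset_of_card_le hsub
      (Finset.card_image_of_injective S (add_left_injective y)).ge
    rw [← heq] at hx
    obtain ⟨z, hz, rfl⟩ := Finset.mem_image.1 hx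
    simpa using hz

theorem exists_subset_sum {G ι κ : Type*} [AddCommGroup G] [Fintype G] [Inhabited κ]
    {g : ι → κ → G} {adm : ι → κ → Prop}
    (h : ∀ J : Finset ι, J.card < Fintype.card G → ∀ K : AddSubgroup G,
      (∀ j, j ∉ J → ∀ q, adm j q → g j q ∈ K) → K = ⊤) (x : G) :
    ∃ (T : Finset ι) (p : ι → κ), T.card < Fintype.card G ∧ (∀ j ∈ T, adm j (p j)) ∧
      ∑ j ∈ T, g j (p j) = x := by
  have key : ∀ m : ℕ, m + 1 ≤ Fintype.card G → ∃ (J : Finset ι) (p : ι → κ), J.card ≤ m ∧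
      (∀ j ∈ J, adm j (p j)) ∧
      m + 1 ≤ (J.powerset.image fun T => ∑ j ∈ T, g j (p j)).card := by
    intro m
    induction m with
    | zero =>
      intro _
      exact ⟨∅, fun _ => default, by simp, by simp, by simp⟩
    | succ m ih =>
      intro hm
      obtain ⟨J, p, hJ, hadm, hcard⟩ := ih (by omega)
      set S := J.powerset.image fun T => ∑ j ∈ T, g j (p j) with hS
      by_cases hlarge : m + 1 + 1 ≤ S.card
      · exact ⟨J, p, by omega, hadm, hlarge⟩
      have h0 : (0 : G) ∈ S := Finset.mem_image.2 ⟨∅, by simp, by simp⟩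
      obtain ⟨j, hj, q, hq, x, hx, hxg⟩ : ∃ j, j ∉ J ∧ ∃ q, adm j q ∧ ∃ x ∈ S, x + g j q ∉ S := by
        by_contra hcon
        push Not at hcon
        have hK := h J (by omega) (transStab S) fun j hj q hq => hcon j hj q hq
        have huniv : S = Finset.univ := Finset.eq_univ_of_forall fun y => by
          have hy : y ∈ transStab S := by rw [hK]; trivial
          simpa using hy 0 h0
        rw [huniv, Finset.card_univ] at hlarge
        omega
      have hpe : ∀ i ∈ J, Function.update p j q i = p i := fun i hi =>
        Function.update_of_ne (by rintro rfl; exact hj hi) _ _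
      refine ⟨insert j J, Function.update p j q, ?_, ?_, ?_⟩
      · exact (Finset.card_insert_le _ _).trans (by omega)
      · intro i hi
        rcases Finset.mem_insert.1 hi with rfl | hi
        · rwa [Function.update_self]
        · rw [hpe i hi]
          exact hadm i hi
      · have hsub : insert (x + g j q) S ⊆ (insert j J).powerset.image
            fun T => ∑ i ∈ T, g i (Function.update p j q i) := by
          intro y hy
          rw [Finset.mem_image]
          rcases Finset.mem_insert.1 hy with rfl | hy
          · obtain ⟨T, hT, rfl⟩ := Finset.mem_image.1 hx
            rw [Finset.mem_powerset] at hT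
            refine ⟨insert j T, Finset.mem_powerset.2 (Finset.insert_subset_insert _ hT), ?_⟩
            rw [Finset.sum_insert fun hjT => hj (hT hjT), Function.update_self, add_comm]
            congr 1
            exact Finset.sum_congr rfl fun i hi => by rw [hpe i (hT hi)]
          · obtain ⟨T, hT, rfl⟩ := Finset.mem_image.1 hy
            rw [Finset.mem_powerset] at hT
            refine ⟨T, Finset.mem_powerset.2 (hT.trans (Finset.subset_insert _ _)), ?_⟩
            exact Finset.sum_congr rfl fun i hi => by rw [hpe i (hT hi)]
        refine le_trans ?_ (Finset.card_le_card hsub)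
        rw [Finset.card_insert_of_notMem hxg]
        omega
  have hpos : 0 < Fintype.card G := Fintype.card_pos_iff.2 ⟨0⟩
  obtain ⟨J, p, hJ, hadm, hcard⟩ := key (Fintype.card G - 1) (by omega)
  have huniv := (Finset.card_eq_iff_eq_univ
    (J.powerset.image fun T => ∑ j ∈ T, g j (p j))).1
      (le_antisymm (Finset.card_le_univ _) (by omega))
  have hx : x ∈ J.powerset.image fun T => ∑ j ∈ T, g j (p j) := by
    rw [huniv]
    exact Finset.mem_univ _
  obtain ⟨T, hT, hTx⟩ := Finset.mem_image.1 hx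
  rw [Finset.mem_powerset] at hT
  exact ⟨T, p, lt_of_le_of_lt (Finset.card_le_card hT) (by omega), fun j hj => hadm j (hT hj), hTx⟩

theorem ZMod.addSubgroup_eq_top {H : ℕ} [NeZero H] {K : AddSubgroup (ZMod H)}
    (h : ∀ q : ℕ, q.Prime → q ∣ H → ∃ z : ℤ, ¬ (q : ℤ) ∣ z ∧ (z : ZMod H) ∈ K) : K = ⊤ := by
  obtain ⟨d, hd⟩ := Int.subgroup_cyclic (K.comap (Int.castAddHom (ZMod H)))
  have hmem : ∀ z : ℤ, (z : ZMod H) ∈ K ↔ d ∣ z := by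
    intro z
    have : (z : ZMod H) ∈ K ↔ z ∈ K.comap (Int.castAddHom (ZMod H)) := Iff.rfl
    rw [this, hd, ← AddSubgroup.zmultiples_eq_closure, Int.mem_zmultiples_iff]
  have hdH : d ∣ H := by
    rw [← hmem]
    simp [K.zero_mem]
  have hd1 : d.natAbs = 1 := by
    by_contra hne
    obtain ⟨q, hq, hqd⟩ := Nat.exists_prime_and_dvd hne
    have hqd' : (q : ℤ) ∣ d := Int.natCast_dvd.2 hqd
    obtain ⟨z, hz, hzK⟩ := h q hq (by exact_mod_cast hqd'.trans hdH)
    exact hz (hqd'.trans ((hmem z).1 hzK))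
  rw [AddSubgroup.eq_top_iff']
  intro y
  obtain ⟨z, rfl⟩ := ZMod.intCast_surjective y
  rw [hmem]
  exact (Int.isUnit_iff_natAbs_eq.2 hd1).dvd

/-- If for each small prime many coefficients are coprime to it, then few coordinates suffice to
correct the sum modulo `modH k`. -/
theorem exists_corrector {k s : ℕ} (hk : 0 < k) {a : Fin s → ℤ} (W : Finset (Fin s))
    (ha : ∀ q : ℕ, q.Prime → q ≤ k + 1 →
      modH k + W.card ≤ (Finset.univ.filter fun j => ¬ (q : ℤ) ∣ a j).card) :
    ∃ (T : Finset (Fin s)) (p : Fin s → ℕ), T.card < modH k ∧ Disjoint T W ∧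
      (∀ j ∈ T, (p j).Prime ∧ p j ≤ k + 1) ∧
      (modH k : ℤ) ∣ ∑ j, a j + ∑ j ∈ T, a j * ((p j : ℤ) ^ k - 1) := by
  have hH := modH_pos hk
  have : NeZero (modH k) := ⟨hH.ne'⟩
  obtain ⟨T, p, hT, hadm, hsum⟩ := exists_subset_sum (G := ZMod (modH k)) (ι := Fin s) (κ := ℕ)
    (g := fun j q => ((a j * ((q : ℤ) ^ k - 1) : ℤ) : ZMod (modH k)))
    (adm := fun j q => j ∉ W ∧ q.Prime ∧ q ≤ k + 1) (by
      intro J hJ K hK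
      rw [ZMod.card] at hJ
      refine ZMod.addSubgroup_eq_top fun q hq hqH => ?_
      have hqk := prime_le_of_dvd_modH hk hq hqH
      obtain ⟨j, hj, hjJ⟩ : ∃ j ∈ Finset.univ.filter (fun j => ¬ (q : ℤ) ∣ a j), j ∉ J ∪ W := by
        refine Finset.exists_mem_notMem_of_card_lt_card ?_
        have := Finset.card_union_le J W
        have := ha q hq hqk
        omega
      rw [Finset.mem_filter] at hj
      rw [Finset.mem_union, not_or] at hjJ
      refine ⟨a j * ((q : ℤ) ^ k - 1), fun hd => ?_, hK j hjJ.1 q ⟨hjJ.2, hq, hqk⟩⟩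
      rcases (Nat.prime_iff_prime_int.1 hq).dvd_or_dvd hd with h1 | h1
      · exact hj.2 h1
      · have h2 : (q : ℤ) ∣ (q : ℤ) ^ k := dvd_pow_self _ hk.ne'
        have h3 : (q : ℤ) ∣ 1 := by
          have := dvd_sub h2 h1
          simpa using this
        exact (Nat.prime_iff_prime_int.1 hq).not_dvd_one h3)
    (((-∑ j, a j : ℤ)) : ZMod (modH k))
  rw [ZMod.card] at hT
  refine ⟨T, p, hT, ?_, fun j hj => (hadm j hj).2, ?_⟩
  · rw [Finset.disjoint_left]
    exact fun j hj => (hadm j hj).1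
  · rw [← ZMod.intCast_zmod_eq_zero_iff_dvd]
    push_cast at hsum ⊢
    rw [hsum]
    simp

end

section

attribute [local irreducible] modH

/-- The form with coefficients `a` has a zero in the primes. -/
def HasPrimeZero {s : ℕ} (k : ℕ) (a : Fin s → ℤ) : Prop :=
  ∃ x : Fin s → ℕ, (∀ j, (x j).Prime) ∧ ∑ j, a j * (x j : ℤ) ^ k = 0

/-- The conclusion of `exists_core` at fixed parameters. -/
def CoreBound (k t : ℕ) (C θ c₂ : ℝ) (Z A : ℕ) : Prop :=
  ∀ a₁ n : ℤ, θ * A ≤ (a₁ : ℝ) → a₁ ≤ A → 2 * (t * 2 ^ k) * (A * Z ^ k) ≤ (n : ℝ) →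
    (n : ℝ) ≤ c₂ * (A * Z ^ k) → ∀ α : Fin t → ℤ,
    (∀ p : ℕ, p.Prime → p ∣ modH k → ∃ l, ¬ (p : ℤ) ∣ α l) →
    (modH k : ℤ) ∣ a₁ + ∑ l, α l - n →
    (((boxClass (modH k) α A).filter (fun a => ¬ HasPrimeSol k a₁ n a)).card : ℝ) ≤
      C * (1 / 2) ^ t * (2 * A / modH k) ^ t

/-- A coefficient vector in the box without prime zeros, with distinguished coordinates `i₁`, `i₂`
of opposite signs and with a correction on the coordinates in `T`. -/
def BadAt {s : ℕ} (k A : ℕ) (θ : ℝ) (i₁ i₂ : Fin s) (T : Finset (Fin s)) (p : Fin s → ℕ)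
    (a : Fin s → ℤ) : Prop :=
  θ * A ≤ (a i₁ : ℝ) ∧ (a i₂ : ℝ) ≤ -(θ * A) ∧
    (∀ q : ℕ, q.Prime → q ∣ modH k → ∃ l ∉ insert i₁ (insert i₂ T), ¬ (q : ℤ) ∣ a l) ∧
    (modH k : ℤ) ∣ ∑ j, a j + ∑ j ∈ T, a j * ((p j : ℤ) ^ k - 1) ∧ ¬ HasPrimeZero k a

/-- The box `[-A, A]^s`. -/
def intBox (s A : ℕ) : Finset (Fin s → ℤ) :=
  Fintype.piFinset fun _ => Finset.Icc (-(A : ℤ)) A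

theorem mem_intBox {s A : ℕ} {a : Fin s → ℤ} : a ∈ intBox s A ↔ ∀ j, |a j| ≤ A := by
  simp [intBox, abs_le]

theorem sum_eq_sum_embedding {s t : ℕ} {i₁ i₂ : Fin s} {T : Finset (Fin s)} {e : Fin t ↪ Fin s}
    (h12 : i₁ ≠ i₂) (h1 : i₁ ∉ T) (h2 : i₂ ∉ T)
    (he : ∀ j, (∃ l, e l = j) ↔ j ∉ insert i₁ (insert i₂ T)) (g : Fin s → ℤ) :
    ∑ j, g j = g i₁ + (g i₂ + ∑ j ∈ T, g j) + ∑ l, g (e l) := by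
  have hm : Finset.univ.map e = (insert i₁ (insert i₂ T))ᶜ := by
    ext j
    rw [Finset.mem_compl, ← he]
    simp
  have hs : ∑ l, g (e l) = ∑ j ∈ (insert i₁ (insert i₂ T))ᶜ, g j := by
    rw [← hm, Finset.sum_map]
  rw [hs, ← Finset.sum_add_sum_compl (insert i₁ (insert i₂ T)) g,
    Finset.sum_insert (by simp [h12, h1]), Finset.sum_insert h2]

theorem hasPrimeZero_of_hasPrimeSol {k s t : ℕ} {i₁ i₂ : Fin s} {T : Finset (Fin s)}
    {e : Fin t ↪ Fin s} {p : Fin s → ℕ} {p₂ : ℕ} {a : Fin s → ℤ} {n : ℤ}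
    (h12 : i₁ ≠ i₂) (h1 : i₁ ∉ T) (h2 : i₂ ∉ T)
    (he : ∀ j, (∃ l, e l = j) ↔ j ∉ insert i₁ (insert i₂ T)) (hp : ∀ j ∈ T, (p j).Prime)
    (hp₂ : p₂.Prime) (hn : n = -(a i₂ * (p₂ : ℤ) ^ k) - ∑ j ∈ T, a j * (p j : ℤ) ^ k)
    (h : HasPrimeSol k (a i₁) n (a ∘ e)) : HasPrimeZero k a := by
  obtain ⟨x, hx, v, hv, hsol⟩ := h
  set Y : Fin s → ℕ := fun j => if j = i₁ then x else if j = i₂ then p₂ else p j with hY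
  have hnr : ∀ j, j ∈ insert i₁ (insert i₂ T) → Function.extend e v Y j = Y j := fun j hj =>
    Function.extend_apply' _ _ _ fun hex => (he j).1 hex hj
  have hY1 : Y i₁ = x := if_pos rfl
  have hY2 : Y i₂ = p₂ := by rw [hY]; simp [h12.symm]
  have hYT : ∀ j ∈ T, Y j = p j := fun j hj => by
    have e1 : j ≠ i₁ := by rintro rfl; exact h1 hj
    have e2 : j ≠ i₂ := by rintro rfl; exact h2 hj
    rw [hY]
    simp [e1, e2]
  refine ⟨Function.extend e v Y, fun j => ?_, ?_⟩
  · by_cases hj : j ∈ insert i₁ (insert i₂ T)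
    · rw [hnr j hj]
      rcases Finset.mem_insert.1 hj with rfl | hj
      · rwa [hY1]
      · rcases Finset.mem_insert.1 hj with rfl | hj
        · rwa [hY2]
        · rw [hYT j hj]
          exact hp j hj
    · obtain ⟨l, rfl⟩ := (he j).2 hj
      rw [e.injective.extend_apply]
      exact hv l
  · rw [sum_eq_sum_embedding h12 h1 h2 he, hnr i₁ (by simp), hnr i₂ (by simp), hY1, hY2]
    have eT : ∑ j ∈ T, a j * ((Function.extend e v Y j : ℕ) : ℤ) ^ k =
        ∑ j ∈ T, a j * (p j : ℤ) ^ k := Finset.sum_congr rfl fun j hj => by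
      rw [hnr j (by simp [hj]), hYT j hj]
    have eV : ∑ l, a (e l) * ((Function.extend e v Y (e l) : ℕ) : ℤ) ^ k =
        linForm k (a ∘ e) v := Finset.sum_congr rfl fun l _ => by
      rw [e.injective.extend_apply]
      rfl
    rw [eT, eV]
    rw [IsSol] at hsol
    linarith

theorem card_le_mul_card_of_fiber {α β : Type*} [DecidableEq β] {S : Finset α} {D : Finset β}
    {f : α → β} {B : ℝ} (hf : ∀ a ∈ S, f a ∈ D)
    (h : ∀ b ∈ D, ((S.filter fun a => f a = b).card : ℝ) ≤ B) : (S.card : ℝ) ≤ D.card * B := by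
  rw [Finset.card_eq_sum_card_fiberwise (f := f) (t := D) hf]
  push_cast
  exact (Finset.sum_le_card_nsmul _ _ _ h).trans (by rw [nsmul_eq_mul])

theorem card_badAt_le {k s t Z A lam p₂ : ℕ} (hk : 0 < k) {C θ c₂ : ℝ} {i₁ i₂ : Fin s}
    {T : Finset (Fin s)} {p : Fin s → ℕ}
    (hcore : CoreBound k t C θ c₂ Z A) (hC : 0 ≤ C) (h12 : i₁ ≠ i₂) (h1 : i₁ ∉ T) (h2 : i₂ ∉ T)
    (hp : ∀ j ∈ T, (p j).Prime ∧ p j ≤ k + 1) (hts : T.card + 2 + t = s)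
    (hp₂ : p₂.Prime) (hp₂L : (modL k : ℤ) ∣ (p₂ : ℤ) - 1) (hp₂1 : lam * Z ≤ p₂)
    (hp₂2 : p₂ ≤ 2 * lam * Z) (hlam : 1 ≤ lam) (hlamθ : 2 ^ (k + 1) * s + 1 ≤ θ * lam)
    (hθ : 0 ≤ θ)
    (hZ : s * (k + 1) ^ k ≤ Z ^ k) (hc₂ : ((2 * lam) ^ k + 1 : ℝ) ≤ c₂) :
    (((intBox s A).filter (BadAt k A θ i₁ i₂ T p)).card : ℝ) ≤
      ((2 * A + 1) ^ (T.card + 2) * (modH k) ^ t) * (C * (1 / 2) ^ t * (2 * A / modH k) ^ t) := by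
  have hH := modH_pos hk
  have hHz : (0 : ℤ) < modH k := by exact_mod_cast hH
  obtain ⟨W, hW⟩ : ∃ W, W = insert i₁ (insert i₂ T) := ⟨_, rfl⟩
  have hWc : W.card = T.card + 2 := by
    rw [hW, Finset.card_insert_of_notMem (by simp [h12, h1]), Finset.card_insert_of_notMem h2]
  have hWt : Wᶜ.card = t := by
    rw [Finset.card_compl, Fintype.card_fin]
    omega
  set e : Fin t ↪ Fin s := (Wᶜ.orderEmbOfFin hWt).toEmbedding with he_def
  have he : ∀ j, (∃ l, e l = j) ↔ j ∉ insert i₁ (insert i₂ T) := by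
    intro j
    have := Finset.range_orderEmbOfFin Wᶜ hWt
    have h3 : j ∈ Set.range (Wᶜ.orderEmbOfFin hWt) ↔ j ∈ (Wᶜ : Finset (Fin s)) := by
      rw [this]; simp
    rw [← hW, ← Finset.mem_compl, ← h3]
    rfl
  set D₁ : Finset (Fin s → ℤ) := Fintype.piFinset fun j =>
    if j ∈ W then Finset.Icc (-(A : ℤ)) A else {0} with hD₁
  set D₂ : Finset (Fin t → ℤ) := Fintype.piFinset fun _ => Finset.Ico (0 : ℤ) (modH k) with hD₂
  have hc1 : (D₁.card : ℝ) = (2 * A + 1) ^ (T.card + 2) := by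
    have : D₁.card = (2 * A + 1) ^ (T.card + 2) := by
      rw [hD₁, Fintype.card_piFinset]
      have : ∀ j, (if j ∈ W then Finset.Icc (-(A : ℤ)) A else {0}).card =
          if j ∈ W then 2 * A + 1 else 1 := by
        intro j
        split_ifs
        · rw [Int.card_Icc]; omega
        · simp
      simp_rw [this]
      rw [Finset.prod_ite, Finset.prod_const, Finset.prod_const_one, mul_one,
        Finset.filter_mem_eq_inter, Finset.univ_inter, hWc]
    rw [this]
    push_cast
    ring
  have hc2 : (D₂.card : ℝ) = (modH k : ℝ) ^ t := by
    rw [hD₂, Fintype.card_piFinset]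
    simp
  have hcard : ((D₁ ×ˢ D₂).card : ℝ) = (2 * A + 1) ^ (T.card + 2) * (modH k) ^ t := by
    rw [Finset.card_product, Nat.cast_mul, hc1, hc2]
  rw [← hcard]
  refine card_le_mul_card_of_fiber
    (f := fun a => ((fun j => if j ∈ W then a j else 0), fun l => a (e l) % (modH k : ℤ))) ?_ ?_
  · intro a ha
    rw [Finset.mem_filter, mem_intBox] at ha
    rw [Finset.mem_product, hD₁, hD₂, Fintype.mem_piFinset, Fintype.mem_piFinset]
    refine ⟨fun j => ?_, fun l => ?_⟩
    · by_cases hj : j ∈ W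
      · simpa [hj, abs_le] using ha.1 j
      · simp [hj]
    · rw [Finset.mem_Ico]
      exact ⟨Int.emod_nonneg _ hHz.ne', Int.emod_lt_of_pos _ hHz⟩
  · rintro ⟨u, α⟩ -
    rcases Finset.eq_empty_or_nonempty (((intBox s A).filter (BadAt k A θ i₁ i₂ T p)).filter
      fun a => ((fun j => if j ∈ W then a j else 0), fun l => a (e l) % (modH k : ℤ)) = (u, α))
      with hE | ⟨a₀, ha₀⟩
    · rw [hE, Finset.card_empty, Nat.cast_zero]
      positivity
    have hfib : ∀ a : Fin s → ℤ,
        ((fun j => if j ∈ W then a j else 0), fun l => a (e l) % (modH k : ℤ)) = (u, α) →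
        (∀ j ∈ W, a j = u j) ∧ ∀ l, a (e l) % (modH k : ℤ) = α l := by
      intro a h
      rw [Prod.mk.injEq] at h
      refine ⟨fun j hj => ?_, fun l => congrFun h.2 l⟩
      have := congrFun h.1 j
      rwa [if_pos hj] at this
    obtain ⟨n, hn⟩ : ∃ n : ℤ, n = -(u i₂ * (p₂ : ℤ) ^ k) - ∑ j ∈ T, u j * (p j : ℤ) ^ k := ⟨_, rfl⟩
    have hi1 : i₁ ∈ W := by simp [hW]
    have hi2 : i₂ ∈ W := by simp [hW]
    have hiT : ∀ j ∈ T, j ∈ W := fun j hj => by simp [hW, hj]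
    rw [Finset.mem_filter, Finset.mem_filter, mem_intBox] at ha₀
    obtain ⟨⟨hbox, hb1, hb2, hbq, hbH, -⟩, hfa⟩ := ha₀
    obtain ⟨hu, hα⟩ := hfib a₀ hfa
    have hαd : ∀ l, (modH k : ℤ) ∣ a₀ (e l) - α l := fun l => by
      rw [← hα l]
      exact Int.dvd_self_sub_emod
    have hsumT : |((∑ j ∈ T, u j * (p j : ℤ) ^ k : ℤ) : ℝ)| ≤ A * Z ^ k := by
      have e1 : |∑ j ∈ T, u j * (p j : ℤ) ^ k| ≤ A * Z ^ k := by
        calc |∑ j ∈ T, u j * (p j : ℤ) ^ k| ≤ ∑ j ∈ T, |u j * (p j : ℤ) ^ k| :=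
              Finset.abs_sum_le_sum_abs _ _
          _ ≤ ∑ j ∈ T, (A : ℤ) * ((k : ℤ) + 1) ^ k := Finset.sum_le_sum fun j hj => by
              rw [abs_mul, abs_pow, Nat.abs_cast]
              refine mul_le_mul ?_ (pow_le_pow_left₀ (by positivity) ?_ k) (by positivity)
                (by positivity)
              · rw [← hu j (hiT j hj)]
                exact hbox j
              · exact_mod_cast (hp j hj).2
          _ = T.card * (A * ((k : ℤ) + 1) ^ k) := by rw [Finset.sum_const, nsmul_eq_mul]
          _ ≤ s * (A * ((k : ℤ) + 1) ^ k) :=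
              mul_le_mul_of_nonneg_right (by exact_mod_cast (by omega : T.card ≤ s)) (by positivity)
          _ = A * ((s * (k + 1) ^ k : ℕ) : ℤ) := by push_cast; ring
          _ ≤ A * ((Z ^ k : ℕ) : ℤ) :=
              mul_le_mul_of_nonneg_left (by exact_mod_cast hZ) (by positivity)
          _ = A * Z ^ k := by push_cast; ring
      exact_mod_cast e1
    rw [abs_le] at hsumT
    have hu2 : (u i₂ : ℝ) ≤ -(θ * A) := by rw [← hu i₂ hi2]; exact hb2
    have hu2' : -(A : ℝ) ≤ u i₂ := by
      rw [← hu i₂ hi2]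
      exact_mod_cast (abs_le.1 (hbox i₂)).1
    have hnr : (n : ℝ) = -(u i₂ : ℝ) * (p₂ : ℝ) ^ k - ((∑ j ∈ T, u j * (p j : ℤ) ^ k : ℤ) : ℝ) := by
      rw [hn]
      push_cast
      ring
    refine le_trans ?_ (hcore (u i₁) n ?_ ?_ ?_ ?_ α ?_ ?_)
    · refine Nat.cast_le.2 (Finset.card_le_card_of_injOn (fun a => a ∘ e) ?_ ?_)
      · intro a ha
        rw [Finset.mem_coe, Finset.mem_filter, Finset.mem_filter, mem_intBox] at ha
        obtain ⟨⟨hbox', -, -, -, -, hno⟩, hfa'⟩ := ha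
        obtain ⟨hu', hα'⟩ := hfib a hfa'
        rw [Finset.mem_coe, Finset.mem_filter, mem_boxClass]
        refine ⟨fun l => ⟨hbox' _, ?_⟩, fun hsol => hno ?_⟩
        · rw [← hα' l]
          exact Int.dvd_self_sub_emod
        · rw [← hu' i₁ hi1] at hsol
          refine hasPrimeZero_of_hasPrimeSol h12 h1 h2 he (fun j hj => (hp j hj).1) hp₂ ?_ hsol
          rw [hn, hu' i₂ hi2]
          congr 1
          exact Finset.sum_congr rfl fun j hj => by rw [hu' j (hiT j hj)]
      · intro a ha b hb hab
        rw [Finset.mem_coe, Finset.mem_filter] at ha hb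
        funext j
        by_cases hj : j ∈ W
        · rw [(hfib a ha.2).1 j hj, (hfib b hb.2).1 j hj]
        · rw [hW] at hj
          obtain ⟨l, rfl⟩ := (he j).2 hj
          exact congrFun hab l
    · rw [← hu i₁ hi1]
      exact hb1
    · rw [← hu i₁ hi1]
      exact (abs_le.1 (hbox i₁)).2
    · have e1 : θ * A * (lam * Z) ^ k ≤ -(u i₂ : ℝ) * (p₂ : ℝ) ^ k :=
        mul_le_mul (by linarith) (pow_le_pow_left₀ (by positivity) (by exact_mod_cast hp₂1) k)
          (by positivity) (by linarith [mul_nonneg hθ (Nat.cast_nonneg (α := ℝ) A)])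
      have e2 : (lam : ℝ) ≤ (lam : ℝ) ^ k :=
        le_self_pow₀ (by exact_mod_cast hlam) hk.ne'
      have e3 : θ * lam ≤ θ * (lam : ℝ) ^ k := mul_le_mul_of_nonneg_left e2 hθ
      have e4 : (2 : ℝ) * (t * 2 ^ k) ≤ 2 ^ (k + 1) * s := by
        have : (t : ℝ) ≤ s := by exact_mod_cast (by omega : t ≤ s)
        rw [pow_succ]
        nlinarith [mul_le_mul_of_nonneg_left this (by positivity : (0 : ℝ) ≤ 2 ^ k * 2)]
      have e5 : (2 : ℝ) * (t * 2 ^ k) * (A * Z ^ k) ≤ (θ * lam ^ k - 1) * (A * Z ^ k) :=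
        mul_le_mul_of_nonneg_right (by linarith) (by positivity)
      have e6 : θ * A * (lam * Z) ^ k = θ * lam ^ k * (A * (Z : ℝ) ^ k) := by
        rw [mul_pow]; ring
      rw [hnr]
      linarith
    · have e1 : -(u i₂ : ℝ) * (p₂ : ℝ) ^ k ≤ A * (2 * lam * Z) ^ k :=
        mul_le_mul (by linarith) (pow_le_pow_left₀ (by positivity) (by exact_mod_cast hp₂2) k)
          (by positivity) (by positivity)
      have e2 : (A : ℝ) * (2 * lam * Z) ^ k = (2 * lam) ^ k * (A * (Z : ℝ) ^ k) := by
        rw [mul_pow]; ring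
      have e3 := mul_le_mul_of_nonneg_right hc₂ (by positivity : (0 : ℝ) ≤ A * (Z : ℝ) ^ k)
      rw [hnr]
      linarith
    · intro q hq hqH
      obtain ⟨j, hj, hqj⟩ := hbq q hq hqH
      obtain ⟨l, rfl⟩ := (he j).2 hj
      refine ⟨l, fun hd => hqj ?_⟩
      have h3 : (q : ℤ) ∣ a₀ (e l) - α l := (Int.natCast_dvd_natCast.2 hqH).trans (hαd l)
      have := dvd_add h3 hd
      simpa using this
    · have e1 : (modH k : ℤ) ∣ u i₂ * ((p₂ : ℤ) ^ k - 1) :=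
        Dvd.dvd.mul_left (modH_dvd_pow_sub_one hp₂L) _
      have e2 : (modH k : ℤ) ∣ ∑ l, (a₀ (e l) - α l) := Finset.dvd_sum fun l _ => hαd l
      rw [sum_eq_sum_embedding h12 h1 h2 he, hu i₁ hi1, hu i₂ hi2] at hbH
      have e3 : ∑ j ∈ T, a₀ j + ∑ j ∈ T, a₀ j * ((p j : ℤ) ^ k - 1) =
          ∑ j ∈ T, u j * (p j : ℤ) ^ k := by
        rw [← Finset.sum_add_distrib]
        exact Finset.sum_congr rfl fun j hj => by rw [hu j (hiT j hj)]; ring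
      rw [Finset.sum_sub_distrib] at e2
      have := dvd_sub (dvd_add hbH e1) e2
      have e4 : u i₁ + ∑ l, α l - n =
          u i₁ + (u i₂ + ∑ j ∈ T, a₀ j) + ∑ l, a₀ (e l) +
            ∑ j ∈ T, a₀ j * ((p j : ℤ) ^ k - 1) + u i₂ * ((p₂ : ℤ) ^ k - 1) -
            (∑ l, a₀ (e l) - ∑ l, α l) := by
        rw [hn, ← e3]
        ring
      rwa [e4]

end

section

attribute [local irreducible] modH

theorem Finset.exists_fin_cover {α : Type*} [Nonempty α] {n : ℕ} {T : Finset α} (hT : T.card ≤ n) :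
    ∃ τ : Fin n → α, ∀ j ∈ T, ∃ i, τ i = j := by
  refine ⟨fun i => if h : (i : ℕ) < T.card then (T.equivFin.symm ⟨i, h⟩ : α) else
    Classical.arbitrary α, fun j hj => ?_⟩
  have hlt := (T.equivFin ⟨j, hj⟩).2
  refine ⟨⟨T.equivFin ⟨j, hj⟩, hlt.trans_le hT⟩, ?_⟩
  simp

/-- The support of a function into `Fin (m + 1)`. -/
def finSupp {s m : ℕ} (w : Fin s → Fin (m + 1)) : Finset (Fin s) :=
  Finset.univ.filter fun j => w j ≠ 0

theorem mem_finSupp {s m : ℕ} {w : Fin s → Fin (m + 1)} {j : Fin s} : j ∈ finSupp w ↔ w j ≠ 0 := by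
  simp [finSupp]

theorem card_finSupp_le (s n m : ℕ) (hs : 0 < s) :
    (Finset.univ.filter fun w : Fin s → Fin (m + 1) => (finSupp w).card ≤ n).card ≤
      s ^ n * (m + 1) ^ n := by
  have : Nonempty (Fin s) := ⟨⟨0, hs⟩⟩
  set F : (Fin n → Fin s) × (Fin n → Fin (m + 1)) → Fin s → Fin (m + 1) := fun q j =>
    if h : ∃ i, q.1 i = j then q.2 h.choose else 0 with hF
  have hsub : (Finset.univ.filter fun w : Fin s → Fin (m + 1) => (finSupp w).card ≤ n) ⊆
      Finset.univ.image F := by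
    intro w hw
    rw [Finset.mem_filter] at hw
    obtain ⟨τ, hτ⟩ := Finset.exists_fin_cover hw.2
    refine Finset.mem_image.2 ⟨(τ, fun i => w (τ i)), Finset.mem_univ _, ?_⟩
    funext j
    by_cases h : ∃ i, τ i = j
    · rw [hF]
      simp only [dif_pos h]
      rw [h.choose_spec]
    · rw [hF]
      simp only [dif_neg h]
      by_contra hne
      exact h (hτ j (mem_finSupp.2 (Ne.symm hne)))
  refine (Finset.card_le_card hsub).trans (Finset.card_image_le.trans ?_)
  simp [Fintype.card_prod]

theorem exists_badAt {k s A : ℕ} (hk : 0 < k) {θ : ℝ} (hθA : 0 < θ * A) {a : Fin s → ℤ}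
    (hno : ¬ HasPrimeZero k a) (h1 : ∃ j, θ * A ≤ (a j : ℝ)) (h2 : ∃ j, (a j : ℝ) ≤ -(θ * A))
    (h3 : ∀ q : ℕ, q.Prime → q ≤ k + 1 →
      modH k + 2 < (Finset.univ.filter fun j => ¬ (q : ℤ) ∣ a j).card) :
    ∃ i₁ i₂ : Fin s, ∃ w : Fin s → Fin (k + 1 + 1), i₁ ≠ i₂ ∧ w i₁ = 0 ∧ w i₂ = 0 ∧
      (∀ j ∈ finSupp w, (w j : ℕ).Prime) ∧ (finSupp w).card < modH k ∧
      BadAt k A θ i₁ i₂ (finSupp w) (fun j => (w j : ℕ)) a := by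
  obtain ⟨i₁, h1⟩ := h1
  obtain ⟨i₂, h2⟩ := h2
  have h12 : i₁ ≠ i₂ := by
    rintro rfl
    linarith
  obtain ⟨T, p, hT, hdis, hp, hdvd⟩ := exists_corrector (a := a) hk {i₁, i₂} fun q hq hqk => by
    rw [Finset.card_pair h12]
    exact (h3 q hq hqk).le
  set w : Fin s → Fin (k + 1 + 1) := fun j => if j ∈ T then Fin.ofNat (k + 1 + 1) (p j) else 0
    with hw
  have hwT : ∀ j ∈ T, (w j : ℕ) = p j := fun j hj => by
    rw [hw]
    simp only [if_pos hj]
    exact Nat.mod_eq_of_lt (by have := (hp j hj).2; omega)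
  have hsupp : finSupp w = T := by
    ext j
    rw [mem_finSupp]
    refine ⟨fun h => ?_, fun hj h0 => ?_⟩
    · by_contra hj
      exact h (if_neg hj)
    · have e1 := hwT j hj
      rw [h0] at e1
      exact (hp j hj).1.ne_zero e1.symm
  have hn1 : i₁ ∉ T := fun h => Finset.disjoint_left.1 hdis h (by simp)
  have hn2 : i₂ ∉ T := fun h => Finset.disjoint_left.1 hdis h (by simp)
  refine ⟨i₁, i₂, w, h12, if_neg hn1, if_neg hn2, ?_, by rwa [hsupp], h1, h2, ?_, ?_, hno⟩
  · intro j hj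
    rw [hsupp] at hj
    rw [hwT j hj]
    exact (hp j hj).1
  · intro q hq hqH
    rw [hsupp]
    obtain ⟨l, hl, hlW⟩ := Finset.exists_mem_notMem_of_card_lt_card
      (s := insert i₁ (insert i₂ T)) (t := Finset.univ.filter fun j => ¬ (q : ℤ) ∣ a j) (by
        have e1 := h3 q hq (prime_le_of_dvd_modH hk hq hqH)
        have e2 := Finset.card_insert_le i₁ (insert i₂ T)
        have e3 := Finset.card_insert_le i₂ T
        omega)
    exact ⟨l, hlW, (Finset.mem_filter.1 hl).2⟩
  · rw [hsupp]
    have e : ∑ j ∈ T, a j * (((w j : ℕ) : ℤ) ^ k - 1) = ∑ j ∈ T, a j * ((p j : ℤ) ^ k - 1) :=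
      Finset.sum_congr rfl fun j hj => by rw [hwT j hj]
    rw [e]
    exact hdvd

theorem one_add_div_pow_le {s : ℕ} (hs : 0 < s) {c : ℝ} (hc : 0 ≤ c) :
    (1 + c / s) ^ s ≤ Real.exp c := by
  have hs' : (0 : ℝ) < s := by exact_mod_cast hs
  calc (1 + c / s) ^ s ≤ (Real.exp (c / s)) ^ s :=
        pow_le_pow_left₀ (by positivity) (by linarith [Real.add_one_le_exp (c / s)]) s
    _ = Real.exp c := by
        rw [← Real.exp_nat_mul]
        congr 1
        field_simp

theorem card_box_le_of_forall_mem {s A : ℕ} (hs : 0 < s) (hA : s ≤ A) {P : (Fin s → ℤ) → Prop}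
    [DecidablePred P] {lo hi : ℤ} (hlen : (hi : ℝ) - lo ≤ A + 1 / s * A)
    (h : ∀ a ∈ intBox s A, P a → ∀ j, lo ≤ a j ∧ a j ≤ hi) :
    (((intBox s A).filter P).card : ℝ) ≤ Real.exp 2 * A ^ s := by
  have hs' : (0 : ℝ) < s := by exact_mod_cast hs
  have hA' : (s : ℝ) ≤ A := by exact_mod_cast hA
  have hsub : (intBox s A).filter P ⊆ Fintype.piFinset fun _ => Finset.Icc lo hi := by
    intro a ha
    rw [Finset.mem_filter] at ha
    rw [Fintype.mem_piFinset]
    exact fun j => Finset.mem_Icc.2 (h a ha.1 ha.2 j)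
  have hc : ((Finset.Icc lo hi).card : ℝ) ≤ (1 + 2 / s) * A := by
    have h1 : (1 : ℝ) ≤ 1 / s * A := by
      rw [one_div, inv_mul_eq_div, le_div_iff₀ hs']
      linarith
    have h2 : ((1 : ℝ) + 2 / s) * A = A + 1 / s * A + 1 / s * A := by ring
    rw [Int.card_Icc]
    rcases le_total 0 (hi + 1 - lo) with h0 | h0
    · have h3 : (((hi + 1 - lo).toNat : ℕ) : ℝ) = hi + 1 - lo := by
        have : (((hi + 1 - lo).toNat : ℕ) : ℤ) = hi + 1 - lo := Int.toNat_of_nonneg h0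
        exact_mod_cast this
      rw [h3]
      linarith
    · rw [Int.toNat_of_nonpos h0, Nat.cast_zero]
      positivity
  calc (((intBox s A).filter P).card : ℝ) ≤
        ((Fintype.piFinset fun _ : Fin s => Finset.Icc lo hi).card : ℝ) :=
        Nat.cast_le.2 (Finset.card_le_card hsub)
    _ = ((Finset.Icc lo hi).card : ℝ) ^ s := by rw [Fintype.card_piFinset_const]; push_cast; rfl
    _ ≤ ((1 + 2 / s) * A) ^ s := pow_le_pow_left₀ (by positivity) hc s
    _ = (1 + 2 / s) ^ s * A ^ s := by rw [mul_pow]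
    _ ≤ Real.exp 2 * A ^ s :=
        mul_le_mul_of_nonneg_right (one_add_div_pow_le hs (by norm_num)) (by positivity)

theorem card_filter_dvd_Icc_le {q : ℕ} (hq : 2 ≤ q) (A : ℕ) :
    ((Finset.Icc (-(A : ℤ)) A).filter fun b : ℤ => (q : ℤ) ∣ b).card ≤ A + 1 := by
  have hqz : (0 : ℤ) < q := by exact_mod_cast (by omega : 0 < q)
  have hsub : ((Finset.Icc (-(A : ℤ)) A).filter fun b : ℤ => (q : ℤ) ∣ b) ⊆
      (Finset.Icc (-((A / q : ℕ) : ℤ)) ((A / q : ℕ) : ℤ)).image fun c => (q : ℤ) * c := by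
    intro b hb
    rw [Finset.mem_filter, Finset.mem_Icc] at hb
    obtain ⟨⟨h1, h2⟩, c, rfl⟩ := hb
    refine Finset.mem_image.2 ⟨c, ?_, rfl⟩
    rw [Finset.mem_Icc]
    push_cast
    refine ⟨?_, ?_⟩
    · rw [neg_le, Int.le_ediv_iff_mul_le hqz]
      linarith
    · rw [Int.le_ediv_iff_mul_le hqz]
      linarith
  refine (Finset.card_le_card hsub).trans (Finset.card_image_le.trans ?_)
  rw [Int.card_Icc]
  have : A / q ≤ A / 2 := Nat.div_le_div_left hq (by norm_num)
  omega

theorem card_box_filter_dvd_le {s A q m : ℕ} (hs : 0 < s) (hA : s ≤ A) (hq : 2 ≤ q) :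
    (((intBox s A).filter fun a =>
      (Finset.univ.filter fun j => ¬ (q : ℤ) ∣ a j).card ≤ m).card : ℝ) ≤
      (s ^ m * 4 ^ m) * (Real.exp 2 * A ^ s) := by
  set D := Finset.univ.filter fun w : Fin s → Fin (1 + 1) => (finSupp w).card ≤ m with hD
  set B : (Fin s → Fin (1 + 1)) → Finset (Fin s → ℤ) := fun w => Fintype.piFinset fun j =>
    if w j = 0 then (Finset.Icc (-(A : ℤ)) A).filter fun b : ℤ => (q : ℤ) ∣ b else
      Finset.Icc (-(A : ℤ)) A with hB
  have hsub : ((intBox s A).filter fun a =>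
      (Finset.univ.filter fun j => ¬ (q : ℤ) ∣ a j).card ≤ m) ⊆ D.biUnion B := by
    intro a ha
    rw [Finset.mem_filter, mem_intBox] at ha
    obtain ⟨w, hw⟩ : ∃ w : Fin s → Fin (1 + 1), w = fun j => if (q : ℤ) ∣ a j then 0 else 1 :=
      ⟨_, rfl⟩
    have hsw : finSupp w = Finset.univ.filter fun j => ¬ (q : ℤ) ∣ a j := by
      ext j
      rw [mem_finSupp, hw]
      by_cases h : (q : ℤ) ∣ a j <;> simp [h]
    refine Finset.mem_biUnion.2 ⟨w, ?_, ?_⟩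
    · rw [hD, Finset.mem_filter, hsw]
      exact ⟨Finset.mem_univ _, ha.2⟩
    · rw [hB, Fintype.mem_piFinset]
      intro j
      have hj := abs_le.1 (ha.1 j)
      by_cases h : (q : ℤ) ∣ a j
      · simp [hw, h, hj]
      · simp [hw, h, hj]
  have hBc : ∀ w ∈ D, (B w).card ≤ 2 ^ m * (A + 1) ^ s := by
    intro w hw
    rw [hD, Finset.mem_filter] at hw
    rw [hB, Fintype.card_piFinset]
    calc _ ≤ ∏ j : Fin s, (if w j ≠ 0 then 2 else 1) * (A + 1) :=
          Finset.prod_le_prod' fun j _ => by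
            by_cases h : w j = 0
            · simpa [h] using card_filter_dvd_Icc_le hq A
            · simp only [h, if_false, ne_eq, not_false_iff, if_true, Int.card_Icc]
              omega
      _ = 2 ^ (finSupp w).card * (A + 1) ^ s := by
          rw [Finset.prod_mul_distrib, Finset.prod_ite, Finset.prod_const, Finset.prod_const_one,
            mul_one, Finset.prod_const, Finset.card_univ, Fintype.card_fin]
          rfl
      _ ≤ 2 ^ m * (A + 1) ^ s :=
          Nat.mul_le_mul_right _ (Nat.pow_le_pow_right (by norm_num) hw.2)
  have hs' : (0 : ℝ) < s := by exact_mod_cast hs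
  have hA' : (s : ℝ) ≤ A := by exact_mod_cast hA
  have hA1 : ((A : ℝ) + 1) ^ s ≤ Real.exp 2 * A ^ s := by
    calc ((A : ℝ) + 1) ^ s ≤ ((1 + 2 / s) * A) ^ s := by
          refine pow_le_pow_left₀ (by positivity) ?_ s
          have h1 : (1 : ℝ) ≤ A / s := by rw [le_div_iff₀ hs']; linarith
          have h2 : ((1 : ℝ) + 2 / s) * A = A + 2 * (A / s) := by ring
          linarith
      _ = (1 + 2 / s) ^ s * A ^ s := by rw [mul_pow]
      _ ≤ Real.exp 2 * A ^ s :=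
          mul_le_mul_of_nonneg_right (one_add_div_pow_le hs (by norm_num)) (by positivity)
  have hN : ((intBox s A).filter fun a =>
      (Finset.univ.filter fun j => ¬ (q : ℤ) ∣ a j).card ≤ m).card ≤
      (s ^ m * (1 + 1) ^ m) * (2 ^ m * (A + 1) ^ s) :=
    (Finset.card_le_card hsub).trans ((Finset.card_biUnion_le_card_mul _ _ _ hBc).trans
      (Nat.mul_le_mul_right _ (card_finSupp_le s m 1 hs)))
  calc _ ≤ (((s ^ m * (1 + 1) ^ m) * (2 ^ m * (A + 1) ^ s) : ℕ) : ℝ) := Nat.cast_le.2 hN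
    _ = (s ^ m * 4 ^ m) * ((A : ℝ) + 1) ^ s := by
        push_cast
        rw [show (4 : ℝ) = (1 + 1) * 2 by norm_num, mul_pow]
        ring
    _ ≤ _ := mul_le_mul_of_nonneg_left hA1 (by positivity)

end

section

attribute [local irreducible] modH

theorem exists_prime_window {k lam : ℕ} (hlam : 0 < lam) :
    ∃ Z₀ : ℕ, ∀ Z ≥ Z₀, ∃ p : ℕ, p.Prime ∧ (modL k : ℤ) ∣ (p : ℤ) - 1 ∧ lam * Z ≤ p ∧
      p ≤ 2 * lam * Z := by
  have : NeZero (modL k) := ⟨(modL_pos k).ne'⟩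
  obtain ⟨c, hc, hw⟩ := primes_window (ρ := 2) (by norm_num)
  have h1 := (hw (modL k) this 1 isUnit_one).and (eventually_gt_atTop 1)
  obtain ⟨x₀, hx₀⟩ := eventually_atTop.1 h1
  refine ⟨⌈x₀⌉₊, fun Z hZ => ?_⟩
  have hx : x₀ ≤ ((lam * Z : ℕ) : ℝ) := by
    refine (Nat.le_ceil x₀).trans ?_
    exact_mod_cast hZ.le.trans (Nat.le_mul_of_pos_left Z hlam)
  obtain ⟨h2, h3⟩ := hx₀ _ hx
  have hφ : (0 : ℝ) < (modL k).totient := by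
    exact_mod_cast Nat.totient_pos.2 (modL_pos k)
  have hlog : 0 < Real.log ((lam * Z : ℕ) : ℝ) := Real.log_pos h3
  have hpos : (0 : ℝ) < c * ((modL k).totient : ℝ)⁻¹ * ((lam * Z : ℕ) : ℝ) /
      Real.log ((lam * Z : ℕ) : ℝ) := by positivity
  have h4 := hpos.trans_le h2
  rw [Nat.cast_pos, Finset.card_pos] at h4
  obtain ⟨p, hp⟩ := h4
  rw [Finset.mem_filter, Finset.mem_Ioc, Nat.floor_natCast] at hp
  have e : ⌊(2 : ℝ) * ((lam * Z : ℕ) : ℝ)⌋₊ = 2 * lam * Z := by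
    rw [show (2 : ℝ) * ((lam * Z : ℕ) : ℝ) = ((2 * lam * Z : ℕ) : ℝ) by push_cast; ring,
      Nat.floor_natCast]
  rw [e] at hp
  refine ⟨p, hp.2.1, ?_, hp.1.1.le, hp.1.2⟩
  rw [← ZMod.intCast_zmod_eq_zero_iff_dvd]
  push_cast
  rw [hp.2.2, sub_self]

theorem exists_pow_scale {E : ℕ} (hE : 0 < E) (Z₁ : ℕ) :
    ∃ A₀ : ℕ, ∀ A ≥ A₀, ∃ Z ≥ Z₁, Z ^ E ≤ A ∧ A ≤ (2 * Z) ^ E := by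
  refine ⟨(Z₁ + 1) ^ E, fun A hA => ?_⟩
  have h1 : Z₁ + 1 ≤ A := (Nat.le_self_pow hE.ne' _).trans hA
  obtain ⟨Z, hZ⟩ : ∃ Z, Z = Nat.findGreatest (fun Z => Z ^ E ≤ A) A := ⟨_, rfl⟩
  have hZ1 : Z₁ + 1 ≤ Z := by
    rw [hZ]
    exact Nat.le_findGreatest h1 hA
  refine ⟨Z, by omega, ?_, ?_⟩
  · rw [hZ]
    exact Nat.findGreatest_spec (P := fun Z => Z ^ E ≤ A) h1 hA
  · have h2 : A ≤ (Z + 1) ^ E := by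
      rcases le_or_gt (Z + 1) A with h | h
      · have h3 := Nat.findGreatest_is_greatest (P := fun Z => Z ^ E ≤ A) (n := A) (k := Z + 1)
          (by omega) h
        omega
      · exact h.le.trans (Nat.le_self_pow hE.ne' _)
    exact h2.trans (Nat.pow_le_pow_left (by omega) E)

theorem exists_uniform_core {k : ℕ} (hk : 0 < k) :
    ∃ C : ℝ, 0 < C ∧ ∃ t₀ : ℕ, ∀ s : ℕ, ∀ θ c₂ : ℝ, 0 < θ → 0 < c₂ → ∃ Z₀ : ℕ, ∀ Z ≥ Z₀, ∀ A : ℕ,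
      Z ^ (2 * k + 1) ≤ A → A ≤ (2 * Z) ^ (2 * k + 1) → ∀ t, t₀ ≤ t → t ≤ s →
      CoreBound k t C θ c₂ Z A := by
  obtain ⟨C, hC, t₀, h⟩ := exists_core hk (le_refl (2 * k + 1))
  refine ⟨C, hC, t₀, fun s θ c₂ hθ hc₂ => ?_⟩
  have h' : ∀ t : ℕ, ∃ Z₀ : ℕ, t₀ ≤ t → ∀ Z ≥ Z₀, ∀ A : ℕ, Z ^ (2 * k + 1) ≤ A →
      A ≤ (2 * Z) ^ (2 * k + 1) → CoreBound k t C θ c₂ Z A := fun t => by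
    by_cases ht : t₀ ≤ t
    · obtain ⟨Z₀, hZ₀⟩ := h t ht θ c₂ hθ hc₂
      exact ⟨Z₀, fun _ => hZ₀⟩
    · exact ⟨0, fun h => absurd h ht⟩
  choose Z₀ hZ₀ using h'
  refine ⟨(Finset.range (s + 1)).sup Z₀, fun Z hZ A hA1 hA2 t ht hts => ?_⟩
  exact hZ₀ t ht Z ((Finset.le_sup (f := Z₀) (Finset.mem_range.2 (by omega))).trans hZ) A hA1 hA2

theorem badAt_bound_le {A H c t s : ℕ} {C : ℝ} (hC : 0 ≤ C) (hA : 1 ≤ A) (hH : 0 < H)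
    (hc : c < H) (hts : c + 2 + t = s) :
    ((2 * A + 1) ^ (c + 2) * (H : ℝ) ^ t) * (C * (1 / 2) ^ t * (2 * A / H) ^ t) ≤
      C * 4 ^ (H + 1) * (A : ℝ) ^ s := by
  have hA' : (1 : ℝ) ≤ A := by exact_mod_cast hA
  have hH' : (H : ℝ) ≠ 0 := by exact_mod_cast hH.ne'
  have e : ((2 * A + 1) ^ (c + 2) * (H : ℝ) ^ t) * (C * (1 / 2) ^ t * (2 * A / H) ^ t) =
      C * (2 * A + 1) ^ (c + 2) * (A : ℝ) ^ t := by
    have : (H : ℝ) ^ t * ((1 / 2) ^ t * (2 * A / H) ^ t) = (A : ℝ) ^ t := by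
      rw [← mul_pow, ← mul_pow]
      congr 1
      field_simp
    linear_combination (C * (2 * A + 1) ^ (c + 2)) * this
  rw [e]
  calc C * (2 * A + 1) ^ (c + 2) * (A : ℝ) ^ t ≤ C * (4 * A) ^ (c + 2) * (A : ℝ) ^ t := by
        gcongr
        linarith
    _ = C * 4 ^ (c + 2) * (A : ℝ) ^ s := by
        rw [← hts, pow_add (A : ℝ) (c + 2) t, mul_pow]
        ring
    _ ≤ C * 4 ^ (H + 1) * (A : ℝ) ^ s := by
        refine mul_le_mul_of_nonneg_right (mul_le_mul_of_nonneg_left ?_ hC) (by positivity)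
        exact pow_le_pow_right₀ (by norm_num) (by omega)

theorem card_not_hasPrimeZero_le {k : ℕ} (hk : 0 < k) :
    ∃ K : ℝ, 0 < K ∧ ∃ s₀ : ℕ, ∀ s ≥ s₀, ∃ A₀ : ℕ, ∀ A ≥ A₀,
      (((intBox s A).filter fun a => ¬ HasPrimeZero k a).card : ℝ) ≤
        K * s ^ (modH k + 2) * A ^ s := by
  obtain ⟨C, hC, t₀, hcore⟩ := exists_uniform_core hk
  have hH := modH_pos hk
  obtain ⟨m, hm⟩ : ∃ m, m = modH k + 2 := ⟨_, rfl⟩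
  refine ⟨2 * Real.exp 2 + (k + 2) * (4 ^ m * Real.exp 2) +
    ((k + 2) ^ modH k * (C * 4 ^ (modH k + 1))), by positivity, t₀ + modH k + 2, fun s hs => ?_⟩
  have hs0 : 0 < s := by omega
  have hs' : (1 : ℝ) ≤ s := by exact_mod_cast hs0
  obtain ⟨lam, hlam⟩ : ∃ lam, lam = s * (2 ^ (k + 1) * s + 1) := ⟨_, rfl⟩
  have hlam0 : 0 < lam := by rw [hlam]; positivity
  obtain ⟨Z₁, hZ₁⟩ := hcore s (1 / s) ((2 * lam) ^ k + 1) (by positivity) (by positivity)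
  obtain ⟨Z₂, hZ₂⟩ := exists_prime_window (k := k) hlam0
  obtain ⟨A₀, hA₀⟩ := exists_pow_scale (E := 2 * k + 1) (by omega) (Z₁ + Z₂ + s * (k + 1) ^ k)
  refine ⟨A₀ + s, fun A hA => ?_⟩
  obtain ⟨Z, hZ, hZA1, hZA2⟩ := hA₀ A (by omega)
  obtain ⟨p₂, hp₂, hp₂L, hp₂1, hp₂2⟩ := hZ₂ Z (by omega)
  have hsA : s ≤ A := by omega
  have hA' : (0 : ℝ) < A := by exact_mod_cast (by omega : 0 < A)
  have hθA : (0 : ℝ) < 1 / s * A := by positivity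
  obtain ⟨F1, hF1⟩ : ∃ F, F = (intBox s A).filter fun a => ∀ j, (a j : ℝ) < 1 / s * A := ⟨_, rfl⟩
  obtain ⟨F2, hF2⟩ : ∃ F, F = (intBox s A).filter fun a => ∀ j, -(1 / s * A) < (a j : ℝ) :=
    ⟨_, rfl⟩
  obtain ⟨F3, hF3⟩ : ∃ F : ℕ → Finset (Fin s → ℤ), F = fun q : ℕ => (intBox s A).filter fun a =>
    (Finset.univ.filter fun j => ¬ (q : ℤ) ∣ a j).card ≤ m := ⟨_, rfl⟩
  obtain ⟨Q, hQ⟩ : ∃ Q, Q = (Finset.range (k + 2)).filter Nat.Prime := ⟨_, rfl⟩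
  obtain ⟨V, hV⟩ : ∃ V : Finset (Fin s → Fin (k + 1 + 1)),
    V = Finset.univ.filter fun w => (finSupp w).card ≤ modH k := ⟨_, rfl⟩
  obtain ⟨I, hI⟩ : ∃ I : Finset (Fin s × Fin s × (Fin s → Fin (k + 1 + 1))),
    I = (Finset.univ ×ˢ (Finset.univ ×ˢ V)).filter fun q => q.1 ≠ q.2.1 ∧ q.2.2 q.1 = 0 ∧
      q.2.2 q.2.1 = 0 ∧ (∀ j ∈ finSupp q.2.2, (q.2.2 j : ℕ).Prime) ∧
      (finSupp q.2.2).card < modH k := ⟨_, rfl⟩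
  obtain ⟨F4, hF4⟩ : ∃ F : Fin s × Fin s × (Fin s → Fin (k + 1 + 1)) → Finset (Fin s → ℤ),
    F = fun q : Fin s × Fin s × (Fin s → Fin (k + 1 + 1)) => (intBox s A).filter
      (BadAt k A (1 / s) q.1 q.2.1 (finSupp q.2.2) fun j => (q.2.2 j : ℕ)) := ⟨_, rfl⟩
  have hsub : ((intBox s A).filter fun a => ¬ HasPrimeZero k a) ⊆
      (F1 ∪ F2) ∪ (Q.biUnion F3) ∪ (I.biUnion F4) := by
    intro a ha
    rw [Finset.mem_filter] at ha
    rw [Finset.mem_union, Finset.mem_union, Finset.mem_union]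
    by_cases h1 : ∃ j, 1 / (s : ℝ) * A ≤ (a j : ℝ)
    swap
    · push Not at h1
      exact Or.inl (Or.inl (Or.inl (by rw [hF1, Finset.mem_filter]; exact ⟨ha.1, h1⟩)))
    by_cases h2 : ∃ j, (a j : ℝ) ≤ -(1 / (s : ℝ) * A)
    swap
    · push Not at h2
      exact Or.inl (Or.inl (Or.inr (by rw [hF2, Finset.mem_filter]; exact ⟨ha.1, h2⟩)))
    by_cases h3 : ∀ q : ℕ, q.Prime → q ≤ k + 1 →
      modH k + 2 < (Finset.univ.filter fun j => ¬ (q : ℤ) ∣ a j).card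
    swap
    · push Not at h3
      obtain ⟨q, hq, hqk, hqc⟩ := h3
      refine Or.inl (Or.inr (Finset.mem_biUnion.2 ⟨q, ?_, ?_⟩))
      · rw [hQ, Finset.mem_filter, Finset.mem_range]
        exact ⟨by omega, hq⟩
      · rw [hF3, Finset.mem_filter, hm]
        exact ⟨ha.1, hqc⟩
    obtain ⟨i₁, i₂, w, h12, hw1, hw2, hwp, hwc, hbad⟩ := exists_badAt hk hθA ha.2 h1 h2 h3
    refine Or.inr (Finset.mem_biUnion.2 ⟨(i₁, i₂, w), ?_, ?_⟩)
    · rw [hI, Finset.mem_filter, Finset.mem_product, Finset.mem_product, hV, Finset.mem_filter]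
      exact ⟨⟨Finset.mem_univ _, Finset.mem_univ _, Finset.mem_univ _, hwc.le⟩, h12, hw1, hw2, hwp,
        hwc⟩
    · rw [hF4, Finset.mem_filter]
      exact ⟨ha.1, hbad⟩
  have hb1 : (F1.card : ℝ) ≤ Real.exp 2 * A ^ s := by
    rw [hF1]
    refine card_box_le_of_forall_mem hs0 hsA (lo := -A) (hi := ⌊1 / (s : ℝ) * A⌋) ?_ ?_
    · have := Int.floor_le (1 / (s : ℝ) * A)
      push_cast
      linarith
    · intro a ha h j
      exact ⟨(abs_le.1 (mem_intBox.1 ha j)).1, Int.le_floor.2 (h j).le⟩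
  have hb2 : (F2.card : ℝ) ≤ Real.exp 2 * A ^ s := by
    rw [hF2]
    refine card_box_le_of_forall_mem hs0 hsA (lo := ⌈-(1 / (s : ℝ) * A)⌉) (hi := A) ?_ ?_
    · have := Int.le_ceil (-(1 / (s : ℝ) * A))
      push_cast
      linarith
    · intro a ha h j
      exact ⟨Int.ceil_le.2 (h j).le, (abs_le.1 (mem_intBox.1 ha j)).2⟩
  have hb3 : ((Q.biUnion F3).card : ℝ) ≤ (k + 2) * ((s ^ m * 4 ^ m) * (Real.exp 2 * A ^ s)) := by
    have e1 : ((Q.biUnion F3).card : ℝ) ≤ ∑ q ∈ Q, ((F3 q).card : ℝ) := by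
      exact_mod_cast Finset.card_biUnion_le
    have e2 : ∀ q ∈ Q, ((F3 q).card : ℝ) ≤ (s ^ m * 4 ^ m) * (Real.exp 2 * A ^ s) := by
      intro q hq
      rw [hQ, Finset.mem_filter] at hq
      rw [hF3]
      exact card_box_filter_dvd_le hs0 hsA hq.2.two_le
    have e3 : (Q.card : ℝ) ≤ k + 2 := by
      have := Finset.card_filter_le (Finset.range (k + 2)) Nat.Prime
      rw [Finset.card_range, ← hQ] at this
      exact_mod_cast this
    refine e1.trans ((Finset.sum_le_card_nsmul _ _ _ e2).trans ?_)
    rw [nsmul_eq_mul]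
    exact mul_le_mul_of_nonneg_right e3 (by positivity)
  have hb4 : ((I.biUnion F4).card : ℝ) ≤
      (s * (s * (s ^ modH k * (k + 2) ^ modH k))) * (C * 4 ^ (modH k + 1) * A ^ s) := by
    have e1 : ((I.biUnion F4).card : ℝ) ≤ ∑ q ∈ I, ((F4 q).card : ℝ) := by
      exact_mod_cast Finset.card_biUnion_le
    have e2 : ∀ q ∈ I, ((F4 q).card : ℝ) ≤ C * 4 ^ (modH k + 1) * A ^ s := by
      rintro ⟨i₁, i₂, w⟩ hq
      rw [hI, Finset.mem_filter] at hq
      obtain ⟨-, h12, hw1, hw2, hwp, hwc⟩ := hq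
      simp only at h12 hw1 hw2 hwp hwc
      obtain ⟨t, ht⟩ : ∃ t, t = s - ((finSupp w).card + 2) := ⟨_, rfl⟩
      have hts : (finSupp w).card + 2 + t = s := by omega
      rw [hF4]
      refine (card_badAt_le (c₂ := (2 * lam) ^ k + 1) (lam := lam) (p₂ := p₂) hk
        (hZ₁ Z (by omega) A hZA1 hZA2 t (by omega) (by omega))
        hC.le h12 (fun h => mem_finSupp.1 h hw1) (fun h => mem_finSupp.1 h hw2)
        (fun j hj => ⟨hwp j hj, Nat.lt_succ_iff.1 (w j).2⟩) hts hp₂ hp₂L hp₂1 hp₂2 hlam0 ?_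
        (by positivity) ?_ le_rfl).trans (badAt_bound_le hC.le (by omega) hH hwc hts)
      · rw [hlam]
        push_cast
        rw [one_div, inv_mul_cancel_left₀ (by positivity)]
      · exact (by omega : s * (k + 1) ^ k ≤ Z).trans (Nat.le_self_pow hk.ne' _)
    have e3 : (I.card : ℝ) ≤ s * (s * (s ^ modH k * (k + 2) ^ modH k)) := by
      have h1 : I.card ≤ s * (s * V.card) := by
        rw [hI]
        refine (Finset.card_filter_le _ _).trans (le_of_eq ?_)
        rw [Finset.card_product, Finset.card_product, Finset.card_univ, Fintype.card_fin]
      have h2 : V.card ≤ s ^ modH k * (k + 1 + 1) ^ modH k := by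
        rw [hV]
        exact card_finSupp_le s (modH k) (k + 1) hs0
      exact_mod_cast h1.trans (Nat.mul_le_mul_left _ (Nat.mul_le_mul_left _ h2))
    refine e1.trans ((Finset.sum_le_card_nsmul _ _ _ e2).trans ?_)
    rw [nsmul_eq_mul]
    exact mul_le_mul_of_nonneg_right e3 (by positivity)
  have htot : (((intBox s A).filter fun a => ¬ HasPrimeZero k a).card : ℝ) ≤
      F1.card + F2.card + (Q.biUnion F3).card + (I.biUnion F4).card := by
    have h1 := Finset.card_le_card hsub
    have h2 := Finset.card_union_le ((F1 ∪ F2) ∪ (Q.biUnion F3)) (I.biUnion F4)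
    have h3 := Finset.card_union_le (F1 ∪ F2) (Q.biUnion F3)
    have h4 := Finset.card_union_le F1 F2
    exact_mod_cast (by omega : _ ≤ F1.card + F2.card + (Q.biUnion F3).card + (I.biUnion F4).card)
  have hsm : (1 : ℝ) ≤ (s : ℝ) ^ m := one_le_pow₀ hs'
  have hX : Real.exp 2 * (A : ℝ) ^ s ≤ (s : ℝ) ^ m * (Real.exp 2 * A ^ s) :=
    le_mul_of_one_le_left (by positivity) hsm
  have e5 : (s : ℝ) * (s * (s ^ modH k * (k + 2) ^ modH k)) = s ^ m * (k + 2) ^ modH k := by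
    rw [hm, pow_add]; ring
  rw [e5] at hb4
  rw [← hm]
  linear_combination htot + hb1 + hb2 + hb3 + hb4 + 2 * hX

end

theorem card_intBox (s A : ℕ) : (intBox s A).card = (2 * A + 1) ^ s := by
  rw [intBox, Fintype.card_piFinset_const, Int.card_Icc]
  congr 1
  omega

theorem card_intBox_ne_zero (s A : ℕ) :
    ((intBox s A).filter fun a => ∀ j, a j ≠ 0).card = (2 * A) ^ s := by
  have e : ((intBox s A).filter fun a => ∀ j, a j ≠ 0) =
      Fintype.piFinset fun _ : Fin s => (Finset.Icc (-(A : ℤ)) A).erase 0 := by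
    ext a
    simp only [Finset.mem_filter, intBox, Fintype.mem_piFinset, Finset.mem_erase]
    exact ⟨fun h j => ⟨h.2 j, h.1 j⟩, fun h => ⟨fun j => (h j).2, fun j => (h j).1⟩⟩
  rw [e, Fintype.card_piFinset_const, Finset.card_erase_of_mem (by simp), Int.card_Icc]
  congr 1
  omega

theorem mem_intBox_floor_iff {s : ℕ} {A : ℝ} (hA : 0 ≤ A) {a : Fin s → ℤ} :
    a ∈ intBox s ⌊A⌋₊ ↔ hgt a ≤ A := by
  rw [mem_intBox, hgt, ← Nat.le_floor_iff hA, Finset.sup_le_iff]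
  refine forall_congr' fun j => ?_
  rw [Int.abs_eq_natAbs, Nat.cast_le]
  simp

theorem ncard_primeZero_eq {s : ℕ} (k : ℕ) {A : ℝ} (hA : 0 ≤ A) :
    {a : Fin s → ℤ | (∀ j, a j ≠ 0) ∧ hgt a ≤ A ∧
      ∃ x : Fin s → ℕ, (∀ j, (x j).Prime) ∧ ∑ j, a j * (x j : ℤ) ^ k = 0}.ncard =
    ((intBox s ⌊A⌋₊).filter fun a => (∀ j, a j ≠ 0) ∧ HasPrimeZero k a).card := by
  rw [← Set.ncard_coe_finset]
  congr 1
  ext a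
  rw [Finset.mem_coe, Finset.mem_filter, mem_intBox_floor_iff hA, Set.mem_ofPred_eq, HasPrimeZero]
  tauto

theorem liminf_primeZero_ge {k s : ℕ} {δ : ℝ} {A₀ : ℕ}
    (h : ∀ A ≥ A₀, (((intBox s A).filter fun a =>
      (∀ j, a j ≠ 0) ∧ ¬ HasPrimeZero k a).card : ℝ) ≤ δ * (2 * A) ^ s) :
    1 - δ ≤ Filter.liminf (fun A : ℝ =>
      ({a : Fin s → ℤ | (∀ j, a j ≠ 0) ∧ hgt a ≤ A ∧
        ∃ x : Fin s → ℕ, (∀ j, (x j).Prime) ∧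
          ∑ j, a j * (x j : ℤ) ^ k = 0}.ncard : ℝ) / (2 * A) ^ s) atTop := by
  have hg : Tendsto (fun A : ℝ => ((⌊A⌋₊ : ℝ) / A) ^ s * (1 - δ)) atTop (nhds (1 - δ)) := by
    have := ((tendsto_nat_floor_div_atTop (R := ℝ)).pow s).mul_const (1 - δ)
    simpa using this
  rw [← hg.liminf_eq]
  refine liminf_le_liminf ?_ hg.isBoundedUnder_ge ?_
  · filter_upwards [eventually_ge_atTop ((A₀ : ℝ) + 1)] with A hA
    have hA0 : 0 < A := by linarith [Nat.cast_nonneg (α := ℝ) A₀]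
    rw [ncard_primeZero_eq k hA0.le, le_div_iff₀ (by positivity)]
    have h1 := h ⌊A⌋₊ (Nat.le_floor (by linarith))
    have h2 : (2 * ⌊A⌋₊) ^ s ≤
        ((intBox s ⌊A⌋₊).filter fun a => (∀ j, a j ≠ 0) ∧ HasPrimeZero k a).card +
        ((intBox s ⌊A⌋₊).filter fun a => (∀ j, a j ≠ 0) ∧ ¬ HasPrimeZero k a).card := by
      rw [← card_intBox_ne_zero]
      refine (Finset.card_le_card fun a ha => ?_).trans (Finset.card_union_le _ _)
      rw [Finset.mem_filter] at ha
      rw [Finset.mem_union, Finset.mem_filter, Finset.mem_filter]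
      by_cases hz : HasPrimeZero k a
      · exact Or.inl ⟨ha.1, ha.2, hz⟩
      · exact Or.inr ⟨ha.1, ha.2, hz⟩
    have h3 : ((2 * ⌊A⌋₊ : ℝ)) ^ s ≤
        (((intBox s ⌊A⌋₊).filter fun a => (∀ j, a j ≠ 0) ∧ HasPrimeZero k a).card : ℝ) +
        (((intBox s ⌊A⌋₊).filter fun a =>
          (∀ j, a j ≠ 0) ∧ ¬ HasPrimeZero k a).card : ℝ) := by
      exact_mod_cast h2
    have h4 : ((⌊A⌋₊ : ℝ) / A) ^ s * (1 - δ) * (2 * A) ^ s = (1 - δ) * (2 * (⌊A⌋₊ : ℝ)) ^ s := by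
      rw [mul_right_comm, ← mul_pow, mul_comm]
      congr 2
      field_simp
    rw [h4]
    linarith
  · refine IsBoundedUnder.isCoboundedUnder_ge ⟨2 ^ s, ?_⟩
    rw [eventually_map]
    filter_upwards [eventually_ge_atTop (1 : ℝ)] with A hA
    have hA0 : 0 < A := by linarith
    rw [ncard_primeZero_eq k hA0.le, div_le_iff₀ (by positivity), ← mul_pow]
    have h1 := Finset.card_filter_le (intBox s ⌊A⌋₊)
      fun a => (∀ j, a j ≠ 0) ∧ HasPrimeZero k a
    rw [card_intBox] at h1
    have h2 := Nat.floor_le hA0.le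
    calc _ ≤ (((2 * ⌊A⌋₊ + 1) ^ s : ℕ) : ℝ) := Nat.cast_le.2 h1
      _ = (2 * (⌊A⌋₊ : ℝ) + 1) ^ s := by push_cast; rfl
      _ ≤ (2 * (2 * A)) ^ s := pow_le_pow_left₀ (by positivity) (by linarith) s

theorem stmt7 (k : ℕ) (hk : 2 ≤ k) :
    ∃ lam C : ℝ, 0 < C ∧ ∀ s : ℕ, 2 ≤ s →
      1 - C * (s : ℝ) ^ lam * (2 : ℝ) ^ (-(s : ℤ)) ≤
        Filter.liminf (fun A : ℝ =>
          ({a : Fin s → ℤ | (∀ j, a j ≠ 0) ∧ hgt a ≤ A ∧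
              ∃ x : Fin s → ℕ, (∀ j, (x j).Prime) ∧
                ∑ j, a j * (x j : ℤ) ^ k = 0}.ncard : ℝ) / (2 * A) ^ s) atTop := by
  obtain ⟨K, hK, s₀, h⟩ := card_not_hasPrimeZero_le (by omega : 0 < k)
  refine ⟨((modH k + 2 : ℕ) : ℝ), K + 2 ^ s₀, by positivity, fun s hs => ?_⟩
  have hs1 : (1 : ℝ) ≤ (s : ℝ) ^ (modH k + 2) :=
    one_le_pow₀ (by exact_mod_cast (by omega : 1 ≤ s))
  rw [Real.rpow_natCast, zpow_neg, zpow_natCast]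
  refine le_trans (sub_le_sub_left (a := (K * s ^ (modH k + 2) + 2 ^ s₀) * ((2 : ℝ) ^ s)⁻¹) ?_ 1) ?_
  · refine mul_le_mul_of_nonneg_right ?_ (by positivity)
    rw [add_mul]
    linarith [le_mul_of_one_le_right (by positivity : (0 : ℝ) ≤ 2 ^ s₀) hs1]
  rcases le_or_gt s₀ s with hss | hss
  · obtain ⟨A₀, hA₀⟩ := h s hss
    refine liminf_primeZero_ge (A₀ := A₀) fun A hA =>
      ((Nat.cast_le.2 (Finset.card_le_card fun a ha => ?_)).trans (hA₀ A hA)).trans ?_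
    · rw [Finset.mem_filter] at ha ⊢
      exact ⟨ha.1, ha.2.2⟩
    have e : (K * s ^ (modH k + 2) + 2 ^ s₀) * ((2 : ℝ) ^ s)⁻¹ * (2 * A) ^ s =
        (K * s ^ (modH k + 2) + 2 ^ s₀) * A ^ s := by
      rw [mul_pow]
      field_simp
    rw [e]
    exact mul_le_mul_of_nonneg_right (le_add_of_nonneg_right (by positivity)) (by positivity)
  · have h1 : (2 : ℝ) ^ s ≤ 2 ^ s₀ := pow_le_pow_right₀ (by norm_num) hss.le
    refine le_trans (b := 1 - (1 : ℝ)) (sub_le_sub_left ?_ 1) (liminf_primeZero_ge (A₀ := 0) ?_)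
    · rw [← div_eq_mul_inv, le_div_iff₀ (by positivity), one_mul]
      exact h1.trans (le_add_of_nonneg_left (by positivity))
    · intro A _
      rw [one_mul]
      have h2 := (card_intBox_ne_zero s A).symm
      have h3 : (2 * A) ^ s ≥
          ((intBox s A).filter fun a => (∀ j, a j ≠ 0) ∧ ¬ HasPrimeZero k a).card := by
        rw [h2]
        refine Finset.card_le_card fun a ha => ?_
        rw [Finset.mem_filter] at ha ⊢
        exact ⟨ha.1, ha.2.1⟩
      exact_mod_cast h3
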